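/- Let n be a positive integer with 8 ∣ n. Then the weighted class number of positive definite integral quadratic forms in n variables with discriminant 1, namely the sum of 1/#Aut(Q) over a set of representatives Q of the GL_n(ℤ)-equivalence classes of such forms, equals (|B_{n/2}|/n) · ∏_{k=1}^{(n/2)−1} |B_{2k}|/(4k), where B_k are the Bernoulli numbers defined by x/(eˣ−1) = ∑_{k≥0} B_k xᵏ/k!. -/

import Mathlib

open scoped BigOperators

/-- The integral quadratic form `Q(x) = ∑_{i ≤ j} a_{ij} x_i x_j` attached to the
coefficient matrix `a` (only entries with `i ≤ j` are used). -/
def Qform {n : ℕ} (a : Matrix (Fin n) (Fin n) ℤ) (x : Fin n → ℤ) : ℤ :=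
  ∑ i, ∑ j, if i ≤ j then a i j * x i * x j else 0

/-- The associated bilinear form `T(x,y) = Q(x+y) - Q(x) - Q(y)`. -/
def Tbil {n : ℕ} (a : Matrix (Fin n) (Fin n) ℤ) (x y : Fin n → ℤ) : ℤ :=
  Qform a (x + y) - Qform a x - Qform a y

/-- The Gram matrix `[T] = (T(e_i, e_j))_{i,j}`. -/
def gram {n : ℕ} (a : Matrix (Fin n) (Fin n) ℤ) : Matrix (Fin n) (Fin n) ℤ :=
  Matrix.of fun i j => Tbil a (Pi.single i 1) (Pi.single j 1)

/-- `ε(n) = 0` if `n` is even, `1` if `n` is odd. -/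
def eps (n : ℕ) : ℕ := if Even n then 0 else 1

/-- `Q` has (half-)discriminant `d`, i.e. `det [T] = 2^{ε(n)} d`. -/
def HasDisc {n : ℕ} (a : Matrix (Fin n) (Fin n) ℤ) (d : ℤ) : Prop :=
  (gram a).det = 2 ^ (eps n) * d

/-- `Q` is positive definite: `Q(x) > 0` for all `x ≠ 0`. -/
def PosDef {n : ℕ} (a : Matrix (Fin n) (Fin n) ℤ) : Prop :=
  ∀ x : Fin n → ℤ, x ≠ 0 → 0 < Qform a x

/-- Two integral quadratic forms (as functions) are `GL_n(ℤ)`-equivalent: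
`Q'(x) = Q(g⁻¹ x)` for some `g ∈ GL_n(ℤ)`. -/
def FormEquiv {n : ℕ} (Q Q' : (Fin n → ℤ) → ℤ) : Prop :=
  ∃ g : GL (Fin n) ℤ, ∀ x, Q' x = Q (Matrix.mulVec (↑(g⁻¹) : Matrix (Fin n) (Fin n) ℤ) x)

/-- The automorphism group of the quadratic form `Q = Qform a`:
elements `g ∈ GL_n(ℤ)` with `Q(g⁻¹ x) = Q(x)` for all `x`. -/
def AutGrp {n : ℕ} (a : Matrix (Fin n) (Fin n) ℤ) : Type :=
  {g : GL (Fin n) ℤ // ∀ x, Qform a (Matrix.mulVec (↑(g⁻¹) : Matrix (Fin n) (Fin n) ℤ) x) = Qform a x}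

namespace MF
open Matrix

abbrev Mt (n : ℕ) := Matrix (Fin n) (Fin n) ℤ
abbrev Vc (n : ℕ) := Fin n → ℤ

/-- bilinear form of a Gram matrix -/
def bf {n : ℕ} (G : Mt n) (x y : Vc n) : ℤ := x ⬝ᵥ G *ᵥ y
/-- norm form -/
def nf {n : ℕ} (G : Mt n) (x : Vc n) : ℤ := bf G x x

/-- positive definite unimodular Gram matrices -/
structure IsU {n : ℕ} (G : Mt n) : Prop where
  sym : Gᵀ = G
  det : G.det = 1
  pos : ∀ x : Vc n, x ≠ 0 → 0 < nf G x

variable {n : ℕ} {G H G' : Mt n}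

lemma bf_add_left (G : Mt n) (x y z : Vc n) : bf G (x + y) z = bf G x z + bf G y z := by
  simp [bf, add_dotProduct]
lemma bf_add_right (G : Mt n) (x y z : Vc n) : bf G x (y + z) = bf G x y + bf G x z := by
  simp [bf, mulVec_add, dotProduct_add]
lemma bf_sub_left (G : Mt n) (x y z : Vc n) : bf G (x - y) z = bf G x z - bf G y z := by
  simp [bf, sub_dotProduct]
lemma bf_sub_right (G : Mt n) (x y z : Vc n) : bf G x (y - z) = bf G x y - bf G x z := by
  simp [bf, mulVec_sub, dotProduct_sub]
lemma bf_smul_left (G : Mt n) (c : ℤ) (x z : Vc n) : bf G (c • x) z = c * bf G x z := by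
  rw [bf, smul_dotProduct]; rfl
lemma bf_smul_right (G : Mt n) (c : ℤ) (x z : Vc n) : bf G x (c • z) = c * bf G x z := by
  rw [bf, mulVec_smul, dotProduct_smul]; rfl
lemma bf_zero_left (G : Mt n) (z : Vc n) : bf G 0 z = 0 := by simp [bf]
lemma bf_zero_right (G : Mt n) (z : Vc n) : bf G z 0 = 0 := by simp [bf]
lemma bf_neg_left (G : Mt n) (x z : Vc n) : bf G (-x) z = -bf G x z := by simp [bf]
lemma bf_neg_right (G : Mt n) (x z : Vc n) : bf G x (-z) = -bf G x z := by simp [bf, mulVec_neg]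
lemma bf_comm (h : Gᵀ = G) (x y : Vc n) : bf G x y = bf G y x := by
  unfold bf
  rw [dotProduct_comm, ← vecMul_transpose, h, dotProduct_mulVec]
lemma bf_smul_mat (G : Mt n) (c : ℤ) (x z : Vc n) : bf (c • G) x z = c * bf G x z := by
  rw [bf, smul_mulVec, dotProduct_smul]; rfl
lemma bf_mulVec (G A : Mt n) (x y : Vc n) : bf G (A *ᵥ x) (A *ᵥ y) = bf (Aᵀ * G * A) x y := by
  unfold bf
  rw [← mulVec_mulVec, ← mulVec_mulVec, mulVec_transpose, dotProduct_comm x, ← dotProduct_mulVec,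
    dotProduct_comm]
lemma nf_mulVec (G A : Mt n) (x : Vc n) : nf G (A *ᵥ x) = nf (Aᵀ * G * A) x := bf_mulVec G A x x
lemma nf_smul (G : Mt n) (c : ℤ) (x : Vc n) : nf G (c • x) = c ^ 2 * nf G x := by
  simp only [nf, bf_smul_left, bf_smul_right]; ring
lemma nf_smul_mat (G : Mt n) (c : ℤ) (x : Vc n) : nf (c • G) x = c * nf G x := bf_smul_mat G c x x
lemma nf_add (h : Gᵀ = G) (x y : Vc n) : nf G (x + y) = nf G x + 2 * bf G x y + nf G y := by
  simp only [nf, bf_add_left, bf_add_right, bf_comm h y x]; ring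
lemma nf_sub (h : Gᵀ = G) (x y : Vc n) : nf G (x - y) = nf G x - 2 * bf G x y + nf G y := by
  simp only [nf, bf_sub_left, bf_sub_right, bf_comm h y x]; ring
lemma nf_neg (G : Mt n) (x : Vc n) : nf G (-x) = nf G x := by
  simp only [nf, bf_neg_left, bf_neg_right, neg_neg]
lemma nf_zero (G : Mt n) : nf G 0 = 0 := bf_zero_left G 0
lemma bf_single (G : Mt n) (i j : Fin n) : bf G (Pi.single i 1) (Pi.single j 1) = G i j := by
  simp [bf]
lemma bf_ext (h : ∀ x y, bf G x y = bf H x y) : G = H := by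
  ext i j; rw [← bf_single G, ← bf_single H, h]

lemma IsU.isUnit (h : IsU G) : IsUnit G.det := by rw [h.det]; exact isUnit_one
lemma IsU.mul_inv (h : IsU G) : G * G⁻¹ = 1 := mul_nonsing_inv _ h.isUnit
lemma IsU.inv_mul (h : IsU G) : G⁻¹ * G = 1 := nonsing_inv_mul _ h.isUnit
lemma IsU.inv_sym (h : IsU G) : (G⁻¹)ᵀ = G⁻¹ := by rw [transpose_nonsing_inv, h.sym]
lemma IsU.nonneg (h : IsU G) (x : Vc n) : 0 ≤ nf G x := by
  by_cases hx : x = 0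
  · rw [hx, nf_zero]
  · exact (h.pos x hx).le
lemma IsU.eq_zero (h : IsU G) {x : Vc n} (hx : nf G x = 0) : x = 0 := by
  by_contra h0; exact (h.pos x h0).ne' hx
lemma IsU.cs (h : IsU G) (u x : Vc n) : bf G u x ^ 2 ≤ nf G u * nf G x := by
  by_cases hu : u = 0
  · subst hu; simp [bf_zero_left, nf_zero]
  have h1 := h.nonneg (nf G u • x - bf G u x • u)
  have h2 := h.pos u hu
  rw [nf_sub h.sym, nf_smul, nf_smul, bf_smul_left, bf_smul_right, bf_comm h.sym x u] at h1
  have : 0 ≤ nf G u * (nf G u * nf G x - bf G u x ^ 2) := by nlinarith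
  have := nonneg_of_mul_nonneg_right this h2
  linarith

/-- vectors dual to the coordinates -/
lemma IsU.dual (h : IsU G) (v x : Vc n) : bf G (G⁻¹ *ᵥ v) x = v ⬝ᵥ x := by
  rw [bf_comm h.sym]; unfold bf
  rw [mulVec_mulVec, h.mul_inv, one_mulVec, dotProduct_comm]

lemma IsU.finite_le (h : IsU G) (m : ℤ) : {x : Vc n | nf G x ≤ m}.Finite := by
  set B : ℤ := ∑ i, nf G (G⁻¹ *ᵥ Pi.single i 1) with hB
  have hBi : ∀ i, nf G (G⁻¹ *ᵥ Pi.single i 1) ≤ B := fun i =>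
    Finset.single_le_sum (f := fun i => nf G (G⁻¹ *ᵥ Pi.single i 1)) (fun i _ => h.nonneg _)
      (Finset.mem_univ i)
  have hB0 : 0 ≤ B := Finset.sum_nonneg fun i _ => h.nonneg _
  apply (Set.Finite.pi (fun _ : Fin n => Set.finite_Icc (-(B * |m|)) (B * |m|))).subset
  intro x hx
  simp only [Set.mem_ofPred_eq] at hx
  simp only [Set.mem_pi, Set.mem_univ, true_implies, Set.mem_Icc]
  intro i
  have h1 := h.cs (G⁻¹ *ᵥ Pi.single i 1) x
  rw [h.dual] at h1
  have h2 : (Pi.single i 1 : Vc n) ⬝ᵥ x = x i := by simp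
  rw [h2] at h1
  have h3 : x i ^ 2 ≤ B * |m| := by
    calc x i ^ 2 ≤ _ := h1
      _ ≤ B * nf G x := mul_le_mul_of_nonneg_right (hBi i) (h.nonneg x)
      _ ≤ B * |m| := mul_le_mul_of_nonneg_left (hx.trans (le_abs_self m)) hB0
  rw [← abs_le]
  have h4 : |x i| ≤ x i ^ 2 := by
    rw [← sq_abs]
    rcases (abs_nonneg (x i)).lt_or_eq with h | h
    · nlinarith
    · rw [← h]; norm_num
  linarith

/-- isometries -/
def isos (G H : Mt n) : Set (Mt n) := {A | Aᵀ * G * A = H}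

lemma finite_isos' (h : IsU G) (H : Mt n) : {A : Mt n | Aᵀ * G * A = H}.Finite := by
  set m : ℤ := ∑ i, |H i i|
  have hf := Set.Finite.pi (fun _ : Fin n => h.finite_le m)
  apply Set.Finite.of_finite_image (f := fun A : Mt n => Aᵀ)
  · apply hf.subset
    rintro _ ⟨A, hA, rfl⟩
    simp only [Set.mem_ofPred_eq] at hA
    intro i _
    have : Aᵀ i = A *ᵥ Pi.single i 1 := by ext j; simp
    show nf G (Aᵀ i) ≤ m
    rw [this, nf_mulVec, hA]
    unfold nf; rw [bf_single]
    exact (le_abs_self _).trans (Finset.single_le_sum (f := fun i => |H i i|)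
      (fun i _ => abs_nonneg _) (Finset.mem_univ i))
  · intro A _ B _ hAB; simpa using hAB

lemma finite_isos (h : IsU G) (H : Mt n) : (isos G H).Finite := finite_isos' h H

/-- order of the automorphism group -/
noncomputable def autc (G : Mt n) : ℕ := (isos G G).ncard

lemma autc_pos (h : IsU G) : 0 < autc G := by
  rw [autc, Set.ncard_pos (finite_isos h G)]
  exact ⟨1, by simp [isos]⟩

lemma iso_det_ne (hH : IsU H) {A : Mt n} {c : ℤ} (hc : c ≠ 0)
    (hA : Aᵀ * G * A = c • H) : A.det ≠ 0 := by
  intro h0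
  have := congrArg Matrix.det hA
  rw [det_mul, h0, mul_zero, det_smul, hH.det, mul_one] at this
  exact pow_ne_zero _ hc this.symm

lemma iso_isUnit (h : IsU G) (hH : IsU H) {A : Mt n} (hA : A ∈ isos G H) : IsUnit A.det := by
  have := congrArg Matrix.det hA
  rw [det_mul, det_mul, det_transpose, h.det, hH.det, mul_one] at this
  exact IsUnit.of_mul_eq_one _ this

/-- isometric -/
def Iso (G H : Mt n) : Prop := (isos G H).Nonempty

lemma isos_comp {K A B : Mt n} (hA : A ∈ isos G H) (hB : B ∈ isos H K) : A * B ∈ isos G K := by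
  simp only [isos, Set.mem_ofPred_eq] at *
  rw [← hB, ← hA, transpose_mul]; simp only [Matrix.mul_assoc]

lemma isos_inv {A : Mt n} (hu : IsUnit A.det) (hA : A ∈ isos G H) : A⁻¹ ∈ isos H G := by
  simp only [isos, Set.mem_ofPred_eq] at *
  have h1 := mul_nonsing_inv A hu
  have h2 : (A⁻¹)ᵀ * Aᵀ = 1 := by rw [← transpose_mul, h1, transpose_one]
  rw [← hA]
  calc (A⁻¹)ᵀ * (Aᵀ * G * A) * A⁻¹ = ((A⁻¹)ᵀ * Aᵀ) * G * (A * A⁻¹) := by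
        simp only [Matrix.mul_assoc]
    _ = G := by rw [h1, h2]; simp

lemma Iso.refl (G : Mt n) : Iso G G := ⟨1, by simp [isos]⟩
lemma Iso.trans {K : Mt n} (h1 : Iso G H) (h2 : Iso H K) : Iso G K := by
  obtain ⟨A, hA⟩ := h1; obtain ⟨B, hB⟩ := h2; exact ⟨_, isos_comp hA hB⟩
lemma Iso.symm (h : IsU G) (hH : IsU H) (h1 : Iso G H) : Iso H G := by
  obtain ⟨A, hA⟩ := h1
  exact ⟨_, isos_inv (iso_isUnit h hH hA) hA⟩

lemma isU_of_unit (h : IsU G) {A : Mt n} (hu : IsUnit A.det) : IsU (Aᵀ * G * A) := by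
  refine ⟨?_, ?_, ?_⟩
  · rw [transpose_mul, transpose_mul, transpose_transpose, h.sym, Matrix.mul_assoc]
  · rw [det_mul, det_mul, det_transpose, h.det, mul_one]
    rcases Int.isUnit_iff.mp hu with h | h <;> rw [h] <;> norm_num
  · intro x hx
    rw [← nf_mulVec]
    apply h.pos
    intro h0
    apply hx
    have := congrArg (fun y => A⁻¹ *ᵥ y) h0
    simpa [mulVec_mulVec, nonsing_inv_mul _ hu] using this

lemma mul_left_inj_of_det {A B C : Mt n} (h : A.det ≠ 0) (hh : A * B = A * C) : B = C := by
  have := congrArg (fun X => A.adjugate * X) hh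
  simp only [← Matrix.mul_assoc, adjugate_mul, smul_mul, Matrix.one_mul] at this
  exact smul_right_injective _ h this

lemma mulVec_inj_of_det {A : Mt n} (h : A.det ≠ 0) {x y : Vc n} (hh : A *ᵥ x = A *ᵥ y) :
    x = y := by
  have := congrArg (fun X => A.adjugate *ᵥ X) hh
  simp only [mulVec_mulVec, adjugate_mul, smul_mulVec, one_mulVec] at this
  exact smul_right_injective _ h this

/-- torsor counting -/
lemma ncard_torsor {A : Mt n} (h : A.det ≠ 0) {X : Set (Mt n)}
    (hX : ∀ B, B ∈ X ↔ ∃ U ∈ isos G G, B = A * U) : X.ncard = autc G := by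
  have : X = (fun U => A * U) '' isos G G := by
    ext B; rw [hX]; simp only [Set.mem_image, eq_comm]
  rw [this, Set.ncard_image_of_injective]
  · rfl
  · intro B C; exact mul_left_inj_of_det h

/-- abstract weighted counting -/
lemma count_torsor {ι α β : Type*} (R : Finset ι) (X : ι → Set α) (f : ι → α → β) (Y : Set β)
    (c : ι → ℕ) (hc : ∀ i ∈ R, 0 < c i) (hX : ∀ i ∈ R, (X i).Finite)
    (hmap : ∀ i ∈ R, ∀ a ∈ X i, f i a ∈ Y)
    (hfib : ∀ y ∈ Y, ∃ i ∈ R, {a ∈ X i | f i a = y}.ncard = c i ∧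
      ∀ j ∈ R, j ≠ i → ∀ a ∈ X j, f j a ≠ y) :
    Y.Finite ∧ ∑ i ∈ R, ((X i).ncard : ℝ) / c i = Y.ncard := by
  classical
  have hYf : Y.Finite := by
    apply (R.finite_toSet.biUnion (t := fun i => f i '' X i) (fun i hi => (hX i hi).image _)).subset
    intro y hy
    obtain ⟨i, hi, h1, -⟩ := hfib y hy
    have : {a ∈ X i | f i a = y}.Nonempty := by
      apply Set.nonempty_of_ncard_ne_zero; rw [h1]; exact (hc i hi).ne'
    obtain ⟨a, ha, hay⟩ := this
    simp only [Set.mem_iUnion]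
    exact ⟨i, hi, a, ha, hay⟩
  refine ⟨hYf, ?_⟩
  have h1 : ∀ i ∈ R, ((X i).ncard : ℝ) = ∑ y ∈ hYf.toFinset, ({a ∈ X i | f i a = y}.ncard : ℝ) := by
    intro i hi
    have hXi := hX i hi
    rw [Set.ncard_eq_toFinset_card _ hXi]
    rw [Finset.card_eq_sum_card_fiberwise (f := f i) (t := hYf.toFinset)]
    · push_cast
      apply Finset.sum_congr rfl
      intro y _
      rw [← Set.ncard_coe_finset]
      congr 2; ext a; simp
    · intro a ha; simp at ha ⊢; exact hmap i hi a ha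
  calc ∑ i ∈ R, ((X i).ncard : ℝ) / c i
      = ∑ i ∈ R, ∑ y ∈ hYf.toFinset, ({a ∈ X i | f i a = y}.ncard : ℝ) / c i := by
        apply Finset.sum_congr rfl; intro i hi; rw [h1 i hi, Finset.sum_div]
    _ = ∑ y ∈ hYf.toFinset, ∑ i ∈ R, ({a ∈ X i | f i a = y}.ncard : ℝ) / c i := Finset.sum_comm
    _ = ∑ y ∈ hYf.toFinset, 1 := by
        apply Finset.sum_congr rfl
        intro y hy
        obtain ⟨i, hi, h2, h3⟩ := hfib y (by simpa using hy)
        rw [Finset.sum_eq_single i]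
        · rw [h2]; exact div_self (by exact_mod_cast (hc i hi).ne')
        · intro j hj hji
          have : {a ∈ X j | f j a = y} = ∅ := by
            ext a; simp only [Set.mem_ofPred_eq, Set.mem_empty_iff_false, iff_false, not_and]
            exact h3 j hj hji a
          rw [this]; simp
        · intro h; exact absurd hi h
    _ = Y.ncard := by
        rw [Set.ncard_eq_toFinset_card _ hYf]; simp

/-- systems of representatives of a class -/
structure IsReps (P : Mt n → Prop) (R : Finset (Mt n)) : Prop where
  mem : ∀ G ∈ R, IsU G ∧ P G
  cover : ∀ G, IsU G → P G → ∃ H ∈ R, Iso G H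
  irr : ∀ G ∈ R, ∀ H ∈ R, Iso G H → G = H

noncomputable def mass (R : Finset (Mt n)) : ℝ := ∑ G ∈ R, 1 / (autc G : ℝ)

lemma exists_reps (P : Mt n → Prop)
    (T : Set (Mt n)) (hT : T.Finite)
    (hTU : ∀ H ∈ T, IsU H) (hcov : ∀ G, IsU G → P G → ∃ H ∈ T, Iso G H) :
    ∃ R, IsReps P R := by
  classical
  let s : Setoid {G : Mt n // IsU G ∧ P G} :=
    ⟨fun a b => Iso a.1 b.1, fun a => Iso.refl _, fun {a b} h => Iso.symm a.2.1 b.2.1 h,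
      fun h1 h2 => h1.trans h2⟩
  have hfin : Finite (Quotient s) := by
    have : ∀ q : Quotient s, ∃ H ∈ T, Iso q.out.1 H := fun q => hcov _ q.out.2.1 q.out.2.2
    choose φ hφ hφ' using this
    have := hT.to_subtype
    apply Finite.of_injective (fun q => (⟨φ q, hφ q⟩ : T))
    intro q q' h
    simp only [Subtype.mk.injEq] at h
    obtain ⟨A, hA⟩ := hφ' q
    obtain ⟨B, hB⟩ := hφ' q'
    rw [← h] at hB
    have hu : IsU (φ q) → Iso q.out.1 q'.out.1 := fun hu =>
      (hφ' q).trans (Iso.symm q'.out.2.1 hu ⟨B, hB⟩)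
    rw [← Quotient.out_eq q, ← Quotient.out_eq q']
    exact Quotient.sound (hu (hTU _ (hφ q)))
  have := Fintype.ofFinite (Quotient s)
  refine ⟨Finset.univ.image (fun q : Quotient s => q.out.1), ?_, ?_, ?_⟩
  · intro G hG
    simp only [Finset.mem_image, Finset.mem_univ, true_and] at hG
    obtain ⟨q, rfl⟩ := hG; exact q.out.2
  · intro G h1 h2
    refine ⟨(Quotient.mk s ⟨G, h1, h2⟩).out.1, ?_, ?_⟩
    · simp
    · have := Quotient.mk_out (s := s) ⟨G, h1, h2⟩
      exact Iso.symm (Quotient.mk s ⟨G, h1, h2⟩).out.2.1 h1 this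
  · intro G hG H hH h
    simp only [Finset.mem_image, Finset.mem_univ, true_and] at hG hH
    obtain ⟨q, rfl⟩ := hG; obtain ⟨q', rfl⟩ := hH
    have : q = q' := by
      rw [← Quotient.out_eq q, ← Quotient.out_eq q']
      exact Quotient.sound h
    rw [this]

end MF

namespace MF
open Matrix
variable {n : ℕ} {G H G' : Mt n}

/-- `c`-scaled self-dual sublattices -/
def SD (G : Mt n) (c : ℤ) (Λ : Submodule ℤ (Vc n)) : Prop :=
  (∀ x ∈ Λ, ∀ y ∈ Λ, c ∣ bf G x y) ∧ ∀ y, (∀ l ∈ Λ, c ∣ bf G y l) → y ∈ Λ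

/-- lattice spanned by the columns -/
def rng (A : Mt n) : Submodule ℤ (Vc n) := LinearMap.range A.mulVecLin

lemma mem_rng {A : Mt n} {y : Vc n} : y ∈ rng A ↔ ∃ x, A *ᵥ x = y := by
  simp [rng]

lemma rng_mul_unit (A U : Mt n) (hU : IsUnit U.det) : rng (A * U) = rng A := by
  ext y; simp only [mem_rng]
  constructor
  · rintro ⟨x, rfl⟩; exact ⟨U *ᵥ x, by rw [mulVec_mulVec]⟩
  · rintro ⟨x, rfl⟩
    exact ⟨U⁻¹ *ᵥ x, by rw [mulVec_mulVec, Matrix.mul_assoc, mul_nonsing_inv _ hU, Matrix.mul_one]⟩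

lemma exists_mul_of_rng_le {A B : Mt n} (h : rng B ≤ rng A) : ∃ U, B = A * U := by
  have : ∀ j, ∃ x, A *ᵥ x = B *ᵥ Pi.single j 1 := fun j =>
    mem_rng.mp (h (mem_rng.mpr ⟨_, rfl⟩))
  choose u hu using this
  refine ⟨Matrix.of fun i j => u j i, ?_⟩
  ext i j
  have := congrFun (hu j) i
  simp only [mulVec_single, MulOpposite.op_one, one_smul] at this
  rw [show B i j = B.col j i from rfl, ← this]
  simp [Matrix.mul_apply, mulVec, dotProduct]

lemma exists_unit_of_rng_eq {A B : Mt n} (hA : A.det ≠ 0) (h : rng A = rng B) :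
    ∃ U, IsUnit U.det ∧ B = A * U := by
  obtain ⟨U, hU⟩ := exists_mul_of_rng_le h.ge
  obtain ⟨V, hV⟩ := exists_mul_of_rng_le h.le
  refine ⟨U, ?_, hU⟩
  have : A * (U * V) = A * 1 := by rw [← Matrix.mul_assoc, ← hU, ← hV, Matrix.mul_one]
  have := congrArg Matrix.det (mul_left_inj_of_det hA this)
  rw [det_mul, det_one] at this
  exact IsUnit.of_mul_eq_one _ this

lemma conj_mul (A U : Mt n) : (A * U)ᵀ * G * (A * U) = Uᵀ * (Aᵀ * G * A) * U := by
  rw [transpose_mul]; simp only [Matrix.mul_assoc]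

lemma sd_of_iso (h' : IsU G') (h : IsU G) {c : ℤ} (hc : c ≠ 0) {A : Mt n}
    (hA : Aᵀ * G' * A = c • G) : SD G' c (rng A) := by
  constructor
  · intro x hx y hy
    obtain ⟨x, rfl⟩ := mem_rng.mp hx
    obtain ⟨y, rfl⟩ := mem_rng.mp hy
    rw [bf_mulVec, hA, bf_smul_mat]; exact dvd_mul_right _ _
  · intro y hy
    have h1 : ∀ i, c ∣ ((Aᵀ * G') *ᵥ y) i := by
      intro i
      have := hy (A *ᵥ Pi.single i 1) (mem_rng.mpr ⟨_, rfl⟩)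
      rw [bf_comm h'.sym] at this
      unfold bf at this
      rw [dotProduct_comm, dotProduct_mulVec, ← mulVec_transpose, mulVec_mulVec] at this
      simpa using this
    choose v hv using h1
    have h2 : (Aᵀ * G') *ᵥ (A *ᵥ (G⁻¹ *ᵥ v)) = (Aᵀ * G') *ᵥ y := by
      rw [mulVec_mulVec, hA, mulVec_mulVec, smul_mul, h.mul_inv, smul_mulVec, one_mulVec]
      ext i; rw [hv i]; simp
    have hd : (Aᵀ * G').det ≠ 0 := by
      rw [det_mul, det_transpose, h'.det, mul_one]; exact iso_det_ne h hc hA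
    exact mem_rng.mpr ⟨_, mulVec_inj_of_det hd h2⟩

lemma smul_mem_of_sd {c : ℤ} {Λ : Submodule ℤ (Vc n)} (h : SD G c Λ) (x : Vc n) : c • x ∈ Λ :=
  h.2 _ fun l _ => by rw [bf_smul_left]; exact dvd_mul_right _ _

lemma exists_rng {c : ℤ} (hc : c ≠ 0) {Λ : Submodule ℤ (Vc n)} (h : ∀ x, c • x ∈ Λ) :
    ∃ A : Mt n, rng A = Λ ∧ A.det ≠ 0 := by
  have hr : Module.finrank ℤ Λ = n := by
    apply le_antisymm
    · have := Submodule.finrank_le Λ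
      simpa using this
    · let f : Vc n →ₗ[ℤ] Λ := LinearMap.codRestrict Λ (c • LinearMap.id) (fun x => h x)
      have hf : Function.Injective f := by
        intro x y hxy
        have : c • x = c • y := congrArg Subtype.val hxy
        exact smul_right_injective _ hc this
      have := LinearMap.finrank_le_finrank_of_injective hf
      simpa using this
  let b := Module.finBasisOfFinrankEq ℤ Λ hr
  let A : Mt n := Matrix.of fun i j => (b j).1 i
  have key : ∀ x : Vc n, A *ᵥ x = (∑ j, x j • b j : Λ) := by
    intro x; ext i
    simp only [A, mulVec, dotProduct, of_apply, AddSubmonoidClass.coe_finset_sum,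
      Finset.sum_apply, Submodule.coe_smul, Pi.smul_apply, smul_eq_mul, mul_comm]
  refine ⟨A, ?_, ?_⟩
  · ext y; rw [mem_rng]; constructor
    · rintro ⟨x, rfl⟩; rw [key]; exact Subtype.prop _
    · intro hy
      refine ⟨fun j => b.repr ⟨y, hy⟩ j, ?_⟩
      rw [key, b.sum_repr]
  · intro h0
    obtain ⟨v, hv, hv0⟩ := Matrix.exists_mulVec_eq_zero_iff.mpr h0
    rw [key] at hv0
    have h1 : (∑ j, v j • b j : Λ) = 0 := Subtype.ext hv0
    have := Fintype.linearIndependent_iff.mp b.linearIndependent v h1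
    exact hv (funext this)

lemma exists_of_sd (h' : IsU G') {c : ℤ} (hc : 0 < c) {Λ : Submodule ℤ (Vc n)}
    (h : SD G' c Λ) : ∃ A G, rng A = Λ ∧ Aᵀ * G' * A = c • G ∧ IsU G := by
  obtain ⟨A, hA, hd⟩ := exists_rng hc.ne' (smul_mem_of_sd h)
  have hmem : ∀ x, A *ᵥ x ∈ Λ := fun x => hA ▸ mem_rng.mpr ⟨x, rfl⟩
  have h1 : ∀ i j, c ∣ (Aᵀ * G' * A) i j := by
    intro i j
    rw [← bf_single (Aᵀ * G' * A), ← bf_mulVec]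
    exact h.1 _ (hmem _) _ (hmem _)
  choose G hG using h1
  have hG : Aᵀ * G' * A = c • (Matrix.of G) := by
    ext i j; rw [hG]; simp
  refine ⟨A, Matrix.of G, hA, hG, ?_, ?_, ?_⟩
  · have : (c • (Matrix.of G))ᵀ = c • Matrix.of G := by
      rw [← hG, transpose_mul, transpose_mul, transpose_transpose, h'.sym, Matrix.mul_assoc]
    rw [transpose_smul] at this
    exact smul_right_injective _ hc.ne' this
  · -- unimodularity
    have hpos : 0 < (Matrix.of G).det := by
      have := congrArg Matrix.det hG
      rw [det_mul, det_mul, det_transpose, h'.det, mul_one, det_smul] at this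
      have h2 : 0 < A.det * A.det := mul_self_pos.mpr hd
      rw [this] at h2
      exact pos_of_mul_pos_right h2 (by positivity)
    obtain ⟨C, hC⟩ : ∃ C, A * C = c • (1 : Mt n) := by
      obtain ⟨C, hC⟩ := exists_mul_of_rng_le (A := A) (B := c • (1 : Mt n)) (by
        intro y hy; obtain ⟨x, rfl⟩ := mem_rng.mp hy
        rw [smul_mulVec, one_mulVec, hA]; exact smul_mem_of_sd h x)
      exact ⟨C, hC.symm⟩
    have hCA : C * A = c • (1 : Mt n) := by
      apply mul_left_inj_of_det hd
      rw [← Matrix.mul_assoc, hC, smul_mul, Matrix.mul_smul, Matrix.mul_one, Matrix.one_mul]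
    have h3 : ∀ v : Vc n, ∃ z, (Matrix.of G) *ᵥ z = v := by
      intro v
      have hy : A.transpose *ᵥ (G' *ᵥ (G'⁻¹ *ᵥ (Cᵀ *ᵥ v))) = c • v := by
        rw [mulVec_mulVec _ G', h'.mul_inv, one_mulVec, mulVec_mulVec, ← transpose_mul, hCA]
        rw [transpose_smul, transpose_one, smul_mulVec, one_mulVec]
      set y := G'⁻¹ *ᵥ (Cᵀ *ᵥ v)
      have hyΛ : y ∈ Λ := by
        apply h.2
        intro l hl
        rw [← hA] at hl
        obtain ⟨x, rfl⟩ := mem_rng.mp hl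
        rw [bf_comm h'.sym]
        unfold bf
        rw [dotProduct_comm, dotProduct_mulVec, ← mulVec_transpose, hy, smul_dotProduct]
        exact dvd_mul_right _ _
      rw [← hA] at hyΛ
      obtain ⟨z, hz⟩ := mem_rng.mp hyΛ
      refine ⟨z, ?_⟩
      rw [← hz, mulVec_mulVec, mulVec_mulVec, hG, smul_mulVec] at hy
      exact smul_right_injective _ hc.ne' hy
    have h4 : IsUnit (Matrix.of G).det := by
      obtain ⟨U, hU⟩ := exists_mul_of_rng_le (A := Matrix.of G) (B := 1) (by
        intro y _; exact mem_rng.mpr (h3 y))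
      have := congrArg Matrix.det hU
      rw [det_mul, det_one] at this
      exact IsUnit.of_mul_eq_one _ this.symm
    rcases Int.isUnit_iff.mp h4 with h5 | h5
    · exact h5
    · rw [h5] at hpos; norm_num at hpos
  · intro x hx
    have : 0 < nf G' (A *ᵥ x) := by
      apply h'.pos
      intro h0
      exact hx (mulVec_inj_of_det hd (by rw [h0, mulVec_zero]))
    rw [nf_mulVec, hG, nf_smul_mat] at this
    exact pos_of_mul_pos_right this hc.le

/-- matrices `A` embedding `c • G` into `G'` with a property -/
def embs (G' G : Mt n) (c : ℤ) (Pr : Submodule ℤ (Vc n) → Prop) : Set (Mt n) :=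
  {A | Aᵀ * G' * A = c • G ∧ Pr (rng A)}

lemma finite_embs (h' : IsU G') (G : Mt n) (c : ℤ) (Pr) : (embs G' G c Pr).Finite :=
  (finite_isos' h' (c • G)).subset fun _ h => h.1

lemma emb_fiber (h : IsU G) {A : Mt n} {c : ℤ} (hc : c ≠ 0)
    (hA : Aᵀ * G' * A = c • G) (B : Mt n) :
    (Bᵀ * G' * B = c • G ∧ rng B = rng A) ↔ ∃ U ∈ isos G G, B = A * U := by
  have hd := iso_det_ne h hc hA
  constructor
  · rintro ⟨hB, hr⟩
    obtain ⟨U, hU, rfl⟩ := exists_unit_of_rng_eq hd hr.symm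
    refine ⟨U, ?_, rfl⟩
    rw [conj_mul, hA, Matrix.mul_smul, smul_mul] at hB
    exact smul_right_injective _ hc hB
  · rintro ⟨U, hU, rfl⟩
    refine ⟨?_, rng_mul_unit _ _ (iso_isUnit h h hU)⟩
    rw [conj_mul, hA, Matrix.mul_smul, smul_mul, show Uᵀ * G * U = G from hU]

lemma emb_iso {A B : Mt n} {c : ℤ} (hc : c ≠ 0) (h : IsU G)
    (hA : Aᵀ * G' * A = c • G) (hB : Bᵀ * G' * B = c • H) (hr : rng A = rng B) : Iso G H := by
  obtain ⟨U, hU, rfl⟩ := exists_unit_of_rng_eq (iso_det_ne h hc hA) hr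
  refine ⟨U, ?_⟩
  rw [conj_mul, hA, Matrix.mul_smul, smul_mul] at hB
  exact smul_right_injective _ hc hB

lemma emb_move {A U : Mt n} {c : ℤ} (hA : Aᵀ * G' * A = c • G) (hU : U ∈ isos G H) :
    (A * U)ᵀ * G' * (A * U) = c • H := by
  rw [conj_mul, hA, Matrix.mul_smul, smul_mul, show Uᵀ * G * U = H from hU]

/-- Lemma T -/
lemma count_sub (h' : IsU G') {c : ℤ} (hc : 0 < c) {P : Mt n → Prop} {R : Finset (Mt n)}
    (hR : IsReps P R) (Pr : Submodule ℤ (Vc n) → Prop)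
    (hP : ∀ A G, IsU G → Aᵀ * G' * A = c • G → Pr (rng A) → P G) :
    {Λ | SD G' c Λ ∧ Pr Λ}.Finite ∧
    ∑ G ∈ R, ((embs G' G c Pr).ncard : ℝ) / autc G = {Λ | SD G' c Λ ∧ Pr Λ}.ncard := by
  apply count_torsor R (fun G => embs G' G c Pr) (fun _ A => rng A)
  · intro G hG; exact autc_pos (hR.mem G hG).1
  · intro G hG; exact finite_embs h' G c Pr
  · intro G hG A hA
    exact ⟨sd_of_iso h' (hR.mem G hG).1 hc.ne' hA.1, hA.2⟩
  · rintro Λ ⟨h1, h2⟩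
    obtain ⟨A, G, rfl, hA, hG⟩ := exists_of_sd h' hc h1
    obtain ⟨G1, hG1, U, hU⟩ := hR.cover G hG (hP A G hG hA h2)
    have hG1u := (hR.mem G1 hG1).1
    have hA1 := emb_move hA hU
    have hr : rng (A * U) = rng A := rng_mul_unit _ _ (iso_isUnit hG hG1u hU)
    refine ⟨G1, hG1, ?_, ?_⟩
    · apply ncard_torsor (iso_det_ne hG1u hc.ne' hA1)
      intro B
      rw [← emb_fiber hG1u hc.ne' hA1 B]
      simp only [embs, Set.mem_ofPred_eq, hr]
      constructor
      · rintro ⟨⟨h3, h4⟩, h5⟩; exact ⟨h3, h5⟩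
      · rintro ⟨h3, h5⟩; exact ⟨⟨h3, h5 ▸ h2⟩, h5⟩
    · intro G2 hG2 hne B hB hr2
      apply hne
      exact hR.irr _ hG2 _ hG1 (emb_iso hc.ne' (hR.mem G2 hG2).1 hB.1 hA1 (hr2.trans hr.symm))

end MF

namespace MF
open Matrix

/-- orthogonal sum with the one-dimensional unit form -/
def oneSum {m : ℕ} (H : Mt m) : Mt (m + 1) :=
  Matrix.of fun i j => Fin.cases (Fin.cases 1 (fun _ => 0) j)
    (fun i' => Fin.cases 0 (fun j' => H i' j') j) i

variable {m : ℕ} {H K : Mt m}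

@[simp] lemma oneSum_00 (H : Mt m) : oneSum H 0 0 = 1 := rfl
@[simp] lemma oneSum_0s (H : Mt m) (j : Fin m) : oneSum H 0 j.succ = 0 := rfl
@[simp] lemma oneSum_s0 (H : Mt m) (j : Fin m) : oneSum H j.succ 0 = 0 := rfl
@[simp] lemma oneSum_ss (H : Mt m) (i j : Fin m) : oneSum H i.succ j.succ = H i j := rfl

lemma oneSum_inj : Function.Injective (oneSum (m := m)) := by
  intro H K h; ext i j; simpa using congrFun (congrFun h i.succ) j.succ

lemma oneSum_transpose (H : Mt m) : (oneSum H)ᵀ = oneSum Hᵀ := by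
  ext i j; refine Fin.cases ?_ (fun i => ?_) i <;> refine Fin.cases ?_ (fun j => ?_) j <;> simp

lemma oneSum_mul (H K : Mt m) : oneSum H * oneSum K = oneSum (H * K) := by
  ext i j; rw [Matrix.mul_apply, Fin.sum_univ_succ]
  refine Fin.cases ?_ (fun i => ?_) i <;> refine Fin.cases ?_ (fun j => ?_) j <;>
    simp [Matrix.mul_apply]

lemma oneSum_one : oneSum (1 : Mt m) = 1 := by
  ext i j; refine Fin.cases ?_ (fun i => ?_) i <;> refine Fin.cases ?_ (fun j => ?_) j <;>
    simp [Matrix.one_apply, Fin.succ_ne_zero, (Fin.succ_ne_zero _).symm]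

lemma oneSum_det (H : Mt m) : (oneSum H).det = H.det := by
  rw [det_succ_row_zero, Fin.sum_univ_succ]
  simp only [oneSum_00, oneSum_0s]
  simp
  congr 1

lemma bf_oneSum (H : Mt m) (x y : Vc (m + 1)) :
    bf (oneSum H) x y = x 0 * y 0 + bf H (fun i => x i.succ) (fun i => y i.succ) := by
  simp [bf, dotProduct, mulVec, Fin.sum_univ_succ]

lemma isU_oneSum_iff : IsU (oneSum H) ↔ IsU H := by
  constructor
  · intro h
    refine ⟨?_, ?_, ?_⟩
    · apply oneSum_inj; rw [← oneSum_transpose, h.sym]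
    · rw [← oneSum_det, h.det]
    · intro x hx
      have := h.pos (Fin.cons 0 x) (by
        intro h0; apply hx; ext i; simpa using congrFun h0 i.succ)
      unfold nf at this
      rw [bf_oneSum] at this
      simpa [nf] using this
  · intro h
    refine ⟨?_, ?_, ?_⟩
    · rw [oneSum_transpose, h.sym]
    · rw [oneSum_det, h.det]
    · intro x hx
      unfold nf; rw [bf_oneSum]
      have h1 := h.nonneg (fun i => x i.succ)
      by_cases h0 : (fun i : Fin m => x i.succ) = 0
      · have : x 0 ≠ 0 := by
          intro h2; apply hx; ext i
          refine Fin.cases h2 (fun i => congrFun h0 i) i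
        have h3 : 0 < x 0 * x 0 := mul_self_pos.mpr this
        unfold nf at h1; linarith
      · have h2 := h.pos _ h0
        have h3 : 0 ≤ x 0 * x 0 := mul_self_nonneg _
        unfold nf at h2; linarith

lemma oneSum_isos {A : Mt m} : oneSum A ∈ isos (oneSum H) (oneSum K) ↔ A ∈ isos H K := by
  simp only [isos, Set.mem_ofPred_eq, oneSum_transpose, oneSum_mul]
  exact oneSum_inj.eq_iff

/-- the first basis vector -/
def e0 (m : ℕ) : Vc (m + 1) := Pi.single 0 1

lemma nf_e0 : nf (oneSum H) (e0 m) = 1 := by unfold nf e0; rw [bf_single]; rfl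

lemma isos_fix {C : Mt (m + 1)} (hC : C ∈ isos (oneSum H) (oneSum K)) (h0 : C *ᵥ e0 m = e0 m) :
    ∃ U ∈ isos H K, C = oneSum U := by
  have hC' : Cᵀ * oneSum H * C = oneSum K := hC
  have hcol : ∀ i, C i 0 = (e0 m) i := by
    intro i; rw [← h0]; simp [e0]
  have hrow : ∀ j : Fin m, C 0 j.succ = 0 := by
    intro j
    have h1 : bf (oneSum K) (e0 m) (Pi.single j.succ 1) = 0 := by
      unfold e0; rw [bf_single]; rfl
    rw [← hC', ← bf_mulVec, h0, bf_oneSum] at h1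
    have h2 : (fun i : Fin m => e0 m i.succ) = 0 := by ext i; simp [e0]
    rw [h2, bf_zero_left] at h1
    simpa [e0] using h1
  have : C = oneSum (Matrix.of fun i j : Fin m => C i.succ j.succ) := by
    ext i j; refine Fin.cases ?_ (fun i => ?_) i <;> refine Fin.cases ?_ (fun j => ?_) j
    · rw [hcol]; simp [e0]
    · rw [hrow]; rfl
    · rw [hcol]; simp [e0]
    · rfl
  refine ⟨_, ?_, this⟩
  rw [← oneSum_isos, ← this]; exact hC

/-- a norm-one vector splits off -/
lemma exists_split {G : Mt (m + 1)} (h : IsU G) {e : Vc (m + 1)} (he : nf G e = 1) :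
    ∃ (H : Mt m) (A : Mt (m + 1)), IsU H ∧ A ∈ isos G (oneSum H) ∧ A *ᵥ e0 m = e := by
  let φ : Vc (m + 1) →ₗ[ℤ] ℤ :=
    { toFun := fun x => bf G e x
      map_add' := fun x y => bf_add_right G e x y
      map_smul' := fun c x => bf_smul_right G c e x }
  have hφ : ∀ x, φ x = bf G e x := fun _ => rfl
  have hr : LinearMap.range φ = ⊤ := by
    rw [LinearMap.range_eq_top]; intro c
    refine ⟨c • e, ?_⟩
    rw [hφ, bf_smul_right]; change c * nf G e = c; rw [he, mul_one]
  have hk : Module.finrank ℤ (LinearMap.ker φ) = m := by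
    have h1 := Submodule.finrank_quotient_add_finrank (LinearMap.ker φ)
    have h2 := (φ.quotKerEquivOfSurjective (LinearMap.range_eq_top.mp hr)).finrank_eq
    rw [h2] at h1
    simp at h1
    omega
  let b := Module.finBasisOfFinrankEq ℤ (LinearMap.ker φ) hk
  let A : Mt (m + 1) := Matrix.of fun i j => (Fin.cons e (fun j => (b j).1) : Fin (m+1) → Vc (m+1)) j i
  have hA0 : A *ᵥ e0 m = e := by ext i; simp [A, e0]
  have hAs : ∀ j : Fin m, A *ᵥ Pi.single j.succ 1 = (b j).1 := by intro j; ext i; simp [A]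
  have key : ∀ x : Vc (m + 1), A *ᵥ x = x 0 • e + (∑ j, x j.succ • b j : LinearMap.ker φ) := by
    intro x; ext i
    simp only [A, mulVec, dotProduct, of_apply, Fin.sum_univ_succ, Fin.cons_zero, Fin.cons_succ,
      AddSubmonoidClass.coe_finset_sum, Finset.sum_apply, Submodule.coe_smul, Pi.smul_apply,
      Pi.add_apply, smul_eq_mul, mul_comm]
  have hu : IsUnit A.det := by
    obtain ⟨U, hU⟩ := exists_mul_of_rng_le (A := A) (B := 1) (by
      intro y _
      rw [mem_rng]
      have hy : y - φ y • e ∈ LinearMap.ker φ := by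
        rw [LinearMap.mem_ker, map_sub, map_smul, hφ e]
        change φ y - φ y * nf G e = 0
        rw [he]; ring
      refine ⟨Fin.cons (φ y) (fun j => b.repr ⟨_, hy⟩ j), ?_⟩
      rw [key]
      simp only [Fin.cons_zero, Fin.cons_succ]
      rw [b.sum_repr]; simp)
    have := congrArg Matrix.det hU
    rw [det_mul, det_one] at this
    exact IsUnit.of_mul_eq_one _ this.symm
  have hU := isU_of_unit h hu
  set H : Mt m := Matrix.of fun i j => (Aᵀ * G * A) i.succ j.succ with hH
  have hs : ∀ j : Fin m, (Aᵀ * G * A) 0 j.succ = 0 := by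
    intro j
    rw [← bf_single (Aᵀ * G * A), ← bf_mulVec]
    change bf G (A *ᵥ e0 m) _ = 0
    rw [hA0, hAs]
    exact LinearMap.mem_ker.mp (b j).2
  have hAG : Aᵀ * G * A = oneSum H := by
    ext i j; refine Fin.cases ?_ (fun i => ?_) i <;> refine Fin.cases ?_ (fun j => ?_) j
    · rw [← bf_single (Aᵀ * G * A), ← bf_mulVec]
      change bf G (A *ᵥ e0 m) (A *ᵥ e0 m) = 1
      rw [hA0]; exact he
    · rw [hs]; rfl
    · have := congrFun (congrFun hU.sym i.succ) 0
      rw [transpose_apply] at this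
      rw [← this, hs]; rfl
    · rfl
  refine ⟨H, A, ?_, hAG, hA0⟩
  rw [← isU_oneSum_iff, ← hAG]; exact hU

/-- Oddness -/
def OddF {n : ℕ} (G : Mt n) : Prop := ∃ x, Odd (nf G x)
def EvenF {n : ℕ} (G : Mt n) : Prop := ∀ x, Even (nf G x)

lemma not_oddF {n : ℕ} {G : Mt n} : ¬ OddF G ↔ EvenF G := by simp [OddF, EvenF]

lemma OddF.iso {n : ℕ} {G H : Mt n} (hG : IsU G) (hH : IsU H) (h : Iso G H) (ho : OddF G) :
    OddF H := by
  obtain ⟨A, hA⟩ := h.symm hG hH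
  obtain ⟨x, hx⟩ := ho
  refine ⟨A *ᵥ x, ?_⟩
  rw [nf_mulVec, show Aᵀ * H * A = G from hA]; exact hx

lemma oddF_oneSum (H : Mt m) : OddF (oneSum H) := ⟨e0 m, by rw [nf_e0]; exact odd_one⟩

/-- representation numbers -/
noncomputable def rep {n : ℕ} (G : Mt n) (k : ℤ) : ℕ := {x : Vc n | nf G x = k}.ncard

lemma finite_rep {n : ℕ} {G : Mt n} (h : IsU G) (k : ℤ) : {x : Vc n | nf G x = k}.Finite :=
  (h.finite_le k).subset fun _ hx => le_of_eq hx

lemma split_a {G : Mt (m + 1)} (h : IsU G) {R' : Finset (Mt m)} (hR' : IsReps (fun _ => True) R') :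
    ∑ H ∈ R', ((isos G (oneSum H)).ncard : ℝ) / autc H = rep G 1 := by
  refine (count_torsor R' (fun H => isos G (oneSum H)) (fun _ A => A *ᵥ e0 m)
    {x | nf G x = 1} autc ?_ ?_ ?_ ?_).2
  · intro H hH; exact autc_pos (hR'.mem H hH).1
  · intro H _; exact finite_isos h _
  · intro H _ A hA
    change nf G _ = 1
    rw [nf_mulVec, show Aᵀ * G * A = _ from hA, nf_e0]
  · intro e he
    obtain ⟨H, A, hH, hA, hAe⟩ := exists_split h he
    obtain ⟨H1, hH1, V, hV⟩ := hR'.cover H hH trivial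
    have hH1u := (hR'.mem H1 hH1).1
    set B := A * oneSum V
    have hB : B ∈ isos G (oneSum H1) := isos_comp hA (oneSum_isos.mpr hV)
    have hV0 : ∀ V : Mt m, oneSum V *ᵥ e0 m = e0 m := by
      intro V; ext i; refine Fin.cases ?_ (fun i => ?_) i <;> simp [e0]
    have hBe : B *ᵥ e0 m = e := by rw [← mulVec_mulVec, hV0, hAe]
    have hBu : IsUnit B.det := iso_isUnit h (isU_oneSum_iff.mpr hH1u) hB
    have key : ∀ (H2 : Mt m) (C : Mt (m+1)), C ∈ isos G (oneSum H2) → C *ᵥ e0 m = e →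
        ∃ U ∈ isos H1 H2, C = B * oneSum U := by
      intro H2 C hC hCe
      obtain ⟨U, hU, hU'⟩ := isos_fix (isos_comp (isos_inv hBu hB) hC) (by
        rw [← mulVec_mulVec, hCe, ← hBe, mulVec_mulVec, nonsing_inv_mul _ hBu, one_mulVec])
      refine ⟨U, hU, ?_⟩
      rw [← hU', ← Matrix.mul_assoc, mul_nonsing_inv _ hBu, Matrix.one_mul]
    refine ⟨H1, hH1, ?_, ?_⟩
    · have : {a | a ∈ isos G (oneSum H1) ∧ a *ᵥ e0 m = e} = (fun U => B * oneSum U) '' isos H1 H1 := by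
        ext C
        simp only [Set.mem_ofPred_eq, Set.mem_image]
        constructor
        · rintro ⟨h1, h2⟩
          obtain ⟨U, hU, rfl⟩ := key H1 C h1 h2
          exact ⟨U, hU, rfl⟩
        · rintro ⟨U, hU, rfl⟩
          refine ⟨isos_comp hB (oneSum_isos.mpr hU), ?_⟩
          rw [← mulVec_mulVec, hV0, hBe]
      rw [this, Set.ncard_image_of_injective]
      · rfl
      · intro U V hUV
        exact oneSum_inj (mul_left_inj_of_det hBu.ne_zero hUV)
    · intro H2 hH2 hne C hC hCe
      obtain ⟨U, hU, -⟩ := key H2 C hC hCe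
      exact hne (hR'.irr _ hH1 _ hH2 ⟨U, hU⟩).symm

lemma iso_count_one {n : ℕ} {P : Mt n → Prop} {R : Finset (Mt n)} (hR : IsReps P R) {K : Mt n}
    (hK : IsU K) (hP : P K) : ∑ G ∈ R, ((isos G K).ncard : ℝ) / autc G = 1 := by
  have := (count_torsor R (fun G => isos G K) (fun _ _ => ()) Set.univ autc ?_ ?_ ?_ ?_).2
  · rw [this]; simp
  · intro H hH; exact autc_pos (hR.mem H hH).1
  · intro G hG; exact finite_isos (hR.mem G hG).1 _
  · intro H _ A hA; trivial
  · intro _ _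
    obtain ⟨G1, hG1, V, hV⟩ := hR.cover K hK hP
    have hG1u := (hR.mem G1 hG1).1
    have hVu := iso_isUnit hK hG1u hV
    refine ⟨G1, hG1, ?_, ?_⟩
    · have : {a | a ∈ isos G1 K ∧ () = ()} = (fun U => U * V⁻¹) '' isos G1 G1 := by
        ext C
        simp only [Set.mem_ofPred_eq, Set.mem_image, and_true]
        constructor
        · intro h1
          exact ⟨C * V, isos_comp h1 hV, by
            rw [Matrix.mul_assoc, mul_nonsing_inv _ hVu, Matrix.mul_one]⟩
        · rintro ⟨U, hU, rfl⟩
          exact isos_comp hU (isos_inv hVu hV)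
      rw [this, Set.ncard_image_of_injective]
      · rfl
      · intro U W hUW
        have := congrArg (fun X => X * V) hUW
        simpa only [Matrix.mul_assoc, nonsing_inv_mul _ hVu, Matrix.mul_one] using this
    · intro G2 hG2 hne C hC _
      exact hne (hR.irr _ hG2 _ hG1 (Iso.trans ⟨C, hC⟩ ⟨V, hV⟩))

/-- Step 1 -/
theorem split_mass {R : Finset (Mt (m + 1))} (hR : IsReps OddF R) {R' : Finset (Mt m)}
    (hR' : IsReps (fun _ => True) R') :
    ∑ G ∈ R, (rep G 1 : ℝ) / autc G = mass R' := by
  calc ∑ G ∈ R, (rep G 1 : ℝ) / autc G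
      = ∑ G ∈ R, ∑ H ∈ R', ((isos G (oneSum H)).ncard : ℝ) / autc G * (1 / autc H) := by
        apply Finset.sum_congr rfl; intro G hG
        rw [← split_a (hR.mem G hG).1 hR', Finset.sum_div]
        apply Finset.sum_congr rfl; intro H _; ring
    _ = ∑ H ∈ R', (∑ G ∈ R, ((isos G (oneSum H)).ncard : ℝ) / autc G) * (1 / autc H) := by
        rw [Finset.sum_comm]
        apply Finset.sum_congr rfl; intro H _; rw [Finset.sum_mul]
    _ = mass R' := by
        unfold mass
        apply Finset.sum_congr rfl; intro H hH
        rw [iso_count_one hR (isU_oneSum_iff.mpr (hR'.mem H hH).1) (oddF_oneSum H), one_mul]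

/-- finiteness descends -/
lemma reps_descend {R : Finset (Mt (m + 1))} (hR : IsReps OddF R) :
    ∃ R' : Finset (Mt m), IsReps (fun _ => True) R' := by
  classical
  have hfin : {p : Mt (m+1) × Vc (m+1) | p.1 ∈ R ∧ nf p.1 p.2 = 1}.Finite := by
    apply (R.finite_toSet.biUnion (t := fun G => (fun e => (G, e)) '' {x | nf G x = 1})
      (fun G hG => (finite_rep (hR.mem G hG).1 1).image _)).subset
    rintro ⟨G, e⟩ ⟨h1, h2⟩
    simp only [Set.mem_iUnion]
    exact ⟨G, h1, e, h2, rfl⟩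
  have hch : ∀ p : Mt (m+1) × Vc (m+1), ∃ H : Mt m, p.1 ∈ R ∧ nf p.1 p.2 = 1 →
      IsU H ∧ ∃ A, A ∈ isos p.1 (oneSum H) ∧ A *ᵥ e0 m = p.2 := by
    intro p
    by_cases hp : p.1 ∈ R ∧ nf p.1 p.2 = 1
    · obtain ⟨H, A, h1, h2, h3⟩ := exists_split (hR.mem _ hp.1).1 hp.2
      exact ⟨H, fun _ => ⟨h1, A, h2, h3⟩⟩
    · exact ⟨0, fun h => absurd h hp⟩
  choose φ hφ using hch
  apply exists_reps _ (φ '' {p | p.1 ∈ R ∧ nf p.1 p.2 = 1}) (hfin.image _)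
  · rintro _ ⟨p, hp, rfl⟩; exact (hφ p hp).1
  · intro H hH _
    have hHu := isU_oneSum_iff.mpr hH
    obtain ⟨G, hG, hiso⟩ := hR.cover (oneSum H) hHu (oddF_oneSum H)
    have hGu := (hR.mem G hG).1
    obtain ⟨B, hB⟩ := hiso.symm hHu hGu
    have he : nf G (B *ᵥ e0 m) = 1 := by
      rw [nf_mulVec, show Bᵀ * G * B = _ from hB, nf_e0]
    refine ⟨φ (G, B *ᵥ e0 m), ⟨_, ⟨hG, he⟩, rfl⟩, ?_⟩
    obtain ⟨-, A, hA, hAe⟩ := hφ (G, B *ᵥ e0 m) ⟨hG, he⟩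
    have hBu := iso_isUnit hGu hHu hB
    obtain ⟨U, hU, -⟩ := isos_fix (isos_comp (isos_inv hBu hB) hA) (by
        rw [← mulVec_mulVec, hAe]; simp only [mulVec_mulVec, nonsing_inv_mul _ hBu, one_mulVec])
    exact ⟨U, hU⟩

end MF

namespace MF
open Matrix
variable {n : ℕ} {G H G' : Mt n} {p : ℕ}

/-- divisibility of a vector -/
def pdv (p : ℕ) (x : Vc n) : Prop := ∀ i, (p : ℤ) ∣ x i

lemma pdv_iff {x : Vc n} : pdv p x ↔ ∃ z, x = (p : ℤ) • z := by
  constructor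
  · intro h; choose z hz using h; exact ⟨z, funext hz⟩
  · rintro ⟨z, rfl⟩ i; exact dvd_mul_right _ _
lemma pdv.add {x y : Vc n} (hx : pdv p x) (hy : pdv p y) : pdv p (x + y) :=
  fun i => dvd_add (hx i) (hy i)
lemma pdv.sub {x y : Vc n} (hx : pdv p x) (hy : pdv p y) : pdv p (x - y) :=
  fun i => dvd_sub (hx i) (hy i)
lemma pdv.smul {x : Vc n} (hx : pdv p x) (c : ℤ) : pdv p (c • x) :=
  fun i => (hx i).mul_left c
lemma pdv_smul (z : Vc n) : pdv p ((p : ℤ) • z) := fun _ => dvd_mul_right _ _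
lemma pdv_of_smul (hp : p.Prime) {x : Vc n} {c : ℤ} (hc : ¬ (p : ℤ) ∣ c) (h : pdv p (c • x)) :
    pdv p x := fun i => ((Nat.prime_iff_prime_int.mp hp).dvd_or_dvd (h i)).resolve_left hc
lemma pdv.mulVec {x : Vc n} (hx : pdv p x) (A : Mt n) : pdv p (A *ᵥ x) := by
  obtain ⟨z, rfl⟩ := pdv_iff.mp hx
  rw [mulVec_smul]; exact pdv_smul _
lemma pdv.bf {x : Vc n} (hx : pdv p x) (y : Vc n) : (p : ℤ) ∣ bf G x y := by
  obtain ⟨z, rfl⟩ := pdv_iff.mp hx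
  rw [bf_smul_left]; exact dvd_mul_right _ _

lemma exists_inv_mod (hp : p.Prime) {a : ℤ} (ha : ¬ (p : ℤ) ∣ a) : ∃ b : ℤ, (p : ℤ) ∣ b * a - 1 := by
  have : IsCoprime (p : ℤ) a := (Nat.prime_iff_prime_int.mp hp).irreducible.coprime_iff_not_dvd.mpr ha
  obtain ⟨u, v, h⟩ := this
  exact ⟨v, -u, by linarith⟩

lemma pdv_of_bf (h : IsU G) {x : Vc n} (hx : ∀ z, (p : ℤ) ∣ bf G z x) : pdv p x := by
  intro i
  have := hx (G⁻¹ *ᵥ Pi.single i 1)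
  rw [h.dual] at this; simpa using this

lemma exists_bf_one (h : IsU G) (hp : p.Prime) {w : Vc n} (hw : ¬ pdv p w) :
    ∃ v, (p : ℤ) ∣ bf G v w - 1 := by
  have : ∃ z, ¬ (p : ℤ) ∣ bf G z w := by
    by_contra hc; push Not at hc; exact hw (pdv_of_bf h hc)
  obtain ⟨z, hz⟩ := this
  obtain ⟨b, hb⟩ := exists_inv_mod hp hz
  exact ⟨b • z, by rw [bf_smul_left]; exact hb⟩

/-- the neighbour lattice attached to `w` -/
def Lam (p : ℕ) (G : Mt n) (w : Vc n) : Submodule ℤ (Vc n) where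
  carrier := {y | ∃ (z : Vc n) (t : ℤ), (p : ℤ) ∣ bf G z w ∧ y = (p : ℤ) • z + t • w}
  add_mem' := by
    rintro _ _ ⟨z, t, hz, rfl⟩ ⟨z', t', hz', rfl⟩
    refine ⟨z + z', t + t', ?_, ?_⟩
    · rw [bf_add_left]; exact dvd_add hz hz'
    · rw [smul_add, add_smul]; abel
  zero_mem' := ⟨0, 0, by rw [bf_zero_left]; exact dvd_zero _, by simp⟩
  smul_mem' := by
    rintro c _ ⟨z, t, hz, rfl⟩
    refine ⟨c • z, c * t, ?_, ?_⟩
    · rw [bf_smul_left]; exact hz.mul_left c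
    · rw [smul_add, smul_comm, smul_smul c t]

lemma mem_Lam {w y : Vc n} : y ∈ Lam p G w ↔
    ∃ (z : Vc n) (t : ℤ), (p : ℤ) ∣ bf G z w ∧ y = (p : ℤ) • z + t • w := Iff.rfl

lemma self_mem_Lam (w : Vc n) : w ∈ Lam p G w :=
  ⟨0, 1, by rw [bf_zero_left]; exact dvd_zero _, by simp⟩

/-- rank one modulo `p` -/
def RkS (p : ℕ) (Λ : Submodule ℤ (Vc n)) : Prop :=
  ∃ w ∈ Λ, ¬ pdv p w ∧ ∀ y ∈ Λ, ∃ t : ℤ, pdv p (y - t • w)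

lemma rkS_Lam {w : Vc n} (hw : ¬ pdv p w) : RkS p (Lam p G w) := by
  refine ⟨w, self_mem_Lam w, hw, ?_⟩
  rintro _ ⟨z, t, -, rfl⟩
  exact ⟨t, by rw [add_sub_cancel_right]; exact pdv_smul z⟩

lemma sd_Lam (h : IsU G) (hp : p.Prime) {w : Vc n} (hw : ¬ pdv p w)
    (hN : (p : ℤ) ^ 2 ∣ nf G w) : SD G ((p : ℤ) ^ 2) (Lam p G w) := by
  have hp0 : (p : ℤ) ≠ 0 := by exact_mod_cast hp.ne_zero
  constructor
  · rintro _ ⟨z, t, ⟨a, hz⟩, rfl⟩ _ ⟨z', t', ⟨a', hz'⟩, rfl⟩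
    obtain ⟨N, hN⟩ := hN
    unfold nf at hN
    simp only [bf_add_left, bf_add_right, bf_smul_left, bf_smul_right, hz, hN,
      bf_comm h.sym w z', hz']
    exact ⟨bf G z z' + t' * a + t * a' + t * t' * N, by ring⟩
  · intro y hy
    obtain ⟨v, hv⟩ := exists_bf_one h hp hw
    have h1 : ∀ z, (p : ℤ) ∣ bf G z w → (p : ℤ) ∣ bf G y z := by
      intro z hz
      have := hy ((p : ℤ) • z) ⟨z, 0, hz, by simp⟩
      rw [bf_smul_right, sq] at this
      exact (mul_dvd_mul_iff_left hp0).mp this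
    have h2 : pdv p (y - bf G y v • w) := by
      apply pdv_of_bf h
      intro z
      have h3 := h1 (z - bf G z w • v) (by
        rw [bf_sub_left, bf_smul_left]
        have := hv.mul_left (bf G z w)
        have h4 : bf G z w - bf G z w * bf G v w = -(bf G z w * (bf G v w - 1)) := by ring
        rw [h4]; exact this.neg_right)
      rw [bf_sub_right, bf_smul_right] at h3
      rw [bf_sub_right, bf_smul_right, bf_comm h.sym z y]
      convert h3 using 1; ring
    obtain ⟨z, hz⟩ := pdv_iff.mp h2
    have hyz : y = (p : ℤ) • z + bf G y v • w := by rw [← hz]; abel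
    refine ⟨z, bf G y v, ?_, hyz⟩
    have h3 := hy w (self_mem_Lam w)
    rw [hyz] at h3
    rw [bf_add_left, bf_smul_left, bf_smul_left] at h3
    have h4 : (p : ℤ) ^ 2 ∣ (p : ℤ) * bf G z w := by
      have := dvd_sub h3 (hN.mul_left (bf G y v))
      unfold nf at this
      rwa [add_sub_cancel_right] at this
    rw [sq] at h4
    exact (mul_dvd_mul_iff_left hp0).mp h4

lemma sd_eq_of_le (h : IsU G) {c : ℤ} {Λ M : Submodule ℤ (Vc n)} (h1 : SD G c Λ) (h2 : SD G c M)
    (hle : Λ ≤ M) : Λ = M := by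
  apply le_antisymm hle
  intro y hy
  exact h1.2 y fun l hl => h2.1 y hy l (hle hl)

lemma eq_Lam (h : IsU G) (hp : p.Prime) {Λ : Submodule ℤ (Vc n)} (hΛ : SD G ((p : ℤ) ^ 2) Λ)
    (hr : RkS p Λ) {w : Vc n} (hwΛ : w ∈ Λ) (hw : ¬ pdv p w) : Λ = Lam p G w := by
  have hp0 : (p : ℤ) ≠ 0 := by exact_mod_cast hp.ne_zero
  have hN : (p : ℤ) ^ 2 ∣ nf G w := hΛ.1 w hwΛ w hwΛ
  apply sd_eq_of_le h hΛ (sd_Lam h hp hw hN)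
  intro y hy
  obtain ⟨w0, hw0, hw0', hall⟩ := hr
  obtain ⟨t, ht⟩ := hall y hy
  obtain ⟨s, hs⟩ := hall w hwΛ
  have hsp : ¬ (p : ℤ) ∣ s := by
    rintro ⟨s', rfl⟩
    apply hw
    have : w = (w - ((p : ℤ) * s') • w0) + (p : ℤ) • (s' • w0) := by
      rw [smul_smul]; abel
    rw [this]; exact hs.add (pdv_smul _)
  obtain ⟨b, hb⟩ := exists_inv_mod hp hsp
  have h1 : pdv p (y - (t * b) • w) := by
    obtain ⟨z1, hz1⟩ := pdv_iff.mp ht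
    obtain ⟨z2, hz2⟩ := pdv_iff.mp hs
    obtain ⟨q, hq⟩ := hb
    have e1 : y = (p : ℤ) • z1 + t • w0 := by rw [← hz1]; abel
    have e2 : w = (p : ℤ) • z2 + s • w0 := by rw [← hz2]; abel
    rw [pdv_iff]
    refine ⟨z1 - (t * b) • z2 - (t * q) • w0, ?_⟩
    have e3 : b * s = 1 + p * q := by linarith
    ext i
    simp only [e1, e2, Pi.sub_apply, Pi.add_apply, Pi.smul_apply, smul_eq_mul]
    linear_combination (-t * w0 i) * e3
  obtain ⟨z, hz⟩ := pdv_iff.mp h1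
  have hyz : y = (p : ℤ) • z + (t * b) • w := by rw [← hz]; abel
  refine ⟨z, t * b, ?_, hyz⟩
  have h3 := hΛ.1 y hy w hwΛ
  rw [hyz, bf_add_left, bf_smul_left, bf_smul_left] at h3
  have h4 : (p : ℤ) ^ 2 ∣ (p : ℤ) * bf G z w := by
    have := dvd_sub h3 (hN.mul_left (t * b))
    unfold nf at this
    rwa [add_sub_cancel_right] at this
  rw [sq] at h4
  exact (mul_dvd_mul_iff_left hp0).mp h4

/-- adjoint embedding -/
noncomputable def adj (G' G A : Mt n) : Mt n := G⁻¹ * Aᵀ * G'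

lemma adj_mul (h : IsU G) {A : Mt n} {c : ℤ}
    (hA : Aᵀ * G' * A = c • G) : adj G' G A * A = c • (1 : Mt n) := by
  unfold adj
  rw [Matrix.mul_assoc, Matrix.mul_assoc, ← Matrix.mul_assoc Aᵀ, hA, Matrix.mul_smul, h.inv_mul]

lemma mul_adj (h : IsU G) {A : Mt n} {c : ℤ} (hc : c ≠ 0)
    (hA : Aᵀ * G' * A = c • G) : A * adj G' G A = c • (1 : Mt n) := by
  have h1 := adj_mul h hA
  have hd := iso_det_ne h hc hA
  have h2 : (adj G' G A).det ≠ 0 := by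
    intro h0
    have := congrArg Matrix.det h1
    rw [det_mul, h0, zero_mul, det_smul, det_one, mul_one] at this
    exact pow_ne_zero _ hc this.symm
  apply mul_left_inj_of_det h2
  rw [← Matrix.mul_assoc, h1, smul_mul, Matrix.mul_smul, Matrix.one_mul, Matrix.mul_one]

lemma adj_emb (h' : IsU G') (h : IsU G) {A : Mt n} {c : ℤ} (hc : c ≠ 0)
    (hA : Aᵀ * G' * A = c • G) : (adj G' G A)ᵀ * G * adj G' G A = c • G' := by
  have h1 : (adj G' G A)ᵀ * G = G' * A := by
    unfold adj
    rw [transpose_mul, transpose_mul, transpose_transpose, h'.sym, h.inv_sym]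
    rw [Matrix.mul_assoc, Matrix.mul_assoc, h.inv_mul, Matrix.mul_one]
  rw [h1, Matrix.mul_assoc, mul_adj h hc hA, Matrix.mul_smul, Matrix.mul_one]

lemma adj_adj (h' : IsU G') (h : IsU G) (A : Mt n) : adj G G' (adj G' G A) = A := by
  unfold adj
  rw [transpose_mul, transpose_mul, transpose_transpose, h'.sym, h.inv_sym]
  rw [← Matrix.mul_assoc, h'.inv_mul, Matrix.one_mul, Matrix.mul_assoc, h.inv_mul, Matrix.mul_one]

lemma rkS_adj (h' : IsU G') (h : IsU G) (hp : p.Prime) {A : Mt n} (hr : RkS p (rng A)) :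
    RkS p (rng (adj G' G A)) := by
  obtain ⟨w, hw, hwp, hall⟩ := hr
  have h1 : ∀ j, ∃ t : ℤ, pdv p (A *ᵥ Pi.single j 1 - t • w) :=
    fun j => hall _ (mem_rng.mpr ⟨_, rfl⟩)
  choose t ht using h1
  have h2 : ∀ x, pdv p (A *ᵥ x - (t ⬝ᵥ x) • w) := by
    intro x i
    have : (A *ᵥ x - (t ⬝ᵥ x) • w) i = ∑ j, x j * (A *ᵥ Pi.single j 1 - t j • w) i := by
      simp only [Pi.sub_apply, Pi.smul_apply, smul_eq_mul, mul_sub, Finset.sum_sub_distrib]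
      congr 1
      · simp only [mulVec_single_one]
        simp [mulVec, dotProduct, mul_comm]
      · simp only [dotProduct, Finset.sum_mul]
        apply Finset.sum_congr rfl; intros; ring
    rw [this]
    exact Finset.dvd_sum fun j _ => (ht j i).mul_left _
  have htp : ¬ pdv p t := by
    intro hc
    obtain ⟨x, rfl⟩ := mem_rng.mp hw
    apply hwp
    have h3 := h2 x
    have h4 : pdv p ((t ⬝ᵥ x) • (A *ᵥ x)) := fun i =>
      (Finset.dvd_sum (fun j _ => (hc j).mul_right _) : (p : ℤ) ∣ t ⬝ᵥ x).mul_right _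
    have := h3.add h4
    rwa [sub_add_cancel] at this
  -- action of the adjoint
  have h5 : ∀ y, pdv p (adj G' G A *ᵥ y - bf G' w y • (G⁻¹ *ᵥ t)) := by
    intro y
    apply pdv_of_bf h
    intro z
    rw [bf_sub_right, bf_smul_right, bf_comm h.sym z (G⁻¹ *ᵥ t), h.dual]
    have h6 : bf G z (adj G' G A *ᵥ y) = bf G' (A *ᵥ z) y := by
      unfold bf adj
      rw [← mulVec_mulVec, ← mulVec_mulVec, mulVec_mulVec _ G, h.mul_inv, one_mulVec,
        mulVec_transpose, dotProduct_comm z, ← dotProduct_mulVec, dotProduct_comm]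
    rw [h6]
    have := (h2 z).bf (G := G') y
    rw [bf_sub_left, bf_smul_left] at this
    convert this using 1; ring
  obtain ⟨v, hv⟩ := exists_bf_one h' hp hwp
  have htp' : ¬ pdv p (G⁻¹ *ᵥ t) := by
    intro hc
    have := hc.mulVec G
    rw [mulVec_mulVec, h.mul_inv, one_mulVec] at this
    exact htp this
  have hv' : pdv p (adj G' G A *ᵥ v - G⁻¹ *ᵥ t) := by
    have h6 := h5 v
    have h7 : pdv p ((bf G' w v - 1) • (G⁻¹ *ᵥ t)) := fun i => by
      rw [bf_comm h'.sym]; exact hv.mul_right _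
    have := h6.add h7
    rw [sub_smul, one_smul] at this
    convert this using 1; abel
  refine ⟨adj G' G A *ᵥ v, mem_rng.mpr ⟨_, rfl⟩, ?_, ?_⟩
  · intro hc; apply htp'
    have := hc.sub hv'
    convert this using 1; abel
  · intro y hy
    obtain ⟨y, rfl⟩ := mem_rng.mp hy
    refine ⟨bf G' w y, ?_⟩
    have := (h5 y).sub (hv'.smul (bf G' w y))
    rw [smul_sub] at this
    convert this using 1; abel

lemma adj_pdv_iff (h' : IsU G') (h : IsU G) (A : Mt n) (e : Vc n) :
    ¬ pdv p (adj G' G A *ᵥ e) ↔ ∃ y ∈ rng A, ¬ (p : ℤ) ∣ bf G' y e := by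
  have h6 : ∀ z, bf G z (adj G' G A *ᵥ e) = bf G' (A *ᵥ z) e := by
    intro z
    unfold bf adj
    rw [← mulVec_mulVec, ← mulVec_mulVec, mulVec_mulVec _ G, h.mul_inv, one_mulVec,
      mulVec_transpose, dotProduct_comm z, ← dotProduct_mulVec, dotProduct_comm]
  constructor
  · intro hn
    by_contra hc; push Not at hc
    apply hn; apply pdv_of_bf h; intro z
    rw [h6]; exact hc _ (mem_rng.mpr ⟨z, rfl⟩)
  · rintro ⟨y, hy, hn⟩ hc
    obtain ⟨z, rfl⟩ := mem_rng.mp hy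
    apply hn; rw [← h6, bf_comm h.sym]; exact hc.bf z

end MF

namespace MF
open Matrix
variable {n : ℕ} {G H G' : Mt n} {p : ℕ}

/-- the condition on neighbour lattices -/
def PrE (p : ℕ) (G : Mt n) (e : Vc n) (Λ : Submodule ℤ (Vc n)) : Prop :=
  RkS p Λ ∧ ∃ y ∈ Λ, ¬ (p : ℤ) ∣ bf G y e

/-- pairs embedding, unit vector -/
def XS (p : ℕ) (G G' : Mt n) : Set (Mt n × Vc n) :=
  {q | q.1ᵀ * G * q.1 = ((p : ℤ) ^ 2) • G' ∧ RkS p (rng q.1) ∧ nf G' q.2 = 1 ∧ ¬ pdv p (q.1 *ᵥ q.2)}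

lemma finite_XS (h : IsU G) (h' : IsU G') : (XS p G G').Finite := by
  apply Set.Finite.subset ((finite_isos' h (((p : ℤ) ^ 2) • G')).prod (finite_rep h' 1))
  rintro ⟨A, e⟩ ⟨h1, _, h2, _⟩
  exact ⟨h1, h2⟩

lemma countA (h : IsU G) (hp : p.Prime) {R : Finset (Mt n)} (hR : IsReps OddF R) (hodd : p ≠ 2) :
    ∑ G' ∈ R, ((XS p G G').ncard : ℝ) / autc G' =
      {w : Vc n | nf G w = (p : ℤ) ^ 2 ∧ ¬ pdv p w}.ncard := by
  have hp0 : (p : ℤ) ≠ 0 := by exact_mod_cast hp.ne_zero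
  have hp2 : ((p : ℤ) ^ 2) ≠ 0 := pow_ne_zero _ hp0
  have hp2' : 0 < ((p : ℤ) ^ 2) := by positivity
  refine (count_torsor R (fun G' => XS p G G') (fun _ q => q.1 *ᵥ q.2) _ (fun G' => autc G')
    ?_ ?_ ?_ ?_).2
  · intro G' hG'; exact autc_pos (hR.mem G' hG').1
  · intro G' hG'; exact finite_XS h (hR.mem G' hG').1
  · rintro G' hG' ⟨A, e⟩ ⟨h1, h2, h3, h4⟩
    refine ⟨?_, h4⟩
    show nf G (A *ᵥ e) = _
    simp only at h1 h3
    rw [nf_mulVec, h1, nf_smul_mat, h3, mul_one]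
  · rintro w ⟨hw1, hw2⟩
    have hsd := sd_Lam h hp hw2 (by rw [hw1])
    obtain ⟨A, G1, hrA, hA, hG1⟩ := exists_of_sd h hp2' hsd
    have hwA : w ∈ rng A := hrA ▸ self_mem_Lam w
    obtain ⟨e, he⟩ := mem_rng.mp hwA
    have hne : nf G1 e = 1 := by
      have := nf_mulVec G A e
      rw [he, hA, nf_smul_mat, hw1] at this
      have h3 : ((p : ℤ) ^ 2) * 1 = (p : ℤ) ^ 2 * nf G1 e := by rw [mul_one]; exact this
      exact (mul_left_cancel₀ hp2 h3).symm
    have hoddG1 : OddF G1 := by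
      by_contra hc
      have := not_oddF.mp hc e
      rw [hne] at this
      revert this; decide
    obtain ⟨G2, hG2, U, hU⟩ := hR.cover G1 hG1 hoddG1
    have hG2u := (hR.mem G2 hG2).1
    have hA1 := emb_move hA hU
    have hr : rng (A * U) = rng A := rng_mul_unit _ _ (iso_isUnit hG1 hG2u hU)
    have key : ∀ G3, IsU G3 → ∀ q ∈ XS p G G3, q.1 *ᵥ q.2 = w → rng q.1 = rng A := by
      rintro G3 hG3 ⟨B, f⟩ ⟨h1, h2, h3, h4⟩ h5
      simp only at *
      rw [hrA]
      exact eq_Lam h hp (sd_of_iso h hG3 hp2 h1) h2 (mem_rng.mpr ⟨f, h5⟩) hw2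
    refine ⟨G2, hG2, ?_, ?_⟩
    · rw [← ncard_torsor (iso_det_ne hG2u hp2 hA1)
        (X := {B | Bᵀ * G * B = ((p : ℤ) ^ 2) • G2 ∧ rng B = rng (A * U)})
        (fun B => emb_fiber hG2u hp2 hA1 B)]
      apply Set.ncard_congr (fun q _ => q.1)
      · rintro q ⟨hq, hq2⟩
        exact ⟨hq.1, (key _ hG2u q hq hq2).trans hr.symm⟩
      · rintro ⟨B, f⟩ ⟨C, g⟩ ⟨hq, hq2⟩ ⟨_, hq3⟩ hBC
        simp only at hBC hq2 hq3
        subst hBC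
        have := mulVec_inj_of_det (iso_det_ne hG2u hp2 hq.1) (hq2.trans hq3.symm)
        rw [this]
      · rintro B ⟨hB1, hB2⟩
        have : w ∈ rng B := by rw [hB2, hr]; exact hwA
        obtain ⟨f, hf⟩ := mem_rng.mp this
        refine ⟨(B, f), ⟨⟨hB1, ?_, ?_, ?_⟩, hf⟩, rfl⟩
        · show RkS p (rng B)
          rw [hB2, hr, hrA]; exact rkS_Lam hw2
        · have := nf_mulVec G B f
          rw [hf, hB1, nf_smul_mat, hw1] at this
          have h3 : ((p : ℤ) ^ 2) * 1 = (p : ℤ) ^ 2 * nf G2 f := by rw [mul_one]; exact this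
          exact (mul_left_cancel₀ hp2 h3).symm
        · show ¬ pdv p (B *ᵥ f)
          rw [hf]; exact hw2
    · intro G3 hG3 hne3 q hq hq2
      apply hne3
      have := key _ (hR.mem G3 hG3).1 q hq hq2
      exact hR.irr _ hG3 _ hG2 (emb_iso hp2 (hR.mem G3 hG3).1 hq.1 hA1 (this.trans hr.symm))

lemma rep_p_sq (h : IsU G) (hp : p.Prime) :
    ({w : Vc n | nf G w = (p : ℤ) ^ 2 ∧ ¬ pdv p w}.ncard : ℝ) = rep G ((p : ℤ) ^ 2) - rep G 1 := by
  have hp0 : (p : ℤ) ≠ 0 := by exact_mod_cast hp.ne_zero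
  have hp2 : ((p : ℤ) ^ 2) ≠ 0 := pow_ne_zero _ hp0
  have h1 : {w : Vc n | nf G w = (p : ℤ) ^ 2} =
      {w : Vc n | nf G w = (p : ℤ) ^ 2 ∧ ¬ pdv p w} ∪ (fun z => (p : ℤ) • z) '' {x | nf G x = 1} := by
    ext w
    simp only [Set.mem_ofPred_eq, Set.mem_union, Set.mem_image]
    constructor
    · intro hw
      by_cases hd : pdv p w
      · right
        obtain ⟨z, rfl⟩ := pdv_iff.mp hd
        rw [nf_smul] at hw
        have h3 : (p : ℤ) ^ 2 * nf G z = ((p : ℤ) ^ 2) * 1  := by rw [mul_one]; exact hw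
        exact ⟨z, mul_left_cancel₀ hp2 h3, rfl⟩
      · exact Or.inl ⟨hw, hd⟩
    · rintro (hw | ⟨z, hz, rfl⟩)
      · exact hw.1
      · rw [nf_smul, hz, mul_one]
  have hinj : Function.Injective (fun z : Vc n => (p : ℤ) • z) := smul_right_injective _ hp0
  unfold rep
  rw [h1, Set.ncard_union_eq ?_ ((finite_rep h _).subset fun _ hw => hw.1)
    ((finite_rep h 1).image _), Set.ncard_image_of_injective _ hinj]
  · push_cast; ring
  · rw [Set.disjoint_left]
    rintro _ ⟨_, hw⟩ ⟨z, _, rfl⟩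
    exact hw (pdv_smul z)

lemma XS_eq (h : IsU G) (h' : IsU G') (hp : p.Prime) :
    (XS p G G').ncard = ∑ e ∈ (finite_rep h' 1).toFinset, (embs G' G ((p : ℤ) ^ 2) (PrE p G' e)).ncard := by
  classical
  have hp0 : (p : ℤ) ≠ 0 := by exact_mod_cast hp.ne_zero
  have hp2 : ((p : ℤ) ^ 2) ≠ 0 := pow_ne_zero _ hp0
  have hf : ∀ e, (embs G' G ((p : ℤ) ^ 2) (PrE p G' e)).Finite := fun e => finite_embs h' _ _ _
  have : ∀ e, (embs G' G ((p : ℤ) ^ 2) (PrE p G' e)).ncard = (hf e).toFinset.card := fun e =>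
    Set.ncard_eq_toFinset_card _ _
  simp_rw [this]
  rw [← Finset.card_sigma, ← Set.ncard_coe_finset]
  symm
  apply Set.ncard_congr (fun (q : (_ : Vc n) × Mt n) _ => (adj G' G q.2, q.1))
  · rintro ⟨e, A⟩ hq
    simp only [Finset.coe_sigma, Set.Finite.coe_toFinset, Set.mem_sigma_iff, Set.mem_ofPred_eq] at hq
    obtain ⟨he, hA, hr, hy⟩ := hq
    refine ⟨adj_emb h' h hp2 hA, rkS_adj h' h hp hr, he, ?_⟩
    exact (adj_pdv_iff h' h A e).mpr hy
  · rintro ⟨e, A⟩ ⟨f, B⟩ _ _ heq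
    simp only [Prod.mk.injEq] at heq
    obtain ⟨h1, rfl⟩ := heq
    have : A = B := by rw [← adj_adj h' h A, h1, adj_adj h' h B]
    rw [this]
  · rintro ⟨B, e⟩ ⟨h1, h2, h3, h4⟩
    simp only at h1 h2 h3 h4
    refine ⟨⟨e, adj G G' B⟩, ?_, ?_⟩
    · simp only [Finset.coe_sigma, Set.Finite.coe_toFinset, Set.mem_sigma_iff, Set.mem_ofPred_eq]
      refine ⟨h3, adj_emb h h' hp2 h1, rkS_adj h h' hp h2, ?_⟩
      apply (adj_pdv_iff (p := p) h' h _ e).mp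
      rw [adj_adj h h']; exact h4
    · simp only [adj_adj h h']

/-- number of neighbour lattices -/
noncomputable def bS (p : ℕ) (G' : Mt n) (e : Vc n) : ℕ :=
  {Λ | SD G' ((p : ℤ) ^ 2) Λ ∧ PrE p G' e Λ}.ncard

lemma countB (h' : IsU G') (hp : p.Prime) (hodd : p ≠ 2) {R : Finset (Mt n)} (hR : IsReps OddF R)
    {e : Vc n} (he : nf G' e = 1) :
    ∑ G ∈ R, ((embs G' G ((p : ℤ) ^ 2) (PrE p G' e)).ncard : ℝ) / autc G = bS p G' e := by
  have hp0 : (p : ℤ) ≠ 0 := by exact_mod_cast hp.ne_zero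
  have hp2 : ((p : ℤ) ^ 2) ≠ 0 := pow_ne_zero _ hp0
  have hp2' : 0 < ((p : ℤ) ^ 2) := by positivity
  refine (count_sub h' hp2' hR _ ?_).2
  rintro A G hG hA -
  by_contra hc
  have hm := smul_mem_of_sd (sd_of_iso h' hG hp2 hA) e
  obtain ⟨z, hz⟩ := mem_rng.mp hm
  have h1 := nf_mulVec G' A z
  rw [hz, hA, nf_smul_mat, nf_smul, he, mul_one, sq ((p : ℤ) ^ 2)] at h1
  have h2 := mul_left_cancel₀ hp2 h1
  have h3 := not_oddF.mp hc z
  rw [← h2] at h3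
  have : Odd p := hp.odd_of_ne_two hodd
  have : Odd ((p : ℤ) ^ 2) := by exact_mod_cast this.pow
  exact (Int.not_even_iff_odd.mpr this) h3

theorem nbr_identity (hp : p.Prime) (hodd : p ≠ 2) {R : Finset (Mt n)} (hR : IsReps OddF R) :
    ∑ G ∈ R, ((rep G ((p : ℤ) ^ 2) : ℝ) - rep G 1) / autc G =
      ∑ G ∈ R.attach, (∑ e ∈ (finite_rep (hR.mem G.1 G.2).1 1).toFinset, (bS p G.1 e : ℝ)) / autc G.1 := by
  have h1 : ∀ G ∈ R, ((rep G ((p : ℤ) ^ 2) : ℝ) - rep G 1) / autc G =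
      ∑ G' ∈ R, ((XS p G G').ncard : ℝ) / autc G' / autc G := by
    intro G hG
    rw [← rep_p_sq (hR.mem G hG).1 hp, ← countA (hR.mem G hG).1 hp hR hodd, Finset.sum_div]
  rw [Finset.sum_congr rfl h1, Finset.sum_comm, ← Finset.sum_attach]
  apply Finset.sum_congr rfl
  rintro ⟨G', hG'⟩ -
  have h' := (hR.mem G' hG').1
  have : ∀ G ∈ R, ((XS p G G').ncard : ℝ) / autc G' / autc G =
     ∑ e ∈ (finite_rep h' 1).toFinset,
       ((embs G' G ((p : ℤ) ^ 2) (PrE p G' e)).ncard : ℝ) / autc G / autc G' := by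
    intro G hG
    rw [XS_eq (hR.mem G hG).1 h' hp]
    push_cast
    rw [Finset.sum_div, Finset.sum_div]
    exact Finset.sum_congr rfl fun e _ => div_right_comm _ _ _
  rw [Finset.sum_congr rfl this, Finset.sum_comm, Finset.sum_div]
  apply Finset.sum_congr rfl
  intro e he
  have he1 : nf G' e = 1 := by simpa using he
  rw [← countB h' hp hodd hR he1, Finset.sum_div]

/-- reduction mod p -/
def red (p : ℕ) (x : Vc n) : Fin n → ZMod p := fun i => (x i : ZMod p)

/-- residue count set -/
def resS (p : ℕ) (G : Mt n) (e : Vc n) : Set (Fin n → ZMod p) :=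
  {x | x ⬝ᵥ (G.map (fun a : ℤ => (a : ZMod p)) *ᵥ x) = 0 ∧
       x ⬝ᵥ (G.map (fun a : ℤ => (a : ZMod p)) *ᵥ red p e) = 1}

lemma red_bf (G : Mt n) (x y : Vc n) :
    red p x ⬝ᵥ (G.map (fun a : ℤ => (a : ZMod p)) *ᵥ red p y) = ((bf G x y : ℤ) : ZMod p) := by
  simp [bf, red, dotProduct, mulVec]

lemma red_lift [NeZero p] (x : Fin n → ZMod p) : ∃ w : Vc n, red p w = x :=
  ⟨fun i => ((x i).val : ℤ), by funext i; simp [red]⟩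

lemma red_eq_iff {x y : Vc n} : red p x = red p y ↔ pdv p (x - y) := by
  unfold red pdv
  rw [funext_iff]
  refine forall_congr' fun i => ?_
  rw [ZMod.intCast_eq_intCast_iff_dvd_sub, Pi.sub_apply, ← dvd_neg, neg_sub]

lemma exists_wx (h : IsU G) (hp : p.Prime) (hodd : p ≠ 2) {e : Vc n} {x : Fin n → ZMod p}
    (hx : x ∈ resS p G e) :
    ∃ w : Vc n, red p w = x ∧ (p : ℤ) ^ 2 ∣ nf G w ∧ (p : ℤ) ∣ bf G w e - 1 ∧ ¬ pdv p w := by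
  haveI : NeZero p := ⟨hp.ne_zero⟩
  obtain ⟨w0, rfl⟩ := red_lift x
  obtain ⟨h1, h2⟩ := hx
  rw [red_bf] at h1 h2
  have h1 : (p : ℤ) ∣ nf G w0 := (ZMod.intCast_zmod_eq_zero_iff_dvd _ _).mp h1
  have h2 : (p : ℤ) ∣ bf G w0 e - 1 := by
    rw [← ZMod.intCast_zmod_eq_zero_iff_dvd]; push_cast; rw [h2, sub_self]
  have hw0 : ¬ pdv p w0 := by
    intro hc
    have := dvd_sub (hc.bf (G := G) e) h2
    rw [sub_sub_cancel] at this
    exact hp.one_lt.ne' (by exact_mod_cast Int.eq_one_of_dvd_one (by positivity) this)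
  obtain ⟨v, hv⟩ := exists_bf_one h hp hw0
  have h2p : ¬ (p : ℤ) ∣ 2 := by
    intro hc
    have : p ∣ 2 := by exact_mod_cast hc
    exact hodd ((Nat.prime_dvd_prime_iff_eq hp Nat.prime_two).mp this)
  obtain ⟨b, hb⟩ := exists_inv_mod hp h2p
  obtain ⟨c, hc⟩ := h1
  set s := - (b * c) with hs
  refine ⟨w0 + (p : ℤ) • (s • v), ?_, ?_, ?_, ?_⟩
  · rw [red_eq_iff, add_sub_cancel_left]; exact pdv_smul _
  · rw [nf_add h.sym, nf_smul, bf_smul_right, bf_smul_right, bf_comm h.sym, hc]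
    obtain ⟨d, hd⟩ := hv
    obtain ⟨f, hf⟩ := hb
    have e1 : bf G v w0 = p * d + 1 := by linarith
    have e2 : b * 2 = p * f + 1 := by linarith
    rw [e1, hs]
    exact ⟨ - f * c - 2 * b * c * d + nf G (-(b * c) • v), by linear_combination (-(p:ℤ) * c) * e2⟩
  · rw [bf_add_left, bf_smul_left, add_sub_right_comm]
    exact dvd_add h2 (dvd_mul_right _ _)
  · intro hc
    have := hc.sub (pdv_smul (p := p) (s • v))
    rw [add_sub_cancel_right] at this
    exact hw0 this

lemma bS_eq (h : IsU G) (hp : p.Prime) (hodd : p ≠ 2) (e : Vc n) :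
    bS p G e = (resS p G e).ncard := by
  classical
  have hex := fun x (hx : x ∈ resS p G e) => exists_wx h hp hodd hx
  choose w hw1 hw2 hw3 hw4 using hex
  symm
  apply Set.ncard_congr (fun x hx => Lam p G (w x hx))
  · intro x hx
    refine ⟨sd_Lam h hp (hw4 x hx) (hw2 x hx), rkS_Lam (hw4 x hx), w x hx, self_mem_Lam _, ?_⟩
    intro hc
    have := dvd_sub hc (hw3 x hx)
    rw [sub_sub_cancel] at this
    exact hp.one_lt.ne' (by exact_mod_cast Int.eq_one_of_dvd_one (by positivity) this)
  · intro x y hx hy hxy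
    have hm : w y hy ∈ Lam p G (w x hx) := by rw [hxy]; exact self_mem_Lam _
    obtain ⟨z, t, hz, hwy⟩ := hm
    have h1 := hw3 x hx
    have h2 := hw3 y hy
    rw [hwy, bf_add_left, bf_smul_left, bf_smul_left] at h2
    have ht : (p : ℤ) ∣ t - 1 := by
      have := (h2.sub (h1.mul_left t)).sub (dvd_mul_right (p : ℤ) (bf G z e))
      ring_nf at this ⊢; exact this
    rw [← hw1 x hx, ← hw1 y hy, eq_comm, red_eq_iff, hwy]
    have : (p : ℤ) • z + t • w x hx - w x hx = (p : ℤ) • z + (t - 1) • w x hx := by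
      rw [sub_smul, one_smul]; abel
    rw [this]
    refine (pdv_smul z).add ?_
    obtain ⟨d, hd⟩ := ht
    rw [hd, mul_smul]; exact pdv_smul _
  · rintro Λ ⟨hsd, hrk, y, hy, hye⟩
    obtain ⟨b, hb⟩ := exists_inv_mod hp hye
    set y' := b • y with hy'
    have hyΛ : y' ∈ Λ := Λ.smul_mem b hy
    have hye' : (p : ℤ) ∣ bf G y' e - 1 := by rw [hy', bf_smul_left]; exact hb
    have hN : (p : ℤ) ^ 2 ∣ nf G y' := hsd.1 _ hyΛ _ hyΛ
    have hnp : ¬ pdv p y' := by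
      intro hc
      have := dvd_sub (hc.bf (G := G) e) hye'
      rw [sub_sub_cancel] at this
      exact hp.one_lt.ne' (by exact_mod_cast Int.eq_one_of_dvd_one (by positivity) this)
    have hx : red p y' ∈ resS p G e := by
      refine ⟨?_, ?_⟩
      · rw [red_bf]
        exact (ZMod.intCast_zmod_eq_zero_iff_dvd _ _).mpr ((dvd_pow_self _ two_ne_zero).trans hN)
      · rw [red_bf, ← sub_eq_zero]
        have := (ZMod.intCast_zmod_eq_zero_iff_dvd _ p).mpr hye'
        push_cast at this; exact this
    refine ⟨red p y', hx, ?_⟩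
    have hEq := eq_Lam h hp hsd hrk hyΛ hnp
    have h1 := red_eq_iff.mp (hw1 _ hx)
    obtain ⟨z, hz⟩ := pdv_iff.mp h1
    have hwz : w _ hx = y' + (p : ℤ) • z := by rw [← hz]; abel
    have h2 := hw2 _ hx
    rw [hwz, nf_add h.sym, nf_smul G (p : ℤ) z, bf_smul_right] at h2
    have h3 : (p : ℤ) ^ 2 ∣ p * (2 * bf G y' z) := by
      have := (h2.sub hN).sub (dvd_mul_right ((p : ℤ) ^ 2) (nf G z))
      rwa [show nf G y' + 2 * ((p : ℤ) * bf G y' z) + (p : ℤ) ^ 2 * nf G z - nf G y' - (p : ℤ) ^ 2 * nf G z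
        = p * (2 * bf G y' z) by ring] at this
    rw [sq] at h3
    have h4 := (mul_dvd_mul_iff_left (by exact_mod_cast hp.ne_zero : (p : ℤ) ≠ 0)).mp h3
    have h5 : (p : ℤ) ∣ bf G y' z := by
      rcases (Nat.prime_iff_prime_int.mp hp).dvd_or_dvd h4 with hc | hc
      · exfalso
        have : p ∣ 2 := by exact_mod_cast hc
        exact hodd ((Nat.prime_dvd_prime_iff_eq hp Nat.prime_two).mp this)
      · exact hc
    have hmem : w _ hx ∈ Λ := by
      rw [hEq, hwz]
      exact ⟨z, 1, by rw [bf_comm h.sym]; exact h5, by rw [one_smul, add_comm]⟩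
    exact (eq_Lam h hp hsd hrk hmem (hw4 _ hx)).symm
end MF

namespace MF
open Matrix
variable {n : ℕ} {G H G' : Mt n} {p : ℕ}

/-- additive character values -/
noncomputable def ps (p : ℕ) [NeZero p] (a : ZMod p) : ℂ := ZMod.stdAddChar a

lemma ps_add [NeZero p] (a b : ZMod p) : ps p (a + b) = ps p a * ps p b := AddChar.map_add_eq_mul _ _ _
lemma ps_zero [NeZero p] : ps p 0 = 1 := AddChar.map_zero_eq_one _
lemma ps_conj [NeZero p] (a : ZMod p) : (starRingEnd ℂ) (ps p a) = ps p (-a) := by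
  unfold ps
  rw [AddChar.map_neg_eq_conj]
lemma ps_sum [Fact p.Prime] (a : ZMod p) : ∑ b : ZMod p, ps p (b * a) = if a = 0 then (p : ℂ) else 0 := by
  have := AddChar.sum_mulShift a (ZMod.isPrimitive_stdAddChar p)
  simpa [ps, ZMod.card] using this

lemma ps_sum_vec [Fact p.Prime] (v : Fin n → ZMod p) :
    ∑ y : Fin n → ZMod p, ps p (v ⬝ᵥ y) = if v = 0 then (p : ℂ) ^ n else 0 := by
  have h1 : ∀ y : Fin n → ZMod p, ps p (v ⬝ᵥ y) = ∏ i, ps p (y i * v i) := by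
    intro y
    have : ∀ (s : Finset (Fin n)), ps p (∑ i ∈ s, v i * y i) = ∏ i ∈ s, ps p (y i * v i) := by
      intro s
      induction s using Finset.cons_induction with
      | empty => simp [ps_zero]
      | cons a s ha ih => rw [Finset.sum_cons, Finset.prod_cons, ps_add, ih, mul_comm (v a)]
    exact this _
  simp_rw [h1]
  have h2 := (Finset.prod_univ_sum (fun _ : Fin n => (Finset.univ : Finset (ZMod p)))
    (fun i b => ps p (b * v i))).symm
  rw [Fintype.piFinset_univ] at h2
  rw [h2]
  simp_rw [ps_sum]
  by_cases hv : v = 0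
  · simp [hv]
  · rw [if_neg hv]
    obtain ⟨i, hi⟩ := Function.ne_iff.mp hv
    exact Finset.prod_eq_zero (Finset.mem_univ i) (if_neg hi)

lemma gauss_abs [Fact p.Prime] (hodd : p ≠ 2) (M : Matrix (Fin n) (Fin n) (ZMod p)) (hM : Mᵀ = M)
    (hu : IsUnit M.det) (v : Fin n → ZMod p) {a : ZMod p} (ha : a ≠ 0) :
    ‖∑ x : Fin n → ZMod p, ps p (a * (x ⬝ᵥ (M *ᵥ x)) + v ⬝ᵥ x)‖ ^ 2 = (p : ℝ) ^ n := by
  have h2 : (2 : ZMod p) ≠ 0 := by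
    intro hc
    have : ((2 : ℕ) : ZMod p) = 0 := by exact_mod_cast hc
    rw [ZMod.natCast_eq_zero_iff] at this
    exact hodd ((Nat.prime_dvd_prime_iff_eq Fact.out Nat.prime_two).mp this)
  apply Complex.ofReal_injective
  rw [Complex.ofReal_pow, ← Complex.mul_conj', map_sum, Finset.sum_mul_sum]
  simp_rw [ps_conj, ← ps_add]
  rw [Finset.sum_comm]
  have h3 : ∀ y : Fin n → ZMod p, ∑ x : Fin n → ZMod p,
      ps p (a * (x ⬝ᵥ (M *ᵥ x)) + v ⬝ᵥ x + -(a * (y ⬝ᵥ (M *ᵥ y)) + v ⬝ᵥ y)) =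
      ∑ u : Fin n → ZMod p, ps p (a * (u ⬝ᵥ (M *ᵥ u)) + v ⬝ᵥ u) * ps p (((2 * a) • (M *ᵥ u)) ⬝ᵥ y) := by
    intro y
    rw [← Equiv.sum_comp (Equiv.addRight y)]
    apply Finset.sum_congr rfl
    intro u _
    rw [← ps_add]
    congr 1
    simp only [Equiv.coe_addRight, mulVec_add, dotProduct_add, add_dotProduct, smul_dotProduct, smul_eq_mul]
    have h4 : y ⬝ᵥ (M *ᵥ u) = u ⬝ᵥ (M *ᵥ y) := by
      rw [dotProduct_mulVec, ← mulVec_transpose, hM, dotProduct_comm]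
    rw [dotProduct_comm (M *ᵥ u) y, h4]; ring
  simp_rw [h3]
  rw [Finset.sum_comm]
  simp_rw [← Finset.mul_sum, ps_sum_vec]
  rw [Finset.sum_eq_single 0]
  · simp [ps_zero]
  · intro u _ hu0
    rw [if_neg, mul_zero]
    intro hc
    apply hu0
    have h5 : M *ᵥ u = 0 := (smul_eq_zero.mp hc).resolve_left (mul_ne_zero h2 ha)
    have h6 := congrArg (fun z => M⁻¹ *ᵥ z) h5
    simpa [mulVec_mulVec, nonsing_inv_mul _ hu] using h6
  · simp

lemma resS_bound (h : IsU G) (hp : p.Prime) (hodd : p ≠ 2) {e : Vc n} (he : nf G e = 1) (hn : 2 ≤ n) :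
    |((resS p G e).ncard : ℝ) - (p : ℝ) ^ (n - 2)| ≤ Real.sqrt ((p : ℝ) ^ n) := by
  classical
  haveI : Fact p.Prime := ⟨hp⟩
  set M := G.map (fun a : ℤ => (a : ZMod p)) with hMdef
  have hM : Mᵀ = M := by rw [hMdef, ← transpose_map, h.sym]
  have hu : IsUnit M.det := by
    have : M.det = ((G.det : ℤ) : ZMod p) := ((Int.castRingHom (ZMod p)).map_det G).symm
    rw [this, h.det]; simp
  have hpR : (0 : ℝ) < p := by exact_mod_cast hp.pos
  set ev := M *ᵥ red p e with hev
  have hev0 : ev ≠ 0 := by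
    intro hc
    have := red_bf (p := p) G e e
    change _ ⬝ᵥ ev = _ at this
    rw [hc, show bf G e e = nf G e from rfl, he] at this
    simp at this
  -- count as character sum
  have hcard : ((resS p G e).ncard : ℂ) * (p : ℂ) ^ 2 =
      ∑ a : ZMod p, ∑ b : ZMod p, ps p (-b) * ∑ x : Fin n → ZMod p, ps p (a * (x ⬝ᵥ (M *ᵥ x)) + (b • ev) ⬝ᵥ x) := by
    have h1 : ∀ x : Fin n → ZMod p, (∑ a : ZMod p, ps p (a * (x ⬝ᵥ (M *ᵥ x)))) *
        (∑ b : ZMod p, ps p (b * (x ⬝ᵥ ev - 1))) = if x ∈ resS p G e then (p : ℂ) ^ 2 else 0 := by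
      intro x
      rw [ps_sum, ps_sum]
      have : x ∈ resS p G e ↔ x ⬝ᵥ (M *ᵥ x) = 0 ∧ x ⬝ᵥ ev - 1 = 0 := by
        rw [sub_eq_zero]; rfl
      by_cases c1 : x ⬝ᵥ (M *ᵥ x) = 0 <;> by_cases c2 : x ⬝ᵥ ev - 1 = 0 <;> simp [this, c1, c2, sq]
    have h2 : ∑ x : Fin n → ZMod p, (if x ∈ resS p G e then (p : ℂ) ^ 2 else 0) =
        ((resS p G e).ncard : ℂ) * (p : ℂ) ^ 2 := by
      rw [← Finset.sum_filter, Finset.sum_const, nsmul_eq_mul, Set.ncard_eq_toFinset_card']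
      congr 3
      ext x; simp
    rw [← h2, ← Finset.sum_congr rfl fun x _ => h1 x]
    simp_rw [Finset.sum_mul_sum]
    rw [Finset.sum_comm]
    apply Finset.sum_congr rfl; intro a _
    rw [Finset.sum_comm]
    apply Finset.sum_congr rfl; intro b _
    rw [Finset.mul_sum]
    apply Finset.sum_congr rfl; intro x _
    rw [← ps_add, ← ps_add, smul_dotProduct, smul_eq_mul, dotProduct_comm ev x]
    congr 1; ring
  rw [Fintype.sum_eq_add_sum_compl 0] at hcard
  have hz : ∑ b : ZMod p, ps p (-b) * ∑ x : Fin n → ZMod p, ps p (0 * (x ⬝ᵥ (M *ᵥ x)) + (b • ev) ⬝ᵥ x)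
      = (p : ℂ) ^ n := by
    simp_rw [zero_mul, zero_add, ps_sum_vec, smul_eq_zero, hev0, or_false]
    rw [Finset.sum_eq_single 0]
    · simp [ps_zero]
    · intro b _ hb; simp [hb]
    · simp
  rw [hz] at hcard
  set E := ∑ a ∈ ({0} : Finset (ZMod p))ᶜ, ∑ b : ZMod p, ps p (-b) *
    ∑ x : Fin n → ZMod p, ps p (a * (x ⬝ᵥ (M *ᵥ x)) + (b • ev) ⬝ᵥ x) with hE
  have hEb : ‖E‖ ≤ (p : ℝ) ^ 2 * Real.sqrt ((p : ℝ) ^ n) := by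
    have hps : ∀ b : ZMod p, ‖ps p b‖ = 1 := fun b => AddChar.norm_apply _ _
    calc ‖E‖ ≤ ∑ a ∈ ({0} : Finset (ZMod p))ᶜ, ∑ b : ZMod p, Real.sqrt ((p : ℝ) ^ n) := by
          refine (norm_sum_le _ _).trans (Finset.sum_le_sum fun a ha => ?_)
          refine (norm_sum_le _ _).trans (Finset.sum_le_sum fun b _ => ?_)
          rw [norm_mul, hps, one_mul]
          apply Real.le_sqrt_of_sq_le
          have ha0 : a ≠ 0 := by simpa using ha
          exact (gauss_abs hodd M hM hu (b • ev) ha0).le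
      _ ≤ ∑ a : ZMod p, ∑ b : ZMod p, Real.sqrt ((p : ℝ) ^ n) := by
          apply Finset.sum_le_sum_of_subset_of_nonneg (Finset.subset_univ _)
          intros; positivity
      _ = _ := by simp [ZMod.card]; ring
  have h3 : (((resS p G e).ncard : ℂ) - (p : ℂ) ^ (n - 2)) * (p : ℂ) ^ 2 = E := by
    rw [sub_mul, ← pow_add, Nat.sub_add_cancel hn, hcard]; ring
  have h4 := congrArg norm h3
  rw [norm_mul, norm_pow, Complex.norm_natCast] at h4
  have h5 : ‖((resS p G e).ncard : ℂ) - (p : ℂ) ^ (n - 2)‖ = |((resS p G e).ncard : ℝ) - (p : ℝ) ^ (n - 2)| := by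
    rw [← Real.norm_eq_abs, ← Complex.norm_real]; push_cast; rfl
  rw [h5] at h4
  have h6 : (0 : ℝ) < (p : ℝ) ^ 2 := by positivity
  rw [← h4, mul_comm] at hEb
  exact le_of_mul_le_mul_left hEb h6

open Filter Topology

/-- primes tending to infinity -/
def Pf : Filter ℕ := atTop ⊓ 𝓟 {p | p.Prime}

instance : NeBot Pf := by
  unfold Pf
  rw [← frequently_mem_iff_neBot]
  rw [frequently_atTop]
  intro a
  obtain ⟨p, hp1, hp2⟩ := Nat.exists_infinite_primes a
  exact ⟨p, hp1, hp2⟩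

lemma Pf_le : Pf ≤ atTop := inf_le_left

lemma Pf_event : ∀ᶠ p in Pf, p.Prime ∧ p ≠ 2 := by
  have h1 : ∀ᶠ p in Pf, p.Prime := mem_inf_of_right (mem_principal_self _)
  have h2 : ∀ᶠ p in Pf, 2 < p := Pf_le (eventually_gt_atTop 2)
  filter_upwards [h1, h2] with p h1 h2
  exact ⟨h1, h2.ne'⟩

theorem nbr_limit (hn : 5 ≤ n) {R : Finset (Mt n)} (hR : IsReps OddF R) {c : ℝ}
    (hc : ∀ G ∈ R, Tendsto (fun p : ℕ => (rep G ((p : ℤ) ^ 2) : ℝ) / (p : ℝ) ^ (n - 2)) Pf (𝓝 c)) :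
    c * mass R = ∑ G ∈ R, (rep G 1 : ℝ) / autc G := by
  have hpow : Tendsto (fun p : ℕ => (p : ℝ) ^ (n - 2)) Pf atTop :=
    ((tendsto_pow_atTop (by omega)).comp tendsto_natCast_atTop_atTop).mono_left Pf_le
  -- left side
  have hL : Tendsto (fun p : ℕ => (∑ G ∈ R, ((rep G ((p : ℤ) ^ 2) : ℝ) - rep G 1) / autc G) / (p : ℝ) ^ (n - 2))
      Pf (𝓝 (c * mass R)) := by
    have : Tendsto (fun p : ℕ => ∑ G ∈ R, ((rep G ((p : ℤ) ^ 2) : ℝ) / (p : ℝ) ^ (n - 2) -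
        rep G 1 / (p : ℝ) ^ (n - 2)) * (1 / autc G)) Pf (𝓝 (∑ G ∈ R, (c - 0) * (1 / autc G))) := by
      apply tendsto_finsetSum
      intro G hG
      exact ((hc G hG).sub (tendsto_const_nhds.div_atTop hpow)).mul_const _
    have e : ∑ G ∈ R, (c - 0) * (1 / (autc G : ℝ)) = c * mass R := by
      rw [← Finset.mul_sum, sub_zero]; rfl
    rw [← e]
    refine this.congr fun p => ?_
    rw [Finset.sum_div]
    exact Finset.sum_congr rfl fun G _ => by ring
  -- right side
  have hRt : Tendsto (fun p : ℕ => (∑ G ∈ R.attach, (∑ e ∈ (finite_rep (hR.mem G.1 G.2).1 1).toFinset,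
      (bS p G.1 e : ℝ)) / autc G.1) / (p : ℝ) ^ (n - 2)) Pf (𝓝 (∑ G ∈ R, (rep G 1 : ℝ) / autc G)) := by
    have : Tendsto (fun p : ℕ => ∑ G ∈ R.attach, (∑ e ∈ (finite_rep (hR.mem G.1 G.2).1 1).toFinset,
      (bS p G.1 e : ℝ) / (p : ℝ) ^ (n - 2)) * (1 / autc G.1)) Pf
      (𝓝 (∑ G ∈ R.attach, (∑ e ∈ (finite_rep (hR.mem G.1 G.2).1 1).toFinset, 1) * (1 / autc G.1))) := by
      apply tendsto_finsetSum
      rintro ⟨G, hG⟩ -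
      refine Tendsto.mul_const _ ?_
      apply tendsto_finsetSum
      intro e he
      have he1 : nf G e = 1 := by simpa using he
      rw [tendsto_iff_dist_tendsto_zero]
      have hs : Tendsto (fun p : ℕ => Real.sqrt ((p : ℝ)⁻¹)) Pf (𝓝 0) := by
        have := ((Real.continuous_sqrt.tendsto 0).comp
          (tendsto_inv_atTop_zero.comp (tendsto_natCast_atTop_atTop (R := ℝ)))).mono_left Pf_le
        rw [Real.sqrt_zero] at this
        exact this
      refine tendsto_of_tendsto_of_tendsto_of_le_of_le' tendsto_const_nhds hs
        (Eventually.of_forall fun _ => dist_nonneg) ?_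
      filter_upwards [Pf_event] with p hp
      have hp0 : (0 : ℝ) < p := by exact_mod_cast hp.1.pos
      have hp1 : (1 : ℝ) ≤ p := by exact_mod_cast hp.1.one_lt.le
      have hb := resS_bound (hR.mem G hG).1 hp.1 hp.2 he1 (by omega)
      rw [← bS_eq (hR.mem G hG).1 hp.1 hp.2 e] at hb
      have hpp : (0 : ℝ) < (p : ℝ) ^ (n - 2) := by positivity
      rw [Real.dist_eq, show (bS p G e : ℝ) / (p : ℝ) ^ (n - 2) - 1 =
        ((bS p G e : ℝ) - (p : ℝ) ^ (n - 2)) / (p : ℝ) ^ (n - 2) by field_simp, abs_div, abs_of_pos hpp,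
        div_le_iff₀ hpp]
      refine hb.trans ?_
      rw [← Real.sqrt_sq hpp.le, ← Real.sqrt_mul (by positivity)]
      apply Real.sqrt_le_sqrt
      rw [← pow_mul, show (n - 2) * 2 = n + (n - 5) + 1 by omega, pow_succ', inv_mul_cancel_left₀ hp0.ne', pow_add]
      exact le_mul_of_one_le_right (by positivity) (one_le_pow₀ hp1)
    have e : (∑ G ∈ R.attach, (∑ e ∈ (finite_rep (hR.mem G.1 G.2).1 1).toFinset, (1 : ℝ)) * (1 / autc G.1)) =
        ∑ G ∈ R, (rep G 1 : ℝ) / autc G := by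
      rw [← Finset.sum_attach R]
      apply Finset.sum_congr rfl
      rintro ⟨G, hG⟩ -
      rw [Finset.sum_const, nsmul_eq_mul, mul_one, mul_one_div, rep, Set.ncard_eq_toFinset_card _ (finite_rep (hR.mem G hG).1 1)]
    rw [← e]
    refine this.congr fun p => ?_
    rw [Finset.sum_div]
    exact Finset.sum_congr rfl fun G _ => by rw [← Finset.sum_div]; ring
  refine tendsto_nhds_unique hL (hRt.congr' ?_)
  filter_upwards [Pf_event] with p hp
  rw [nbr_identity hp.1 hp.2 hR]

end MF

namespace MF
open Matrix
variable {n : ℕ} {G H G' : Mt n}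

/-- characteristic vectors -/
def IsChar (G : Mt n) (c : Vc n) : Prop := ∀ x, Even (nf G x - bf G x c)

lemma nf_diag (h : IsU G) (x : Vc n) : Even (nf G x - ∑ i, G i i * x i) := by
  -- the function is additive mod two
  have key : ∀ x y : Vc n, Even (nf G x - ∑ i, G i i * x i) → Even (nf G y - ∑ i, G i i * y i) →
      Even (nf G (x + y) - ∑ i, G i i * (x + y) i) := by
    intro x y hx hy
    have : nf G (x + y) - ∑ i, G i i * (x + y) i =
      (nf G x - ∑ i, G i i * x i) + (nf G y - ∑ i, G i i * y i) + 2 * bf G x y := by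
      rw [nf_add h.sym]; simp only [Pi.add_apply, mul_add, Finset.sum_add_distrib]; ring
    rw [this]; exact (hx.add hy).add (even_two_mul _)
  have hs : ∀ (i : Fin n) (t : ℤ), Even (nf G (Pi.single i t) - ∑ j, G j j * (Pi.single i t : Vc n) j) := by
    intro i t
    have e1 : (Pi.single i t : Vc n) = t • Pi.single i 1 := by
      rw [← Pi.single_smul, smul_eq_mul, mul_one]
    have e2 : nf G (Pi.single i t) = t ^ 2 * G i i := by
      rw [e1, nf_smul, show nf G (Pi.single i 1) = bf G (Pi.single i 1) (Pi.single i 1) from rfl, bf_single]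
    rw [e2, Finset.sum_eq_single i]
    · rw [Pi.single_eq_same, show t ^ 2 * G i i - G i i * t = G i i * (t * (t - 1)) by ring]
      exact (Int.even_mul_pred_self t).mul_left _
    · intro j _ hj; rw [Pi.single_eq_of_ne hj, mul_zero]
    · simp
  have : ∀ s : Finset (Fin n), Even (nf G (∑ i ∈ s, Pi.single i (x i)) -
      ∑ j, G j j * (∑ i ∈ s, Pi.single i (x i) : Vc n) j) := by
    intro s
    induction s using Finset.cons_induction with
    | empty => simp [nf_zero]
    | cons a s ha ih => rw [Finset.sum_cons]; exact key _ _ (hs a _) ih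
  have := this Finset.univ
  rwa [Finset.univ_sum_single] at this

lemma exists_char (h : IsU G) : ∃ c, IsChar G c := by
  refine ⟨G⁻¹ *ᵥ (fun i => G i i), fun x => ?_⟩
  rw [bf_comm h.sym, h.dual]
  exact nf_diag h x

lemma even_mod {a b : ℤ} (h : Even (a - b)) : a % 2 = b % 2 := by
  obtain ⟨r, hr⟩ := h; omega

lemma char_not_pdv {c : Vc n} (h : IsU G) (hc : IsChar G c) (ho : OddF G) : ¬ pdv 2 c := by
  intro hd
  have : EvenF G := by
    intro x
    have h1 := hc x
    have h2 : ((2 : ℕ) : ℤ) ∣ bf G c x := hd.bf x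
    rw [bf_comm h.sym] at h2
    rw [Int.even_iff] at *; push_cast at h2; omega
  exact not_oddF.mpr this ho

/-- the even lattices in an odd one -/
def PrEv (G : Mt n) (Λ : Submodule ℤ (Vc n)) : Prop := RkS 2 Λ ∧ ∀ y ∈ Λ, (8 : ℤ) ∣ nf G y
/-- the odd lattices in an even one -/
def PrOd (G : Mt n) (Λ : Submodule ℤ (Vc n)) : Prop := RkS 2 Λ ∧ ∃ y ∈ Λ, ¬ (8 : ℤ) ∣ nf G y

lemma char_shift (h : IsU G) {c : Vc n} (hc : IsChar G c) (h8 : (8 : ℤ) ∣ nf G c) (z : Vc n) :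
    (8 : ℤ) ∣ nf G (c + (2 : ℤ) • z) ∧ IsChar G (c + (2 : ℤ) • z) := by
  constructor
  · rw [nf_add h.sym, nf_smul, bf_smul_right, bf_comm h.sym]
    have h1 := even_mod (hc z); omega
  · intro x
    have h1 := hc x
    rw [bf_add_right, bf_smul_right, ← sub_sub]
    exact h1.sub (even_two_mul _)

lemma prEv_Lam (h : IsU G) {c : Vc n} (hc : IsChar G c) (h8 : (8 : ℤ) ∣ nf G c) (ho : OddF G) :
    SD G 4 (Lam 2 G c) ∧ PrEv G (Lam 2 G c) := by
  have hnp := char_not_pdv h hc ho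
  refine ⟨?_, rkS_Lam hnp, ?_⟩
  · exact sd_Lam h Nat.prime_two hnp (by push_cast; exact Dvd.dvd.trans (by norm_num) h8)
  · rintro _ ⟨z, t, hz, rfl⟩
    rw [nf_add h.sym, nf_smul, nf_smul, bf_smul_left, bf_smul_right]
    have h1 := even_mod (hc z)
    push_cast at *
    obtain ⟨a, ha⟩ := hz
    obtain ⟨b, hb⟩ := h8
    rw [ha] at h1 ⊢
    obtain ⟨d, hd⟩ : ∃ d, nf G z = 2 * d := ⟨nf G z / 2, by omega⟩
    rw [hb, hd]
    exact ⟨d + t * a + t ^ 2 * b, by ring⟩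

lemma mem_Lam_iff (h : IsU G) {c z : Vc n} (h8 : (8 : ℤ) ∣ nf G c) (hnp : ¬ pdv 2 c) :
    c + (2 : ℤ) • z ∈ Lam 2 G c ↔ Even (bf G z c) := by
  constructor
  · rintro ⟨z', t, hz', he⟩
    push_cast at hz' he
    have h1 : (2 : ℤ) • (z' - z) = (1 - t) • c := by
      rw [smul_sub, sub_smul, one_smul]
      have : (2 : ℤ) • z' = c + (2 : ℤ) • z - t • c := by rw [he]; abel
      rw [this]; abel
    have ht : (2 : ℤ) ∣ 1 - t := by
      by_contra hcon
      exact hnp (pdv_of_smul Nat.prime_two (by exact_mod_cast hcon) (h1 ▸ pdv_smul (p := 2) (z' - z)))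
    obtain ⟨s, hs⟩ := ht
    rw [hs, mul_smul] at h1
    have h2 := smul_right_injective (Vc n) (two_ne_zero (α := ℤ)) h1
    have h3 := congrArg (fun y => bf G y c) h2
    simp only [bf_sub_left, bf_smul_left] at h3
    change _ = s * nf G c at h3
    obtain ⟨b, hb⟩ := h8
    obtain ⟨a, ha⟩ := hz'
    rw [ha, hb] at h3
    exact ⟨a - s * (4 * b), by linarith⟩
  · intro hz
    refine ⟨z, 1, ?_, ?_⟩
    · exact_mod_cast hz.two_dvd
    · rw [one_smul, add_comm]; rfl

lemma two_even (h : IsU G) {c : Vc n} (hc : IsChar G c) (h8 : (8 : ℤ) ∣ nf G c) (ho : OddF G) :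
    {Λ | SD G 4 Λ ∧ PrEv G Λ}.ncard = 2 := by
  have hnp := char_not_pdv h hc ho
  obtain ⟨v, hv⟩ := exists_bf_one h Nat.prime_two hnp
  push_cast at hv
  obtain ⟨h8', hc'⟩ := char_shift h hc h8 v
  have hnp' := char_not_pdv h hc' ho
  have hne : Lam 2 G c ≠ Lam 2 G (c + (2 : ℤ) • v) := by
    intro he
    have : c + (2 : ℤ) • v ∈ Lam 2 G c := by rw [he]; exact self_mem_Lam _
    rw [mem_Lam_iff h h8 hnp, Int.even_iff] at this
    omega
  rw [← Set.ncard_pair hne]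
  congr 1
  ext Λ
  simp only [Set.mem_ofPred_eq, Set.mem_insert_iff, Set.mem_singleton_iff]
  constructor
  · rintro ⟨hsd, hrk, hev⟩
    obtain ⟨w, hw, hwnp, -⟩ := id hrk
    have hEq := eq_Lam h Nat.prime_two (by exact_mod_cast hsd) hrk hw hwnp
    have hwN := hev w hw
    have h1 : ∀ z, Even (bf G z w) → Even (bf G z c) := by
      intro z hz
      have hm : (2 : ℤ) • z ∈ Λ := by
        rw [hEq]; exact ⟨z, 0, by exact_mod_cast hz.two_dvd, by simp⟩
      have := hev _ hm
      rw [nf_smul] at this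
      have h2 := even_mod (hc z)
      rw [Int.even_iff]; omega
    obtain ⟨u, hu⟩ := exists_bf_one h Nat.prime_two hwnp
    push_cast at hu
    have h2 : ∀ z, ((2 : ℕ) : ℤ) ∣ bf G z (c - bf G u c • w) := by
      intro z
      rw [bf_sub_right, bf_smul_right]
      rcases Int.even_or_odd (bf G z w) with hz | hz
      · have := h1 z hz
        exact_mod_cast (this.sub (hz.mul_left _)).two_dvd
      · have h3 : Even (bf G (z + u) w) := by rw [bf_add_left, Int.even_iff]; rw [Int.odd_iff] at hz; omega
        have h4 := h1 _ h3
        rw [bf_add_left] at h4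
        have h5 : Even (bf G z c + bf G u c - bf G u c * (bf G z w + 1)) :=
          h4.sub (hz.add_one.mul_left _)
        have h6 : bf G z c - bf G u c * bf G z w = bf G z c + bf G u c - bf G u c * (bf G z w + 1) := by ring
        rw [h6]; exact_mod_cast h5.two_dvd
    have h3 := pdv_of_bf h h2
    have h4 : pdv 2 (w - c) := by
      rcases Int.even_or_odd (bf G u c) with hz | hz
      · exfalso; apply hnp
        obtain ⟨a, ha⟩ := hz.two_dvd
        have h5 : pdv 2 (bf G u c • w) := by rw [ha, mul_smul]; exact pdv_smul (p := 2) _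
        have := h3.add h5
        rwa [sub_add_cancel] at this
      · obtain ⟨a, ha⟩ := hz
        have h5 : w - c = ((2 : ℕ) : ℤ) • (- (a • w)) - (c - bf G u c • w) := by
          rw [ha, add_smul, one_smul, smul_neg, smul_smul]; push_cast; abel
        rw [h5]; exact (pdv_smul (p := 2) _).sub h3
    obtain ⟨z, hz⟩ := pdv_iff.mp h4
    have hwz : w = c + (2 : ℤ) • z := by
      rw [← sub_add_cancel w c, hz, add_comm]; rfl
    rcases Int.even_or_odd (bf G z c) with he | he
    · left
      have hm : w ∈ Lam 2 G c := by rw [hwz]; exact (mem_Lam_iff h h8 hnp).mpr he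
      rw [hEq]
      exact (eq_Lam h Nat.prime_two (by exact_mod_cast (prEv_Lam h hc h8 ho).1) (rkS_Lam hnp) hm hwnp).symm
    · right
      have hm : w ∈ Lam 2 G (c + (2 : ℤ) • v) := by
        have : w = (c + (2 : ℤ) • v) + (2 : ℤ) • (z - v) := by rw [hwz, smul_sub]; abel
        rw [this]; apply (mem_Lam_iff h h8' hnp').mpr
        rw [bf_sub_left, bf_add_right, bf_add_right, bf_smul_right, bf_smul_right, Int.even_iff]
        rw [Int.odd_iff] at he; omega
      rw [hEq]
      exact (eq_Lam h Nat.prime_two (by exact_mod_cast (prEv_Lam h hc' h8' ho).1) (rkS_Lam hnp') hm hwnp).symm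
  · rintro (rfl | rfl)
    · exact prEv_Lam h hc h8 ho
    · exact prEv_Lam h hc' h8' ho

/-- singular residues in an even lattice -/
def sing (G : Mt n) : Set (Fin n → ZMod 2) := {u | ∃ w, red 2 w = u ∧ (4 : ℤ) ∣ nf G w}

lemma exists_w4 (h : IsU G) (he : EvenF G) {u : Fin n → ZMod 2} (hu : u ∈ sing G \ {0}) :
    ∃ w, red 2 w = u ∧ nf G w % 8 = 4 ∧ ¬ pdv 2 w := by
  obtain ⟨⟨w, rfl, h4⟩, hu0⟩ := hu
  have hnp : ¬ pdv 2 w := by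
    intro hc; apply hu0
    have : red 2 w = red 2 (0 : Vc n) := by rw [red_eq_iff, sub_zero]; exact hc
    rw [Set.mem_singleton_iff, this]; funext i; simp [red]
  by_cases h8 : nf G w % 8 = 4
  · exact ⟨w, rfl, h8, hnp⟩
  obtain ⟨v, hv⟩ := exists_bf_one h Nat.prime_two hnp
  push_cast at hv
  refine ⟨w + (2 : ℤ) • v, ?_, ?_, ?_⟩
  · rw [red_eq_iff, add_sub_cancel_left]; exact pdv_smul (p := 2) _
  · rw [nf_add h.sym, nf_smul, bf_smul_right, bf_comm h.sym]
    have := Int.even_iff.mp (he v)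
    omega
  · intro hc
    have := hc.sub (pdv_smul (p := 2) v)
    push_cast at this
    rw [add_sub_cancel_right] at this
    exact hnp this

lemma odd_nbrs (h : IsU G) (he : EvenF G) :
    {Λ | SD G 4 Λ ∧ PrOd G Λ}.ncard = (sing G \ {0}).ncard := by
  have hex := fun u (hu : u ∈ sing G \ {0}) => exists_w4 h he hu
  choose w hw1 hw2 hw3 using hex
  symm
  apply Set.ncard_congr (fun x hx => Lam 2 G (w x hx))
  · intro x hx
    refine ⟨?_, rkS_Lam (hw3 x hx), w x hx, self_mem_Lam _, ?_⟩
    · have := hw2 x hx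
      exact sd_Lam h Nat.prime_two (hw3 x hx) (by push_cast; omega)
    · have := hw2 x hx; omega
  · intro x y hx hy hxy
    have hm : w y hy ∈ Lam 2 G (w x hx) := by rw [hxy]; exact self_mem_Lam _
    obtain ⟨z, t, hz, hwy⟩ := hm
    rw [← hw1 x hx, ← hw1 y hy, eq_comm, red_eq_iff]
    rcases Int.even_or_odd' t with ⟨s, hs | hs⟩
    · exfalso
      apply hw3 y hy
      rw [hwy, hs, mul_smul]
      exact (pdv_smul z).add (pdv_smul (p := 2) _)
    · have : w y hy - w x hx = ((2 : ℕ) : ℤ) • (z + s • w x hx) := by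
        rw [hwy, hs, add_smul, one_smul, mul_smul, smul_add]; push_cast; abel
      rw [this]; exact pdv_smul _
  · rintro Λ ⟨hsd, hrk, y, hy, hy8⟩
    have hN := hsd.1 _ hy _ hy
    change (4 : ℤ) ∣ nf G y at hN
    have hnp : ¬ pdv 2 y := by
      intro hc
      obtain ⟨z, rfl⟩ := pdv_iff.mp hc
      rw [nf_smul] at hy8
      have := Int.even_iff.mp (he z)
      push_cast at hy8; omega
    have hx : red 2 y ∈ sing G \ {0} := by
      refine ⟨⟨y, rfl, hN⟩, ?_⟩
      intro hc
      apply hnp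
      have : red 2 y = red 2 (0 : Vc n) := by rw [Set.mem_singleton_iff.mp hc]; funext i; simp [red]
      rw [red_eq_iff, sub_zero] at this; exact this
    refine ⟨red 2 y, hx, ?_⟩
    have hEq := eq_Lam h Nat.prime_two (by exact_mod_cast hsd) hrk hy hnp
    obtain ⟨z, hz⟩ := pdv_iff.mp (red_eq_iff.mp (hw1 _ hx))
    push_cast at hz
    have hwz : w _ hx = y + (2 : ℤ) • z := by rw [← hz]; abel
    have h2 := hw2 _ hx
    rw [hwz, nf_add h.sym, nf_smul, bf_smul_right] at h2
    have h5 : (2 : ℤ) ∣ bf G y z := by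
      have := Int.even_iff.mp (he z); omega
    have hmem : w _ hx ∈ Λ := by
      rw [hEq, hwz]
      refine ⟨z, 1, by rw [bf_comm h.sym]; exact_mod_cast h5, ?_⟩
      rw [one_smul, add_comm]; rfl
    exact (eq_Lam h Nat.prime_two (by exact_mod_cast hsd) hrk hmem (hw3 _ hx)).symm

lemma embs_two (h : IsU G) (h' : IsU G') (ho : OddF G) (he : EvenF G') :
    (embs G' G 4 (PrOd G')).ncard = (embs G G' 4 (PrEv G)).ncard := by
  apply Set.ncard_congr (fun A _ => adj G' G A)
  · rintro A ⟨h1, h2⟩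
    have h3 := adj_emb h' h (by norm_num) h1
    refine ⟨h3, rkS_adj h' h Nat.prime_two h2.1, ?_⟩
    intro y hy
    obtain ⟨z, rfl⟩ := mem_rng.mp hy
    rw [nf_mulVec, h3, nf_smul_mat]
    have := Int.even_iff.mp (he z); omega
  · intro A B _ _ hAB
    rw [← adj_adj h' h A, hAB, adj_adj h' h B]
  · rintro B ⟨h1, h2⟩
    have h3 := adj_emb h h' (by norm_num) h1
    refine ⟨adj G G' B, ⟨h3, rkS_adj h h' Nat.prime_two h2.1, ?_⟩, adj_adj h h' B⟩
    obtain ⟨z, hz⟩ := ho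
    refine ⟨adj G G' B *ᵥ z, mem_rng.mpr ⟨z, rfl⟩, ?_⟩
    rw [nf_mulVec, h3, nf_smul_mat]
    have := Int.odd_iff.mp hz
    omega

/-- van der Blij -/
def VdB (n : ℕ) : Prop := ∀ G : Mt n, IsU G → ∀ c, IsChar G c → (8 : ℤ) ∣ nf G c - n

theorem two_nbr_mass (h8 : 8 ∣ n) (hV : VdB n) {s : ℕ} (hs : ∀ G : Mt n, IsU G → EvenF G → (sing G).ncard = s)
    {Ro Re : Finset (Mt n)} (hRo : IsReps OddF Ro) (hRe : IsReps EvenF Re) :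
    2 * mass Ro = ((s : ℝ) - 1) * mass Re := by
  have h1 : ∀ G ∈ Ro, ∑ G' ∈ Re, ((embs G G' 4 (PrEv G)).ncard : ℝ) / autc G' = 2 := by
    intro G hG
    obtain ⟨hU, ho⟩ := hRo.mem G hG
    obtain ⟨c, hc⟩ := exists_char hU
    have hc8 : (8 : ℤ) ∣ nf G c := by
      have := hV G hU c hc
      have h8' : (8 : ℤ) ∣ (n : ℤ) := by exact_mod_cast h8
      exact (dvd_sub_left h8').mp this
    have := (count_sub hU (c := 4) (by norm_num) hRe (PrEv G) ?_).2
    · rw [this, two_even hU hc hc8 ho]; norm_num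
    · rintro A G' hG' hA ⟨-, hev⟩ z
      have := hev _ (mem_rng.mpr ⟨z, rfl⟩)
      rw [nf_mulVec, hA, nf_smul_mat] at this
      rw [Int.even_iff]; omega
  have h2 : ∀ G' ∈ Re, ∑ G ∈ Ro, ((embs G' G 4 (PrOd G')).ncard : ℝ) / autc G = (s : ℝ) - 1 := by
    intro G' hG'
    obtain ⟨hU, he⟩ := hRe.mem G' hG'
    have := (count_sub hU (c := 4) (by norm_num) hRo (PrOd G') ?_).2
    · rw [this, odd_nbrs hU he, Set.ncard_diff_singleton_of_mem, hs G' hU he, Nat.cast_sub, Nat.cast_one]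
      · rw [← hs G' hU he]
        have h0 : (0 : Fin n → ZMod 2) ∈ sing G' :=
          ⟨0, by funext i; simp [red], by rw [nf_zero]; exact dvd_zero _⟩
        exact (Set.ncard_pos (Set.toFinite _)).mpr ⟨0, h0⟩
      · exact ⟨0, by funext i; simp [red], by rw [nf_zero]; exact dvd_zero _⟩
    · rintro A G hG hA ⟨-, y, hy, hy8⟩
      by_contra hc
      obtain ⟨z, rfl⟩ := mem_rng.mp hy
      rw [nf_mulVec, hA, nf_smul_mat] at hy8
      have := Int.even_iff.mp (not_oddF.mp hc z)
      omega
  have h3 : 2 * mass Ro = ∑ G ∈ Ro, ∑ G' ∈ Re, ((embs G G' 4 (PrEv G)).ncard : ℝ) / autc G' / autc G := by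
    rw [mass, Finset.mul_sum]
    apply Finset.sum_congr rfl; intro G hG
    rw [← Finset.sum_div, h1 G hG]; ring
  rw [h3, Finset.sum_comm, mass, Finset.mul_sum]
  apply Finset.sum_congr rfl; intro G' hG'
  rw [← h2 G' hG', mul_one_div, Finset.sum_div]
  apply Finset.sum_congr rfl; intro G hG
  rw [embs_two (hRo.mem G hG).1 (hRe.mem G' hG').1 (hRo.mem G hG).2 (hRe.mem G' hG').2]
  ring

lemma finite_SD4 (G : Mt n) : {Λ | SD G 4 Λ}.Finite := by
  apply Set.Finite.of_injOn (f := fun Λ : Submodule ℤ (Vc n) => red 4 '' (Λ : Set (Vc n)))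
    (Set.mapsTo_univ _ _) ?_ Set.finite_univ
  have key : ∀ Λ M : Submodule ℤ (Vc n), SD G 4 M → red 4 '' (Λ : Set (Vc n)) = red 4 '' (M : Set (Vc n)) →
      Λ ≤ M := by
    intro Λ M hM h x hx
    have : red 4 x ∈ red 4 '' (M : Set (Vc n)) := h ▸ ⟨x, hx, rfl⟩
    obtain ⟨y, hy, hxy⟩ := this
    obtain ⟨z, hz⟩ := pdv_iff.mp (red_eq_iff.mp hxy)
    have h2 := smul_mem_of_sd hM z
    have h3 : x = y - (4 : ℤ) • z := by
      push_cast at hz; rw [← hz]; abel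
    rw [h3]; exact M.sub_mem hy h2
  intro Λ hΛ M hM h
  exact le_antisymm (key _ _ hM h) (key _ _ hΛ h.symm)

theorem odd_reps (h8 : 8 ∣ n) (hV : VdB n) {Re : Finset (Mt n)} (hRe : IsReps EvenF Re) :
    ∃ Ro : Finset (Mt n), IsReps OddF Ro := by
  classical
  have hex : ∀ (G' : Mt n) (Λ : Submodule ℤ (Vc n)), ∃ H : Mt n, IsU G' → SD G' 4 Λ →
      ∃ A, rng A = Λ ∧ Aᵀ * G' * A = (4 : ℤ) • H ∧ IsU H := by
    intro G' Λ
    by_cases hc : IsU G' ∧ SD G' 4 Λ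
    · obtain ⟨A, G, h1, h2, h3⟩ := exists_of_sd hc.1 (by norm_num) hc.2
      exact ⟨G, fun _ _ => ⟨A, h1, h2, h3⟩⟩
    · exact ⟨0, fun h1 h2 => absurd ⟨h1, h2⟩ hc⟩
  choose F hF using hex
  apply exists_reps OddF (⋃ G' ∈ Re, F G' '' {Λ | SD G' 4 Λ})
  · exact Set.Finite.biUnion Re.finite_toSet fun G' _ => (finite_SD4 G').image _
  · intro H hH
    simp only [Set.mem_iUnion] at hH
    obtain ⟨G', hG', Λ, hΛ, rfl⟩ := hH
    obtain ⟨_, _, _, h⟩ := hF G' Λ (hRe.mem G' hG').1 hΛ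
    exact h
  · intro G hU ho
    obtain ⟨c, hc⟩ := exists_char hU
    have hc8 : (8 : ℤ) ∣ nf G c := by
      have := hV G hU c hc
      have h8' : (8 : ℤ) ∣ (n : ℤ) := by exact_mod_cast h8
      exact (dvd_sub_left h8').mp this
    obtain ⟨hsd, hpr⟩ := prEv_Lam hU hc hc8 ho
    obtain ⟨A, G1, hr, hA, hG1⟩ := exists_of_sd hU (by norm_num) hsd
    have he1 : EvenF G1 := by
      intro z
      have := hpr.2 (A *ᵥ z) (hr ▸ mem_rng.mpr ⟨z, rfl⟩)
      rw [nf_mulVec, hA, nf_smul_mat] at this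
      rw [Int.even_iff]; omega
    obtain ⟨G', hG', U, hUU⟩ := hRe.cover G1 hG1 he1
    have hG'u := (hRe.mem G' hG').1
    have hA1 := emb_move hA hUU
    have hB := adj_emb hU hG'u (by norm_num) hA1
    have hsdB := sd_of_iso hG'u hU (by norm_num) hB
    obtain ⟨C, hC1, hC2, hC3⟩ := hF G' _ hG'u hsdB
    refine ⟨F G' (rng (adj G G' (A * U))), ?_, emb_iso (by norm_num) hU hB hC2 hC1.symm⟩
    simp only [Set.mem_iUnion]
    exact ⟨G', hG', _, hsdB, rfl⟩

end MF

namespace MF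
open Matrix Complex
open scoped Real

/-- real quadratic form -/
def rq {n : ℕ} (Q : Matrix (Fin n) (Fin n) ℝ) (x : Fin n → ℝ) : ℝ := x ⬝ᵥ Q *ᵥ x

/-- integer vectors as real vectors -/
def rv {n : ℕ} (x : Fin n → ℤ) : Fin n → ℝ := fun i => (x i : ℝ)

lemma summable_pi {n : ℕ} (f : Fin n → ℤ → ℝ) (h0 : ∀ i k, 0 ≤ f i k) (hf : ∀ i, Summable (f i)) :
    Summable (fun x : Fin n → ℤ => ∏ i, f i (x i)) := by
  induction n with
  | zero => exact (hasSum_fintype _).summable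
  | succ n ih =>
    rw [← (Fin.consEquiv (fun _ => ℤ)).summable_iff]
    have h1 := (hf 0).mul_of_nonneg (ih (fun i => f i.succ) (fun i => h0 i.succ) (fun i => hf i.succ))
      (fun k => h0 0 k) (fun x => Finset.prod_nonneg fun i _ => h0 _ _)
    refine h1.congr fun x => ?_
    simp [Fin.prod_univ_succ, Fin.consEquiv]

lemma summable_int_gauss {c : ℝ} (hc : 0 < c) : Summable (fun k : ℤ => Real.exp (-c * (k : ℝ) ^ 2)) := by
  have h := (summable_jacobiTheta₂_term_iff 0 ((c / π : ℝ) * I)).mpr (by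
    simp only [mul_im, ofReal_re, I_im, mul_one, ofReal_im, I_re, mul_zero, add_zero]; positivity)
  refine h.norm.congr fun k => ?_
  rw [jacobiTheta₂_term, Complex.norm_exp]
  congr 1
  have : (2 * π * I * k * 0 + π * I * k ^ 2 * ((c / π : ℝ) * I) : ℂ) = ((-c * (k : ℝ) ^ 2 : ℝ) : ℂ) := by
    push_cast
    have hpi : (π : ℂ) ≠ 0 := by exact_mod_cast Real.pi_ne_zero
    field_simp
    linear_combination (k:ℂ)^2*c*I_sq
  rw [this, ofReal_re]

lemma summable_int_gauss' {c : ℝ} (hc : 0 < c) (v : ℝ) :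
    Summable (fun k : ℤ => Real.exp (-c * ((k : ℝ) - v) ^ 2)) := by
  refine Summable.of_nonneg_of_le (fun _ => (Real.exp_pos _).le) (fun k => ?_)
    ((summable_int_gauss (half_pos hc)).mul_left (Real.exp (c * v ^ 2)))
  rw [← Real.exp_add]
  apply Real.exp_le_exp.mpr
  nlinarith [mul_nonneg hc.le (sq_nonneg ((k : ℝ) - 2 * v))]

/-- positive definite real matrices -/
structure RPD {n : ℕ} (Q : Matrix (Fin n) (Fin n) ℝ) : Prop where
  sym : Qᵀ = Q
  pos : ∀ x, x ≠ 0 → 0 < rq Q x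

lemma rq_smul {n : ℕ} (Q : Matrix (Fin n) (Fin n) ℝ) (c : ℝ) (x : Fin n → ℝ) :
    rq Q (c • x) = c ^ 2 * rq Q x := by
  simp only [rq, mulVec_smul, dotProduct_smul, smul_dotProduct, smul_eq_mul]; ring

lemma continuous_rq {n : ℕ} (Q : Matrix (Fin n) (Fin n) ℝ) : Continuous (rq Q) := by
  unfold rq dotProduct mulVec dotProduct; fun_prop

lemma RPD.lower {n : ℕ} {Q : Matrix (Fin n) (Fin n) ℝ} (h : RPD Q) :
    ∃ ε > 0, ∀ x, ε * ∑ i, x i ^ 2 ≤ rq Q x := by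
  rcases Nat.eq_zero_or_pos n with rfl | hn
  · exact ⟨1, one_pos, fun x => by simp [rq]⟩
  haveI : Nonempty (Fin n) := ⟨⟨0, hn⟩⟩
  have hne : (Metric.sphere (0 : Fin n → ℝ) 1).Nonempty := NormedSpace.sphere_nonempty.mpr zero_le_one
  obtain ⟨x0, hx0, hmin⟩ := (isCompact_sphere (0 : Fin n → ℝ) 1).exists_isMinOn hne (continuous_rq Q).continuousOn
  have hx00 : x0 ≠ 0 := by
    rintro rfl; simp at hx0
  have hpos := h.pos x0 hx00
  have hnR : (0 : ℝ) < n := by exact_mod_cast hn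
  refine ⟨rq Q x0 / n, by positivity, fun x => ?_⟩
  have h1 : ∑ i, x i ^ 2 ≤ n * ‖x‖ ^ 2 := by
    calc ∑ i, x i ^ 2 ≤ ∑ _i : Fin n, ‖x‖ ^ 2 := Finset.sum_le_sum fun i _ => by
          rw [← sq_abs, ← Real.norm_eq_abs]
          exact pow_le_pow_left₀ (norm_nonneg _) (norm_le_pi_norm x i) 2
      _ = n * ‖x‖ ^ 2 := by simp
  have h2 : rq Q x0 * ‖x‖ ^ 2 ≤ rq Q x := by
    by_cases hx : x = 0
    · simp [hx, rq]
    · have hx' : ‖x‖ ≠ 0 := norm_ne_zero_iff.mpr hx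
      have hm : ‖x‖⁻¹ • x ∈ Metric.sphere (0 : Fin n → ℝ) 1 := by
        simp [norm_smul, hx']
      have := hmin hm
      simp only [Set.mem_ofPred_eq] at this
      rw [rq_smul] at this
      calc rq Q x0 * ‖x‖ ^ 2 ≤ (‖x‖⁻¹ ^ 2 * rq Q x) * ‖x‖ ^ 2 := by gcongr
        _ = rq Q x := by field_simp
  calc rq Q x0 / n * ∑ i, x i ^ 2 ≤ rq Q x0 / n * (n * ‖x‖ ^ 2) := by gcongr
    _ = rq Q x0 * ‖x‖ ^ 2 := by field_simp
    _ ≤ _ := h2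

lemma RPD.summable {n : ℕ} {Q : Matrix (Fin n) (Fin n) ℝ} (h : RPD Q) {c : ℝ} (hc : 0 < c) (v : Fin n → ℝ) :
    Summable (fun x : Fin n → ℤ => Real.exp (-c * rq Q (rv x - v))) := by
  obtain ⟨ε, hε, hl⟩ := h.lower
  refine Summable.of_nonneg_of_le (fun _ => (Real.exp_pos _).le) (fun x => ?_)
    (summable_pi (fun i k => Real.exp (-(c * ε) * ((k : ℝ) - v i) ^ 2)) (fun _ _ => (Real.exp_pos _).le)
      (fun i => summable_int_gauss' (mul_pos hc hε) (v i)))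
  rw [← Real.exp_sum]
  apply Real.exp_le_exp.mpr
  rw [← Finset.mul_sum]
  have := hl (rv x - v)
  have h2 := mul_le_mul_of_nonneg_left this hc.le
  have e : ∑ i, ((x i : ℝ) - v i) ^ 2 = ∑ i, (rv x - v) i ^ 2 := rfl
  rw [e]
  linarith

lemma bl_cons {n : ℕ} (M : Matrix (Fin (n + 1)) (Fin (n + 1)) ℝ) (α α' : ℝ) (β β' : Fin n → ℝ) :
    (Fin.cons α β : Fin (n + 1) → ℝ) ⬝ᵥ M *ᵥ (Fin.cons α' β' : Fin (n + 1) → ℝ) =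
    α * M 0 0 * α' + α * ((fun j => M 0 j.succ) ⬝ᵥ β') + (β ⬝ᵥ (fun i => M i.succ 0)) * α'
      + β ⬝ᵥ (M.submatrix Fin.succ Fin.succ) *ᵥ β' := by
  simp only [dotProduct, mulVec, Fin.sum_univ_succ, Fin.cons_zero, Fin.cons_succ, submatrix_apply,
    mul_add, Finset.sum_add_distrib, Finset.mul_sum, Finset.sum_mul]
  have : ∀ x, β x * (M x.succ 0 * α') = β x * M x.succ 0 * α' := fun x => by ring
  simp only [this]; ring

section step
variable {n : ℕ} (Q P : Matrix (Fin (n + 1)) (Fin (n + 1)) ℝ)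

/-- shear vector -/
noncomputable def shr : Fin n → ℝ := fun j => Q 0 j.succ / Q 0 0
/-- Schur complement -/
noncomputable def sch : Matrix (Fin n) (Fin n) ℝ :=
  Matrix.of fun i j => Q i.succ j.succ - Q 0 i.succ * Q 0 j.succ / Q 0 0

variable {Q P}

lemma rpd_zero (h : RPD Q) : 0 < Q 0 0 := by
  have := h.pos (Pi.single 0 1) (by simp)
  simpa [rq, mulVec_single] using this

lemma sch_mulVec (x y : Fin n → ℝ) : x ⬝ᵥ sch Q *ᵥ y =
    x ⬝ᵥ (Q.submatrix Fin.succ Fin.succ) *ᵥ y - ((fun j => Q 0 j.succ) ⬝ᵥ x) * (shr Q ⬝ᵥ y) := by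
  simp only [dotProduct, mulVec, sch, shr, of_apply, submatrix_apply, sub_mul, Finset.sum_sub_distrib,
    Finset.mul_sum, Finset.sum_mul, mul_sub]
  congr 1
  rw [Finset.sum_comm]
  refine Finset.sum_congr rfl fun i _ => Finset.sum_congr rfl fun j _ => by ring

lemma rq_cons (h : RPD Q) (α : ℝ) (β : Fin n → ℝ) :
    rq Q (Fin.cons α β) = Q 0 0 * (α + shr Q ⬝ᵥ β) ^ 2 + rq (sch Q) β := by
  have h0 := (rpd_zero h).ne'
  have hc : (fun i : Fin n => Q i.succ 0) = fun i => Q 0 i.succ := by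
    funext i; exact congrFun (congrFun h.sym 0) i.succ
  have hr : (fun j : Fin n => Q 0 j.succ) = Q 0 0 • shr Q := by
    funext j; simp [shr]; field_simp
  rw [rq, bl_cons, rq, sch_mulVec, hc, dotProduct_comm β, hr, smul_dotProduct, smul_eq_mul]
  ring

lemma rpd_sch (h : RPD Q) : RPD (sch Q) := by
  constructor
  · ext i j
    have : Q j.succ i.succ = Q i.succ j.succ := congrFun (congrFun h.sym i.succ) j.succ
    simp only [sch, transpose_apply, of_apply, this]; ring
  · intro β hβ
    have h1 := h.pos (Fin.cons (-(shr Q ⬝ᵥ β)) β) (by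
      intro hc; apply hβ; funext i
      have := congrFun hc i.succ; simpa using this)
    rw [rq_cons h] at h1
    simpa using h1

lemma inv_parts (h : RPD Q) (hP : Q * P = 1) (hPs : Pᵀ = P) :
    (∀ j : Fin n, P 0 j.succ = - ∑ i, shr Q i * P i.succ j.succ) ∧
    P 0 0 = 1 / Q 0 0 + ∑ i, ∑ j, shr Q i * P i.succ j.succ * shr Q j ∧
    sch Q * P.submatrix Fin.succ Fin.succ = 1 := by
  have h0 := (rpd_zero h).ne'
  have hs : ∀ i : Fin n, Q 0 i.succ = Q 0 0 * shr Q i := fun i => by simp [shr]; field_simp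
  have hPsym : ∀ i : Fin n, P i.succ 0 = P 0 i.succ := fun i => congrFun (congrFun hPs 0) i.succ
  have hQsym : ∀ i : Fin n, Q i.succ 0 = Q 0 i.succ := fun i => congrFun (congrFun h.sym 0) i.succ
  have e1 : ∀ j : Fin n, P 0 j.succ = - ∑ i, shr Q i * P i.succ j.succ := by
    intro j
    have := congrFun (congrFun hP 0) j.succ
    rw [mul_apply, Fin.sum_univ_succ] at this
    simp only [hs, mul_assoc, ← Finset.mul_sum] at this
    rw [← mul_add, one_apply_ne (Fin.succ_ne_zero j).symm] at this
    have := (mul_eq_zero.mp this).resolve_left h0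
    linarith
  refine ⟨e1, ?_, ?_⟩
  · have := congrFun (congrFun hP 0) 0
    rw [mul_apply, Fin.sum_univ_succ] at this
    simp only [hs, mul_assoc, ← Finset.mul_sum, hPsym, e1, one_apply_eq] at this
    rw [← mul_add] at this
    have h2 : P 0 0 = 1 / Q 0 0 - ∑ x, shr Q x * -∑ i, shr Q i * P i.succ x.succ := by
      rw [eq_sub_iff_add_eq, eq_div_iff h0, mul_comm]; exact this
    rw [h2]
    simp only [mul_neg, Finset.sum_neg_distrib, sub_neg_eq_add, Finset.mul_sum]
    rw [Finset.sum_comm]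
    congr 1
    refine Finset.sum_congr rfl fun i _ => Finset.sum_congr rfl fun j _ => by ring
  · ext i j
    have := congrFun (congrFun hP i.succ) j.succ
    rw [mul_apply, Fin.sum_univ_succ, hQsym, e1, hs] at this
    simp only [mul_apply, sch, of_apply, submatrix_apply, sub_mul, Finset.sum_sub_distrib, hs]
    have e2 : ∑ x, Q 0 0 * shr Q i * (Q 0 0 * shr Q x) / Q 0 0 * P x.succ j.succ =
        Q 0 0 * shr Q i * ∑ x, shr Q x * P x.succ j.succ := by
      rw [Finset.mul_sum]; refine Finset.sum_congr rfl fun x _ => by field_simp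
    rw [e2]
    have e3 : (1 : Matrix (Fin (n+1)) (Fin (n+1)) ℝ) i.succ j.succ = (1 : Matrix (Fin n) (Fin n) ℝ) i j := by
      simp [one_apply]
    rw [← e3, ← this]; ring

lemma rq_inv_cons (h : RPD Q) (hP : Q * P = 1) (hPs : Pᵀ = P) (α : ℝ) (β : Fin n → ℝ) :
    rq P (Fin.cons α β) = α ^ 2 / Q 0 0 + rq (P.submatrix Fin.succ Fin.succ) (β - α • shr Q) := by
  obtain ⟨e1, e2, -⟩ := inv_parts h hP hPs
  have hPsym : ∀ i : Fin n, P i.succ 0 = P 0 i.succ := fun i => congrFun (congrFun hPs 0) i.succ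
  have h1 : (fun j : Fin n => P 0 j.succ) ⬝ᵥ β = - (shr Q ⬝ᵥ (P.submatrix Fin.succ Fin.succ) *ᵥ β) := by
    simp only [dotProduct, mulVec, e1, submatrix_apply, neg_mul, Finset.sum_neg_distrib, Finset.sum_mul, Finset.mul_sum]
    rw [Finset.sum_comm]
    congr 1
    refine Finset.sum_congr rfl fun i _ => Finset.sum_congr rfl fun j _ => by ring
  have h2 : P 0 0 = 1 / Q 0 0 + shr Q ⬝ᵥ (P.submatrix Fin.succ Fin.succ) *ᵥ shr Q := by
    rw [e2]; simp only [dotProduct, mulVec, submatrix_apply, Finset.mul_sum, mul_assoc]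
  have h3 : β ⬝ᵥ (P.submatrix Fin.succ Fin.succ) *ᵥ shr Q = shr Q ⬝ᵥ (P.submatrix Fin.succ Fin.succ) *ᵥ β := by
    have ht : (P.submatrix Fin.succ Fin.succ)ᵀ = P.submatrix Fin.succ (Fin.succ (n := n)) := by
      rw [transpose_submatrix, hPs]
    rw [dotProduct_mulVec, ← mulVec_transpose, ht, dotProduct_comm]
  rw [rq, bl_cons]
  simp only [hPsym]
  rw [dotProduct_comm β, h1, h2, rq]
  simp only [mulVec_sub, dotProduct_sub, sub_dotProduct, mulVec_smul, dotProduct_smul, smul_dotProduct, smul_eq_mul, h3]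
  ring
end step

lemma norm_cexp_mul (τ : ℂ) (r : ℝ) : ‖cexp (-π * τ * r)‖ = Real.exp (-(π * τ.re) * r) := by
  rw [Complex.norm_exp]; congr 1
  have : (-π * τ * r : ℂ) = ((-π * r : ℝ) : ℂ) * τ := by push_cast; ring
  rw [this, re_ofReal_mul]; ring

theorem poisson_real (n : ℕ) : ∀ (Q P : Matrix (Fin n) (Fin n) ℝ), RPD Q → RPD P → Q * P = 1 →
    ∃ C : ℝ, 0 < C ∧ ∀ τ : ℂ, 0 < τ.re → ∀ v : Fin n → ℝ,
      ∑' x : Fin n → ℤ, cexp (-π * τ * rq Q (rv x) + 2 * π * I * (rv x ⬝ᵥ v : ℝ)) =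
      C * (τ ^ (1 / 2 : ℂ))⁻¹ ^ n * ∑' k : Fin n → ℤ, cexp (-π * τ⁻¹ * rq P (rv k - v)) := by
  induction n with
  | zero =>
    intro Q P _ _ _
    refine ⟨1, one_pos, fun τ hτ v => ?_⟩
    rw [tsum_fintype, tsum_fintype]; simp [rq]
  | succ n ih =>
    intro Q P hQ hP hQP
    have ha := rpd_zero hQ
    obtain ⟨e1, e2, e3⟩ := inv_parts hQ hQP hP.sym
    set P' := P.submatrix Fin.succ Fin.succ with hP'
    have hP'pd : RPD P' := by
      refine ⟨by rw [hP', transpose_submatrix, hP.sym], fun β hβ => ?_⟩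
      have := hP.pos (Fin.cons 0 β) (by
        intro hc; apply hβ; funext i
        have := congrFun hc i.succ; simpa using this)
      rw [rq_inv_cons hQ hQP hP.sym] at this
      simpa using this
    obtain ⟨C, hC, hI⟩ := ih (sch Q) P' (rpd_sch hQ) hP'pd e3
    set a := Q 0 0 with haa
    set s := shr Q with hs
    refine ⟨C * (Real.sqrt a)⁻¹, by positivity, fun τ hτ v => ?_⟩
    obtain ⟨v0, v', rfl⟩ : ∃ v0 v', v = Fin.cons v0 v' := ⟨v 0, Fin.tail v, (Fin.cons_self_tail v).symm⟩
    have hτ0 : τ ≠ 0 := by rintro rfl; simp at hτ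
    have hτi : 0 < (τ⁻¹).re := by
      rw [inv_re]; exact div_pos hτ (normSq_pos.mpr hτ0)
    have haτ : 0 < (τ * a).re := by rw [mul_comm, re_ofReal_mul]; positivity
    have hrv : ∀ (k : ℤ) (y : Fin n → ℤ), rv (Fin.cons k y : Fin (n + 1) → ℤ) = Fin.cons (k : ℝ) (rv y) := by
      intro k y; funext i; refine Fin.cases ?_ (fun j => ?_) i <;> simp [rv]
    have hdot : ∀ (k : ℝ) (y : Fin n → ℝ), (Fin.cons k y : Fin (n + 1) → ℝ) ⬝ᵥ (Fin.cons v0 v' : Fin (n + 1) → ℝ)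
        = k * v0 + y ⬝ᵥ v' := by
      intro k y; simp [dotProduct, Fin.sum_univ_succ]
    have hsub : ∀ (k : ℝ) (y : Fin n → ℝ), (Fin.cons k y : Fin (n + 1) → ℝ) - (Fin.cons v0 v' : Fin (n + 1) → ℝ)
        = Fin.cons (k - v0) (y - v') := by
      intro k y; funext i; refine Fin.cases ?_ (fun j => ?_) i <;> simp
    -- the doubly indexed middle family
    let F : ℤ × (Fin n → ℤ) → ℂ := fun q => cexp (-π * (τ * a)⁻¹ * ((q.1 - v0 : ℝ) ^ 2 : ℝ)) *
      cexp (-π * τ * rq (sch Q) (rv q.2) + 2 * π * I * (rv q.2 ⬝ᵥ (v' + ((q.1 : ℝ) - v0) • s) : ℝ))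
    have hFs : Summable F := by
      have hai : 0 < ((τ * a)⁻¹).re := by
        rw [inv_re]; exact div_pos haτ (normSq_pos.mpr (by rintro hc; rw [hc] at haτ; simp at haτ))
      have h1 := (summable_int_gauss' (mul_pos Real.pi_pos hai) v0).mul_of_nonneg
        ((rpd_sch hQ).summable (mul_pos Real.pi_pos hτ) 0) (fun _ => (Real.exp_pos _).le) (fun _ => (Real.exp_pos _).le)
      refine Summable.of_norm_bounded h1 fun q => le_of_eq ?_
      simp only [F]
      rw [norm_mul, norm_cexp_mul, Complex.exp_add, norm_mul, norm_cexp_mul, sub_zero]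
      have : ‖cexp (2 * π * I * (rv q.2 ⬝ᵥ (v' + ((q.1 : ℝ) - v0) • s) : ℝ))‖ = 1 := by
        rw [Complex.norm_exp]
        rw [show (2 * π * I * (rv q.2 ⬝ᵥ (v' + ((q.1 : ℝ) - v0) • s) : ℝ) : ℂ) =
          ((2 * π * (rv q.2 ⬝ᵥ (v' + ((q.1 : ℝ) - v0) • s)) : ℝ) : ℂ) * I by push_cast; ring]
        simp
      rw [this, mul_one]
    -- summability of left and right
    have hsumL : Summable fun x : Fin (n + 1) → ℤ => cexp (-π * τ * rq Q (rv x) +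
        2 * π * I * (rv x ⬝ᵥ (Fin.cons v0 v' : Fin (n + 1) → ℝ) : ℝ)) := by
      refine Summable.of_norm_bounded (hQ.summable (mul_pos Real.pi_pos hτ) 0) fun x => le_of_eq ?_
      rw [Complex.exp_add, norm_mul, norm_cexp_mul, sub_zero]
      have : ‖cexp (2 * π * I * (rv x ⬝ᵥ (Fin.cons v0 v' : Fin (n + 1) → ℝ) : ℝ))‖ = 1 := by
        rw [Complex.norm_exp]
        rw [show (2 * π * I * (rv x ⬝ᵥ (Fin.cons v0 v' : Fin (n + 1) → ℝ) : ℝ) : ℂ) =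
          ((2 * π * (rv x ⬝ᵥ (Fin.cons v0 v' : Fin (n + 1) → ℝ)) : ℝ) : ℂ) * I by push_cast; ring]
        simp
      rw [this, mul_one]
    have hsumR : Summable fun k : Fin (n + 1) → ℤ => cexp (-π * τ⁻¹ *
        rq P (rv k - (Fin.cons v0 v' : Fin (n + 1) → ℝ))) := by
      refine Summable.of_norm_bounded (hP.summable (mul_pos Real.pi_pos hτi) (Fin.cons v0 v')) fun x => le_of_eq ?_
      rw [norm_cexp_mul]
    rw [← (Fin.consEquiv (fun _ => ℤ)).tsum_eq, ← (Fin.consEquiv (fun _ => ℤ)).tsum_eq]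
    have hsumL' := (Fin.consEquiv (fun _ : Fin (n + 1) => ℤ)).summable_iff.mpr hsumL
    have hsumR' := (Fin.consEquiv (fun _ : Fin (n + 1) => ℤ)).summable_iff.mpr hsumR
    simp only [Function.comp_def, Fin.consEquiv, Equiv.coe_fn_mk, hrv, hsub, hdot] at hsumL' hsumR' ⊢
    rw [hsumR'.tsum_prod]
    have hL : ∑' c : ℤ × (Fin n → ℤ), cexp (-π * τ * rq Q (Fin.cons (c.1 : ℝ) (rv c.2)) +
        2 * π * I * ((c.1 : ℝ) * v0 + rv c.2 ⬝ᵥ v' : ℝ)) = 1 / (τ * a) ^ (1 / 2 : ℂ) * ∑' q, F q := by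
      have hsw := (Equiv.prodComm (Fin n → ℤ) ℤ).summable_iff.mpr hsumL'
      have hFsw := (Equiv.prodComm (Fin n → ℤ) ℤ).summable_iff.mpr hFs
      rw [← (Equiv.prodComm (Fin n → ℤ) ℤ).tsum_eq, ← (Equiv.prodComm (Fin n → ℤ) ℤ).tsum_eq (f := F)]
      simp only [Function.comp_def, Equiv.prodComm_apply, Prod.fst_swap, Prod.snd_swap] at hsw hFsw ⊢
      rw [Summable.tsum_prod hsw, Summable.tsum_prod hFsw, ← tsum_mul_left]
      refine tsum_congr fun y => ?_
      set u := s ⬝ᵥ rv y with hu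
      have hp := Complex.tsum_exp_neg_quadratic haτ (I * v0 - τ * a * u)
      have hl : ∀ k : ℤ, cexp (-π * τ * rq Q (Fin.cons (k : ℝ) (rv y)) + 2 * π * I * ((k : ℝ) * v0 + rv y ⬝ᵥ v' : ℝ)) =
          cexp (-π * τ * rq (sch Q) (rv y) + 2 * π * I * (rv y ⬝ᵥ v' : ℝ) - π * τ * a * u ^ 2) *
          cexp (-π * (τ * a) * k ^ 2 + 2 * π * (I * v0 - τ * a * u) * k) := by
        intro k
        rw [← Complex.exp_add, rq_cons hQ, ← hs, ← hu]
        congr 1; push_cast; ring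
      have hr : ∀ k : ℤ, F (k, y) =
          cexp (-π * τ * rq (sch Q) (rv y) + 2 * π * I * (rv y ⬝ᵥ v' : ℝ) - π * τ * a * u ^ 2) *
          cexp (-π / (τ * a) * (k + I * (I * v0 - τ * a * u)) ^ 2) := by
        intro k
        simp only [F]
        rw [← Complex.exp_add, ← Complex.exp_add, dotProduct_add, dotProduct_smul, dotProduct_comm (rv y) s, ← hu, smul_eq_mul]
        congr 1
        have haC : (a : ℂ) ≠ 0 := by exact_mod_cast ha.ne'
        push_cast
        field_simp
        ring_nf
        simp only [I_sq, show I ^ 4 = 1 from I_pow_four, show I ^ 3 = -I from I_pow_three]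
        ring
      simp only [Prod.swap_prod_mk]
      simp_rw [hl, hr]
      rw [tsum_mul_left, tsum_mul_left, hp]; ring
    rw [hL, hFs.tsum_prod]
    have hin : ∀ k : ℤ, ∑' y, F (k, y) = C * (τ ^ (1 / 2 : ℂ))⁻¹ ^ n *
        ∑' y : Fin n → ℤ, cexp (-π * τ⁻¹ * rq P (Fin.cons ((k : ℝ) - v0) (rv y - v'))) := by
      intro k
      simp only [F]
      rw [tsum_mul_left, hI τ hτ, mul_left_comm, ← tsum_mul_left]
      congr 1
      refine tsum_congr fun y => ?_
      rw [← Complex.exp_add, rq_inv_cons hQ hQP hP.sym, sub_add_eq_sub_sub]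
      congr 1
      push_cast
      have haC : (a : ℂ) ≠ 0 := by exact_mod_cast ha.ne'
      rw [← haa, ← hP', ← hs]
      field_simp
      ring
    simp_rw [hin]
    rw [tsum_mul_left]
    have hsq : (τ * a) ^ (1 / 2 : ℂ) = (Real.sqrt a : ℂ) * τ ^ (1 / 2 : ℂ) := by
      have haC : (a : ℂ) ≠ 0 := by exact_mod_cast ha.ne'
      rw [mul_comm, cpow_def_of_ne_zero (mul_ne_zero haC hτ0), cpow_def_of_ne_zero hτ0,
        Complex.log_ofReal_mul ha hτ0, add_mul, Complex.exp_add, Real.sqrt_eq_rpow,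
        Real.rpow_def_of_pos ha]
      push_cast; rfl
    rw [hsq, pow_succ]; push_cast
    ring
end MF

namespace MF
open Matrix Complex
open scoped Real
variable {n : ℕ} {G : Mt n}

/-- real matrix of an integral one -/
def rG (G : Mt n) : Matrix (Fin n) (Fin n) ℝ := G.map (Int.cast)

lemma rv_dot (x y : Vc n) : rv x ⬝ᵥ rv y = ((x ⬝ᵥ y : ℤ) : ℝ) := by
  simp [dotProduct, rv]

lemma rG_mulVec (G : Mt n) (x : Vc n) : rG G *ᵥ rv x = rv (G *ᵥ x) := by
  funext i; simp [mulVec, dotProduct, rv, rG]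

lemma rG_mul (G H : Mt n) : rG (G * H) = rG G * rG H := by
  ext i j; simp [mul_apply, rG]

lemma rG_one : rG (1 : Mt n) = 1 := by
  ext i j; by_cases h : i = j <;> simp [rG, one_apply, h]

lemma rq_rv (G : Mt n) (x : Vc n) : rq (rG G) (rv x) = (nf G x : ℝ) := by
  rw [rq, rG_mulVec, rv_dot]; rfl

lemma rG_sym (h : Gᵀ = G) : (rG G)ᵀ = rG G := by
  rw [rG, ← transpose_map, h]

lemma rq_add {Q : Matrix (Fin n) (Fin n) ℝ} (h : Qᵀ = Q) (x y : Fin n → ℝ) :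
    rq Q (x + y) = rq Q x + 2 * (y ⬝ᵥ Q *ᵥ x) + rq Q y := by
  have : x ⬝ᵥ Q *ᵥ y = y ⬝ᵥ Q *ᵥ x := by
    rw [dotProduct_mulVec, ← mulVec_transpose, h, dotProduct_comm]
  simp only [rq, mulVec_add, dotProduct_add, add_dotProduct, this]; ring

lemma rpd_of_nonneg {G : Mt n} (hs : Gᵀ = G) (hd : G.det ≠ 0) (h0 : ∀ x, 0 ≤ nf G x) : RPD (rG G) := by
  have hnn : ∀ x, 0 ≤ rq (rG G) x := by
    have hdr : DenseRange (Pi.map (fun (_ : Fin n) (q : ℚ) => (q : ℝ))) :=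
      DenseRange.piMap fun _ => Rat.denseRange_cast
    intro x
    refine hdr.induction_on (p := fun x => 0 ≤ rq (rG G) x) x (isClosed_le continuous_const (continuous_rq _)) ?_
    intro q
    let d : ℕ := ∏ i, (q i).den
    have hd0 : (d : ℝ) ≠ 0 := by
      have : d ≠ 0 := Finset.prod_ne_zero_iff.mpr fun i _ => (q i).den_nz
      exact_mod_cast this
    have hex : ∀ i, ∃ m : ℤ, (m : ℝ) = d * (q i : ℝ) := by
      intro i
      obtain ⟨e, he⟩ : (q i).den ∣ d := Finset.dvd_prod_of_mem _ (Finset.mem_univ i)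
      refine ⟨e * (q i).num, ?_⟩
      have h1 : ((q i).den : ℝ) * (q i : ℝ) = (q i).num := by
        have := Rat.den_mul_eq_num (q i)
        exact_mod_cast congrArg (fun t : ℚ => (t : ℝ)) this
      rw [he]; push_cast; rw [← h1]; ring
    choose m hm using hex
    have : Pi.map (fun (_ : Fin n) (q : ℚ) => (q : ℝ)) q = (d : ℝ)⁻¹ • rv m := by
      funext i; simp only [Pi.map_apply, Pi.smul_apply, rv, hm, smul_eq_mul]; field_simp
    rw [this, rq_smul, rq_rv]
    have := h0 m
    positivity
  have hsR := rG_sym hs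
  refine ⟨hsR, fun x hx => lt_of_le_of_ne (hnn x) fun h => hx ?_⟩
  -- Cauchy-Schwarz
  have hz : ∀ y, y ⬝ᵥ rG G *ᵥ x = 0 := by
    intro y
    by_contra hne
    set b := y ⬝ᵥ rG G *ᵥ x
    have hq : ∀ t : ℝ, 0 ≤ 2 * t * b + t ^ 2 * rq (rG G) y := by
      intro t
      have := hnn (x + t • y)
      rw [rq_add hsR, ← h, rq_smul, smul_dotProduct, smul_eq_mul] at this
      linarith
    have hy := hnn y
    have h1 := hq (-b / (rq (rG G) y + 1))
    have h2 : 2 * (-b / (rq (rG G) y + 1)) * b + (-b / (rq (rG G) y + 1)) ^ 2 * rq (rG G) y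
        = -(b ^ 2 * (rq (rG G) y + 2)) / (rq (rG G) y + 1) ^ 2 := by
      have : rq (rG G) y + 1 ≠ 0 := by positivity
      field_simp; ring
    rw [h2] at h1
    have hb : 0 < b ^ 2 := by positivity
    have : -(b ^ 2 * (rq (rG G) y + 2)) / (rq (rG G) y + 1) ^ 2 < 0 := by
      apply div_neg_of_neg_of_pos
      · nlinarith
      · positivity
    linarith
  have h3 : rG G *ᵥ x = 0 := by
    have := hz (rG G *ᵥ x)
    exact dotProduct_self_eq_zero.mp this
  have hdet : (rG G).det ≠ 0 := by
    have : (rG G).det = ((G.det : ℤ) : ℝ) := by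
      rw [rG]; exact (RingHom.map_det (Int.castRingHom ℝ) G).symm
    rw [this]; exact_mod_cast hd
  exact eq_zero_of_mulVec_eq_zero hdet h3

lemma IsU.rpd (h : IsU G) : RPD (rG G) :=
  rpd_of_nonneg h.sym (by rw [h.det]; exact one_ne_zero) h.nonneg

lemma IsU.inv_nf (h : IsU G) (x : Vc n) : nf G⁻¹ (G *ᵥ x) = nf G x := by
  rw [nf_mulVec, h.sym, h.mul_inv, Matrix.one_mul]

lemma IsU.mulVec_inv (h : IsU G) (x : Vc n) : G *ᵥ (G⁻¹ *ᵥ x) = x := by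
  rw [mulVec_mulVec, h.mul_inv, one_mulVec]
lemma IsU.inv_mulVec (h : IsU G) (x : Vc n) : G⁻¹ *ᵥ (G *ᵥ x) = x := by
  rw [mulVec_mulVec, h.inv_mul, one_mulVec]

lemma IsU.rpd_inv (h : IsU G) : RPD (rG G⁻¹) := by
  refine rpd_of_nonneg h.inv_sym ?_ fun x => ?_
  · intro hc
    have := congrArg Matrix.det h.mul_inv
    rw [det_mul, hc, mul_zero, det_one] at this
    exact zero_ne_one this
  · have := h.inv_nf (G⁻¹ *ᵥ x)
    rw [h.mulVec_inv] at this
    rw [this]; exact h.nonneg _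

/-- theta series of the translate by `-u/2` -/
noncomputable def psi (G : Mt n) (u : Vc n) (z : ℂ) : ℂ :=
  ∑' x : Vc n, cexp (π * I * z * ((nf G (2 • x - u) : ℝ) / 4 : ℝ))

/-- theta series twisted -/
noncomputable def thu (G : Mt n) (u : Vc n) (z : ℂ) : ℂ :=
  ∑' x : Vc n, cexp (π * I * z * nf G x + π * I * bf G x u)

/-- the square root automorphy factor -/
noncomputable def sq (z : ℂ) : ℂ := (-I * z) ^ (1 / 2 : ℂ)

lemma sq_sq (z : ℂ) : sq z ^ 2 = -I * z := by
  rw [sq, ← cpow_nat_mul]; norm_num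

lemma sq_I : sq I = 1 := by
  rw [sq]; simp

lemma norm_cexp_pi (z : ℂ) (r : ℝ) : ‖cexp (π * I * z * r)‖ = Real.exp (-(π * z.im) * r) := by
  rw [Complex.norm_exp]; congr 1
  rw [show (π * I * z * r : ℂ) = ((π * r : ℝ) : ℂ) * (I * z) by push_cast; ring, re_ofReal_mul]
  simp; ring

lemma norm_cexp_pi_I (r : ℝ) : ‖cexp (π * I * r)‖ = 1 := by
  rw [show (π * I * r : ℂ) = ((π * r : ℝ) : ℂ) * I by push_cast; ring, norm_exp_ofReal_mul_I]

lemma rq_half (G : Mt n) (x u : Vc n) : rq (rG G) (rv x - (1 / 2 : ℝ) • rv u) = (nf G (2 • x - u) : ℝ) / 4 := by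
  rw [← rq_rv]
  have : rv (2 • x - u) = (2 : ℝ) • (rv x - (1 / 2 : ℝ) • rv u) := by
    funext i; simp [rv]; ring
  rw [this, rq_smul]; ring

lemma IsU.summable_psi (h : IsU G) (u : Vc n) {c : ℝ} (hc : 0 < c) :
    Summable fun x : Vc n => Real.exp (-c * ((nf G (2 • x - u) : ℝ) / 4)) := by
  have := h.rpd.summable hc ((1 / 2 : ℝ) • rv u)
  simpa only [rq_half] using this

lemma IsU.summable_th (h : IsU G) {c : ℝ} (hc : 0 < c) :
    Summable fun x : Vc n => Real.exp (-c * (nf G x : ℝ)) := by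
  have := h.rpd.summable hc 0
  simpa only [sub_zero, rq_rv] using this

lemma IsU.summable_cpsi (h : IsU G) (u : Vc n) {z : ℂ} (hz : 0 < z.im) :
    Summable fun x : Vc n => cexp (π * I * z * ((nf G (2 • x - u) : ℝ) / 4 : ℝ)) := by
  refine Summable.of_norm_bounded (h.summable_psi u (mul_pos Real.pi_pos hz)) fun x => le_of_eq ?_
  rw [norm_cexp_pi]

lemma IsU.summable_cthu (h : IsU G) (u : Vc n) {z : ℂ} (hz : 0 < z.im) :
    Summable fun x : Vc n => cexp (π * I * z * nf G x + π * I * bf G x u) := by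
  refine Summable.of_norm_bounded (h.summable_th (mul_pos Real.pi_pos hz)) fun x => le_of_eq ?_
  have h1 := norm_cexp_pi z (nf G x : ℝ)
  have h2 := norm_cexp_pi_I (bf G x u : ℝ)
  push_cast at h1 h2
  rw [Complex.exp_add, norm_mul, h1, h2, mul_one]

lemma psi_I_pos (h : IsU G) (u : Vc n) {t : ℝ} (ht : 0 < t) : 0 < (psi G u (I * t)).re ∧ (psi G u (I * t)).im = 0 := by
  have e : psi G u (I * t) = ((∑' x : Vc n, Real.exp (-(π * t) * ((nf G (2 • x - u) : ℝ) / 4)) : ℝ) : ℂ) := by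
    rw [psi, ofReal_tsum]
    refine tsum_congr fun x => ?_
    rw [ofReal_exp]; congr 1
    push_cast
    linear_combination (π * t * ((nf G (2 • x - u) : ℂ) / 4)) * I_sq
  rw [e]
  refine ⟨?_, ofReal_im _⟩
  rw [ofReal_re]
  exact (h.summable_psi u (mul_pos Real.pi_pos ht)).tsum_pos (fun _ => (Real.exp_pos _).le) 0 (Real.exp_pos _)

lemma thu_zero (G : Mt n) (z : ℂ) : thu G 0 z = psi G 0 z := by
  refine tsum_congr fun x => ?_
  rw [bf_zero_right, sub_zero]
  have : nf G (2 • x) = 4 * nf G x := by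
    have := nf_smul G 2 x; norm_num at this; simpa using this
  rw [this]; push_cast; congr 1; ring

theorem th_poisson (h : IsU G) (u : Vc n) {z : ℂ} (hz : 0 < z.im) :
    thu G u z = (sq z)⁻¹ ^ n * psi G u (-1 / z) := by
  obtain ⟨C, hC, hP⟩ := poisson_real n (rG G) (rG G⁻¹) h.rpd h.rpd_inv (by rw [← rG_mul, h.mul_inv, rG_one])
  have key : ∀ u : Vc n, ∀ z : ℂ, 0 < z.im → thu G u z = C * (sq z)⁻¹ ^ n * psi G u (-1 / z) := by
    intro u z hz
    have hz0 : z ≠ 0 := by rintro rfl; simp at hz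
    have := hP (-I * z) (by simpa using hz) ((1 / 2 : ℝ) • rv (G *ᵥ u))
    rw [thu, psi, sq]
    have hGm : Function.Bijective (fun x : Vc n => G *ᵥ x) :=
      ⟨fun x y hxy => by rw [← h.inv_mulVec x, ← h.inv_mulVec y]; exact congrArg _ hxy,
        fun y => ⟨G⁻¹ *ᵥ y, h.mulVec_inv y⟩⟩
    rw [← (Equiv.ofBijective _ hGm).tsum_eq (fun k : Fin n → ℤ =>
      cexp (-π * (-I * z)⁻¹ * rq (rG G⁻¹) (rv k - (1 / 2 : ℝ) • rv (G *ᵥ u))))] at this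
    have e1 : ∀ x : Vc n, cexp (π * I * z * nf G x + π * I * bf G x u) =
        cexp (-π * (-I * z) * rq (rG G) (rv x) + 2 * π * I * (rv x ⬝ᵥ (1 / 2 : ℝ) • rv (G *ᵥ u) : ℝ)) := by
      intro x
      rw [rq_rv, dotProduct_smul, rv_dot, smul_eq_mul]
      congr 1
      rw [bf]; push_cast; ring
    have e2 : ∀ x : Vc n, cexp (π * I * (-1 / z) * ((nf G (2 • x - u) : ℝ) / 4 : ℝ)) =
        cexp (-π * (-I * z)⁻¹ * rq (rG G⁻¹) (rv (Equiv.ofBijective _ hGm x) - (1 / 2 : ℝ) • rv (G *ᵥ u))) := by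
      intro x
      rw [Equiv.ofBijective_apply, rq_half]
      have : 2 • G *ᵥ x - G *ᵥ u = G *ᵥ (2 • x - u) := by rw [mulVec_sub, mulVec_smul]
      rw [this, h.inv_nf]
      congr 1
      rw [mul_inv, inv_neg, inv_I]; ring
    simp_rw [e1, e2]
    exact this
  have hC1 : (C : ℂ) = 1 := by
    have := key 0 I (by simp)
    rw [thu_zero, sq_I, inv_one, one_pow, mul_one, show (-1 / I : ℂ) = I by
      rw [div_I]; ring] at this
    have hp := (psi_I_pos h 0 (t := 1) one_pos).1
    have hne : psi G 0 I ≠ 0 := by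
      intro h0; rw [ofReal_one, mul_one, h0] at hp; simp at hp
    exact mul_right_cancel₀ hne (by rw [← this, one_mul])
  rw [key u z hz, hC1, one_mul]
end MF

namespace MF
open Matrix Complex Filter Topology
open scoped Real
variable {n : ℕ} {G : Mt n}

lemma cexp_even {m : ℤ} (h : Even m) : cexp (π * I * m) = 1 := by
  obtain ⟨k, rfl⟩ := h
  rw [Complex.exp_eq_one_iff]
  exact ⟨k, by push_cast; ring⟩

lemma nf_two_sub (h : Gᵀ = G) (x u : Vc n) : nf G (2 • x - u) = 4 * (nf G x - bf G x u) + nf G u := by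
  have h2 : (2 : ℕ) • x = (2 : ℤ) • x := by rw [two_smul, two_smul]
  rw [h2, nf_sub h, nf_smul, bf_smul_left]; ring

lemma thu_add_one {w : Vc n} (hw : IsChar G w) (z : ℂ) : thu G 0 (z + 1) = thu G w z := by
  refine tsum_congr fun x => ?_
  rw [bf_zero_right]
  have := cexp_even (hw x)
  rw [show (π * I * (z + 1) * nf G x + π * I * (0 : ℤ) : ℂ) = (π * I * z * nf G x + π * I * bf G x w) +
    π * I * ((nf G x - bf G x w : ℤ) : ℂ) by push_cast; ring, Complex.exp_add, this, mul_one]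

lemma thu_add_one' {w : Vc n} (hw : IsChar G w) (z : ℂ) : thu G w (z + 1) = thu G 0 z := by
  refine tsum_congr fun x => ?_
  rw [bf_zero_right]
  have h1 : Even (nf G x + bf G x w) := by
    have := hw x
    rw [show nf G x + bf G x w = nf G x - bf G x w + 2 * bf G x w by ring]
    exact this.add (even_two_mul _)
  have := cexp_even h1
  rw [show (π * I * (z + 1) * nf G x + π * I * bf G x w : ℂ) = (π * I * z * nf G x + π * I * (0 : ℤ)) +
    π * I * ((nf G x + bf G x w : ℤ) : ℂ) by push_cast; ring, Complex.exp_add, this, mul_one]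

lemma psi_add_one (h : IsU G) {w : Vc n} (hw : IsChar G w) (z : ℂ) :
    psi G w (z + 1) = cexp (π * I * (nf G w / 4)) * psi G w z := by
  rw [psi, psi, ← tsum_mul_left]
  refine tsum_congr fun x => ?_
  have := cexp_even (hw x)
  rw [nf_two_sub h.sym, ← Complex.exp_add]
  rw [show (π * I * (z + 1) * ((((4 * (nf G x - bf G x w) + nf G w : ℤ) : ℝ) / 4 : ℝ) : ℂ)) =
    (π * I * (nf G w / 4) + π * I * z * ((((4 * (nf G x - bf G x w) + nf G w : ℤ) : ℝ) / 4 : ℝ) : ℂ)) +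
    π * I * ((nf G x - bf G x w : ℤ) : ℂ) by push_cast; ring, Complex.exp_add, this, mul_one]

lemma th_S (h : IsU G) {z : ℂ} (hz : 0 < z.im) : thu G 0 z = (sq z)⁻¹ ^ n * thu G 0 (-1 / z) := by
  rw [th_poisson h 0 hz, thu_zero]

lemma im_S {z : ℂ} (hz : 0 < z.im) : 0 < (-1 / z).im := by
  have hz0 : z ≠ 0 := by rintro rfl; simp at hz
  have : (-1 / z).im = z.im / normSq z := by simp [div_im]; ring
  rw [this]; exact div_pos hz (normSq_pos.mpr hz0)

lemma sqrt_expI (r θ : ℝ) (h1 : -π < θ) (h2 : θ ≤ π) :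
    (cexp (r + θ * I)) ^ (1 / 2 : ℂ) = cexp ((r + θ * I) / 2) := by
  rw [cpow_def_of_ne_zero (Complex.exp_ne_zero _), Complex.log_exp (by simpa using h1) (by simpa using h2)]
  congr 1; ring

lemma ratio_A : sq (-1 / (I + 1)) = cexp (π * I / 4) * sq (I / (I + 1)) := by
  have hI1 : (I + 1 : ℂ) ≠ 0 := by
    intro h; have := congrArg re h; simp at this
  have hl : cexp (-(Real.log 2) / 2 : ℝ) = (Real.sqrt 2 / 2 : ℝ) := by
    rw [← ofReal_exp]; congr 1
    rw [neg_div, Real.exp_neg, show Real.log 2 / 2 = Real.log (Real.sqrt 2) by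
      rw [Real.log_sqrt (by norm_num)], Real.exp_log (by positivity)]
    have := Real.mul_self_sqrt (show (0:ℝ) ≤ 2 by norm_num)
    field_simp; nlinarith
  have h2 : (Real.sqrt 2 : ℂ) * Real.sqrt 2 = 2 := by
    rw [← ofReal_mul, Real.mul_self_sqrt (by norm_num)]; norm_num
  have e1 : -I * (-1 / (I + 1)) = cexp ((-(Real.log 2) / 2 : ℝ) + (π / 4 : ℝ) * I) := by
    rw [Complex.exp_add, hl, Complex.exp_mul_I, ← ofReal_cos, ← ofReal_sin, Real.cos_pi_div_four, Real.sin_pi_div_four]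
    push_cast
    field_simp
    linear_combination (-(1 + I) ^ 2) * h2 + (-2) * I_sq
  have e2 : -I * (I / (I + 1)) = cexp ((-(Real.log 2) / 2 : ℝ) + (-(π / 4) : ℝ) * I) := by
    rw [Complex.exp_add, hl, Complex.exp_mul_I, ← ofReal_cos, ← ofReal_sin, Real.cos_neg, Real.sin_neg, Real.cos_pi_div_four, Real.sin_pi_div_four]
    push_cast
    field_simp
    linear_combination (-(1 - I ^ 2)) * h2 + (-2) * I_sq
  rw [sq, sq, e1, e2, sqrt_expI _ _ (by linarith [Real.pi_pos]) (by linarith [Real.pi_pos]),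
    sqrt_expI _ _ (by linarith [Real.pi_pos]) (by linarith [Real.pi_pos]), ← Complex.exp_add]
  congr 1; push_cast; ring

theorem vdB (n : ℕ) : VdB n := by
  intro G h w hw
  have hI1 : (I + 1 : ℂ) ≠ 0 := by
    intro h; have := congrArg re h; simp at this
  have hne : psi G w I ≠ 0 := by
    have hp := (psi_I_pos h w (t := 1) one_pos).1
    intro h0; rw [ofReal_one, mul_one, h0] at hp; simp at hp
  have e1 : thu G 0 (-1 / (I + 1) + 1) = (sq (-1 / (I + 1)))⁻¹ ^ n * (cexp (π * I * (nf G w / 4)) * psi G w I) := by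
    rw [thu_add_one hw, th_poisson h w (im_S (by simp)), ← psi_add_one h hw]
    congr 2; field_simp
  have e2 : thu G 0 (-1 / (I + 1) + 1) = (sq (I / (I + 1)))⁻¹ ^ n * psi G w I := by
    have e3 : -1 / (I + 1) + 1 = I / (I + 1) := by field_simp; ring
    have him : 0 < (I / (I + 1)).im := by
      rw [← e3, add_im, one_im, add_zero]; exact im_S (by simp)
    rw [e3, th_S h him, show (-1 / (I / (I + 1)) : ℂ) = -1 + I by
      have := I_ne_zero; field_simp; linear_combination (-1) * I_sq, ← thu_add_one' hw, th_poisson h w (by simp)]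
    rw [show (-1 + I + 1 : ℂ) = I by ring, sq_I, inv_one, one_pow, one_mul, div_I]
    congr 2; ring
  have hn : ∀ z : ℂ, z ≠ 0 → sq z ≠ 0 := by
    intro z hz h0
    have := sq_sq z; rw [h0] at this
    apply hz
    simpa [I_ne_zero] using this.symm
  rw [e1, ratio_A] at e2
  have hs := hn (I / (I + 1)) (div_ne_zero I_ne_zero hI1)
  have e4 : cexp (π * I * (nf G w / 4)) = cexp (π * I / 4) ^ n := by
    have hE := Complex.exp_ne_zero (π * I / 4)
    rw [mul_inv, mul_pow] at e2
    have hp : (sq (I / (I + 1)))⁻¹ ^ n ≠ 0 := pow_ne_zero _ (inv_ne_zero hs)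
    have e5 : ((sq (I / (I + 1)))⁻¹ ^ n * psi G w I) * ((cexp (π * I / 4))⁻¹ ^ n * cexp (π * I * (nf G w / 4))) =
      ((sq (I / (I + 1)))⁻¹ ^ n * psi G w I) * 1 := by linear_combination e2
    have e6 := mul_left_cancel₀ (mul_ne_zero hp hne) e5
    rw [inv_pow] at e6
    field_simp at e6
    rw [← mul_div_assoc]; exact e6
  rw [← Complex.exp_nat_mul, Complex.exp_eq_exp_iff_exists_int] at e4
  obtain ⟨m, hm⟩ := e4
  refine ⟨m, ?_⟩
  have : (nf G w : ℂ) = n + 8 * m := by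
    have hpi : (π * I : ℂ) ≠ 0 := mul_ne_zero (by exact_mod_cast Real.pi_ne_zero) I_ne_zero
    apply mul_left_cancel₀ hpi
    linear_combination 4 * hm
  have : nf G w = n + 8 * m := by exact_mod_cast this
  rw [this]; ring

/-- decay of theta to the constant term -/
lemma thu_tendsto (h : IsU G) (u : Vc n) (a : ℝ) :
    Tendsto (fun t : ℝ => thu G u (a + t * I)) atTop (𝓝 1) := by
  have key := tendsto_tsum_of_dominated_convergence (𝓕 := atTop)
    (f := fun (t : ℝ) (x : Vc n) => cexp (π * I * (a + t * I) * nf G x + π * I * bf G x u))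
    (g := fun x => if x = 0 then 1 else 0) (bound := fun x => Real.exp (-π * (nf G x : ℝ)))
    (h.summable_th Real.pi_pos) ?_ ?_
  · rw [tsum_ite_eq] at key; exact key
  · intro x
    split_ifs with hx
    · subst hx; simp [nf_zero, bf_zero_left]
    · rw [tendsto_zero_iff_norm_tendsto_zero]
      have hN : 0 < (nf G x : ℝ) := by exact_mod_cast h.pos x hx
      have e : ∀ t : ℝ, ‖cexp (π * I * (a + t * I) * nf G x + π * I * bf G x u)‖ = Real.exp (-(π * nf G x * t)) := by
        intro t
        have h1 := norm_cexp_pi (a + t * I) (nf G x : ℝ)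
        have h2 := norm_cexp_pi_I (bf G x u : ℝ)
        push_cast at h1 h2
        rw [Complex.exp_add, norm_mul, h1, h2, mul_one]; congr 1; simp; ring
      simp_rw [e]
      exact Real.tendsto_exp_neg_atTop_nhds_zero.comp (tendsto_id.const_mul_atTop (by positivity))
  · filter_upwards [eventually_ge_atTop 1] with t ht x
    have h1 := norm_cexp_pi (a + t * I) (nf G x : ℝ)
    have h2 := norm_cexp_pi_I (bf G x u : ℝ)
    push_cast at h1 h2
    rw [Complex.exp_add, norm_mul, h1, h2, mul_one]
    apply Real.exp_le_exp.mpr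
    have := h.nonneg x
    have hN : 0 ≤ (nf G x : ℝ) := by exact_mod_cast this
    simp
    nlinarith [mul_nonneg (mul_nonneg Real.pi_pos.le hN) (sub_nonneg.mpr ht)]

/-- standard lift mod two -/
def lif (u : Fin n → ZMod 2) : Vc n := fun i => ((u i).val : ℤ)

lemma red_lif (u : Fin n → ZMod 2) : red 2 (lif u) = u := by funext i; simp [red, lif]

lemma cosets_bij : Function.Bijective (fun q : (Fin n → ZMod 2) × Vc n => 2 • q.2 - lif q.1) := by
  have hr : ∀ (u : Fin n → ZMod 2) (x : Vc n), red 2 (2 • x - lif u) = u := by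
    intro u x; funext i
    have : ((2 : ℕ) : ZMod 2) = 0 := ZMod.natCast_self 2
    have e : (2 • x - lif u) i = 2 * x i - (u i).val := by simp [lif]
    rw [red, e]
    push_cast at this ⊢
    rw [this]; simp [ZMod.neg_eq_self_mod_two]
  constructor
  · rintro ⟨u, x⟩ ⟨u', x'⟩ hh
    simp only at hh
    have h1 : u = u' := by rw [← hr u x, ← hr u' x', hh]
    subst h1
    have h2 : 2 • x = 2 • x' := by simpa using hh
    have : x = x' := by
      funext i
      have := congrFun h2 i
      simp at this
      exact this
    rw [this]
  · intro y
    have : red 2 y = red 2 (-lif (red 2 y)) := by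
      funext i
      simp [red, lif, ZMod.neg_eq_self_mod_two]
    rw [red_eq_iff] at this
    choose c hc using this
    refine ⟨(red 2 y, c), ?_⟩
    funext i
    have := hc i
    simp at this ⊢
    linarith

lemma nf_coset (h : IsU G) (he : EvenF G) (x u : Vc n) :
    cexp (π * I * (1 / 2) * nf G (2 • x - u)) = cexp (π * I * (1 / 2) * nf G u) := by
  obtain ⟨a, ha⟩ := he x
  have := cexp_even (m := 2 * (nf G x - bf G x u)) (even_two_mul _)
  rw [nf_two_sub h.sym, show (π * I * (1 / 2) * ((4 * (nf G x - bf G x u) + nf G u : ℤ) : ℂ)) =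
    π * I * (1 / 2) * nf G u + π * I * ((2 * (nf G x - bf G x u) : ℤ) : ℂ) by push_cast; ring,
    Complex.exp_add, this, mul_one]

lemma sq_pow_eight (m : ℕ) (z : ℂ) : sq z ^ (8 * m) = z ^ (4 * m) := by
  have : sq z ^ 8 = z ^ 4 := by
    rw [show sq z ^ 8 = (sq z ^ 2) ^ 4 by ring, sq_sq, mul_pow]
    have : (-I) ^ 4 = 1 := by rw [neg_pow, I_pow_four]; norm_num
    rw [this, one_mul]
  rw [pow_mul, this, pow_mul]

theorem gauss_exact (h : IsU G) (he : EvenF G) {m : ℕ} (hn : n = 8 * m) {t : ℝ} (ht : 0 < t) :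
    (2 : ℂ) ^ (4 * m) * thu G 0 ((-1 / 2 : ℝ) + t * I) =
      ∑ u : Fin n → ZMod 2, cexp (π * I * (1 / 2) * nf G (lif u)) * thu G (lif u) ((0 : ℝ) + t * I) := by
  have hc0 : IsChar G 0 := fun x => by rw [bf_zero_right, sub_zero]; exact he x
  have htC : (t : ℂ) ≠ 0 := by exact_mod_cast ht.ne'
  set z : ℂ := 1 / 2 + 1 / (4 * t) * I with hz
  have hzim : z.im = 1 / (4 * t) := by
    rw [hz, show (1 / (4 * t) * I : ℂ) = ((1 / (4 * t) : ℝ) : ℂ) * I by push_cast; ring]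
    simp
  have hzpos : 0 < z.im := by rw [hzim]; positivity
  have hz0 : z ≠ 0 := by intro h0; rw [h0] at hzpos; simp at hzpos
  -- modular side
  have e1 : thu G 0 z = (2 * t) ^ (4 * m) * thu G 0 ((-1 / 2 : ℝ) + t * I) := by
    have hw : (-1 / z + 1 + 1) = (I / (2 * t)) / z := by
      field_simp; rw [hz]; field_simp; ring
    have hwim : 0 < (-1 / z + 1 + 1).im := by simpa using im_S hzpos
    have hw0 : -1 / (-1 / z + 1 + 1) = ((-1 / 2 : ℝ) + t * I : ℂ) := by
      rw [hw]; have := I_ne_zero; field_simp; rw [hz]; push_cast; field_simp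
      linear_combination (-8 * t) * I_sq
    rw [th_S h hzpos, ← thu_add_one hc0, ← thu_add_one hc0, th_S h hwim, hw0, ← mul_assoc]
    congr 1
    rw [← mul_pow, ← mul_inv, ← inv_inv ((2 * t : ℂ) ^ (4 * m)), inv_pow, ← inv_pow (2 * t : ℂ), mul_pow, hn, sq_pow_eight, sq_pow_eight, ← mul_pow, hw]
    congr 1
    rw [show z * (I / (2 * t) / z) = I / (2 * t) by field_simp, div_pow, pow_mul I, I_pow_four, one_pow, inv_pow, one_div]
  -- coset side
  have e2 : thu G 0 z = ∑ u : Fin n → ZMod 2, cexp (π * I * (1 / 2) * nf G (lif u)) *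
      psi G (lif u) (-1 / ((0 : ℝ) + t * I)) := by
    have hs := h.summable_cthu 0 hzpos
    rw [thu, ← (Equiv.ofBijective _ (cosets_bij (n := n))).tsum_eq]
    have hs' := (Equiv.ofBijective _ (cosets_bij (n := n))).summable_iff.mpr hs
    simp only [Function.comp_def] at hs'
    rw [Summable.tsum_prod hs', tsum_fintype]
    refine Finset.sum_congr rfl fun u _ => ?_
    rw [psi, ← tsum_mul_left]
    refine tsum_congr fun x => ?_
    simp only [Equiv.ofBijective_apply]
    rw [bf_zero_right, ← nf_coset h he x, ← Complex.exp_add]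
    congr 1
    have := I_ne_zero
    rw [hz]; push_cast; field_simp
    linear_combination (2 * t * (nf G (2 • x - lif u) : ℂ)) * I_sq
  have him : 0 < ((0 : ℝ) + t * I : ℂ).im := by simpa using ht
  have e3 : ∀ u : Vc n, psi G u (-1 / ((0 : ℝ) + t * I)) = t ^ (4 * m) * thu G u ((0 : ℝ) + t * I) := by
    intro u
    rw [th_poisson h u him, ← mul_assoc]
    have : sq ((0 : ℝ) + t * I) ^ n = t ^ (4 * m) := by
      rw [hn, sq_pow_eight, ofReal_zero, zero_add, mul_pow, pow_mul I, I_pow_four, one_pow, mul_one]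
    rw [inv_pow, this, mul_inv_cancel₀ (pow_ne_zero _ htC), one_mul]
  rw [e1] at e2
  simp_rw [e3] at e2
  apply mul_left_cancel₀ (pow_ne_zero (4 * m) htC)
  rw [Finset.mul_sum]
  calc _ = (2 * (t : ℂ)) ^ (4 * m) * thu G 0 ((-1 / 2 : ℝ) + t * I) := by rw [mul_pow]; ring
    _ = _ := by rw [e2]; exact Finset.sum_congr rfl fun u _ => by ring

theorem gauss_sum (h : IsU G) (he : EvenF G) {m : ℕ} (hn : n = 8 * m) :
    ∑ u : Fin n → ZMod 2, cexp (π * I * (1 / 2) * nf G (lif u)) = 2 ^ (4 * m) := by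
  have h1 : Tendsto (fun t : ℝ => (2 : ℂ) ^ (4 * m) * thu G 0 ((-1 / 2 : ℝ) + t * I)) atTop (𝓝 (2 ^ (4 * m) * 1)) :=
    (thu_tendsto h 0 (-1 / 2)).const_mul _
  have h2 : Tendsto (fun t : ℝ => ∑ u : Fin n → ZMod 2, cexp (π * I * (1 / 2) * nf G (lif u)) *
      thu G (lif u) ((0 : ℝ) + t * I)) atTop (𝓝 (∑ u : Fin n → ZMod 2, cexp (π * I * (1 / 2) * nf G (lif u)) * 1)) :=
    tendsto_finsetSum _ fun u _ => (thu_tendsto h (lif u) 0).const_mul _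
  have h3 := tendsto_nhds_unique (h2.congr' (by
    filter_upwards [eventually_gt_atTop 0] with t ht
    exact (gauss_exact h he hn ht).symm)) h1
  simpa using h3

theorem sing_count (h : IsU G) (he : EvenF G) {m : ℕ} (hm : 0 < m) (hn : n = 8 * m) :
    (sing G).ncard = 2 ^ (8 * m - 1) + 2 ^ (4 * m - 1) := by
  classical
  have hs : ∀ u : Fin n → ZMod 2, u ∈ sing G ↔ (4 : ℤ) ∣ nf G (lif u) := by
    intro u
    refine ⟨?_, fun hd => ⟨lif u, red_lif u, hd⟩⟩
    rintro ⟨w, rfl, hd⟩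
    have : red 2 w = red 2 (- lif (red 2 w)) := by
      funext i; simp [red, lif, ZMod.neg_eq_self_mod_two]
    rw [red_eq_iff] at this
    choose c hc using this
    have hw : w = 2 • c - lif (red 2 w) := by
      funext i; have := hc i; simp at this ⊢; linarith
    rw [hw, nf_two_sub h.sym] at hd
    exact (Int.dvd_add_right ⟨_, rfl⟩).mp hd
  have hval : ∀ u : Fin n → ZMod 2, cexp (π * I * (1 / 2) * nf G (lif u)) = (2 * (if u ∈ sing G then 1 else 0) - 1 : ℂ) := by
    intro u
    obtain ⟨a, ha⟩ := he (lif u)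
    have e : (π * I * (1 / 2) * nf G (lif u) : ℂ) = π * I * a := by rw [ha]; push_cast; ring
    rw [e]
    rcases Int.even_or_odd a with hev | hod
    · rw [cexp_even hev, if_pos ((hs u).mpr (by obtain ⟨b, hb⟩ := hev; exact ⟨b, by omega⟩))]; norm_num
    · rw [if_neg (by rw [hs]; obtain ⟨b, hb⟩ := hod; omega)]
      obtain ⟨b, rfl⟩ := hod
      rw [show (π * I * ((2 * b + 1 : ℤ) : ℂ) : ℂ) = π * I * ((2 * b : ℤ) : ℂ) + π * I by push_cast; ring,
        Complex.exp_add, cexp_even (even_two_mul b), Complex.exp_pi_mul_I]; norm_num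
  have hg := gauss_sum h he hn
  simp_rw [hval] at hg
  rw [Finset.sum_sub_distrib, ← Finset.mul_sum, Finset.sum_boole] at hg
  have hc : (sing G).ncard = (Finset.univ.filter (· ∈ sing G)).card := by
    rw [← Set.ncard_coe_finset]; congr 1; ext; simp
  rw [← hc] at hg
  simp at hg
  have hg2 : 2 * (sing G).ncard = 2 ^ (4 * m) + 2 ^ n := by
    have : (2 * (sing G).ncard : ℂ) = 2 ^ (4 * m) + 2 ^ n := by linear_combination hg
    exact_mod_cast this
  obtain ⟨k, rfl⟩ : ∃ k, m = k + 1 := ⟨m - 1, by omega⟩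
  replace hg2 := hg2.trans (show _ = 2 ^ (4 * (k + 1)) + 2 ^ (8 * (k + 1)) by rw [hn])
  have e1 : 2 ^ (8 * (k + 1)) = 2 * 2 ^ (8 * (k + 1) - 1) := by
    rw [← pow_succ']; congr 1
  have e2 : 2 ^ (4 * (k + 1)) = 2 * 2 ^ (4 * (k + 1) - 1) := by
    rw [← pow_succ']; congr 1
  omega
end MF

namespace MF
open Matrix Complex Filter Topology
open scoped Real
variable {n : ℕ} {G : Mt n}

lemma pow_exp_le (j : ℕ) {c N : ℝ} (hc : 0 < c) (hN : 0 ≤ N) :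
    N ^ j * Real.exp (-c * N) ≤ (j.factorial * (2 / c) ^ j) * Real.exp (-(c / 2) * N) := by
  have h1 := Real.pow_div_factorial_le_exp (c / 2 * N) (by positivity) j
  have hj : (0 : ℝ) < j.factorial := by exact_mod_cast j.factorial_pos
  rw [div_le_iff₀ hj] at h1
  have e : Real.exp (-c * N) = Real.exp (-(c / 2) * N) * Real.exp (-(c / 2) * N) := by
    rw [← Real.exp_add]; congr 1; ring
  have e2 : Real.exp (c / 2 * N) * Real.exp (-(c / 2) * N) = 1 := by
    rw [← Real.exp_add, ← Real.exp_zero]; congr 1; ring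
  have e3 : N ^ j = (2 / c) ^ j * (c / 2 * N) ^ j := by
    rw [← mul_pow]; congr 1; field_simp
  have hE := Real.exp_pos (-(c / 2) * N)
  rw [e, e3]
  calc (2 / c) ^ j * (c / 2 * N) ^ j * (Real.exp (-(c / 2) * N) * Real.exp (-(c / 2) * N))
      ≤ (2 / c) ^ j * (Real.exp (c / 2 * N) * j.factorial) * (Real.exp (-(c / 2) * N) * Real.exp (-(c / 2) * N)) := by
        gcongr
    _ = (j.factorial * (2 / c) ^ j) * Real.exp (-(c / 2) * N) * (Real.exp (c / 2 * N) * Real.exp (-(c / 2) * N)) := by ring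
    _ = _ := by rw [e2, mul_one]

lemma IsU.summable_pow (h : IsU G) (j : ℕ) {c : ℝ} (hc : 0 < c) :
    Summable fun x : Vc n => (nf G x : ℝ) ^ j * Real.exp (-c * (nf G x : ℝ)) := by
  have hnn : ∀ x, (0 : ℝ) ≤ nf G x := fun x => by exact_mod_cast h.nonneg x
  refine Summable.of_nonneg_of_le (fun x => mul_nonneg (pow_nonneg (hnn x) _) (Real.exp_pos _).le)
    (fun x => pow_exp_le j hc (hnn x)) ((h.summable_th (half_pos hc)).mul_left _)

/-- real theta derivatives -/
noncomputable def Th (G : Mt n) (j : ℕ) (t : ℝ) : ℝ := ∑' x : Vc n, (nf G x : ℝ) ^ j * Real.exp (-(π * t) * (nf G x : ℝ))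

lemma Th_deriv (h : IsU G) (j : ℕ) {t : ℝ} (ht : 0 < t) :
    HasDerivAt (Th G j) (-π * Th G (j + 1) t) t := by
  have hnn : ∀ x, (0 : ℝ) ≤ nf G x := fun x => by exact_mod_cast h.nonneg x
  have key := hasDerivAt_tsum_of_isPreconnected (𝕜 := ℝ) (F := ℝ)
    (g := fun (x : Vc n) (t : ℝ) => (nf G x : ℝ) ^ j * Real.exp (-(π * t) * (nf G x : ℝ)))
    (g' := fun x t => -π * ((nf G x : ℝ) ^ (j + 1) * Real.exp (-(π * t) * (nf G x : ℝ))))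
    (u := fun x => π * ((nf G x : ℝ) ^ (j + 1) * Real.exp (-(π * (t / 2)) * (nf G x : ℝ))))
    (t := Set.Ioi (t / 2)) (y₀ := t) (y := t) ((h.summable_pow (j + 1) (by positivity)).mul_left _)
    isOpen_Ioi isPreconnected_Ioi ?_ ?_ (by simp [ht]) (h.summable_pow j (by positivity)) (by simp [ht])
  · rw [tsum_mul_left] at key; exact key
  · intro x y _
    have h1 : HasDerivAt (fun t : ℝ => -(π * t) * (nf G x : ℝ)) (-(π * 1) * (nf G x : ℝ)) y :=
      (((hasDerivAt_id y).const_mul π).neg).mul_const _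
    have := (h1.exp).const_mul ((nf G x : ℝ) ^ j)
    refine this.congr_deriv ?_
    ring
  · intro x y hy
    have hN := hnn x
    rw [norm_mul, norm_neg, Real.norm_of_nonneg Real.pi_pos.le, Real.norm_of_nonneg (by positivity)]
    have hy' : t / 2 < y := hy
    have : π * (t / 2) ≤ π * y := by gcongr
    gcongr

lemma Th_zero (G : Mt n) {t : ℝ} : thu G 0 (I * t) = (Th G 0 t : ℂ) := by
  rw [thu, Th, ofReal_tsum]
  refine tsum_congr fun x => ?_
  rw [bf_zero_right]; push_cast
  rw [pow_zero, one_mul]; congr 1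
  linear_combination (π * t * (nf G x : ℂ)) * I_sq

lemma Th_S (h : IsU G) {t : ℝ} (ht : 0 < t) : Th G 0 t = (Real.sqrt t)⁻¹ ^ n * Th G 0 t⁻¹ := by
  have := th_S h (z := I * t) (by simpa using ht)
  have e : sq (I * t) = (Real.sqrt t : ℂ) := by
    rw [sq, show -I * (I * t) = (t : ℂ) by linear_combination (-t) * I_sq, Real.sqrt_eq_rpow,
      ofReal_cpow ht.le]; norm_num
  have e2 : -1 / (I * t) = I * (t⁻¹ : ℝ) := by
    have : (t : ℂ) ≠ 0 := by exact_mod_cast ht.ne'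
    have := I_ne_zero
    push_cast; field_simp; linear_combination (-1) * I_sq
  rw [e, e2, Th_zero, Th_zero] at this
  exact_mod_cast this

/-- symmetrised theta -/
noncomputable def Fj (G : Mt n) (j : ℕ) (u : ℝ) : ℝ :=
  Real.exp ((n : ℝ) / 4 * u) * Real.exp u ^ j * Th G j (Real.exp u)

lemma Fj_deriv (h : IsU G) (j : ℕ) (u : ℝ) :
    HasDerivAt (Fj G j) (((n : ℝ) / 4 + j) * Fj G j u - π * Fj G (j + 1) u) u := by
  have h1 : HasDerivAt (fun u : ℝ => Real.exp ((n : ℝ) / 4 * u)) (Real.exp ((n : ℝ) / 4 * u) * ((n : ℝ) / 4 * 1)) u :=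
    ((hasDerivAt_id u).const_mul _).exp
  have h2 : HasDerivAt (fun u : ℝ => Real.exp u ^ j) (j * Real.exp u ^ j) u := by
    have : HasDerivAt (fun u : ℝ => Real.exp (j * u)) (Real.exp (j * u) * (j * 1)) u :=
      ((hasDerivAt_id u).const_mul _).exp
    simp only [← Real.exp_nat_mul]
    refine this.congr_deriv ?_; ring
  have h3 := (Th_deriv h j (Real.exp_pos u)).comp u (Real.hasDerivAt_exp u)
  have := (h1.mul h2).mul h3
  refine this.congr_deriv ?_
  simp only [Fj, Pi.mul_apply, Function.comp]
  ring

lemma F0_even (h : IsU G) (u : ℝ) : Fj G 0 (-u) = Fj G 0 u := by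
  simp only [Fj, pow_zero, mul_one]
  rw [Th_S h (Real.exp_pos u), ← mul_assoc, Real.exp_neg]
  congr 1
  have : (Real.sqrt (Real.exp u)) = Real.exp (u / 2) := by
    rw [Real.sqrt_eq_rpow, ← Real.exp_mul]; congr 1; ring
  rw [this, ← Real.exp_neg, ← Real.exp_nat_mul, ← Real.exp_add]
  congr 1; ring

lemma deriv_parity {f f' : ℝ → ℝ} (hd : ∀ u, HasDerivAt f (f' u) u) (s : ℝ) (hf : ∀ u, f (-u) = s * f u) (u : ℝ) :
    f' (-u) = -s * f' u := by
  have h1 : HasDerivAt (fun u => f (-u)) (f' (-u) * -1) u :=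
    HasDerivAt.comp u (hd (-u)) (hasDerivAt_neg u)
  have h2 : HasDerivAt (fun u => f (-u)) (s * f' u) u := by
    have := (hd u).const_mul s
    simpa only [hf] using this
  have := h1.unique h2
  linarith

theorem lp_identity (h : IsU G) : ∑' x : Vc n, ((2 * ((n : ℝ) / 4) + 1) * (n / 4 + 1) * (π * nf G x)
    - 3 * ((n : ℝ) / 4 + 1) * (π * nf G x) ^ 2 + (π * nf G x) ^ 3) * Real.exp (-π * nf G x) = 0 := by
  set a : ℝ := (n : ℝ) / 4 with ha
  have d0 := Fj_deriv h 0
  have d1 := Fj_deriv h 1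
  have d2 := Fj_deriv h 2
  simp only [← ha] at d0 d1 d2
  have p0 : ∀ u, Fj G 0 (-u) = 1 * Fj G 0 u := fun u => by rw [F0_even h, one_mul]
  have p1 := deriv_parity d0 1 p0
  have dd1 : ∀ u, HasDerivAt (fun u => (a + (0 : ℕ)) * Fj G 0 u - π * Fj G (0 + 1) u) _ u := fun u =>
    ((d0 u).const_mul (a + (0 : ℕ))).sub ((d1 u).const_mul π)
  have p2 := deriv_parity dd1 (-1) (fun u => p1 u)
  have dd2 := fun u => ((((d0 u).const_mul (a + (0 : ℕ))).sub ((d1 u).const_mul π)).const_mul (a + (0 : ℕ))).sub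
    ((((d1 u).const_mul (a + (1 : ℕ))).sub ((d2 u).const_mul π)).const_mul π)
  have p3 := deriv_parity dd2 1 (fun u => by
    have := p2 u
    simp only [Pi.sub_apply, neg_neg] at this ⊢
    convert this using 1 )
  have q1 := p1 0
  have q3 := p3 0
  simp only [neg_zero, Nat.cast_zero, add_zero, zero_add, Nat.cast_one, Nat.cast_ofNat] at q1 q3
  have hF : ∀ j, Fj G j 0 = Th G j 1 := by intro j; simp [Fj]
  norm_num at q1 q3
  simp only [hF] at q1 q3
  have key : (2 * a + 1) * (a + 1) * (π * Th G 1 1) - 3 * (a + 1) * (π ^ 2 * Th G 2 1) + π ^ 3 * Th G 3 1 = 0 := by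
    linear_combination (-1/2) * q3 + (1/2) * a ^ 2 * q1
  have hs := fun j => (h.summable_pow j Real.pi_pos).hasSum
  have e : ∀ j, ∑' x : Vc n, (nf G x : ℝ) ^ j * Real.exp (-π * (nf G x : ℝ)) = Th G j 1 := fun j => by
    simp only [Th, mul_one]
  simp only [e] at hs
  have := ((((hs 1).mul_left π).mul_left ((2 * a + 1) * (a + 1))).sub
    (((hs 2).mul_left (π ^ 2)).mul_left (3 * (a + 1)))).add ((hs 3).mul_left (π ^ 3))
  rw [key] at this
  rw [← this.tsum_eq]
  refine tsum_congr fun x => by ring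

theorem exists_norm_one (h : IsU G) (hn0 : 0 < n) (hn : n ≤ 7) : ∃ x, nf G x = 1 := by
  by_contra hcon
  push Not at hcon
  have h2 : ∀ x : Vc n, x ≠ 0 → 2 ≤ nf G x := by
    intro x hx
    have h1 := h.pos x hx
    have h2 := hcon x
    omega
  have hsum := lp_identity h
  have hpos : ∀ x : Vc n, x ≠ 0 → 0 < ((2 * ((n : ℝ) / 4) + 1) * (n / 4 + 1) * (π * nf G x)
    - 3 * ((n : ℝ) / 4 + 1) * (π * nf G x) ^ 2 + (π * nf G x) ^ 3) * Real.exp (-π * nf G x) := by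
    intro x hx
    apply mul_pos _ (Real.exp_pos _)
    have hN : (2 : ℝ) ≤ nf G x := by exact_mod_cast h2 x hx
    set y := π * (nf G x : ℝ) with hy
    have hy1 : 6.283 ≤ y := by
      have := Real.pi_gt_d4
      nlinarith
    have hn' : (n : ℝ) / 4 ≤ 7 / 4 := by
      have : (n : ℝ) ≤ 7 := by exact_mod_cast hn
      linarith
    have ha0 : 0 ≤ (n : ℝ) / 4 := by positivity
    set a := (n : ℝ) / 4
    have : 0 < y ^ 2 - 3 * (a + 1) * y + (2 * a + 1) * (a + 1) := by
      nlinarith [mul_nonneg (sub_nonneg.mpr hn') (sub_nonneg.mpr hy1), sq_nonneg (y - 6.283), mul_nonneg ha0 (sub_nonneg.mpr hn')]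
    have hy0 : 0 < y := by linarith
    nlinarith [mul_pos hy0 this]
  have hs : Summable fun x : Vc n => ((2 * ((n : ℝ) / 4) + 1) * (n / 4 + 1) * (π * nf G x)
    - 3 * ((n : ℝ) / 4 + 1) * (π * nf G x) ^ 2 + (π * nf G x) ^ 3) * Real.exp (-π * nf G x) := by
    have hs := fun j => h.summable_pow j Real.pi_pos
    refine (((((hs 1).mul_left π).mul_left ((2 * ((n : ℝ) / 4) + 1) * (n / 4 + 1))).sub
      (((hs 2).mul_left (π ^ 2)).mul_left (3 * ((n : ℝ) / 4 + 1)))).add ((hs 3).mul_left (π ^ 3))).congr fun x => by ring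
  have hx0 : (Pi.single ⟨0, hn0⟩ 1 : Vc n) ≠ 0 := by simp
  have := hs.tsum_pos (fun x => by
    by_cases hx : x = 0
    · subst hx; simp [nf_zero]
    · exact (hpos x hx).le) _ (hpos _ hx0)
  exact this.ne' hsum

lemma isU_one (n : ℕ) : IsU (1 : Mt n) := by
  refine ⟨transpose_one, det_one, fun x hx => ?_⟩
  have e : nf 1 x = ∑ i, x i ^ 2 := by simp [nf, bf, dotProduct, pow_two]
  rw [e]
  obtain ⟨i, hi⟩ : ∃ i, x i ≠ 0 := by
    by_contra hc; push Not at hc; exact hx (funext hc)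
  exact Finset.sum_pos' (fun i _ => sq_nonneg _) ⟨i, Finset.mem_univ i, by positivity⟩

lemma nf_one (x : Vc n) : nf 1 x = ∑ i, x i ^ 2 := by simp [nf, bf, dotProduct, pow_two]

theorem iso_one : ∀ n : ℕ, n ≤ 7 → ∀ G : Mt n, IsU G → Iso G 1 := by
  intro n
  induction n with
  | zero => intro _ G _; exact ⟨1, by ext i; exact i.elim0⟩
  | succ m ih =>
    intro hm G h
    obtain ⟨e, he⟩ := exists_norm_one h (Nat.succ_pos m) hm
    obtain ⟨H, A, hH, hA, -⟩ := exists_split h he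
    obtain ⟨B, hB⟩ := ih (by omega) H hH
    refine Iso.trans ⟨A, hA⟩ ⟨oneSum B, ?_⟩
    rw [← oneSum_one]; exact oneSum_isos.mpr hB

lemma reps_one (hn : n ≤ 7) : IsReps (fun _ => True) ({1} : Finset (Mt n)) := by
  refine ⟨fun G hG => ?_, fun G h _ => ⟨1, by simp, iso_one n hn G h⟩, fun G hG H hH _ => ?_⟩
  · rw [Finset.mem_singleton] at hG; subst hG; exact ⟨isU_one n, trivial⟩
  · rw [Finset.mem_singleton] at hG hH; rw [hG, hH]

lemma reps_one_odd {m : ℕ} (hn : m + 1 ≤ 7) : IsReps OddF ({1} : Finset (Mt (m + 1))) := by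
  refine ⟨fun G hG => ?_, fun G h _ => ⟨1, by simp, iso_one _ hn G h⟩, fun G hG H hH _ => ?_⟩
  · rw [Finset.mem_singleton] at hG; subst hG
    refine ⟨isU_one _, ?_⟩
    rw [← oneSum_one]; exact oddF_oneSum _
  · rw [Finset.mem_singleton] at hG hH; rw [hG, hH]

lemma rep_one_one (n : ℕ) : rep (1 : Mt n) 1 = 2 * n := by
  have : {x : Vc n | nf 1 x = 1} = Set.range (fun q : Bool × Fin n => if q.1 then (Pi.single q.2 1 : Vc n) else Pi.single q.2 (-1)) := by
    ext x
    simp only [Set.mem_ofPred_eq, Set.mem_range]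
    constructor
    · intro hx
      rw [nf_one] at hx
      obtain ⟨i, hi⟩ : ∃ i, x i ≠ 0 := by
        by_contra hc; push Not at hc; simp [hc] at hx
      rw [← Finset.add_sum_erase _ _ (Finset.mem_univ i)] at hx
      have hnn : 0 ≤ ∑ j ∈ Finset.univ.erase i, x j ^ 2 := Finset.sum_nonneg fun _ _ => sq_nonneg _
      have h1 : 0 < x i ^ 2 := by positivity
      have h2 : x i ^ 2 = 1 := by omega
      have h3 : ∑ j ∈ Finset.univ.erase i, x j ^ 2 = 0 := by omega
      rw [Finset.sum_eq_zero_iff_of_nonneg fun _ _ => sq_nonneg _] at h3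
      have h4 : ∀ j, j ≠ i → x j = 0 := fun j hj => by
        have := h3 j (by simp [hj]); simpa using this
      have h6 : x i = 1 ∨ x i = -1 := by
        have : (x i - 1) * (x i + 1) = 0 := by linear_combination h2
        rcases mul_eq_zero.mp this with h | h <;> omega
      rcases h6 with h5 | h5
      · refine ⟨(true, i), funext fun j => ?_⟩
        by_cases hj : j = i
        · subst hj; simp [h5]
        · simp [hj, h4 j hj]
      · refine ⟨(false, i), funext fun j => ?_⟩
        by_cases hj : j = i
        · subst hj; simp [h5]
        · simp [hj, h4 j hj]
    · rintro ⟨⟨b, i⟩, rfl⟩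
      cases b <;> simp [nf, bf_single, bf]
  rw [rep, this, ← Set.image_univ, Set.ncard_image_of_injective, Set.ncard_univ, Nat.card_prod]
  · simp
  · rintro ⟨b, i⟩ ⟨b', i'⟩ hh
    have h1 := congrFun hh i
    have h2 := congrFun hh i'
    by_cases hi : i = i'
    · subst hi; cases b <;> cases b' <;> simp at h1 ⊢ <;> omega
    · cases b <;> cases b' <;> simp [Pi.single_apply, hi] at h1

theorem mass_small : ∀ n : ℕ, n ≤ 7 → mass ({1} : Finset (Mt n)) = 1 / (2 ^ n * n.factorial) := by
  intro n
  induction n with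
  | zero =>
    intro _
    have : autc (1 : Mt 0) = 1 := by
      rw [autc, Set.ncard_eq_one]
      exact ⟨1, by ext A; simp [isos, eq_iff_true_of_subsingleton]⟩
    simp [mass, this]
  | succ m ih =>
    intro hm
    have h1 := split_mass (reps_one_odd hm) (reps_one (n := m) (by omega))
    rw [ih (by omega)] at h1
    rw [Finset.sum_singleton, rep_one_one] at h1
    rw [mass, Finset.sum_singleton]
    have h0 : (autc (1 : Mt (m + 1)) : ℝ) ≠ 0 := by
      have := autc_pos (isU_one (m + 1)); positivity
    have hf : (m.factorial : ℝ) ≠ 0 := by exact_mod_cast m.factorial_ne_zero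
    rw [Nat.factorial_succ]
    push_cast at h1 ⊢
    field_simp at h1 ⊢
    rw [pow_succ]; linarith
end MF

namespace MF
open Matrix Complex Filter Topology
open scoped Real MatrixGroups

/-- uniform bound from invariance under the theta group -/
theorem theta_group_bound {φ : ℂ → ℝ} (h2 : ∀ z : ℂ, 0 < z.im → φ (z + 2) = φ z)
    (hS : ∀ z : ℂ, 0 < z.im → φ (-1 / z) = φ z) {C : ℝ}
    (hb : ∀ z : ℂ, 1 / 2 ≤ z.im → φ z ≤ C) (hb3 : ∀ z : ℂ, 1 / 2 ≤ z.im → φ (1 - 1 / z) ≤ C)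
    (z : ℂ) (hz : 0 < z.im) : φ z ≤ C := by
  let Φ : UpperHalfPlane → ℝ := fun z => max (max (φ z) (φ (z + 1))) (φ (1 - 1 / z))
  have hTc : ∀ z : UpperHalfPlane, ((ModularGroup.T • z : UpperHalfPlane) : ℂ) = z + 1 := fun z => by
    rw [UpperHalfPlane.modular_T_smul, UpperHalfPlane.coe_vadd]; push_cast; ring
  have hSc : ∀ z : UpperHalfPlane, ((ModularGroup.S • z : UpperHalfPlane) : ℂ) = -1 / z := fun z => by
    rw [UpperHalfPlane.modular_S_smul, neg_div, one_div, ← inv_neg]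
  have hne : ∀ z : ℂ, 0 < z.im → z ≠ 0 := fun z hz h => by simp [h] at hz
  have iT : ∀ z : UpperHalfPlane, Φ (ModularGroup.T • z) = Φ z := by
    intro z
    have hz : 0 < (z : ℂ).im := z.im_pos
    have hz1 : 0 < ((z : ℂ) + 1).im := by simpa using hz
    have n1 := hne _ hz
    have n2 := hne _ hz1
    have e3 : φ (1 - 1 / ((z : ℂ) + 1)) = φ (1 - 1 / (z : ℂ)) := by
      have a1 : 0 < ((-1 / ((z : ℂ) + 1)) + 1).im := by
        have := im_S hz1; simpa using this
      have := hS _ a1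
      have a2 : 0 < (-1 / (-1 / ((z : ℂ) + 1) + 1)).im := im_S a1
      rw [← h2 _ a2] at this
      have q : -1 / (-1 / ((z : ℂ) + 1) + 1) + 2 = 1 - 1 / (z : ℂ) := by
        have : -1 / ((z : ℂ) + 1) + 1 = z / (z + 1) := by field_simp; ring
        rw [this]; field_simp; ring
      rw [q] at this
      rw [this]; congr 1; ring
    simp only [Φ]
    rw [hTc, e3, show (z : ℂ) + 1 + 1 = z + 2 by ring, h2 _ hz, max_comm (φ (z + 1))]
  have iS : ∀ z : UpperHalfPlane, Φ (ModularGroup.S • z) = Φ z := by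
    intro z
    have hz : 0 < (z : ℂ).im := z.im_pos
    have n1 := hne _ hz
    simp only [Φ]
    rw [hSc, hS _ hz, max_right_comm]
    congr 2
    · congr 1; rw [neg_div, one_div, one_div, inv_neg, inv_inv]; ring
    · congr 1; ring
  have inv : ∀ γ : SL(2, ℤ), ∀ z : UpperHalfPlane, Φ (γ • z) = Φ z := by
    intro γ
    have hγ : γ ∈ Subgroup.closure {ModularGroup.S, ModularGroup.T} := by
      rw [SpecialLinearGroup.SL2Z_generators]; trivial
    induction hγ using Subgroup.closure_induction with
    | mem x hx =>
      rcases hx with rfl | rfl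
      · exact iS
      · exact iT
    | one => intro z; rw [one_smul]
    | mul x y _ _ hx hy => intro z; rw [mul_smul, hx, hy]
    | inv x _ hx => intro z; rw [← hx (x⁻¹ • z), smul_inv_smul]
  have hΦ : Φ ⟨z, hz⟩ ≤ C := by
    obtain ⟨γ, hγ⟩ := ModularGroup.exists_smul_mem_fd ⟨z, hz⟩
    rw [← inv γ]
    set w := γ • (⟨z, hz⟩ : UpperHalfPlane)
    have hw : 1 / 2 ≤ (w : ℂ).im := by
      have := ModularGroup.three_le_four_mul_im_sq_of_mem_fd hγ
      have h0 : 0 < w.im := w.im_pos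
      change 1 / 2 ≤ w.im
      nlinarith
    refine max_le (max_le (hb _ hw) (hb _ (by simpa using hw))) (hb3 _ hw)
  exact (le_max_left _ _).trans ((le_max_left _ _).trans hΦ)

lemma coeff_integral {b : ℕ → ℂ} {g : ℂ → ℂ}
    (hg : ∀ z : ℂ, 0 < z.im → HasSum (fun m : ℕ => b m * cexp (π * I * m * z)) (g z))
    {y : ℝ} (hy : 0 < y) {B : ℝ} (hB : ∀ x : ℝ, ‖g (x + y * I)‖ ≤ B) (M : ℕ) :
    ‖b M‖ ≤ B * Real.exp (π * M * y) := by
  have hs : Summable fun m : ℕ => ‖b m‖ * Real.exp (-(π * m * y)) := by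
    have := (hg (y * I) (by simpa using hy)).summable.norm
    refine this.congr fun m => ?_
    rw [norm_mul, norm_exp]; congr 2; simp
  have key : HasSum (fun m : ℕ => ∫ x in (0 : ℝ)..2, b m * cexp (π * I * m * (x + y * I)) * cexp (-(π * I * M * (x + y * I))))
      (∫ x in (0 : ℝ)..2, g (x + y * I) * cexp (-(π * I * M * (x + y * I)))) := by
    refine intervalIntegral.hasSum_integral_of_dominated_convergence
      (fun m _ => ‖b m‖ * Real.exp (-(π * m * y)) * Real.exp (π * M * y)) ?_ ?_ ?_ ?_ ?_
    · intro m
      exact Continuous.aestronglyMeasurable (by fun_prop)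
    · intro m
      refine Eventually.of_forall fun x _ => le_of_eq ?_
      rw [norm_mul, norm_mul, norm_exp, norm_exp]
      congr 2
      · congr 1; simp
      · simp
    · exact Eventually.of_forall fun x _ => hs.mul_right _
    · exact intervalIntegrable_const
    · refine Eventually.of_forall fun x _ => ?_
      exact (hg _ (by simpa using hy)).mul_right _
  have hI : ∀ m : ℕ, (∫ x in (0 : ℝ)..2, b m * cexp (π * I * m * (x + y * I)) * cexp (-(π * I * M * (x + y * I)))) = if m = M then 2 * b M else 0 := by
    intro m
    split_ifs with h
    · subst h
      have : ∀ x : ℝ, b m * cexp (π * I * m * (x + y * I)) * cexp (-(π * I * m * (x + y * I))) = b m := fun x => by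
        rw [mul_assoc, ← Complex.exp_add, add_neg_cancel, Complex.exp_zero, mul_one]
      simp only [this]
      simp
    · have hc : (π * I * ((m : ℂ) - M)) ≠ 0 := by
        have : (m : ℂ) - M ≠ 0 := sub_ne_zero.mpr (by exact_mod_cast h)
        have hp : (π : ℂ) ≠ 0 := by exact_mod_cast Real.pi_ne_zero
        simp [this, hp, I_ne_zero]
      have e : ∀ x : ℝ, b m * cexp (π * I * m * (x + y * I)) * cexp (-(π * I * M * (x + y * I)))
          = (b m * cexp (π * I * ((m : ℂ) - M) * (y * I))) * cexp (π * I * ((m : ℂ) - M) * x) := fun x => by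
        rw [mul_assoc, ← Complex.exp_add, mul_assoc (b m), ← Complex.exp_add]; congr 2; ring
      simp only [e]
      rw [intervalIntegral.integral_const_mul, integral_exp_mul_complex hc]
      have : cexp (π * I * ((m : ℂ) - M) * (2 : ℝ)) = 1 := by
        rw [Complex.exp_eq_one_iff]; exact ⟨(m : ℤ) - M, by push_cast; ring⟩
      rw [this]; simp
  simp only [hI] at key
  have h1 := key.unique (hasSum_ite_eq M (2 * b M))
  have h2 : ‖∫ x in (0 : ℝ)..2, g (x + y * I) * cexp (-(π * I * M * (x + y * I)))‖ ≤ B * Real.exp (π * M * y) * |2 - 0| := by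
    refine intervalIntegral.norm_integral_le_of_norm_le_const fun x _ => ?_
    rw [norm_mul, norm_exp]
    have : (-(π * I * M * (x + y * I)) : ℂ).re = π * M * y := by simp
    rw [this]
    gcongr; exact hB x
  rw [h1, norm_mul] at h2
  norm_num at h2
  linarith

theorem coeff_bound {b : ℕ → ℂ} {g : ℂ → ℂ} {w : ℝ} (hw : 0 ≤ w)
    (hg : ∀ z : ℂ, 0 < z.im → HasSum (fun m : ℕ => b m * cexp (π * I * m * z)) (g z)) (hb0 : b 0 = 0)
    (hS : ∀ z : ℂ, 0 < z.im → ‖g (-1 / z)‖ = ‖z‖ ^ w * ‖g z‖)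
    {C₀ δ : ℝ} (hδ : 0 < δ)
    (hT : ∀ z : ℂ, 1 / 2 ≤ z.im → ‖g (1 - 1 / z)‖ ≤ ‖z‖ ^ w * (C₀ * Real.exp (-δ * z.im))) :
    ∃ C : ℝ, 0 ≤ C ∧ ∀ m : ℕ, ‖b m‖ ≤ C * (m : ℝ) ^ (w / 2) := by
  -- decay of y ^ (w/2) exp(-δ y)
  have dec : ∀ δ : ℝ, 0 < δ → ∃ D : ℝ, 0 ≤ D ∧ ∀ y : ℝ, 0 < y → Real.exp (-δ * y) * y ^ (w / 2) ≤ D := by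
    intro δ hδ
    obtain ⟨N, hN⟩ := exists_nat_ge (w / 2)
    refine ⟨1 + N.factorial * (2 / δ) ^ N, by positivity, fun y hy => ?_⟩
    by_cases h1 : y ≤ 1
    · have a1 : Real.exp (-δ * y) ≤ 1 := Real.exp_le_one_iff.mpr (by nlinarith)
      have a2 : y ^ (w / 2) ≤ 1 := Real.rpow_le_one hy.le h1 (by positivity)
      have a3 : 0 ≤ y ^ (w / 2) := by positivity
      have : (0 : ℝ) ≤ N.factorial * (2 / δ) ^ N := by positivity
      nlinarith [Real.exp_pos (-δ * y)]
    · push Not at h1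
      have a1 : y ^ (w / 2) ≤ y ^ N := by
        rw [← Real.rpow_natCast]; exact Real.rpow_le_rpow_of_exponent_le h1.le hN
      have a2 := pow_exp_le N hδ hy.le
      have a3 : Real.exp (-(δ / 2) * y) ≤ 1 := Real.exp_le_one_iff.mpr (by nlinarith)
      have a4 : (0 : ℝ) ≤ N.factorial * (2 / δ) ^ N := by positivity
      calc Real.exp (-δ * y) * y ^ (w / 2) ≤ Real.exp (-δ * y) * y ^ N := by gcongr
        _ ≤ (N.factorial * (2 / δ) ^ N) * Real.exp (-(δ / 2) * y) := by rw [mul_comm]; exact a2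
        _ ≤ (N.factorial * (2 / δ) ^ N) * 1 := by gcongr
        _ ≤ _ := by linarith
  obtain ⟨D1, hD1, d1⟩ := dec π Real.pi_pos
  obtain ⟨D2, hD2, d2⟩ := dec δ hδ
  let K : ℝ := ∑' m : ℕ, ‖b m * cexp (π * I * m * (I / 2))‖
  have hKs : Summable fun m : ℕ => ‖b m * cexp (π * I * m * (I / 2))‖ := (hg (I / 2) (by simp)).summable.norm
  have hK : 0 ≤ K := tsum_nonneg fun _ => norm_nonneg _
  have hgd : ∀ z : ℂ, 1 / 2 ≤ z.im → ‖g z‖ ≤ K * Real.exp (π / 2) * Real.exp (-π * z.im) := by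
    intro z hz
    have hs := hg z (by linarith)
    rw [← hs.tsum_eq]
    refine (norm_tsum_le_tsum_norm hs.summable.norm).trans ?_
    rw [mul_assoc, ← tsum_mul_right]
    refine Summable.tsum_le_tsum (fun m => ?_) hs.summable.norm (hKs.mul_right _)
    rw [norm_mul, norm_mul, norm_exp, norm_exp, mul_assoc ‖b m‖, ← Real.exp_add, ← Real.exp_add]
    rcases Nat.eq_zero_or_pos m with h | h
    · subst h; simp [hb0]
    · gcongr
      have e1 : (π * I * m * z : ℂ).re = -(π * m * z.im) := by simp
      have e2 : (π * I * m * (I / 2) : ℂ).re = -(π * m / 2) := by simp; ring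
      rw [e1, e2]
      have : (1 : ℝ) ≤ m := by exact_mod_cast h
      nlinarith [mul_nonneg (mul_nonneg Real.pi_pos.le (sub_nonneg.mpr this)) (sub_nonneg.mpr hz)]
  have hper : ∀ z : ℂ, 0 < z.im → g (z + 2) = g z := by
    intro z hz
    refine (hg (z + 2) (by simpa using hz)).unique ?_
    have e : (fun m : ℕ => b m * cexp (π * I * m * (z + 2))) = fun m : ℕ => b m * cexp (π * I * m * z) := by
      funext m
      rw [show (π * I * m * (z + 2) : ℂ) = π * I * m * z + m * (2 * π * I) by ring, Complex.exp_add,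
        Complex.exp_nat_mul_two_pi_mul_I, mul_one]
    rw [e]; exact hg z hz
  let C := max (K * Real.exp (π / 2) * D1) (|C₀| * D2)
  have hmain := theta_group_bound (φ := fun z => ‖g z‖ * z.im ^ (w / 2)) (C := C) ?_ ?_ ?_ ?_
  · refine ⟨C * Real.exp π, ?_, fun m => ?_⟩
    · have : 0 ≤ C := le_trans (by positivity) (le_max_left _ _)
      positivity
    rcases Nat.eq_zero_or_pos m with h | h
    · subst h; rw [hb0, norm_zero]
      have : 0 ≤ C := le_trans (by positivity) (le_max_left _ _)
      positivity
    have hm : (0 : ℝ) < m := by exact_mod_cast h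
    have := coeff_integral hg (y := (m : ℝ)⁻¹) (by positivity) (B := C * (m : ℝ) ^ (w / 2)) (fun x => ?_) m
    · rw [mul_assoc π, mul_inv_cancel₀ hm.ne', mul_one] at this
      linarith
    · have h1 := hmain (x + (m : ℝ)⁻¹ * I) (by simpa using hm)
      have e : ((x : ℂ) + ((m : ℝ)⁻¹ : ℝ) * I).im = (m : ℝ)⁻¹ := by simp
      simp only [e] at h1
      rw [Real.inv_rpow hm.le, ← div_eq_mul_inv, div_le_iff₀ (by positivity)] at h1
      exact h1
  · intro z hz
    simp only [hper z hz]; congr 2; simp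
  · intro z hz
    simp only [hS z hz]
    have hz0 : 0 < ‖z‖ := norm_pos_iff.mpr (fun h => by simp [h] at hz)
    have : (-1 / z).im = z.im / ‖z‖ ^ 2 := by
      rw [neg_div, one_div, neg_im, inv_im, normSq_eq_norm_sq]; ring
    rw [this, Real.div_rpow hz.le (by positivity), ← Real.rpow_natCast, ← Real.rpow_mul hz0.le]
    rw [show ((2 : ℕ) : ℝ) * (w / 2) = w by push_cast; ring]
    have := Real.rpow_pos_of_pos hz0 w
    field_simp
  · intro z hz
    have hz0 : 0 < z.im := by linarith
    have := hgd z hz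
    calc ‖g z‖ * z.im ^ (w / 2) ≤ K * Real.exp (π / 2) * Real.exp (-π * z.im) * z.im ^ (w / 2) := by gcongr
      _ = K * Real.exp (π / 2) * (Real.exp (-π * z.im) * z.im ^ (w / 2)) := by ring
      _ ≤ K * Real.exp (π / 2) * D1 := by gcongr; exact d1 _ hz0
      _ ≤ C := le_max_left _ _
  · intro z hz
    have hz0 : 0 < z.im := by linarith
    have hzn : 0 < ‖z‖ := norm_pos_iff.mpr (fun h => by simp [h] at hz0)
    have := hT z hz
    have e : (1 - 1 / z).im = z.im / ‖z‖ ^ 2 := by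
      rw [one_div, sub_im, inv_im, normSq_eq_norm_sq, one_im]; ring
    have hp := Real.rpow_pos_of_pos hzn w
    have e2 : (1 - 1 / z).im ^ (w / 2) = z.im ^ (w / 2) / ‖z‖ ^ w := by
      rw [e, Real.div_rpow hz0.le (by positivity), ← Real.rpow_natCast, ← Real.rpow_mul hzn.le,
        show ((2 : ℕ) : ℝ) * (w / 2) = w by push_cast; ring]
    simp only [e2]
    calc ‖g (1 - 1 / z)‖ * (z.im ^ (w / 2) / ‖z‖ ^ w)
        ≤ ‖z‖ ^ w * (C₀ * Real.exp (-δ * z.im)) * (z.im ^ (w / 2) / ‖z‖ ^ w) := by gcongr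
      _ = C₀ * (Real.exp (-δ * z.im) * z.im ^ (w / 2)) := by field_simp
      _ ≤ |C₀| * (Real.exp (-δ * z.im) * z.im ^ (w / 2)) := by gcongr; exact le_abs_self _
      _ ≤ |C₀| * D2 := by gcongr; exact d2 _ hz0
      _ ≤ C := le_max_right _ _

end MF

namespace MF
open Matrix Complex Filter Topology
open scoped Real
variable {n : ℕ} {G : Mt n}

lemma theta_series (h : IsU G) {z : ℂ} (hz : 0 < z.im) :
    HasSum (fun m : ℕ => (rep G m : ℂ) * cexp (π * I * m * z)) (thu G 0 z) := by
  have h1 : HasSum (fun x : Vc n => cexp (π * I * z * nf G x + π * I * bf G x 0)) (thu G 0 z) :=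
    (h.summable_cthu 0 hz).hasSum
  have h2 := h1.tsum_fiberwise (fun x => (nf G x).toNat)
  suffices hh : (fun m : ℕ => (rep G m : ℂ) * cexp (π * I * m * z)) = _ by rw [hh]; exact h2
  funext m
  have hf : Set.Finite ((fun x : Vc n => (nf G x).toNat) ⁻¹' {m}) := by
    refine (finite_rep h m).subset fun x hx => ?_
    have hx' : (nf G x).toNat = m := hx
    have := h.nonneg x
    change nf G x = m
    omega
  have e : ∀ b : ((fun x : Vc n => (nf G x).toNat) ⁻¹' {m}), cexp (π * I * z * nf G b + π * I * bf G b 0) = cexp (π * I * m * z) := by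
    rintro ⟨x, hx⟩
    have hx' : (nf G x).toNat = m := hx
    have h3 : nf G x = m := by have := h.nonneg x; omega
    simp only [h3, bf_zero_right]
    congr 1; push_cast; ring
  haveI := hf.to_subtype
  haveI := Fintype.ofFinite ((fun x : Vc n => (nf G x).toNat) ⁻¹' {m})
  rw [tsum_congr e, tsum_fintype, Finset.sum_const, nsmul_eq_mul]
  congr 2
  rw [Finset.card_univ, ← Nat.card_eq_fintype_card, rep, ← Nat.card_coe_set_eq]
  congr 2
  ext x
  have := h.nonneg x
  simp only [Set.mem_ofPred_eq, Set.mem_preimage, Set.mem_singleton_iff]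
  omega

lemma rep_zero (h : IsU G) : rep G 0 = 1 := by
  rw [rep, Set.ncard_eq_one]
  refine ⟨0, ?_⟩
  ext x
  simp only [Set.mem_ofPred_eq, Set.mem_singleton_iff]
  constructor
  · intro hx; by_contra h0; have := h.pos x h0; omega
  · rintro rfl; simp [nf, bf]

lemma norm_sq_pow (z : ℂ) (n : ℕ) : ‖sq z ^ n‖ = ‖z‖ ^ ((n : ℝ) / 2) := by
  have h1 : ‖sq z‖ ^ 2 = ‖z‖ := by rw [← norm_pow, sq_sq]; simp
  rw [← h1, norm_pow, ← Real.rpow_natCast, ← Real.rpow_natCast, ← Real.rpow_mul (norm_nonneg _)]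
  congr 1; push_cast; ring

lemma sq_ne {z : ℂ} (hz : 0 < z.im) : sq z ≠ 0 := by
  intro h0
  have := sq_sq z
  rw [h0] at this
  have hz0 : z ≠ 0 := by rintro rfl; simp at hz
  simp [hz0] at this

lemma th_S_inv (h : IsU G) {z : ℂ} (hz : 0 < z.im) : thu G 0 (-1 / z) = sq z ^ n * thu G 0 z := by
  rw [th_S h hz, ← mul_assoc, ← mul_pow, mul_inv_cancel₀ (sq_ne hz), one_pow, one_mul]

lemma th_cusp (h : IsU G) {w : Vc n} (hw : IsChar G w) {z : ℂ} (hz : 0 < z.im) :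
    thu G 0 (1 - 1 / z) = (sq (-1 / z))⁻¹ ^ n * psi G w z := by
  rw [show 1 - 1 / z = -1 / z + 1 by ring, thu_add_one hw, th_poisson h w (im_S hz)]
  congr 2; field_simp

lemma psi_decay (h : IsU G) (ho : OddF G) {w : Vc n} (hw : IsChar G w) :
    ∃ C : ℝ, 0 ≤ C ∧ ∀ z : ℂ, 1 / 2 ≤ z.im → ‖psi G w z‖ ≤ C * Real.exp (-(π / 4) * z.im) := by
  have hN : ∀ x : Vc n, (1 : ℝ) ≤ nf G (2 • x - w) := by
    intro x
    have : 2 • x - w ≠ 0 := by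
      intro h0
      obtain ⟨y, hy⟩ := ho
      have e : w = 2 • x := (sub_eq_zero.mp h0).symm
      have := hw y
      rw [e, two_nsmul, bf_add_right] at this
      rw [← Int.not_even_iff_odd] at hy
      apply hy
      have h3 : Even (nf G y - (bf G y x + bf G y x) + (bf G y x + bf G y x)) := this.add ⟨_, rfl⟩
      simpa using h3
    have := h.pos _ this
    exact_mod_cast this
  have hs := h.summable_psi w (c := π / 2) (by positivity)
  refine ⟨(∑' x : Vc n, Real.exp (-(π / 2) * ((nf G (2 • x - w) : ℝ) / 4))) * Real.exp (π / 8),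
    mul_nonneg (tsum_nonneg fun _ => (Real.exp_pos _).le) (Real.exp_pos _).le, fun z hz => ?_⟩
  have hz0 : 0 < z.im := by linarith
  refine (norm_tsum_le_tsum_norm (h.summable_cpsi w hz0).norm).trans ?_
  rw [mul_assoc _ (Real.exp _), ← Real.exp_add, ← tsum_mul_right]
  refine Summable.tsum_le_tsum (fun x => ?_) (h.summable_cpsi w hz0).norm (hs.mul_right _)
  rw [norm_cexp_pi, ← Real.exp_add]
  refine Real.exp_le_exp.mpr ?_
  have := hN x
  nlinarith [mul_nonneg (mul_nonneg Real.pi_pos.le (sub_nonneg.mpr this)) (sub_nonneg.mpr hz)]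

theorem rep_compare {H : Mt n} (h : IsU G) (h' : IsU H) (ho : OddF G) (ho' : OddF H) :
    ∃ C : ℝ, 0 ≤ C ∧ ∀ m : ℕ, |(rep G m : ℝ) - rep H m| ≤ C * (m : ℝ) ^ ((n : ℝ) / 4) := by
  obtain ⟨w, hw⟩ := exists_char h
  obtain ⟨w', hw'⟩ := exists_char h'
  obtain ⟨C1, hC1, hb1⟩ := psi_decay h ho hw
  obtain ⟨C2, hC2, hb2⟩ := psi_decay h' ho' hw'
  have key := coeff_bound (b := fun m => (rep G m : ℂ) - rep H m) (g := fun z => thu G 0 z - thu H 0 z)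
    (w := (n : ℝ) / 2) (by positivity) ?_ ?_ ?_ (C₀ := C1 + C2) (δ := π / 4) (by positivity) ?_
  · obtain ⟨C, hC, hb⟩ := key
    refine ⟨C, hC, fun m => ?_⟩
    have := hb m
    rw [show (n : ℝ) / 2 / 2 = n / 4 by ring] at this
    refine le_trans (le_of_eq ?_) this
    rw [← Real.norm_eq_abs, ← Complex.norm_real]; push_cast; rfl
  · intro z hz
    simpa only [sub_mul] using (theta_series h hz).sub (theta_series h' hz)
  · simp [rep_zero h, rep_zero h']
  · intro z hz
    simp only [th_S_inv h hz, th_S_inv h' hz, ← mul_sub, norm_mul, norm_sq_pow]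
  · intro z hz
    have hz0 : 0 < z.im := by linarith
    simp only [th_cusp h hw hz0, th_cusp h' hw' hz0, ← mul_sub, norm_mul]
    have e : ‖(sq (-1 / z))⁻¹ ^ n‖ = ‖z‖ ^ ((n : ℝ) / 2) := by
      rw [inv_pow, norm_inv, norm_sq_pow, norm_div, norm_neg, norm_one, one_div, Real.inv_rpow (norm_nonneg _), inv_inv]
    rw [e]
    gcongr
    refine (norm_sub_le _ _).trans ?_
    have := hb1 z hz
    have := hb2 z hz
    linarith

end MF

namespace MF
open Matrix Complex Filter Topology
open scoped Real ArithmeticFunction.sigma ModularForm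

lemma zeta_bern {j : ℕ} (hj : j ≠ 0) :
    HasSum (fun n : ℕ => 1 / (n : ℝ) ^ (2 * j)) (2 ^ (2 * j - 1) * π ^ (2 * j) * |(bernoulli (2 * j) : ℝ)| / (2 * j).factorial) ∧
    |(bernoulli (2 * j) : ℝ)| = (-1) ^ (j + 1) * bernoulli (2 * j) ∧ 0 < |(bernoulli (2 * j) : ℝ)| := by
  have h := hasSum_zeta_nat hj
  have hpos : 0 < (-1 : ℝ) ^ (j + 1) * 2 ^ (2 * j - 1) * π ^ (2 * j) * bernoulli (2 * j) / (2 * j).factorial := by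
    rw [← h.tsum_eq]
    exact h.summable.tsum_pos (fun n => by positivity) 1 (by simp)
  have hf : (0 : ℝ) < 2 ^ (2 * j - 1) * π ^ (2 * j) / (2 * j).factorial := by positivity
  have h1 : 0 < (-1 : ℝ) ^ (j + 1) * bernoulli (2 * j) := by
    rw [show (-1 : ℝ) ^ (j + 1) * 2 ^ (2 * j - 1) * π ^ (2 * j) * bernoulli (2 * j) / (2 * j).factorial
      = (2 ^ (2 * j - 1) * π ^ (2 * j) / (2 * j).factorial) * ((-1 : ℝ) ^ (j + 1) * bernoulli (2 * j)) by ring] at hpos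
    exact (mul_pos_iff_of_pos_left hf).mp hpos
  have h2 : |(bernoulli (2 * j) : ℝ)| = (-1) ^ (j + 1) * bernoulli (2 * j) := by
    rw [← abs_of_pos h1, abs_mul, abs_pow, abs_neg, abs_one, one_pow, one_mul]
  refine ⟨?_, h2, h2 ▸ h1⟩
  rw [h2]
  convert h using 1
  ring

lemma hasSum_eqs {f g : ℕ → ℂ} {a b : ℂ} (h : HasSum f a) (hf : ∀ m, g m = f m) (hab : b = a) : HasSum g b := by
  rw [show g = f from funext hf, hab]; exact h

/-- coefficients of the Eisenstein series -/
noncomputable def ecoef (j : ℕ) (m : ℕ) : ℝ :=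
  if m = 0 then 1 else (-1) ^ j * (4 * j / |(bernoulli (2 * j) : ℝ)|) * (σ (2 * j - 1) m : ℝ)

lemma exists_eis {j : ℕ} (hj : 2 ≤ j) : ∃ E : ℂ → ℂ,
    (∀ z : ℂ, 0 < z.im → HasSum (fun m : ℕ => (ecoef j m : ℂ) * cexp (2 * π * I * m * z)) (E z)) ∧
    (∀ z : ℂ, 0 < z.im → E (-1 / z) = z ^ (2 * j) * E z) := by
  have hk : 3 ≤ 2 * j := by omega
  obtain ⟨-, hB, hB0⟩ := zeta_bern (j := j) (by omega)
  refine ⟨fun z => ModularForm.E hk (UpperHalfPlane.ofComplex z), fun z hz => ?_, fun z hz => ?_⟩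
  · have hS := EisensteinSeries.summable_sigma_mul_cexp_pow (k := 2 * j) (by omega) ⟨z, hz⟩
    have h1 := EisensteinSeries.q_expansion_bernoulli hk (even_two_mul j) ⟨z, hz⟩
    simp only [zpow_natCast] at h1
    change _ = 1 - _ * ∑' n : ℕ+, (fun n : ℕ => (σ (2 * j - 1) n : ℂ) * cexp (2 * π * I * z) ^ n) n at h1
    rw [tsum_pnat_eq_tsum_succ (f := fun n : ℕ => (σ (2 * j - 1) n : ℂ) * cexp (2 * π * I * z) ^ n)] at h1
    simp only [UpperHalfPlane.ofComplex_apply_of_im_pos hz]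
    rw [h1, ← hasSum_nat_add_iff' 1]
    have hS' : Summable fun n : ℕ => (σ (2 * j - 1) (n + 1) : ℂ) * cexp (2 * π * I * z) ^ (n + 1) :=
      (summable_nat_add_iff 1).mpr hS
    have h3 := hS'.hasSum.mul_left (-(2 * (2 * j : ℕ) / bernoulli (2 * j) : ℂ))
    simp only [Finset.range_one, Finset.sum_singleton]
    rw [ecoef, if_pos rfl]
    refine hasSum_eqs h3 (fun m => ?_) ?_
    · rw [ecoef, if_neg (by omega), ← Complex.exp_nat_mul]
      have e1 : ((-1 : ℂ) ^ j) * (-1) ^ j = 1 := by rw [← mul_pow]; simp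
      have hBC : (bernoulli (2 * j) : ℂ) = -(-1) ^ j * (|(bernoulli (2 * j) : ℝ)| : ℝ) := by
        rw [hB]; push_cast
        rw [pow_succ]
        linear_combination (-(bernoulli (2 * j) : ℂ)) * e1
      have hb : ((|(bernoulli (2 * j) : ℝ)| : ℝ) : ℂ) ≠ 0 := by exact_mod_cast hB0.ne'
      have e3 : (-1 : ℂ) ^ j ≠ 0 := by simp
      rw [← mul_assoc, hBC]
      congr 1
      · push_cast
        congr 1
        field_simp
        linear_combination (4 * (j : ℂ)) * e1
      · congr 1; push_cast; ring
    · simp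
  · have hz' := im_S hz
    have hne : (z : ℂ) ≠ 0 := by rintro rfl; simp at hz
    simp only [UpperHalfPlane.ofComplex_apply_of_im_pos hz, UpperHalfPlane.ofComplex_apply_of_im_pos hz']
    have h1 := SlashInvariantForm.slash_S_apply (ModularForm.E hk) (2 * j : ℕ) ⟨z, hz⟩
    have h2 : ((ModularForm.E hk : UpperHalfPlane → ℂ) ∣[((2 * j : ℕ) : ℤ)] ModularGroup.S) = ModularForm.E hk := by
      exact SlashInvariantForm.slash_action_eqn (ModularForm.E hk) _ (by simp)
    rw [h2] at h1
    rw [h1]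
    have : (UpperHalfPlane.mk (-1 / z) hz') = .mk _ (UpperHalfPlane.im_inv_neg_coe_pos ⟨z, hz⟩) := by
      ext1; simp [neg_div, inv_neg]
    rw [this, _root_.zpow_neg, zpow_natCast]
    simp only
    field_simp

lemma series_per {b : ℕ → ℂ} {E : ℂ → ℂ}
    (hE : ∀ z : ℂ, 0 < z.im → HasSum (fun m : ℕ => b m * cexp (2 * π * I * m * z)) (E z)) {z : ℂ} (hz : 0 < z.im) :
    E (z + 1) = E z := by
  refine (hE (z + 1) (by simpa using hz)).unique (hasSum_eqs (hE z hz) (fun m => ?_) rfl)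
  rw [show (2 * π * I * m * (z + 1) : ℂ) = 2 * π * I * m * z + m * (2 * π * I) by ring, Complex.exp_add,
    Complex.exp_nat_mul_two_pi_mul_I, mul_one]

lemma series_decay {b : ℕ → ℂ} {E : ℂ → ℂ} (hb : b 0 = 1)
    (hE : ∀ z : ℂ, 0 < z.im → HasSum (fun m : ℕ => b m * cexp (2 * π * I * m * z)) (E z)) :
    ∃ C : ℝ, 0 ≤ C ∧ ∀ z : ℂ, 1 / 4 ≤ z.im → ‖E z - 1‖ ≤ C * Real.exp (-(2 * π) * z.im) := by
  have hK := (hE (I / 4) (by simp)).summable.norm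
  refine ⟨(∑' m : ℕ, ‖b m * cexp (2 * π * I * m * (I / 4))‖) * Real.exp (π / 2),
    mul_nonneg (tsum_nonneg fun _ => norm_nonneg _) (Real.exp_pos _).le, fun z hz => ?_⟩
  have hz0 : 0 < z.im := by linarith
  have h1 := (hasSum_nat_add_iff' 1).mpr (hE z hz0)
  simp only [Finset.range_one, Finset.sum_singleton, hb, Nat.cast_zero, mul_zero, zero_mul, Complex.exp_zero, mul_one] at h1
  rw [← h1.tsum_eq]
  refine (norm_tsum_le_tsum_norm h1.summable.norm).trans ?_
  have hK1 := (summable_nat_add_iff 1).mpr hK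
  have hle : ∑' m : ℕ, ‖b (m + 1) * cexp (2 * π * I * (m + 1 : ℕ) * (I / 4))‖ ≤ ∑' m : ℕ, ‖b m * cexp (2 * π * I * m * (I / 4))‖ := by
    rw [hK.tsum_eq_zero_add]
    exact le_add_of_nonneg_left (norm_nonneg _)
  refine le_trans ?_ (mul_le_mul_of_nonneg_right (mul_le_mul_of_nonneg_right hle (Real.exp_pos _).le) (Real.exp_pos _).le)
  rw [mul_assoc (tsum _), ← Real.exp_add, ← tsum_mul_right]
  refine Summable.tsum_le_tsum (fun m => ?_) h1.summable.norm (hK1.mul_right _)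
  rw [norm_mul, norm_mul, norm_exp, norm_exp, mul_assoc ‖b (m + 1)‖, ← Real.exp_add]
  gcongr
  have e1 : (2 * π * I * (m + 1 : ℕ) * z : ℂ).re = -(2 * π * (m + 1) * z.im) := by
    rw [show (2 * π * I * (m + 1 : ℕ) * z : ℂ) = ((2 * π * (m + 1) : ℝ) : ℂ) * (I * z) by push_cast; ring, re_ofReal_mul]
    simp
  have e2 : (2 * π * I * (m + 1 : ℕ) * (I / 4) : ℂ).re = -(2 * π * (m + 1) / 4) := by
    rw [show (2 * π * I * (m + 1 : ℕ) * (I / 4) : ℂ) = ((2 * π * (m + 1) / 4 : ℝ) : ℂ) * (I * I) by push_cast; ring, I_mul_I, re_ofReal_mul]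
    simp
  rw [e1, e2]
  have : (0 : ℝ) ≤ m := Nat.cast_nonneg m
  nlinarith [mul_nonneg (mul_nonneg Real.pi_pos.le this) (sub_nonneg.mpr hz)]

/-- the series in terms of dilated exponents -/
lemma series_dilate {b : ℕ → ℂ} {E : ℂ → ℂ}
    (hE : ∀ z : ℂ, 0 < z.im → HasSum (fun m : ℕ => b m * cexp (2 * π * I * m * z)) (E z)) {c : ℕ} (hc : 0 < c)
    {z : ℂ} (hz : 0 < z.im) :
    HasSum (fun m : ℕ => (if c ∣ m then b (m / c) else 0) * cexp (π * I * m * z)) (E (c * z / 2)) := by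
  have hc' : (0 : ℝ) < c := by exact_mod_cast hc
  have hz' : 0 < (c * z / 2 : ℂ).im := by
    rw [show (c * z / 2 : ℂ) = ((c / 2 : ℝ) : ℂ) * z by push_cast; ring, im_ofReal_mul]; positivity
  have h1 := hE _ hz'
  have hinj : Function.Injective (fun m : ℕ => c * m) := fun a b hab => Nat.eq_of_mul_eq_mul_left hc hab
  rw [← hinj.hasSum_iff]
  · refine hasSum_eqs h1 (fun m => ?_) rfl
    simp only [Function.comp]
    rw [if_pos (Dvd.intro _ rfl), Nat.mul_div_cancel_left _ hc]
    congr 2; push_cast; ring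
  · intro x hx
    rw [if_neg, zero_mul]
    rintro ⟨m, rfl⟩
    exact hx ⟨m, rfl⟩

/-- coefficients of the comparator -/
noncomputable def fcoef (j : ℕ) (m : ℕ) : ℝ :=
  (2 ^ (2 * j) * (if 4 ∣ m then ecoef j (m / 4) else 0) + (-1) ^ j * ecoef j m
    - (1 + (-1) ^ j) * (if 2 ∣ m then ecoef j (m / 2) else 0)) / (2 ^ (2 * j) - 1)

theorem rep_eis {j : ℕ} (hj : 2 ≤ j) :
    ∃ C : ℝ, 0 ≤ C ∧ ∀ m : ℕ, |(rep (1 : Mt (4 * j)) m : ℝ) - fcoef j m| ≤ C * (m : ℝ) ^ j := by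
  obtain ⟨E, hE, hES⟩ := exists_eis hj
  have hET : ∀ z : ℂ, 0 < z.im → E (z + 1) = E z := fun z hz => series_per hE hz
  obtain ⟨C1, hC1, hd⟩ := series_decay (by simp [ecoef]) hE
  have h := isU_one (4 * j)
  have ho : OddF (1 : Mt (4 * j)) := by
    obtain ⟨q, hq⟩ : ∃ q, 4 * j = q + 1 := ⟨4 * j - 1, by omega⟩
    rw [hq, ← oneSum_one]; exact oddF_oneSum _
  obtain ⟨w, hw⟩ := exists_char h
  obtain ⟨C2, hC2, hp⟩ := psi_decay h ho hw
  have hne : ∀ z : ℂ, 0 < z.im → z ≠ 0 := fun z hz h => by simp [h] at hz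
  set ε : ℂ := (-1) ^ j with hε
  have hε2 : ε * ε = 1 := by rw [hε, ← mul_pow]; simp
  have hεn : ‖ε‖ = 1 := by rw [hε]; simp
  have h2k : ((2 : ℂ) ^ (2 * j) - 1) ≠ 0 := by
    have h4 : (4 : ℝ) ≤ 2 ^ (2 * j) := by
      calc (4 : ℝ) = 2 ^ 2 := by norm_num
        _ ≤ 2 ^ (2 * j) := pow_le_pow_right₀ (by norm_num) (by omega)
    have : (((2 : ℝ) ^ (2 * j) - 1 : ℝ) : ℂ) ≠ 0 := by
      rw [Ne, ofReal_eq_zero]; linarith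
    exact_mod_cast this
  let F : ℂ → ℂ := fun z => (2 ^ (2 * j) * E (2 * z) + ε * E (z / 2) - (1 + ε) * E z) / (2 ^ (2 * j) - 1)
  have imm : ∀ {z : ℂ}, 0 < z.im → 0 < (2 * z).im ∧ 0 < (z / 2).im := by
    intro z hz
    constructor
    · rw [show (2 * z : ℂ) = ((2 : ℝ) : ℂ) * z by push_cast; ring, im_ofReal_mul]; positivity
    · rw [show (z / 2 : ℂ) = ((1 / 2 : ℝ) : ℂ) * z by push_cast; ring, im_ofReal_mul]; positivity
  have sqk : ∀ z : ℂ, sq z ^ (4 * j) = ε * z ^ (2 * j) := by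
    intro z
    rw [show 4 * j = 2 * (2 * j) by ring, pow_mul, sq_sq, mul_pow, pow_mul (-I)]
    simp [hε]
  have hFS : ∀ z : ℂ, 0 < z.im → F (-1 / z) = ε * z ^ (2 * j) * F z := by
    intro z hz
    have n0 := hne z hz
    have a1 : E (2 * (-1 / z)) = (z / 2) ^ (2 * j) * E (z / 2) := by
      rw [← hES _ (imm hz).2]; congr 1; field_simp
    have a2 : E (-1 / z / 2) = (2 * z) ^ (2 * j) * E (2 * z) := by
      rw [← hES _ (imm hz).1]; congr 1; field_simp
    simp only [F]
    rw [a1, a2, hES _ hz, mul_pow, div_pow]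
    field_simp
    linear_combination (-1) * (E (z / 2)) * hε2 + E z * hε2
  have hFT : ∀ z : ℂ, 0 < z.im → F (1 - 1 / z) = z ^ (2 * j) * ((E (z / 2) + ε * E ((z + 1) / 2) - (1 + ε) * E z) / (2 ^ (2 * j) - 1)) := by
    intro z hz
    have n0 := hne z hz
    have a1 : E (2 * (1 - 1 / z)) = (z / 2) ^ (2 * j) * E (z / 2) := by
      have i1 := im_S (imm hz).2
      rw [← hES _ (imm hz).2, ← hET _ i1, ← hET (-1 / (z / 2) + 1) (by rw [add_im, one_im, add_zero]; exact i1)]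
      congr 1; field_simp; ring
    have a3 : E (1 - 1 / z) = z ^ (2 * j) * E z := by
      rw [← hES _ hz, ← hET _ (im_S hz)]; congr 1; ring
    have a2 : E ((1 - 1 / z) / 2) = z ^ (2 * j) * E ((z + 1) / 2) := by
      have i0 : 0 < ((1 - 1 / z) / 2).im := by
        refine (imm ?_).2
        have := im_S hz
        rw [show 1 - 1 / z = -1 / z + 1 by ring]; simpa using this
      have i1 : 0 < ((z - 1) / 2).im := (imm (by simpa using hz)).2
      have b1 := hES _ i0
      have b2 := hES _ i1
      have n1 := hne _ i0
      have n2 := hne _ i1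
      have n3 : z - 1 ≠ 0 := fun h => by simp [h] at n2
      have q1 : -1 / ((1 - 1 / z) / 2) + 1 + 1 = -1 / ((z - 1) / 2) := by
        have : (1 - 1 / z) / 2 = (z - 1) / (2 * z) := by field_simp
        rw [this]; field_simp; ring
      have q2 : (z - 1) / 2 + 1 = (z + 1) / 2 := by ring
      have c1 := hET _ (im_S i0)
      have c2 := hET (-1 / ((1 - 1 / z) / 2) + 1) (by simpa using im_S i0)
      have c3 := hET _ i1
      rw [q1] at c2
      rw [q2] at c3
      rw [← c3] at b2
      rw [← c1, ← c2, b2] at b1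
      have q3 : ((z - 1) / 2) ^ (2 * j) = ((1 - 1 / z) / 2) ^ (2 * j) * z ^ (2 * j) := by
        rw [← mul_pow]; congr 1; field_simp
      rw [q3, mul_assoc] at b1
      exact (mul_left_cancel₀ (pow_ne_zero _ n1) b1).symm
    simp only [F]
    rw [a1, a2, a3, div_pow]
    field_simp
  have key := coeff_bound (b := fun m => (rep (1 : Mt (4 * j)) m : ℂ) - (fcoef j m : ℂ)) (g := fun z => thu (1 : Mt (4 * j)) 0 z - F z)
    (w := (2 * j : ℕ)) (by positivity) ?_ ?_ ?_ (C₀ := C2 + 4 * C1 / ‖(2 : ℂ) ^ (2 * j) - 1‖) (δ := π / 4) (by positivity) ?_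
  · obtain ⟨C, hC, hb⟩ := key
    refine ⟨C, hC, fun m => ?_⟩
    have := hb m
    rw [show ((2 * j : ℕ) : ℝ) / 2 = j by push_cast; ring, Real.rpow_natCast] at this
    refine le_trans (le_of_eq ?_) this
    rw [← Real.norm_eq_abs, ← Complex.norm_real]; push_cast; rfl
  · intro z hz
    have s1 := series_dilate hE (c := 4) (by norm_num) hz
    have s2 := series_dilate hE (c := 2) (by norm_num) hz
    have s3 := series_dilate hE (c := 1) (by norm_num) hz
    rw [show ((4 : ℕ) * z / 2 : ℂ) = 2 * z by push_cast; ring] at s1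
    rw [show ((2 : ℕ) * z / 2 : ℂ) = z by push_cast; ring] at s2
    rw [show ((1 : ℕ) * z / 2 : ℂ) = z / 2 by push_cast; ring] at s3
    have hF : HasSum (fun m : ℕ => (fcoef j m : ℂ) * cexp (π * I * m * z)) (F z) := by
      refine hasSum_eqs ((((s1.mul_left (2 ^ (2 * j))).add (s3.mul_left ε)).sub (s2.mul_left (1 + ε))).div_const (2 ^ (2 * j) - 1)) (fun m => ?_) rfl
      simp only [fcoef, one_dvd, if_true, Nat.div_one, hε]
      have i4 : ((if 4 ∣ m then ecoef j (m / 4) else 0 : ℝ) : ℂ) = if 4 ∣ m then (ecoef j (m / 4) : ℂ) else 0 := by split_ifs <;> simp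
      have i2 : ((if 2 ∣ m then ecoef j (m / 2) else 0 : ℝ) : ℂ) = if 2 ∣ m then (ecoef j (m / 2) : ℂ) else 0 := by split_ifs <;> simp
      push_cast
      rw [i4, i2]
      ring
    simpa only [sub_mul] using (theta_series h hz).sub hF
  · have : fcoef j 0 = 1 := by
      have h3 : ((2 : ℝ) ^ (2 * j) - 1) ≠ 0 := by exact_mod_cast h2k
      simp only [fcoef, ecoef, dvd_zero, Nat.zero_div, if_true]
      field_simp; ring
    simp [rep_zero h, this]
  · intro z hz
    simp only [th_S_inv h hz, hFS z hz, sqk, ← mul_sub, norm_mul, hεn, one_mul, norm_pow, Real.rpow_natCast]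
  · intro z hz
    have hz0 : 0 < z.im := by linarith
    have n0 := hne z hz0
    have e : (sq (-1 / z))⁻¹ ^ (4 * j) = ε * z ^ (2 * j) := by
      rw [inv_pow, sqk, div_pow]
      have : ε ≠ 0 := fun h => by simp [h] at hεn
      field_simp
      rw [Even.neg_one_pow (even_two_mul j)]; linear_combination (-1) * hε2
    simp only [th_cusp h hw hz0, hFT z hz0, e]
    rw [show ε * z ^ (2 * j) * psi (1 : Mt (4 * j)) w z - z ^ (2 * j) * ((E (z / 2) + ε * E ((z + 1) / 2) - (1 + ε) * E z) / (2 ^ (2 * j) - 1))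
      = z ^ (2 * j) * (ε * psi 1 w z - ((E (z / 2) - 1) + ε * (E ((z + 1) / 2) - 1) - (1 + ε) * (E z - 1)) / (2 ^ (2 * j) - 1)) by ring]
    rw [norm_mul, norm_pow, Real.rpow_natCast]
    gcongr
    refine (norm_sub_le _ _).trans ?_
    rw [add_mul C2]
    have m1 : (z / 2).im = z.im / 2 := by
      rw [show (z / 2 : ℂ) = ((1 / 2 : ℝ) : ℂ) * z by push_cast; ring, im_ofReal_mul]; ring
    have m2 : ((z + 1) / 2).im = z.im / 2 := by
      rw [show ((z + 1) / 2 : ℂ) = ((1 / 2 : ℝ) : ℂ) * (z + 1) by push_cast; ring, im_ofReal_mul]; simp; ring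
    have d1 := hd (z / 2) (by rw [m1]; linarith)
    have d2 := hd ((z + 1) / 2) (by rw [m2]; linarith)
    have d3 := hd z (by linarith)
    rw [m1] at d1
    rw [m2] at d2
    have hpi := Real.pi_pos
    have x1 : C1 * Real.exp (-(2 * π) * (z.im / 2)) ≤ C1 * Real.exp (-(π / 4) * z.im) := by
      gcongr C1 * Real.exp ?_; nlinarith
    have x2 : C1 * Real.exp (-(2 * π) * z.im) ≤ C1 * Real.exp (-(π / 4) * z.im) := by
      gcongr C1 * Real.exp ?_; nlinarith
    have b1 : ‖(1 + ε)‖ ≤ 2 := (norm_add_le _ _).trans (by rw [hεn, norm_one]; norm_num)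
    refine add_le_add ?_ ?_
    · rw [norm_mul, hεn, one_mul]; exact hp z hz
    · rw [norm_div, div_mul_eq_mul_div]
      gcongr
      refine (norm_sub_le _ _).trans ?_
      refine (add_le_add (norm_add_le _ _) le_rfl).trans ?_
      rw [norm_mul, norm_mul, hεn, one_mul]
      have : ‖1 + ε‖ * ‖E z - 1‖ ≤ 2 * (C1 * Real.exp (-(π / 4) * z.im)) := by
        gcongr; exact d3.trans x2
      linarith

end MF

namespace MF
open Matrix Complex Filter Topology
open scoped Real ArithmeticFunction.sigma

noncomputable def beta (j d : ℕ) : ℝ :=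
  1 - (1 + (-1) ^ j) * (if 2 ∣ d then 1 else 0) + (-1) ^ j * 2 ^ (2 * j) * (if 4 ∣ d then 1 else 0)

noncomputable def kap (j : ℕ) : ℝ := 4 * j / |(bernoulli (2 * j) : ℝ)| / (2 ^ (2 * j) - 1)

lemma sigma_div (K c m : ℕ) (hm : m ≠ 0) (hc : c ≠ 0) :
    (if c ∣ m then ((σ K (m / c) : ℕ) : ℝ) else 0) =
      (m : ℝ) ^ K * ∑ d ∈ m.divisors, (if c ∣ d then (1 : ℝ) else 0) / (d : ℝ) ^ K := by
  split_ifs with h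
  · obtain ⟨e, rfl⟩ := h
    have he : e ≠ 0 := by rintro rfl; simp at hm
    rw [Nat.mul_div_cancel_left _ (Nat.pos_of_ne_zero hc), ArithmeticFunction.sigma_eq_sum_div, Finset.mul_sum]
    push_cast
    rw [← Finset.sum_subset (s₁ := e.divisors.image (c * ·)) (s₂ := (c * e).divisors)]
    · rw [Finset.sum_image (fun a _ b _ h => Nat.eq_of_mul_eq_mul_left (Nat.pos_of_ne_zero hc) h)]
      refine Finset.sum_congr rfl fun d hd => ?_
      have hd0 : d ≠ 0 := (Nat.pos_of_mem_divisors hd).ne'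
      rw [if_pos (Dvd.intro _ rfl), Nat.cast_div (Nat.dvd_of_mem_divisors hd) (by exact_mod_cast hd0)]
      have : (c : ℝ) ≠ 0 := by exact_mod_cast hc
      have : (d : ℝ) ≠ 0 := by exact_mod_cast hd0
      push_cast
      rw [mul_div, mul_one, ← div_pow]
      congr 1
      field_simp
    · intro x hx
      obtain ⟨d, hd, rfl⟩ := Finset.mem_image.1 hx
      rw [Nat.mem_divisors] at *
      exact ⟨Nat.mul_dvd_mul_left _ hd.1, hm⟩
    · intro x hx hx'
      rw [if_neg, zero_div, mul_zero]
      rintro ⟨d, rfl⟩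
      refine hx' (Finset.mem_image.2 ⟨d, ?_, rfl⟩)
      rw [Nat.mem_divisors] at *
      exact ⟨Nat.dvd_of_mul_dvd_mul_left (Nat.pos_of_ne_zero hc) hx.1, he⟩
  · symm
    convert mul_zero _
    refine Finset.sum_eq_zero fun d hd => ?_
    rw [if_neg, zero_div]
    exact fun hh => h (hh.trans (Nat.dvd_of_mem_divisors hd))

lemma fcoef_eq (j m : ℕ) (hm : m ≠ 0) :
    fcoef j m = kap j * (m : ℝ) ^ (2 * j - 1) * ∑ d ∈ m.divisors, beta j d / (d : ℝ) ^ (2 * j - 1) := by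
  have h1 := sigma_div (2 * j - 1) 1 m hm one_ne_zero
  have h2 := sigma_div (2 * j - 1) 2 m hm two_ne_zero
  have h4 := sigma_div (2 * j - 1) 4 m hm four_ne_zero
  have e : ∑ d ∈ m.divisors, beta j d / (d : ℝ) ^ (2 * j - 1) =
     (∑ d ∈ m.divisors, (if 1 ∣ d then (1 : ℝ) else 0) / (d : ℝ) ^ (2 * j - 1))
     - (1 + (-1) ^ j) * (∑ d ∈ m.divisors, (if 2 ∣ d then (1 : ℝ) else 0) / (d : ℝ) ^ (2 * j - 1))
     + (-1) ^ j * 2 ^ (2 * j) * (∑ d ∈ m.divisors, (if 4 ∣ d then (1 : ℝ) else 0) / (d : ℝ) ^ (2 * j - 1)) := by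
    rw [Finset.mul_sum, Finset.mul_sum, ← Finset.sum_sub_distrib, ← Finset.sum_add_distrib]
    refine Finset.sum_congr rfl fun d _ => ?_
    rw [beta, if_pos (one_dvd d)]; ring
  have g : ∀ c : ℕ, c ≠ 0 → (if c ∣ m then ecoef j (m / c) else 0) = (-1) ^ j * (4 * j / |(bernoulli (2 * j) : ℝ)|) *
      (if c ∣ m then ((σ (2 * j - 1) (m / c) : ℕ) : ℝ) else 0) := by
    intro c hc
    split_ifs with h
    · rw [ecoef, if_neg]
      · obtain ⟨e, rfl⟩ := h
        rw [Nat.mul_div_cancel_left _ (Nat.pos_of_ne_zero hc)]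
        rintro rfl; simp at hm
    · simp
  have g1 := g 1 one_ne_zero
  simp only [one_dvd, if_true, Nat.div_one] at g1 h1
  have hε : ((-1 : ℝ) ^ j) * (-1) ^ j = 1 := by rw [← mul_pow]; simp
  rw [fcoef, g 4 four_ne_zero, g 2 two_ne_zero, g1, h2, h4, h1, e, kap]
  simp only [one_dvd, if_true]
  generalize (-1 : ℝ) ^ j = ε at *
  generalize ∑ d ∈ m.divisors, (if 2 ∣ d then (1 : ℝ) else 0) / (d : ℝ) ^ (2 * j - 1) = S2
  generalize ∑ d ∈ m.divisors, (if 4 ∣ d then (1 : ℝ) else 0) / (d : ℝ) ^ (2 * j - 1) = S4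
  generalize ∑ d ∈ m.divisors, (1 : ℝ) / (d : ℝ) ^ (2 * j - 1) = S1
  rw [div_mul_eq_mul_div, div_mul_eq_mul_div]
  congr 1
  linear_combination (4 * j / |(bernoulli (2 * j) : ℝ)|) * (m : ℝ) ^ (2 * j - 1) * (S1 - S2) * hε

lemma abs_beta_le (j d : ℕ) : |beta j d| ≤ 3 + 2 ^ (2 * j) := by
  have h : |(-1 : ℝ) ^ j| = 1 := by simp
  have h' := abs_le.1 h.le
  have : (0 : ℝ) < 2 ^ (2 * j) := by positivity
  rw [beta, abs_le]
  split_ifs <;> constructor <;> nlinarith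

/-- formula with the convention at zero, and error term -/
lemma rep_main {j : ℕ} (hj : 2 ≤ j) : ∃ C : ℝ, 0 ≤ C ∧ ∀ m : ℕ,
    |(rep (1 : Mt (4 * j)) m : ℝ) - kap j * (m : ℝ) ^ (2 * j - 1) * ∑ d ∈ m.divisors, beta j d / (d : ℝ) ^ (2 * j - 1)|
      ≤ C * ((m : ℝ) + 1) ^ j := by
  obtain ⟨C, hC, h⟩ := rep_eis hj
  refine ⟨C + rep (1 : Mt (4 * j)) 0, by positivity, fun m => ?_⟩
  rcases eq_or_ne m 0 with rfl | hm
  · simp; exact hC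
  · rw [← fcoef_eq j m hm]
    refine (h m).trans ?_
    gcongr
    · simp
    · linarith

end MF

namespace MF
open Matrix Complex Filter Topology MeasureTheory
open scoped Real

noncomputable def ff (r K : ℕ) (y : Fin r → ℝ) : ℝ := (max 0 (1 - ∑ i, y i ^ 2)) ^ K

noncomputable def sc {r : ℕ} (p : ℕ) (x : Vc r) : Fin r → ℝ := fun i => (x i : ℝ) / p

noncomputable def bx (r p : ℕ) : Finset (Vc r) := Fintype.piFinset fun _ => Finset.Icc (-(p : ℤ)) p

lemma mem_bx {r p : ℕ} {x : Vc r} : x ∈ bx r p ↔ ∀ i, |x i| ≤ p := by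
  simp [bx, abs_le]

lemma card_bx (r p : ℕ) : (bx r p).card = (2 * p + 1) ^ r := by
  rw [bx, Fintype.card_piFinset]
  simp only [Int.card_Icc, Finset.prod_const, Finset.card_univ, Fintype.card_fin]
  congr 1; omega

variable {r K : ℕ}

lemma ff_nonneg (y : Fin r → ℝ) : 0 ≤ ff r K y := by unfold ff; positivity

lemma ff_le_one (y : Fin r → ℝ) : ff r K y ≤ 1 := by
  unfold ff
  refine pow_le_one₀ (le_max_left _ _) (max_le zero_le_one ?_)
  have : 0 ≤ ∑ i, y i ^ 2 := Finset.sum_nonneg fun i _ => sq_nonneg _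
  linarith

lemma ff_cont : Continuous (ff r K) := by unfold ff; fun_prop

lemma ff_zero (hK : K ≠ 0) {y : Fin r → ℝ} {i : Fin r} (h : 1 ≤ |y i|) : ff r K y = 0 := by
  unfold ff
  rw [max_eq_left, zero_pow hK]
  have h1 : y i ^ 2 ≤ ∑ i, y i ^ 2 := Finset.single_le_sum (f := fun i => y i ^ 2) (fun i _ => sq_nonneg _) (Finset.mem_univ i)
  have h2 : 1 ≤ y i ^ 2 := by rw [← sq_abs]; nlinarith
  linarith

lemma ff_uc (hK : K ≠ 0) : UniformContinuous (ff r K) := by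
  refine HasCompactSupport.uniformContinuous_of_continuous ?_ ff_cont
  refine HasCompactSupport.intro (K := Set.Icc (fun _ => -1) (fun _ => 1)) isCompact_Icc fun y hy => ?_
  rw [Set.mem_Icc, Pi.le_def, Pi.le_def, ← forall_and, not_forall] at hy
  obtain ⟨i, hi⟩ := hy
  refine ff_zero hK (i := i) ?_
  rw [← abs_le] at hi
  exact (not_le.1 hi).le

lemma ff_sc_zero (hK : K ≠ 0) {p : ℕ} (hp : p ≠ 0) {x : Vc r} (hx : x ∉ bx r p) : ff r K (sc p x) = 0 := by
  rw [mem_bx, not_forall] at hx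
  obtain ⟨i, hi⟩ := hx
  refine ff_zero hK (i := i) ?_
  have hp' : (0 : ℝ) < p := by positivity
  rw [sc, abs_div, abs_of_pos hp', le_div_iff₀ hp', one_mul]
  exact_mod_cast (not_le.1 hi).le

lemma sc_inj {p : ℕ} (hp : p ≠ 0) : Function.Injective (sc (r := r) p) := by
  intro x y h
  funext i
  have := congrFun h i
  have hp' : (p : ℝ) ≠ 0 := by positivity
  simp only [sc] at this
  rw [div_left_inj' hp'] at this
  exact_mod_cast this

/-- total Riemann sums -/
lemma riemann_total (hK : K ≠ 0) :
    Tendsto (fun p : ℕ => (∑ x ∈ bx r p, ff r K (sc p x)) / (p : ℝ) ^ r) atTop (𝓝 (∫ y, ff r K y)) := by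
  set s : Set (Fin r → ℝ) := Set.Icc (fun _ => -1) (fun _ => 1) with hs
  have hz : ∀ y, y ∉ s → ff r K y = 0 := by
    intro y hy
    rw [hs, Set.mem_Icc, Pi.le_def, Pi.le_def, ← forall_and, not_forall] at hy
    obtain ⟨i, hi⟩ := hy
    refine ff_zero hK (i := i) ?_
    rw [← abs_le] at hi
    exact (not_le.1 hi).le
  have h := tendsto_tsum_div_pow_atTop_integral s (ff r K) ff_cont (Metric.isBounded_Icc _ _)
    measurableSet_Icc ((convex_Icc _ _).addHaar_frontier volume)
  rw [setIntegral_eq_integral_of_forall_compl_eq_zero (fun y hy => hz y hy), Fintype.card_fin] at h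
  refine h.congr' ?_
  filter_upwards [eventually_ne_atTop 0] with p hp
  have : NeZero p := ⟨hp⟩
  have hp' : (p : ℝ) ≠ 0 := by positivity
  congr 1
  rw [tsum_subtype, ← (sc_inj (r := r) hp).tsum_eq]
  · rw [tsum_eq_sum (s := bx r p)]
    · refine Finset.sum_congr rfl fun x _ => ?_
      by_cases hx : sc p x ∈ s
      · rw [Set.indicator_of_mem]
        refine ⟨hx, ?_⟩
        refine BoxIntegral.unitPartition.mem_smul_span_iff.2 fun i => ⟨x i, ?_⟩
        simp only [sc, eq_intCast]
        field_simp
      · rw [hz _ hx]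
        rw [Set.indicator_of_notMem]
        exact fun h => hx h.1
    · intro x hx
      rw [Set.indicator_apply_eq_zero]
      exact fun _ => ff_sc_zero hK hp hx
  · intro y hy
    have hy := Set.mem_of_indicator_ne_zero hy
    have := BoxIntegral.unitPartition.mem_smul_span_iff.1 hy.2
    choose x hx using this
    refine ⟨x, funext fun i => ?_⟩
    have := hx i
    simp only [eq_intCast] at this
    simp only [sc, this]
    field_simp

noncomputable def Tu (r K d p : ℕ) (u : Fin r → ZMod d) : ℝ :=
  (∑ x ∈ bx r p with red d x = u, ff r K (sc p x)) / (p : ℝ) ^ r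

lemma Tu_big (hK : K ≠ 0) {d p q : ℕ} (hp : p ≠ 0) (hq : p ≤ q) (u : Fin r → ZMod d) :
    Tu r K d p u = (∑ x ∈ bx r q with red d x = u, ff r K (sc p x)) / (p : ℝ) ^ r := by
  rw [Tu]
  congr 1
  refine Finset.sum_subset ?_ ?_
  · intro x hx
    simp only [Finset.mem_filter, mem_bx] at *
    exact ⟨fun i => (hx.1 i).trans (by exact_mod_cast hq), hx.2⟩
  · intro x hx hx'
    refine ff_sc_zero hK hp fun h => hx' ?_
    simp only [Finset.mem_filter] at *
    exact ⟨h, hx.2⟩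

lemma Tu_shift (hK : K ≠ 0) {d : ℕ} (w : Vc r) (u : Fin r → ZMod d) :
    Tendsto (fun p : ℕ => Tu r K d p (u + red d w) - Tu r K d p u) atTop (𝓝 0) := by
  rw [Metric.tendsto_atTop]
  intro ε hε
  obtain ⟨δ, hδ, hu⟩ := Metric.uniformContinuous_iff.1 (ff_uc (r := r) hK) (ε / (2 * 7 ^ r)) (by positivity)
  obtain ⟨N, hN⟩ : ∃ N : ℕ, ∀ i, |w i| ≤ N := by
    refine ⟨∑ i, (w i).natAbs, fun i => ?_⟩
    rw [Int.abs_eq_natAbs]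
    exact_mod_cast Finset.single_le_sum (f := fun i => (w i).natAbs) (fun i _ => Nat.zero_le _) (Finset.mem_univ i)
  obtain ⟨M, hM⟩ := exists_nat_gt (N / δ)
  refine ⟨max (max N M) 1, fun p hp => ?_⟩
  have hp1 : 1 ≤ p := (le_max_right _ _).trans hp
  have hpN : N ≤ p := (le_max_left _ _).trans ((le_max_left _ _).trans hp)
  have hpM : M ≤ p := (le_max_right _ _).trans ((le_max_left _ _).trans hp)
  have hp0 : (0 : ℝ) < p := by positivity
  have e1 : Tu r K d p (u + red d w) = (∑ x ∈ bx r (3 * p) with red d x = u, ff r K (sc p (x + w))) / (p : ℝ) ^ r := by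
    rw [Tu]
    congr 1
    refine Finset.sum_of_injOn (fun x => x - w) (fun x _ y _ h => by simpa using h) ?_ ?_ ?_
    · intro x hx
      simp only [Finset.coe_filter, Set.mem_ofPred_eq, mem_bx] at *
      refine ⟨fun i => ?_, ?_⟩
      · have h1 := abs_le.1 (hx.1 i)
        have h2 := abs_le.1 (hN i)
        rw [Pi.sub_apply, abs_le]
        push_cast
        have : (N : ℤ) ≤ p := by exact_mod_cast hpN
        constructor <;> linarith
      · have := hx.2
        funext i
        have := congrFun this i
        simp only [red, Pi.sub_apply, Pi.add_apply, Int.cast_sub] at *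
        rw [this]; ring
    · intro x hx hx'
      refine ff_sc_zero hK (by omega) fun h => hx' ⟨x + w, ?_, by simp⟩
      simp only [Finset.coe_filter, Set.mem_ofPred_eq, Finset.mem_filter] at *
      refine ⟨h, ?_⟩
      rw [← hx.2]
      funext i
      simp [red]
    · intro x _
      simp
  rw [Real.dist_eq, sub_zero, e1, Tu_big hK (by omega) (show p ≤ 3 * p by omega), ← sub_div, ← Finset.sum_sub_distrib, abs_div,
    abs_of_pos (pow_pos hp0 r), div_lt_iff₀ (pow_pos hp0 r)]
  have hb : ∀ x : Vc r, |ff r K (sc p (x + w)) - ff r K (sc p x)| ≤ ε / (2 * 7 ^ r) := by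
    intro x
    refine (hu ?_).le
    refine (dist_pi_lt_iff hδ).2 fun i => ?_
    simp only [sc, Pi.add_apply, Int.cast_add]
    rw [Real.dist_eq, ← sub_div, add_sub_cancel_left, abs_div, abs_of_pos hp0, div_lt_iff₀ hp0]
    have h1 : |(w i : ℝ)| ≤ N := by exact_mod_cast hN i
    have h2 : (N : ℝ) < M * δ := by rwa [div_lt_iff₀ hδ] at hM
    have h3 : (M : ℝ) ≤ p := by exact_mod_cast hpM
    nlinarith
  refine (Finset.abs_sum_le_sum_abs _ _).trans_lt ?_
  refine (Finset.sum_le_card_nsmul _ _ _ fun x _ => hb x).trans_lt ?_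
  rw [nsmul_eq_mul]
  have hc : ((Finset.card {x ∈ bx r (3 * p) | red d x = u} : ℕ) : ℝ) ≤ 7 ^ r * (p : ℝ) ^ r := by
    rw [← mul_pow]
    have : (Finset.card {x ∈ bx r (3 * p) | red d x = u}) ≤ (7 * p) ^ r := by
      refine (Finset.card_filter_le _ _).trans ?_
      rw [card_bx]
      exact Nat.pow_le_pow_left (by omega) r
    exact_mod_cast this
  calc _ ≤ 7 ^ r * (p : ℝ) ^ r * (ε / (2 * 7 ^ r)) := by gcongr
    _ = ε / 2 * (p : ℝ) ^ r := by field_simp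
    _ < ε * (p : ℝ) ^ r := by gcongr; linarith

lemma Tu_sum {d : ℕ} [NeZero d] (p : ℕ) : ∑ u, Tu r K d p u = (∑ x ∈ bx r p, ff r K (sc p x)) / (p : ℝ) ^ r := by
  simp only [Tu]
  rw [← Finset.sum_div, Finset.sum_fiberwise]

lemma Tu_lim (hK : K ≠ 0) {d : ℕ} [NeZero d] (u : Fin r → ZMod d) :
    Tendsto (fun p : ℕ => Tu r K d p u) atTop (𝓝 ((∫ y, ff r K y) / (d : ℝ) ^ r)) := by
  have h1 := riemann_total (r := r) hK
  have h2 : Tendsto (fun p : ℕ => ∑ v, (Tu r K d p v - Tu r K d p u)) atTop (𝓝 (∑ v : Fin r → ZMod d, 0)) := by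
    refine tendsto_finsetSum _ fun v _ => ?_
    obtain ⟨w, hw⟩ := red_lift (v - u)
    have := Tu_shift hK w u
    rwa [hw, add_sub_cancel] at this
  have hd : ((d : ℝ) ^ r) ≠ 0 := by have := NeZero.ne d; positivity
  have h3 := (h1.sub h2).div_const ((d : ℝ) ^ r)
  rw [Finset.sum_const_zero, sub_zero] at h3
  refine h3.congr fun p => ?_
  rw [Finset.sum_sub_distrib, Tu_sum, Finset.sum_const, Finset.card_univ, Fintype.card_fun, Fintype.card_fin, ZMod.card, nsmul_eq_mul]
  push_cast
  field_simp
  ring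

noncomputable def rho (r d : ℕ) : ℕ := {u : Fin r → ZMod d | ∑ i, u i ^ 2 = 1}.ncard

noncomputable def Ad (r K d p : ℕ) : ℝ :=
  (∑ x ∈ bx r p with (d : ℤ) ∣ (p : ℤ) ^ 2 - ∑ i, x i ^ 2, ff r K (sc p x)) / (p : ℝ) ^ r

lemma Ad_nonneg (d p : ℕ) : 0 ≤ Ad r K d p := by
  unfold Ad
  exact div_nonneg (Finset.sum_nonneg fun x _ => ff_nonneg _) (by positivity)

lemma Ad_le (d p : ℕ) (hp : p ≠ 0) : Ad r K d p ≤ 3 ^ r := by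
  unfold Ad
  have hp0 : (0 : ℝ) < p := by positivity
  rw [div_le_iff₀ (by positivity)]
  refine (Finset.sum_le_card_nsmul _ _ 1 fun x _ => ff_le_one _).trans ?_
  rw [nsmul_eq_mul, mul_one, ← mul_pow]
  have : (Finset.card {x ∈ bx r p | (d : ℤ) ∣ (p : ℤ) ^ 2 - ∑ i, x i ^ 2}) ≤ (3 * p) ^ r := by
    refine (Finset.card_filter_le _ _).trans ?_
    rw [card_bx]
    exact Nat.pow_le_pow_left (by omega) r
  exact_mod_cast this

lemma Ad_eq {d : ℕ} [NeZero d] (p : ℕ) :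
    Ad r K d p = ∑ u : Fin r → ZMod d, if ∑ i, u i ^ 2 = (p : ZMod d) ^ 2 then Tu r K d p u else 0 := by
  simp only [Ad, Tu]
  rw [Finset.sum_filter, ← Finset.sum_fiberwise (bx r p) (red d), Finset.sum_div]
  refine Finset.sum_congr rfl fun u _ => ?_
  have key : ∀ x : Vc r, red d x = u → ((d : ℤ) ∣ (p : ℤ) ^ 2 - ∑ i, x i ^ 2 ↔ ∑ i, u i ^ 2 = (p : ZMod d) ^ 2) := by
    rintro x rfl
    rw [← ZMod.intCast_zmod_eq_zero_iff_dvd]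
    push_cast
    rw [sub_eq_zero, eq_comm]
    rfl
  split_ifs with h
  · congr 1
    refine Finset.sum_congr rfl fun x hx => ?_
    rw [if_pos ((key x (Finset.mem_filter.1 hx).2).2 h)]
  · rw [Finset.sum_eq_zero, zero_div]
    intro x hx
    rw [if_neg fun hh => h ((key x (Finset.mem_filter.1 hx).2).1 hh)]

lemma rho_scale {d p : ℕ} [NeZero d] (h : p.Coprime d) :
    {u : Fin r → ZMod d | ∑ i, u i ^ 2 = (p : ZMod d) ^ 2}.ncard = rho r d := by
  rw [rho]
  have hu := (ZMod.isUnit_iff_coprime p d).2 h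
  obtain ⟨a, ha⟩ := hu
  rw [← Set.ncard_image_of_injective {u : Fin r → ZMod d | ∑ i, u i ^ 2 = 1} (f := fun u => (p : ZMod d) • u)]
  · congr 1
    ext u
    simp only [Set.mem_image, Set.mem_ofPred_eq]
    constructor
    · intro hu
      refine ⟨(↑a⁻¹ : ZMod d) • u, ?_, ?_⟩
      · simp only [Pi.smul_apply, smul_eq_mul, mul_pow]
        rw [← Finset.mul_sum, hu, ← ha, ← mul_pow, Units.inv_mul, one_pow]
      · rw [← ha, smul_smul, Units.mul_inv, one_smul]
    · rintro ⟨v, hv, rfl⟩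
      simp only [Pi.smul_apply, smul_eq_mul, mul_pow]
      rw [← Finset.mul_sum, hv, mul_one]
  · intro u v h
    have : (↑a⁻¹ : ZMod d) • ((p : ZMod d) • u) = (↑a⁻¹ : ZMod d) • ((p : ZMod d) • v) := congrArg _ h
    rwa [← ha, smul_smul, smul_smul, Units.inv_mul, one_smul, one_smul] at this

lemma Ad_lim (hK : K ≠ 0) {d : ℕ} [NeZero d] :
    Tendsto (fun p : ℕ => Ad r K d p) Pf (𝓝 ((∫ y, ff r K y) * (rho r d / (d : ℝ) ^ r))) := by
  classical
  have h1 : Tendsto (fun p : ℕ => ∑ u : Fin r → ZMod d, (if ∑ i, u i ^ 2 = (p : ZMod d) ^ 2 then 1 else 0) *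
      (Tu r K d p u - (∫ y, ff r K y) / (d : ℝ) ^ r)) Pf (𝓝 (∑ u : Fin r → ZMod d, 0)) := by
    refine tendsto_finsetSum _ fun u _ => ?_
    have h := ((Tu_lim hK u).mono_left Pf_le).sub_const ((∫ y, ff r K y) / (d : ℝ) ^ r)
    rw [sub_self] at h
    refine squeeze_zero_norm (fun p => ?_) (tendsto_zero_iff_norm_tendsto_zero.1 h)
    rw [norm_mul]
    refine mul_le_of_le_one_left (norm_nonneg _) ?_
    split_ifs <;> simp
  rw [Finset.sum_const_zero] at h1
  have h2 := h1.add_const ((∫ y, ff r K y) * (rho r d / (d : ℝ) ^ r))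
  rw [zero_add] at h2
  refine h2.congr' ?_
  filter_upwards [Pf_event, Pf_le (eventually_gt_atTop d)] with p hp hpd
  have hc : p.Coprime d := (Nat.coprime_of_lt_prime (NeZero.ne d) hpd hp.1)
  rw [Ad_eq, ← rho_scale (r := r) hc]
  have : ((({u : Fin r → ZMod d | ∑ i, u i ^ 2 = (p : ZMod d) ^ 2}.ncard : ℕ) : ℝ)) = ∑ u : Fin r → ZMod d, (if ∑ i, u i ^ 2 = (p : ZMod d) ^ 2 then 1 else 0) := by
    rw [Finset.sum_boole, Set.ncard_eq_toFinset_card']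
    simp
  rw [this, mul_div, ← div_mul_eq_mul_div, Finset.mul_sum, ← Finset.sum_add_distrib]
  refine Finset.sum_congr rfl fun u _ => ?_
  split_ifs <;> ring

end MF

namespace MF
open Matrix Complex Filter Topology MeasureTheory
open scoped Real

variable {r K : ℕ}

lemma rep_neg {n : ℕ} {G : Mt n} (h : IsU G) {k : ℤ} (hk : k < 0) : rep G k = 0 := by
  rw [rep, Set.ncard_eq_zero (finite_rep h k), Set.eq_empty_iff_forall_notMem]
  intro x hx
  have := h.nonneg x
  simp only [Set.mem_ofPred_eq] at hx
  omega

lemma rep_conv (a r p : ℕ) :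
    rep (1 : Mt (a + r)) ((p : ℤ) ^ 2) = ∑ x ∈ bx r p, rep (1 : Mt a) ((p : ℤ) ^ 2 - ∑ i, x i ^ 2) := by
  classical
  have hf := finite_rep (isU_one (a + r)) ((p : ℤ) ^ 2)
  have hnf : ∀ (v : Vc a) (x : Vc r), nf (1 : Mt (a + r)) (Fin.append v x) = nf 1 v + ∑ i, x i ^ 2 := by
    intro v x
    rw [nf_one, nf_one, Fin.sum_univ_add]
    simp
  rw [rep, Set.ncard_eq_toFinset_card _ hf,
    Finset.card_eq_sum_card_fiberwise (f := fun v : Vc (a + r) => (fun i => v (Fin.natAdd a i) : Vc r)) (t := bx r p)]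
  · refine Finset.sum_congr rfl fun x hx => ?_
    rw [rep, ← Set.ncard_coe_finset,
      ← Set.ncard_image_of_injective {v : Vc a | nf 1 v = (p : ℤ) ^ 2 - ∑ i, x i ^ 2} (f := fun v => Fin.append v x)]
    · congr 1
      ext v
      simp only [Finset.coe_filter, Set.Finite.mem_toFinset, Set.mem_ofPred_eq, Set.mem_image]
      constructor
      · rintro ⟨h1, rfl⟩
        have e : Fin.append (fun i => v (Fin.castAdd r i)) (fun i => v (Fin.natAdd a i)) = v := Fin.append_castAdd_natAdd
        refine ⟨fun i => v (Fin.castAdd r i), ?_, e⟩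
        have := hnf (fun i => v (Fin.castAdd r i)) (fun i => v (Fin.natAdd a i))
        rw [e] at this
        linarith
      · rintro ⟨w, hw, rfl⟩
        rw [hnf, hw]
        exact ⟨by ring, by funext i; simp⟩
    · intro v w h
      funext i
      have := congrFun h (Fin.castAdd r i)
      simpa using this
  · intro v hv
    rw [Set.Finite.coe_toFinset, Set.mem_ofPred_eq, nf_one] at hv
    simp only [Finset.mem_coe, mem_bx]
    intro i
    rw [← abs_of_nonneg (Int.natCast_nonneg p), ← sq_le_sq, ← hv]
    exact Finset.single_le_sum (f := fun i => v i ^ 2) (fun i _ => sq_nonneg _) (Finset.mem_univ (Fin.natAdd a i))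

noncomputable def gg (j d : ℕ) : ℝ := beta j d / (d : ℝ) ^ (2 * j - 1)

lemma gg_summable {j : ℕ} (hj : 2 ≤ j) : Summable fun d => |gg j d| := by
  have h : Summable fun d : ℕ => (3 + 2 ^ (2 * j)) * (1 / (d : ℝ) ^ (2 * j - 1)) :=
    (Real.summable_one_div_nat_pow.2 (by omega)).mul_left _
  refine h.of_nonneg_of_le (fun d => abs_nonneg _) fun d => ?_
  rw [gg, abs_div, abs_of_nonneg (by positivity : (0 : ℝ) ≤ (d : ℝ) ^ (2 * j - 1)), mul_one_div]
  gcongr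
  exact abs_beta_le j d

lemma gg_zero {j : ℕ} (hj : 2 ≤ j) : gg j 0 = 0 := by
  rw [gg, Nat.cast_zero, zero_pow (by omega), div_zero]

lemma ff_sc {p : ℕ} (hp : p ≠ 0) (hK : K ≠ 0) (x : Vc r) :
    (((p : ℤ) ^ 2 - ∑ i, x i ^ 2).toNat : ℝ) ^ K = (p : ℝ) ^ (2 * K) * ff r K (sc p x) := by
  have hp0 : (0 : ℝ) < p := by positivity
  rw [ff, pow_mul, ← mul_pow, mul_max_of_nonneg _ _ (by positivity), mul_zero]
  congr 1
  have : (p : ℝ) ^ 2 * (1 - ∑ i, sc p x i ^ 2) = (((p : ℤ) ^ 2 - ∑ i, x i ^ 2 : ℤ) : ℝ) := by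
    simp only [sc, div_pow]
    rw [← Finset.sum_div]
    push_cast
    field_simp
  rw [this]
  have e : ∀ z : ℤ, ((z.toNat : ℕ) : ℝ) = max 0 (z : ℝ) := by
    intro z
    have := Int.toNat_eq_max z
    rw [max_comm]
    exact_mod_cast congrArg (Int.cast : ℤ → ℝ) this
  exact e _

lemma div_sum {j : ℕ} (hj : 2 ≤ j) {m : ℕ} (hm : m ≠ 0) :
    HasSum (fun d : ℕ => gg j d * (if d ∣ m then 1 else 0)) (∑ d ∈ m.divisors, gg j d) := by
  have h : ∑ d ∈ m.divisors, gg j d = ∑ d ∈ m.divisors, gg j d * (if d ∣ m then 1 else 0) :=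
    Finset.sum_congr rfl fun d hd => by rw [if_pos (Nat.dvd_of_mem_divisors hd), mul_one]
  rw [h]
  refine hasSum_sum_of_ne_finset_zero fun d hd => ?_
  rw [Nat.mem_divisors] at hd
  rw [if_neg (fun h => hd ⟨h, hm⟩), mul_zero]

lemma main_hasSum {j : ℕ} (hj : 2 ≤ j) {p : ℕ} (hp : p ≠ 0) :
    HasSum (fun d : ℕ => gg j d * Ad r (2 * j - 1) d p)
      ((∑ x ∈ bx r p, ff r (2 * j - 1) (sc p x) * ∑ d ∈ (((p : ℤ) ^ 2 - ∑ i, x i ^ 2).toNat).divisors, gg j d) / (p : ℝ) ^ r) := by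
  have hK : 2 * j - 1 ≠ 0 := by omega
  have h : ∀ x ∈ bx r p, HasSum (fun d : ℕ => gg j d * (if (d : ℤ) ∣ (p : ℤ) ^ 2 - ∑ i, x i ^ 2 then ff r (2 * j - 1) (sc p x) else 0))
      (ff r (2 * j - 1) (sc p x) * ∑ d ∈ (((p : ℤ) ^ 2 - ∑ i, x i ^ 2).toNat).divisors, gg j d) := by
    intro x _
    have hff := ff_sc hp hK x
    generalize (p : ℤ) ^ 2 - ∑ i, x i ^ 2 = N at hff ⊢
    rcases le_or_gt N 0 with hN | hN
    · rw [Int.toNat_of_nonpos hN, Nat.cast_zero, zero_pow hK] at hff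
      have : ff r (2 * j - 1) (sc p x) = 0 := by
        rcases mul_eq_zero.1 hff.symm with h | h
        · have : (p : ℝ) ^ (2 * (2 * j - 1)) ≠ 0 := by positivity
          exact absurd h this
        · exact h
      simp only [this, ite_self, mul_zero, zero_mul]
      exact hasSum_zero
    · obtain ⟨m, rfl⟩ := Int.eq_ofNat_of_zero_le hN.le
      have hm : m ≠ 0 := by omega
      have := (div_sum hj hm).mul_left (ff r (2 * j - 1) (sc p x))
      rw [Int.toNat_natCast]
      suffices hh : (fun d : ℕ => gg j d * (if (d : ℤ) ∣ (m : ℤ) then ff r (2 * j - 1) (sc p x) else 0)) =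
         fun d => ff r (2 * j - 1) (sc p x) * (gg j d * (if d ∣ m then 1 else 0)) by rw [hh]; exact this
      funext d
      simp only [Int.natCast_dvd_natCast]
      split_ifs <;> ring
  have := (hasSum_sum h).div_const ((p : ℝ) ^ r)
  suffices hh : (fun d : ℕ => gg j d * Ad r (2 * j - 1) d p) = fun d : ℕ => (∑ x ∈ bx r p, gg j d *
     (if (d : ℤ) ∣ (p : ℤ) ^ 2 - ∑ i, x i ^ 2 then ff r (2 * j - 1) (sc p x) else 0)) / (p : ℝ) ^ r by rw [hh]; exact this
  funext d
  rw [Ad, ← Finset.mul_sum, Finset.sum_filter, mul_div]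

noncomputable def ss (j r : ℕ) : ℝ := ∑' d : ℕ, gg j d * (rho r d / (d : ℝ) ^ r)

noncomputable def cn (j r : ℕ) : ℝ := kap j * (∫ y, ff r (2 * j - 1) y) * ss j r

lemma rep_one_lim {j : ℕ} (hj : 2 ≤ j) (r : ℕ) :
    Tendsto (fun p : ℕ => (rep (1 : Mt (4 * j + r)) ((p : ℤ) ^ 2) : ℝ) / (p : ℝ) ^ (4 * j + r - 2)) Pf (𝓝 (cn j r)) := by
  have hK : 2 * j - 1 ≠ 0 := by omega
  obtain ⟨C, hC, hrep⟩ := rep_main hj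
  have hm : Tendsto (fun p : ℕ => kap j * ∑' d : ℕ, gg j d * Ad r (2 * j - 1) d p) Pf (𝓝 (cn j r)) := by
    have : cn j r = kap j * ∑' d : ℕ, gg j d * ((∫ y, ff r (2 * j - 1) y) * (rho r d / (d : ℝ) ^ r)) := by
      rw [cn, ss, mul_assoc, ← tsum_mul_left]
      congr 2
      funext d
      ring
    rw [this]
    refine Tendsto.const_mul _ ?_
    refine tendsto_tsum_of_dominated_convergence (bound := fun d => |gg j d| * 3 ^ r) ((gg_summable hj).mul_right _) ?_ ?_
    · intro d
      rcases eq_or_ne d 0 with rfl | hd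
      · simp only [gg_zero hj, zero_mul]; exact tendsto_const_nhds
      · have : NeZero d := ⟨hd⟩
        exact (Ad_lim hK).const_mul _
    · filter_upwards [Pf_event] with p hp d
      rw [Real.norm_eq_abs, abs_mul, abs_of_nonneg (Ad_nonneg d p)]
      gcongr
      exact Ad_le d p hp.1.ne_zero
  have he : Tendsto (fun p : ℕ => C * (3 ^ r * 2 ^ j) * (1 / (p : ℝ))) Pf (𝓝 0) := by
    rw [← mul_zero (C * (3 ^ r * 2 ^ j))]
    exact (tendsto_one_div_atTop_nhds_zero_nat.mono_left Pf_le).const_mul _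
  rw [← sub_zero (cn j r)]
  have hd : Tendsto (fun p : ℕ => kap j * ∑' d : ℕ, gg j d * Ad r (2 * j - 1) d p -
      (rep (1 : Mt (4 * j + r)) ((p : ℤ) ^ 2) : ℝ) / (p : ℝ) ^ (4 * j + r - 2)) Pf (𝓝 0) := by
    refine squeeze_zero_norm' ?_ he
    filter_upwards [Pf_event] with p hp
    have hp0 := hp.1.ne_zero
    have hp1 : (1 : ℝ) ≤ p := by exact_mod_cast hp.1.one_le
    have hpp : (0 : ℝ) < p := by linarith
    rw [(main_hasSum hj hp0).tsum_eq, rep_conv]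
    have e : (p : ℝ) ^ (4 * j + r - 2) = (p : ℝ) ^ (2 * (2 * j - 1)) * (p : ℝ) ^ r := by
      rw [← pow_add]; congr 1; omega
    have e2 : kap j * ((∑ x ∈ bx r p, ff r (2 * j - 1) (sc p x) * ∑ d ∈ (((p : ℤ) ^ 2 - ∑ i, x i ^ 2).toNat).divisors, gg j d) / (p : ℝ) ^ r)
        = (∑ x ∈ bx r p, kap j * ((((p : ℤ) ^ 2 - ∑ i, x i ^ 2).toNat : ℕ) : ℝ) ^ (2 * j - 1) *
          ∑ d ∈ (((p : ℤ) ^ 2 - ∑ i, x i ^ 2).toNat).divisors, gg j d) / (p : ℝ) ^ (4 * j + r - 2) := by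
      rw [e, mul_div, Finset.mul_sum, eq_div_iff (by positivity), div_mul_eq_mul_div, div_eq_iff (by positivity), Finset.sum_mul, Finset.sum_mul]
      refine Finset.sum_congr rfl fun x _ => ?_
      rw [ff_sc hp0 hK]
      ring
    rw [e2, ← sub_div, Nat.cast_sum, ← Finset.sum_sub_distrib, Real.norm_eq_abs, abs_div,
      abs_of_pos (by positivity : (0 : ℝ) < (p : ℝ) ^ (4 * j + r - 2)), div_le_iff₀ (by positivity)]
    have hb : ∀ x ∈ bx r p, |kap j * ((((p : ℤ) ^ 2 - ∑ i, x i ^ 2).toNat : ℕ) : ℝ) ^ (2 * j - 1) *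
          ∑ d ∈ (((p : ℤ) ^ 2 - ∑ i, x i ^ 2).toNat).divisors, gg j d - rep (1 : Mt (4 * j)) ((p : ℤ) ^ 2 - ∑ i, x i ^ 2)| ≤ C * (2 ^ j * (p : ℝ) ^ (2 * j)) := by
      intro x _
      have hle : (p : ℤ) ^ 2 - ∑ i, x i ^ 2 ≤ (p : ℤ) ^ 2 := by
        have : 0 ≤ ∑ i, x i ^ 2 := Finset.sum_nonneg fun i _ => sq_nonneg _
        linarith
      generalize (p : ℤ) ^ 2 - ∑ i, x i ^ 2 = N at hle
      rcases lt_or_ge N 0 with hN | hN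
      · rw [rep_neg (isU_one _) hN, Int.toNat_of_nonpos hN.le]
        simp
        positivity
      · obtain ⟨m, rfl⟩ := Int.eq_ofNat_of_zero_le hN
        rw [abs_sub_comm]
        refine (hrep m).trans ?_
        rw [pow_mul, ← mul_pow]
        have : (m : ℝ) ≤ (p : ℝ) ^ 2 := by exact_mod_cast hle
        gcongr
        nlinarith
    refine (Finset.abs_sum_le_sum_abs _ _).trans ?_
    refine (Finset.sum_le_card_nsmul _ _ _ hb).trans ?_
    rw [nsmul_eq_mul, card_bx, mul_one_div, div_mul_eq_mul_div, le_div_iff₀ hpp]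
    have h1 : (((2 * p + 1) ^ r : ℕ) : ℝ) ≤ 3 ^ r * (p : ℝ) ^ r := by
      rw [← mul_pow]; push_cast; gcongr; linarith
    have h2 : (p : ℝ) ^ r * (p : ℝ) ^ (2 * j) * p ≤ (p : ℝ) ^ (4 * j + r - 2) := by
      rw [← pow_add, ← pow_succ]
      exact pow_le_pow_right₀ hp1 (by omega)
    calc _ ≤ (3 ^ r * (p : ℝ) ^ r) * (C * (2 ^ j * (p : ℝ) ^ (2 * j))) * p := by gcongr
      _ = C * (3 ^ r * 2 ^ j) * ((p : ℝ) ^ r * (p : ℝ) ^ (2 * j) * p) := by ring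
      _ ≤ _ := by gcongr
  refine (hm.sub hd).congr fun p => ?_
  ring

lemma odd_one {n : ℕ} (hn : n ≠ 0) : OddF (1 : Mt n) := by
  refine ⟨Pi.single ⟨0, by omega⟩ 1, ?_⟩
  rw [nf_one]
  simp [Pi.single_apply]

theorem odd_lim {j : ℕ} (hj : 2 ≤ j) (r : ℕ) {G : Mt (4 * j + r)} (h : IsU G) (ho : OddF G) :
    Tendsto (fun p : ℕ => (rep G ((p : ℤ) ^ 2) : ℝ) / (p : ℝ) ^ (4 * j + r - 2)) Pf (𝓝 (cn j r)) := by
  obtain ⟨C, hC, hb⟩ := rep_compare h (isU_one _) ho (odd_one (by omega))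
  have he : Tendsto (fun p : ℕ => C * (1 / (p : ℝ))) Pf (𝓝 0) := by
    rw [← mul_zero C]
    exact (tendsto_one_div_atTop_nhds_zero_nat.mono_left Pf_le).const_mul _
  have hd : Tendsto (fun p : ℕ => (rep G ((p : ℤ) ^ 2) : ℝ) / (p : ℝ) ^ (4 * j + r - 2) -
     (rep (1 : Mt (4 * j + r)) ((p : ℤ) ^ 2) : ℝ) / (p : ℝ) ^ (4 * j + r - 2)) Pf (𝓝 0) := by
    refine squeeze_zero_norm' ?_ he
    filter_upwards [Pf_event] with p hp
    have hp1 : (1 : ℝ) ≤ p := by exact_mod_cast hp.1.one_le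
    have hpp : (0 : ℝ) < p := by linarith
    rw [← sub_div, Real.norm_eq_abs, abs_div, abs_of_pos (by positivity : (0 : ℝ) < (p : ℝ) ^ (4 * j + r - 2)), div_le_iff₀ (by positivity)]
    have := hb (p ^ 2)
    push_cast at this
    refine this.trans ?_
    rw [mul_assoc]
    gcongr
    rw [one_div, inv_mul_eq_div, le_div_iff₀ hpp]
    rw [← Real.rpow_natCast (p : ℝ) 2, ← Real.rpow_mul hpp.le]
    nth_rewrite 2 [← Real.rpow_one (p : ℝ)]
    rw [← Real.rpow_add hpp, ← Real.rpow_natCast (p : ℝ) (4 * j + r - 2)]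
    refine Real.rpow_le_rpow_of_exponent_le hp1 ?_
    rw [Nat.cast_sub (by omega)]
    push_cast
    have : (2 : ℝ) ≤ j := by exact_mod_cast hj
    have : (0 : ℝ) ≤ r := by positivity
    linarith
  have := hd.add (rep_one_lim hj r)
  rw [zero_add] at this
  refine this.congr fun p => ?_
  ring

theorem odd_chain {m j r : ℕ} (hm : m + 1 = 4 * j + r) (hj : 2 ≤ j) {R : Finset (Mt (m + 1))} {R' : Finset (Mt m)}
    (hR : IsReps OddF R) (hR' : IsReps (fun _ => True) R') : cn j r * mass R = mass R' := by
  rw [← split_mass hR hR']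
  have key : ∀ n : ℕ, n = 4 * j + r → ∀ G : Mt n, IsU G → OddF G →
      Tendsto (fun p : ℕ => (rep G ((p : ℤ) ^ 2) : ℝ) / (p : ℝ) ^ (n - 2)) Pf (𝓝 (cn j r)) := by
    rintro _ rfl G h ho
    exact odd_lim hj r h ho
  exact nbr_limit (by omega) hR fun G hG => key _ hm G (hR.mem G hG).1 (hR.mem G hG).2

end MF

namespace MF
open Matrix Complex Filter Topology MeasureTheory
open scoped Real

noncomputable def VV (K : ℕ) : ℝ := ∫ y in (0 : ℝ)..1, (1 - y ^ 2) ^ K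

lemma VV_rec (K : ℕ) : (2 * K + 3) * VV (K + 1) = (2 * K + 2) * VV K := by
  have hd : ∀ y : ℝ, HasDerivAt (fun y : ℝ => y * (1 - y ^ 2) ^ (K + 1))
      ((2 * K + 3) * (1 - y ^ 2) ^ (K + 1) - (2 * K + 2) * (1 - y ^ 2) ^ K) y := by
    intro y
    have h1 : HasDerivAt (fun y : ℝ => 1 - y ^ 2) (-(2 * y)) y := by
      simpa using ((hasDerivAt_pow 2 y).const_sub 1)
    have h2 := (hasDerivAt_id y).mul (h1.pow (K + 1))
    refine h2.congr_deriv ?_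
    simp only [id, Pi.pow_apply]
    rw [Nat.add_sub_cancel]
    push_cast
    ring
  have h := intervalIntegral.integral_eq_sub_of_hasDerivAt (a := 0) (b := 1) (fun y _ => hd y)
    (Continuous.intervalIntegrable (by fun_prop) _ _)
  rw [intervalIntegral.integral_sub (Continuous.intervalIntegrable (by fun_prop) _ _) (Continuous.intervalIntegrable (by fun_prop) _ _),
    intervalIntegral.integral_const_mul, intervalIntegral.integral_const_mul] at h
  simp only [VV]
  simp at h
  linarith

lemma VV_eq (K : ℕ) : VV K = 4 ^ K * (K.factorial : ℝ) ^ 2 / (2 * K + 1).factorial := by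
  induction K with
  | zero => simp [VV]
  | succ K ih =>
    have h := VV_rec K
    rw [ih] at h
    have h3 : (2 * (K : ℝ) + 3) ≠ 0 := by positivity
    rw [← mul_right_inj' h3, h, show 2 * (K + 1) + 1 = (2 * K + 1) + 1 + 1 by ring, Nat.factorial_succ (2 * K + 1 + 1), Nat.factorial_succ (2 * K + 1), Nat.factorial_succ K]
    push_cast
    have := Nat.factorial_pos (2 * K + 1)
    field_simp
    ring

lemma int_y (K : ℕ) : ∫ y in (0 : ℝ)..1, y * (1 - y ^ 2) ^ K = (1 / (2 * (K + 1)) : ℝ) := by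
  have hd : ∀ y : ℝ, HasDerivAt (fun y : ℝ => -(1 - y ^ 2) ^ (K + 1) / (2 * (K + 1)))
      (y * (1 - y ^ 2) ^ K) y := by
    intro y
    have h1 : HasDerivAt (fun y : ℝ => 1 - y ^ 2) (-(2 * y)) y := by
      simpa using ((hasDerivAt_pow 2 y).const_sub 1)
    have h2 := ((h1.pow (K + 1)).neg).div_const (2 * ((K : ℝ) + 1))
    refine h2.congr_deriv ?_
    simp only [Nat.add_sub_cancel]
    push_cast
    field_simp
  have h := intervalIntegral.integral_eq_sub_of_hasDerivAt (a := 0) (b := 1) (fun y _ => hd y)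
    (Continuous.intervalIntegrable (by fun_prop) _ _)
  rw [h]
  simp
  field_simp

lemma int_y2 (K : ℕ) : ∫ y in (0 : ℝ)..1, y ^ 2 * (1 - y ^ 2) ^ K = VV K / (2 * K + 3) := by
  have : ∀ y : ℝ, y ^ 2 * (1 - y ^ 2) ^ K = (1 - y ^ 2) ^ K - (1 - y ^ 2) ^ (K + 1) := fun y => by ring
  simp only [this]
  rw [intervalIntegral.integral_sub (Continuous.intervalIntegrable (by fun_prop) _ _) (Continuous.intervalIntegrable (by fun_prop) _ _)]
  change VV K - VV (K + 1) = _
  have h := VV_rec K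
  rw [eq_div_iff (by positivity)]
  linarith

lemma ff_radial (r K : ℕ) (hr : r ≠ 0) (hK : K ≠ 0) : ∫ y, ff r K y =
    r * (volume.real (Metric.ball (0 : EuclideanSpace ℝ (Fin r)) 1) * ∫ y in (0 : ℝ)..1, y ^ (r - 1) * (1 - y ^ 2) ^ K) := by
  have : Nonempty (Fin r) := ⟨⟨0, by omega⟩⟩
  have h1 : ∫ y, ff r K y = ∫ x : EuclideanSpace ℝ (Fin r), (max 0 (1 - ‖x‖ ^ 2)) ^ K := by
    rw [← (PiLp.volume_preserving_toLp (Fin r)).integral_comp (MeasurableEquiv.toLp 2 _).measurableEmbedding]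
    refine integral_congr_ae (Eventually.of_forall fun y => ?_)
    simp only [ff]
    rw [EuclideanSpace.norm_sq_eq]
    simp
  rw [h1, integral_fun_norm_addHaar volume (fun t : ℝ => (max 0 (1 - t ^ 2)) ^ K)]
  simp only [finrank_euclideanSpace, Fintype.card_fin, smul_eq_mul, nsmul_eq_mul]
  congr 2
  rw [intervalIntegral.integral_of_le zero_le_one]
  rw [setIntegral_eq_of_subset_of_forall_diff_eq_zero measurableSet_Ioi (s := Set.Ioc 0 1) (fun y hy => hy.1)]
  · refine setIntegral_congr_fun measurableSet_Ioc fun y hy => ?_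
    rw [max_eq_right]
    nlinarith [hy.1, hy.2]
  · intro y hy
    rw [max_eq_left, zero_pow hK, mul_zero]
    have h0 : 0 < y := hy.1
    have : 1 < y := not_le.1 fun h => hy.2 ⟨h0, h⟩
    nlinarith

lemma ff0 (K : ℕ) : ∫ y, ff 0 K y = 1 := by
  have : ∀ y, ff 0 K y = 1 := fun y => by simp [ff]
  simp [this, measureReal_def, volume_pi]

lemma ff1 {K : ℕ} (hK : K ≠ 0) : ∫ y, ff 1 K y = 2 * VV K := by
  rw [ff_radial 1 K one_ne_zero hK, VV, measureReal_def, EuclideanSpace.volume_ball]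
  have : Real.Gamma ((1 : ℝ) / 2 + 1) = √π / 2 := by
    rw [Real.Gamma_add_one (by norm_num), Real.Gamma_one_half_eq]; ring
  simp only [Fintype.card_fin, Nat.cast_one, this, pow_one, Nat.sub_self, pow_zero, one_mul, ENNReal.ofReal_one]
  rw [ENNReal.toReal_ofReal (by positivity)]
  have : √π ≠ 0 := by positivity
  field_simp

lemma ff2 {K : ℕ} (hK : K ≠ 0) : ∫ y, ff 2 K y = π / (K + 1) := by
  rw [ff_radial 2 K two_ne_zero hK, measureReal_def, EuclideanSpace.volume_ball_fin_two]
  simp only [ENNReal.ofReal_one, one_pow, one_mul, Nat.add_one_sub_one, pow_one, int_y]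
  rw [ENNReal.toReal_ofReal (by positivity)]
  push_cast
  field_simp

lemma ff3 {K : ℕ} (hK : K ≠ 0) : ∫ y, ff 3 K y = 4 * π * VV K / (2 * K + 3) := by
  rw [ff_radial 3 K three_ne_zero hK, measureReal_def, EuclideanSpace.volume_ball_fin_three]
  simp only [ENNReal.ofReal_one, one_pow, one_mul, Nat.add_one_sub_one, int_y2]
  rw [ENNReal.toReal_ofReal (by positivity)]
  push_cast
  field_simp

end MF

namespace MF
open Matrix Filter Topology

/-- recursive count of representations as a sum of `r` squares -/
def cr {R : Type} [CommRing R] [Fintype R] [DecidableEq R] : ℕ → R → ℕ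
  | 0, a => if a = 0 then 1 else 0
  | (r + 1), a => ∑ v : R, cr r (a - v ^ 2)

lemma cr_eq {R : Type} [CommRing R] [Fintype R] [DecidableEq R] (r : ℕ) (a : R) :
    {u : Fin r → R | ∑ i, u i ^ 2 = a}.ncard = cr r a := by
  classical
  have e : ∀ (r : ℕ) (a : R), {u : Fin r → R | ∑ i, u i ^ 2 = a}.ncard = ∑ u : Fin r → R, if ∑ i, u i ^ 2 = a then 1 else 0 := by
    intro r a
    rw [Finset.sum_boole, Set.ncard_eq_toFinset_card']
    simp
  induction r generalizing a with
  | zero =>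
    rw [e, cr]
    simp [eq_comm]
  | succ r ih =>
    rw [e, cr, ← (Fin.consEquiv fun _ : Fin (r + 1) => R).sum_comp, Fintype.sum_prod_type]
    refine Finset.sum_congr rfl fun v _ => ?_
    rw [← ih, e]
    refine Finset.sum_congr rfl fun u _ => ?_
    simp only [Fin.consEquiv_apply, Fin.sum_univ_succ, Fin.cons_zero, Fin.cons_succ]
    congr 1
    rw [eq_sub_iff_add_eq, add_comm]

lemma rho_cr (r d : ℕ) [NeZero d] : rho r d = cr r (1 : ZMod d) := cr_eq r 1

lemma rho_one (r : ℕ) : rho r 1 = 1 := by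
  rw [rho, Set.ncard_eq_one]
  refine ⟨fun _ => 0, ?_⟩
  ext u
  simp only [Set.mem_ofPred_eq, Set.mem_singleton_iff]
  exact ⟨fun _ => Subsingleton.elim _ _, fun _ => Subsingleton.elim _ _⟩

lemma rho_2 : rho 1 2 = 1 ∧ rho 1 4 = 2 ∧ rho 1 8 = 4 ∧ rho 2 2 = 2 ∧ rho 2 4 = 8 ∧ rho 2 8 = 16 ∧
    rho 3 2 = 4 ∧ rho 3 4 = 24 ∧ rho 3 8 = 96 := by
  simp only [rho_cr]
  refine ⟨?_, ?_, ?_, ?_, ?_, ?_, ?_, ?_, ?_⟩ <;> decide +kernel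

lemma rho_zero {d : ℕ} (hd : d ≠ 1) : rho 0 d = 0 := by
  rw [rho]
  have : Nontrivial (ZMod d) := by
    rcases d with _ | _ | d
    · exact inferInstanceAs (Nontrivial ℤ)
    · exact absurd rfl hd
    · have : Fact (1 < d + 1 + 1) := ⟨by omega⟩
      exact ZMod.nontrivial _
  have : {u : Fin 0 → ZMod d | ∑ i, u i ^ 2 = 1} = ∅ := by
    ext u
    simp
  rw [this, Set.ncard_empty]

lemma rho_mul (r : ℕ) {m n : ℕ} (h : m.Coprime n) : rho r (m * n) = rho r m * rho r n := by
  rw [rho, rho, rho, ← Set.ncard_prod]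
  let e := ZMod.chineseRemainder h
  refine Set.ncard_congr' (?_ : _ ≃ _)
  refine ((Equiv.arrowCongr (Equiv.refl (Fin r)) e.toEquiv).trans (Equiv.arrowProdEquivProdArrow _ _ _)).subtypeEquiv ?_
  intro u
  simp only [Set.mem_ofPred_eq, Set.mem_prod]
  rw [← e.injective.eq_iff, Prod.ext_iff]
  simp [Equiv.arrowProdEquivProdArrow, Equiv.arrowCongr, map_sum, map_pow, Prod.fst_sum, Prod.snd_sum]

lemma preimage_card {A B : Type} [AddCommGroup A] [AddCommGroup B] [Fintype A] [Fintype B] (φ : A →+ B)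
    (hφ : Function.Surjective φ) (S : Set B) : (φ ⁻¹' S).ncard * Fintype.card B = S.ncard * Fintype.card A := by
  classical
  have hf : ∀ b, Finset.card {a | φ a = b} = Finset.card {a | φ a = 0} := fun b =>
    AddMonoidHom.card_fiber_eq_of_mem_range φ (hφ b) (hφ 0)
  have key : ∀ S : Set B, (φ ⁻¹' S).ncard = S.ncard * Finset.card {a | φ a = 0} := by
    intro S
    rw [Set.ncard_eq_toFinset_card', Set.ncard_eq_toFinset_card',
      Finset.card_eq_sum_card_fiberwise (f := φ) (t := S.toFinset)]
    · rw [Finset.sum_congr rfl (g := fun _ => Finset.card {a | φ a = 0})]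
      · rw [Finset.sum_const, smul_eq_mul]
      · intro b hb
        rw [← hf b]
        congr 1
        ext a
        simp only [Finset.mem_filter, Set.mem_toFinset, Set.mem_preimage, Finset.mem_univ, true_and] at *
        exact ⟨fun h => h.2, fun h => ⟨h ▸ hb, h⟩⟩
    · intro a ha
      simpa using ha
  have h1 := key Set.univ
  rw [Set.preimage_univ, Set.ncard_univ, Set.ncard_univ, Nat.card_eq_fintype_card, Nat.card_eq_fintype_card] at h1
  rw [key, h1]
  ring

lemma rho_lift (r : ℕ) {d e : ℕ} [NeZero d] [NeZero e]
    (hsq : ∀ a : ZMod (d * e), ZMod.castHom (dvd_mul_right d e) (ZMod d) a = 1 → ∃ b : (ZMod (d * e))ˣ, a = (b : ZMod (d * e)) ^ 2) :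
    e * rho r (d * e) = e ^ r * rho r d := by
  classical
  have : NeZero (d * e) := ⟨mul_ne_zero (NeZero.ne d) (NeZero.ne e)⟩
  set φ := ZMod.castHom (dvd_mul_right d e) (ZMod d) with hφ
  have hs : Function.Surjective φ := ZMod.castHom_surjective _
  have h1 := preimage_card φ.toAddMonoidHom hs {1}
  have h2 := preimage_card (A := Fin r → ZMod (d * e)) (B := Fin r → ZMod d)
    (φ.toAddMonoidHom.compLeft (Fin r)) (fun v => ⟨fun i => (hs (v i)).choose, funext fun i => (hs (v i)).choose_spec⟩)
    {u | ∑ i, u i ^ 2 = 1}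
  rw [Set.ncard_singleton, ZMod.card, ZMod.card, one_mul] at h1
  rw [Fintype.card_fun, Fintype.card_fun, Fintype.card_fin, ZMod.card, ZMod.card] at h2
  have h3 : ((φ.toAddMonoidHom.compLeft (Fin r)) ⁻¹' {u | ∑ i, u i ^ 2 = 1}).ncard =
      (φ.toAddMonoidHom ⁻¹' {1}).ncard * rho r (d * e) := by
    rw [Set.ncard_eq_toFinset_card', Set.ncard_eq_toFinset_card' (φ.toAddMonoidHom ⁻¹' {1}),
      Finset.card_eq_sum_card_fiberwise (f := fun u : Fin r → ZMod (d * e) => ∑ i, u i ^ 2) (t := (φ.toAddMonoidHom ⁻¹' {1}).toFinset)]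
    · rw [Finset.sum_congr rfl (g := fun _ => rho r (d * e))]
      · rw [Finset.sum_const, smul_eq_mul]
      · intro a ha
        simp only [Set.mem_toFinset, Set.mem_preimage, Set.mem_singleton_iff] at ha
        obtain ⟨b, rfl⟩ := hsq a ha
        rw [rho, ← Set.ncard_coe_finset,
          ← Set.ncard_image_of_injective {u : Fin r → ZMod (d * e) | ∑ i, u i ^ 2 = 1} (f := fun u => (b : ZMod (d * e)) • u)]
        · congr 1
          ext u
          simp only [Finset.coe_filter, Set.mem_toFinset, Set.mem_preimage, Set.mem_ofPred_eq, Set.mem_image]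
          constructor
          · rintro ⟨_, hu⟩
            refine ⟨(↑b⁻¹ : ZMod (d * e)) • u, ?_, ?_⟩
            · simp only [Pi.smul_apply, smul_eq_mul, mul_pow]
              rw [← Finset.mul_sum, hu, ← mul_pow, Units.inv_mul, one_pow]
            · rw [smul_smul, Units.mul_inv, one_smul]
          · rintro ⟨v, hv, rfl⟩
            have e1 : ∑ i, ((b : ZMod (d * e)) • v) i ^ 2 = (b : ZMod (d * e)) ^ 2 := by
              simp only [Pi.smul_apply, smul_eq_mul, mul_pow]
              rw [← Finset.mul_sum, hv, mul_one]
            refine ⟨?_, e1⟩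
            have := congrArg φ e1
            rw [map_sum] at this
            simp only [map_pow] at this
            exact this.trans ((map_pow φ _ _).symm.trans ha)
        · intro u v h
          have : (↑b⁻¹ : ZMod (d * e)) • ((b : ZMod (d * e)) • u) = (↑b⁻¹ : ZMod (d * e)) • ((b : ZMod (d * e)) • v) := congrArg _ h
          rwa [smul_smul, smul_smul, Units.inv_mul, one_smul, one_smul] at this
    · intro u hu
      simp only [Set.coe_toFinset, Set.mem_preimage, Set.mem_singleton_iff] at *
      have hu : ∑ i, φ (u i) ^ 2 = 1 := hu
      change φ (∑ i, u i ^ 2) = 1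
      rw [map_sum, ← hu]
      simp only [map_pow]
  have hd := Nat.pos_of_ne_zero (NeZero.ne d)
  have h1' : (φ.toAddMonoidHom ⁻¹' {1}).ncard = e := by
    exact Nat.eq_of_mul_eq_mul_right hd (h1.trans (mul_comm d e))
  rw [h3, h1'] at h2
  change _ = rho r d * _ at h2
  have : (e * rho r (d * e)) * d ^ r = (e ^ r * rho r d) * d ^ r := by
    rw [h2, mul_pow]; ring
  exact Nat.eq_of_mul_eq_mul_right (pow_pos hd r) this

lemma sq_unit {q i : ℕ} (hi : 1 ≤ i) [NeZero q] (c : ℤ) {m : ℕ} (hm : 1 ≤ m) (a : ZMod (q ^ i * q))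
    (h : a = ((1 + (q : ℤ) ^ m * c : ℤ) : ZMod (q ^ i * q)) ^ 2) : ∃ b : (ZMod (q ^ i * q))ˣ, a = (b : ZMod (q ^ i * q)) ^ 2 := by
  have hu : IsUnit ((1 + (q : ℤ) ^ m * c : ℤ) : ZMod (q ^ i * q)) := by
    have h1 : IsCoprime (1 + (q : ℤ) ^ m * c) (q : ℤ) := by
      obtain ⟨m, rfl⟩ : ∃ k, m = k + 1 := ⟨m - 1, by omega⟩
      exact ⟨1, -((q : ℤ) ^ m * c), by ring⟩
    have h2 : IsCoprime (1 + (q : ℤ) ^ m * c) (q ^ (i + 1) : ℤ) := h1.pow_right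
    obtain ⟨x, y, hxy⟩ := h2
    refine IsUnit.of_mul_eq_one (x : ZMod (q ^ i * q)) ?_
    have := congrArg (Int.cast : ℤ → ZMod (q ^ i * q)) hxy
    have hz : ((q : ZMod (q ^ i * q)) ^ (i + 1)) = 0 := by
      have := ZMod.natCast_self (q ^ i * q)
      rw [← pow_succ] at this ⊢
      exact_mod_cast this
    push_cast at this ⊢
    rw [hz, mul_zero, add_zero] at this
    first | exact this | exact (mul_comm _ _).trans this
  obtain ⟨b, hb⟩ := hu
  exact ⟨b, by rw [hb, h]⟩

lemma lift_one {q i : ℕ} [NeZero q] (a : ZMod (q ^ i * q))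
    (h : ZMod.castHom (dvd_mul_right (q ^ i) q) (ZMod (q ^ i)) a = 1) : ∃ t : ℤ, a = ((1 + (q : ℤ) ^ i * t : ℤ) : ZMod (q ^ i * q)) := by
  obtain ⟨A, rfl⟩ := ZMod.intCast_surjective a
  rw [map_intCast] at h
  have h' : (A : ZMod (q ^ i)) = ((1 : ℤ) : ZMod (q ^ i)) := by simpa using h
  rw [eq_comm, ZMod.intCast_eq_intCast_iff_dvd_sub] at h'
  obtain ⟨t, ht⟩ := h'
  refine ⟨t, ?_⟩
  congr 1
  push_cast at ht
  linarith

lemma zmod_eq {q i : ℕ} (A B C : ℤ) (h : A - B = (q : ℤ) ^ (i + 1) * C) : (A : ZMod (q ^ i * q)) = B := by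
  rw [eq_comm, ZMod.intCast_eq_intCast_iff_dvd_sub]
  refine ⟨C, ?_⟩
  rw [h]; push_cast; ring

lemma rho_pow_odd (r : ℕ) {q i : ℕ} (hq : q.Prime) (h2 : q ≠ 2) (hi : 1 ≤ i) :
    q * rho r (q ^ (i + 1)) = q ^ r * rho r (q ^ i) := by
  have : NeZero q := ⟨hq.ne_zero⟩
  rw [pow_succ q i]
  refine rho_lift r fun a ha => ?_
  obtain ⟨t, rfl⟩ := lift_one a ha
  obtain ⟨s, hs⟩ := hq.odd_of_ne_two h2
  refine sq_unit hi (t * (s + 1)) hi _ ?_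
  obtain ⟨k, rfl⟩ : ∃ k, i = k + 1 := ⟨i - 1, by omega⟩
  rw [← Int.cast_pow]
  have hs' : (q : ℤ) = 2 * s + 1 := by exact_mod_cast hs
  refine zmod_eq _ _ (-t - q ^ k * (t * (s + 1)) ^ 2) ?_
  have e : (2 : ℤ) * s = q - 1 := by linarith
  linear_combination (-(q : ℤ) ^ (k + 1) * t) * e

lemma rho_pow_two (r : ℕ) {i : ℕ} (hi : 3 ≤ i) :
    2 * rho r (2 ^ (i + 1)) = 2 ^ r * rho r (2 ^ i) := by
  rw [pow_succ 2 i]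
  refine rho_lift r fun a ha => ?_
  obtain ⟨t, rfl⟩ := lift_one a ha
  refine sq_unit (by omega) t (m := i - 1) (by omega) _ ?_
  obtain ⟨k, rfl⟩ : ∃ k, i = k + 3 := ⟨i - 3, by omega⟩
  rw [← Int.cast_pow]
  refine zmod_eq _ _ (- 2 ^ k * t ^ 2) ?_
  rw [show k + 3 - 1 = k + 2 by omega]
  push_cast
  ring

lemma cr_prime {q : ℕ} [Fact q.Prime] (h2 : q ≠ 2) :
    rho 1 q = 2 ∧ ∃ t : ℤ, t ^ 2 = 1 ∧ (rho 2 q : ℤ) = q - t ∧ (rho 3 q : ℤ) = q ^ 2 + t * q := by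
  classical
  set χ := quadraticChar (ZMod q) with hχ
  have hF : ringChar (ZMod q) ≠ 2 := by rwa [ZMod.ringChar_zmod_n]
  have hsq : ∀ F : ZMod q → ℤ, ∑ v, F (v ^ 2) = ∑ x, (χ x + 1) * F x := by
    intro F
    rw [← Finset.sum_fiberwise Finset.univ (fun v : ZMod q => v ^ 2) (fun v => F (v ^ 2))]
    refine Finset.sum_congr rfl fun x _ => ?_
    rw [hχ, ← quadraticChar_card_sqrts hF x]
    rw [Finset.sum_congr rfl (g := fun _ => F x), Finset.sum_const, nsmul_eq_mul]
    · congr 2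
      congr 1
      ext v
      simp
    · intro v hv
      rw [(Finset.mem_filter.1 hv).2]
  have c1 : ∀ a : ZMod q, (cr 1 a : ℤ) = χ a + 1 := by
    intro a
    simp only [cr]
    push_cast
    rw [hsq (fun x => if a - x = 0 then 1 else 0)]
    simp [sub_eq_zero]
  have c2 : ∀ a : ZMod q, (cr 2 a : ℤ) = q + ∑ x, χ x * χ (a - x) := by
    intro a
    rw [cr]
    push_cast
    rw [hsq (fun x => (cr 1 (a - x) : ℤ))]
    simp only [c1]
    have s0 : ∑ x, χ x = 0 := quadraticChar_sum_zero hF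
    have s1 : ∑ x, χ (a - x) = 0 := by
      exact ((Equiv.subLeft a).sum_comp (fun x => χ x)).trans s0
    have : ∀ x, (χ x + 1) * (χ (a - x) + 1) = χ x * χ (a - x) + χ x + χ (a - x) + 1 := fun x => by ring
    simp only [this, Finset.sum_add_distrib, s0, s1]
    simp [ZMod.card]
    ring
  have hJ : ∑ x, χ x * χ (1 - x) = - χ (-1) := by
    have h := jacobiSum_nontrivial_inv (quadraticChar_ne_one hF)
    rw [MulChar.IsQuadratic.inv (quadraticChar_isQuadratic (ZMod q))] at h
    exact h
  have hq0 : (-1 : ZMod q) ≠ 0 := by simp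
  have ht : χ (-1) ^ 2 = 1 := quadraticChar_sq_one hq0
  have c2' : ∀ a : ZMod q, (cr 2 a : ℤ) = q - χ (-1) + (if a = 0 then q * χ (-1) else 0) := by
    intro a
    rw [c2]
    split_ifs with ha
    · subst ha
      have : ∀ x : ZMod q, χ x * χ (0 - x) = χ (-1) * (if x = 0 then 0 else 1) := by
        intro x
        split_ifs with hx
        · rw [hx]; simp [hχ, quadraticChar_zero]
        · rw [zero_sub, neg_eq_neg_one_mul, map_mul]
          have := quadraticChar_sq_one hx
          rw [← hχ] at this
          linear_combination χ (-1) * this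
      simp only [this]
      rw [← Finset.mul_sum]
      have : ∀ x : ZMod q, (if x = 0 then (0 : ℤ) else 1) = 1 - (if x = 0 then 1 else 0) := by
        intro x; split_ifs <;> simp
      simp only [this, Finset.sum_sub_distrib]
      simp [ZMod.card]
      ring
    · have : ∑ x, χ x * χ (a - x) = ∑ x, χ x * χ (1 - x) := by
        rw [← Equiv.sum_comp (Equiv.mulLeft₀ a ha)]
        refine Finset.sum_congr rfl fun x _ => ?_
        have h := quadraticChar_sq_one ha
        rw [← hχ] at h
        rw [Equiv.mulLeft₀_apply, show a - a * x = a * (1 - x) by ring, map_mul, map_mul]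
        linear_combination χ x * χ (1 - x) * h
      rw [this, hJ]
      ring
  refine ⟨?_, χ (-1), ht, ?_, ?_⟩
  · have := c1 1
    rw [← rho_cr, map_one] at this
    exact_mod_cast this
  · have := c2' 1
    rw [← rho_cr, if_neg one_ne_zero, add_zero] at this
    exact this
  · rw [rho_cr, cr]
    push_cast
    rw [hsq (fun x => (cr 2 (1 - x) : ℤ))]
    simp only [c2', mul_add, Finset.sum_add_distrib, sub_eq_zero, add_mul, one_mul]
    rw [← Finset.sum_mul, quadraticChar_sum_zero hF]
    simp [ZMod.card]
    ring

end MF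

namespace MF
open Filter Topology

lemma beta_odd {j d : ℕ} (h : ¬ 2 ∣ d) : beta j d = 1 := by
  have : ¬ 4 ∣ d := fun h4 => h (dvd_trans (by norm_num) h4)
  simp [beta, h, this]

lemma beta_two (j : ℕ) : beta j 2 = -(-1) ^ j := by
  norm_num [beta]

lemma beta_four {j d : ℕ} (h : 4 ∣ d) : beta j d = (-1) ^ j * (2 ^ (2 * j) - 1) := by
  have h2 : 2 ∣ d := dvd_trans (by norm_num) h
  rw [beta, if_pos h2, if_pos h]; ring

lemma beta_mul {j m n : ℕ} (h : m.Coprime n) : beta j (m * n) = beta j m * beta j n := by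
  have key : ∀ m n : ℕ, m.Coprime n → ¬ 2 ∣ m → beta j (m * n) = beta j m * beta j n := by
    intro m n _ hm
    have c2 : Nat.Coprime 2 m := (Nat.Prime.coprime_iff_not_dvd Nat.prime_two).2 hm
    have e2 : 2 ∣ m * n ↔ 2 ∣ n := c2.dvd_mul_left
    have e4 : 4 ∣ m * n ↔ 4 ∣ n := (Nat.Coprime.pow_left 2 c2 : Nat.Coprime (2 ^ 2) m).dvd_mul_left
    rw [beta_odd hm, one_mul, beta, beta]
    simp only [e2, e4]
  by_cases hm : 2 ∣ m
  · have hn : ¬ 2 ∣ n := fun hn => by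
      have := Nat.dvd_gcd hm hn
      rw [h] at this; omega
    rw [mul_comm m n, key n m h.symm hn, mul_comm]
  · exact key m n h hm

noncomputable def fr (j r d : ℕ) : ℝ := gg j d * (rho r d / (d : ℝ) ^ r)

lemma fr_mul {j r m n : ℕ} (h : m.Coprime n) : fr j r (m * n) = fr j r m * fr j r n := by
  simp only [fr, gg]
  rw [beta_mul h, rho_mul r h]
  push_cast
  rw [mul_pow, mul_pow]
  field_simp

lemma rho_le (r d : ℕ) [NeZero d] : (rho r d : ℝ) / (d : ℝ) ^ r ≤ 1 := by
  have hd : (0 : ℝ) < d := by exact_mod_cast Nat.pos_of_ne_zero (NeZero.ne d)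
  rw [div_le_one (by positivity)]
  have : rho r d ≤ d ^ r := by
    refine (Set.ncard_le_card _).trans ?_
    simp
  exact_mod_cast this

lemma fr_one {j r : ℕ} : fr j r 1 = 1 := by
  simp [fr, gg, rho_one, beta_odd (show ¬ 2 ∣ 1 by norm_num)]

lemma fr_zero {j r : ℕ} (hj : 2 ≤ j) : fr j r 0 = 0 := by
  rw [fr, gg_zero hj, zero_mul]

lemma fr_summable {j : ℕ} (hj : 2 ≤ j) (r : ℕ) : Summable fun d => ‖fr j r d‖ := by
  refine (gg_summable hj).of_nonneg_of_le (fun d => norm_nonneg _) fun d => ?_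
  rcases Nat.eq_zero_or_pos d with rfl | hd
  · rw [fr_zero hj, norm_zero]; positivity
  have : NeZero d := ⟨hd.ne'⟩
  rw [fr, norm_mul, Real.norm_eq_abs, Real.norm_eq_abs, abs_of_nonneg (a := (rho r d : ℝ) / (d : ℝ) ^ r) (by positivity)]
  exact mul_le_of_le_one_right (abs_nonneg _) (rho_le r d)

lemma ss_prod {j : ℕ} (hj : 2 ≤ j) (r : ℕ) :
    HasProd (fun p : Nat.Primes => ∑' e, fr j r (p ^ e)) (ss j r) :=
  EulerProduct.eulerProduct_hasProd fr_one fr_mul (fr_summable hj r) (fr_zero hj)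

/-- the inverse power as a multiplicative map -/
noncomputable def ipow (s : ℕ) (hs : s ≠ 0) : ℕ →*₀ ℝ where
  toFun n := 1 / (n : ℝ) ^ s
  map_zero' := by simp [hs]
  map_one' := by simp
  map_mul' m n := by push_cast; rw [mul_pow]; field_simp

noncomputable def Zt (s : ℕ) : ℝ := ∑' n : ℕ, 1 / (n : ℝ) ^ s

lemma zt_prod {s : ℕ} (hs : 2 ≤ s) : HasProd (fun p : Nat.Primes => (1 - 1 / (p : ℝ) ^ s)⁻¹) (Zt s) := by
  refine EulerProduct.eulerProduct_completely_multiplicative_hasProd (f := ipow s (by omega)) ?_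
  have : Summable fun n : ℕ => 1 / (n : ℝ) ^ s := Real.summable_one_div_nat_pow.2 (by omega)
  exact this.norm

lemma prod_compare {A B : Nat.Primes → ℝ} {a b : ℝ} (hA : HasProd A a) (hB : HasProd B b)
    (h : ∀ p : Nat.Primes, (p : ℕ) ≠ 2 → A p = B p) :
    a * B ⟨2, Nat.prime_two⟩ = b * A ⟨2, Nat.prime_two⟩ := by
  classical
  obtain ⟨P, hP⟩ : ∃ P : Nat.Primes, P = ⟨2, Nat.prime_two⟩ := ⟨_, rfl⟩
  rw [← hP]
  have h1 := hA.mul (hasProd_ite_eq P (B P))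
  have h2 := hB.mul (hasProd_ite_eq P (A P))
  refine h1.unique ?_
  suffices hh : (fun p : Nat.Primes => A p * (if p = P then B P else 1)) =
      fun p : Nat.Primes => B p * (if p = P then A P else 1) by
    rw [hh]; exact h2
  funext p
  split_ifs with hp
  · rw [hp, mul_comm]
  · rw [h p fun h => hp (hP ▸ Subtype.ext h)]

lemma geo_tail {f : ℕ → ℝ} {X : ℝ} (h0 : 0 ≤ X) (h1 : X < 1) (m : ℕ) (hf : ∀ i, m ≤ i → f (i + 1) = f i * X) :
    ∑' e, f e = f m / (1 - X) + ∑ i ∈ Finset.range m, f i := by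
  have e : ∀ i, f (i + m) = f m * X ^ i := by
    intro i
    induction i with
    | zero => simp
    | succ i ih => rw [show i + 1 + m = (i + m) + 1 by omega, hf _ (by omega), ih, pow_succ]; ring
  have h : HasSum (fun i => f (i + m)) (f m / (1 - X)) := by
    simp only [e]
    exact (hasSum_geometric_of_lt_one h0 h1).mul_left (f m)
  exact ((hasSum_nat_add_iff m).1 h).tsum_eq

lemma fr_step {j r q i : ℕ} (hj : 2 ≤ j) (hq : q ≠ 0) (hb : beta j (q ^ (i + 1)) = beta j (q ^ i))
    (hr : q * rho r (q ^ (i + 1)) = q ^ r * rho r (q ^ i)) :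
    fr j r (q ^ (i + 1)) = fr j r (q ^ i) * (1 / (q : ℝ) ^ (2 * j)) := by
  obtain ⟨K, hK⟩ : ∃ K, 2 * j = K + 1 := ⟨2 * j - 1, by omega⟩
  have hq' : (q : ℝ) ≠ 0 := by exact_mod_cast hq
  have hr' : (q : ℝ) * rho r (q ^ (i + 1)) = (q : ℝ) ^ r * rho r (q ^ i) := by exact_mod_cast hr
  have hr2 : (rho r (q ^ (i + 1)) : ℝ) = (q : ℝ) ^ r * rho r (q ^ i) / q := by
    rw [← hr']; field_simp
  simp only [fr, gg]
  rw [hb, hr2, hK, show K + 1 - 1 = K by omega]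
  push_cast
  field_simp
  ring

lemma loc_odd {j r q : ℕ} (hj : 2 ≤ j) (hq : q.Prime) (h2 : q ≠ 2) :
    ∑' e, fr j r (q ^ e) = (rho r q : ℝ) / (q : ℝ) ^ r * (q / (q : ℝ) ^ (2 * j)) / (1 - 1 / (q : ℝ) ^ (2 * j)) + 1 := by
  have hq' : (1 : ℝ) < q := by exact_mod_cast hq.one_lt
  have hbe : ∀ i, beta j (q ^ i) = 1 := fun i => beta_odd fun h =>
    h2 ((Nat.prime_dvd_prime_iff_eq Nat.prime_two hq).1 (Nat.prime_two.dvd_of_dvd_pow h)).symm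
  rw [geo_tail (X := 1 / (q : ℝ) ^ (2 * j)) (by positivity) _ 1 fun i hi => fr_step hj hq.ne_zero
    (by rw [hbe, hbe]) (rho_pow_odd r hq h2 hi)]
  · have := hbe 1
    rw [pow_one] at this
    obtain ⟨K, hK⟩ : ∃ K, 2 * j = K + 1 := ⟨2 * j - 1, by omega⟩
    simp only [Finset.sum_range_one, pow_zero, fr_one, pow_one]
    rw [fr, gg, this, hK, show K + 1 - 1 = K by omega]
    congr 2
    rw [pow_succ]
    field_simp
  · rw [div_lt_one (by positivity)]
    exact one_lt_pow₀ hq' (by omega)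

lemma loc_two {j r : ℕ} (hj : 2 ≤ j) :
    ∑' e, fr j r (2 ^ e) = fr j r 8 / (1 - 1 / (2 : ℝ) ^ (2 * j)) + (1 + fr j r 2 + fr j r 4) := by
  have hbe : ∀ i, 3 ≤ i → beta j (2 ^ i) = (-1) ^ j * (2 ^ (2 * j) - 1) := fun i hi =>
    beta_four (by simpa using (pow_dvd_pow 2 (by omega : 2 ≤ i) : (2 : ℕ) ^ 2 ∣ 2 ^ i))
  rw [geo_tail (X := 1 / (2 : ℝ) ^ (2 * j)) (by positivity) _ 3 fun i hi => ?_]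
  · simp only [Finset.sum_range_succ, Finset.sum_range_zero, pow_zero, fr_one, pow_one]
    norm_num
  · rw [div_lt_one (by positivity)]
    exact one_lt_pow₀ (by norm_num) (by omega)
  · have := fr_step (q := 2) (r := r) (i := i) hj (by norm_num) (by rw [hbe _ (by omega), hbe _ hi]) (rho_pow_two r hi)
    exact_mod_cast this

lemma fr_two_vals {j r : ℕ} (hj : 2 ≤ j) :
    fr j r 2 = -(-1) ^ j * (2 / (2 : ℝ) ^ (2 * j)) * (rho r 2 / 2 ^ r) ∧
    fr j r 4 = (-1) ^ j * (2 ^ (2 * j) - 1) * (2 / (2 : ℝ) ^ (2 * j)) ^ 2 * (rho r 4 / 4 ^ r) ∧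
    fr j r 8 = (-1) ^ j * (2 ^ (2 * j) - 1) * (2 / (2 : ℝ) ^ (2 * j)) ^ 3 * (rho r 8 / 8 ^ r) := by
  obtain ⟨K, hK⟩ : ∃ K, 2 * j = K + 1 := ⟨2 * j - 1, by omega⟩
  have e : (2 : ℝ) / (2 : ℝ) ^ (2 * j) = 1 / 2 ^ K := by rw [hK, pow_succ]; field_simp
  refine ⟨?_, ?_, ?_⟩
  · rw [fr, gg, beta_two, e, show 2 * j - 1 = K by omega]; push_cast; ring
  · rw [fr, gg, beta_four (by norm_num), e, show 2 * j - 1 = K by omega, show ((4 : ℕ) : ℝ) = 2 ^ 2 by norm_num, ← pow_mul, mul_comm 2 K, pow_mul, one_div, inv_pow]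
    push_cast; ring
  · rw [fr, gg, beta_four (by norm_num), e, show 2 * j - 1 = K by omega, show ((8 : ℕ) : ℝ) = 2 ^ 3 by norm_num, ← pow_mul, mul_comm 3 K, pow_mul, one_div, inv_pow]
    push_cast; ring

lemma loc_two_vals {j : ℕ} (hj : 2 ≤ j) {x : ℝ} (hx : x = 1 / (2 : ℝ) ^ (2 * j)) :
    ∑' e, fr j 1 (2 ^ e) = 1 + (-1) ^ j * (x + 2 * x ^ 2) ∧
    ∑' e, fr j 2 (2 ^ e) = 1 + (-1) ^ j * x ∧
    ∑' e, fr j 3 (2 ^ e) = 1 + (-1) ^ j * (x / 2) := by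
  have h1 : (1 : ℝ) < 2 ^ (2 * j) := one_lt_pow₀ (by norm_num) (by omega)
  have hx0 : 0 < x := by rw [hx]; positivity
  have hx1 : 1 - x ≠ 0 := by
    have : x < 1 := by rw [hx, div_lt_one (by positivity)]; exact h1
    linarith
  have hp : (2 : ℝ) ^ (2 * j) = 1 / x := by rw [hx]; field_simp
  obtain ⟨a1, a2, a3, b1, b2, b3, c1, c2, c3⟩ := rho_2
  have f := fun r => @fr_two_vals j r hj
  simp only [loc_two hj, (f _).1, (f _).2.1, (f _).2.2, a1, a2, a3, b1, b2, b3, c1, c2, c3, ← hx, hp]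
  refine ⟨?_, ?_, ?_⟩ <;> · field_simp; push_cast; ring

theorem euler_main {j : ℕ} (hj : 2 ≤ j) {x : ℝ} (hx : x = 1 / (2 : ℝ) ^ (2 * j)) :
    ss j 1 * ss j 2 * ss j 3 * Zt (4 * j) * Zt (4 * j + 2) * ((1 - x)⁻¹) ^ 4 =
      Zt (2 * j) ^ 4 * ((1 + (-1) ^ j * (x + 2 * x ^ 2)) * (1 + (-1) ^ j * x) * (1 + (-1) ^ j * (x / 2)) *
        (1 - x ^ 2)⁻¹ * (1 - x ^ 2 / 4)⁻¹) := by
  have hA := ((((ss_prod hj 1).mul (ss_prod hj 2)).mul (ss_prod hj 3)).mul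
    (zt_prod (s := 4 * j) (by omega))).mul (zt_prod (s := 4 * j + 2) (by omega))
  have hz := zt_prod (s := 2 * j) (by omega)
  have hB := ((hz.mul hz).mul hz).mul hz
  have key := prod_compare hA hB ?_
  · obtain ⟨e1, e2, e3⟩ := loc_two_vals hj hx
    have g1 : 1 / (2 : ℝ) ^ (4 * j) = x ^ 2 := by rw [hx, one_div_pow, ← pow_mul]; ring_nf
    have g2 : 1 / (2 : ℝ) ^ (4 * j + 2) = x ^ 2 / 4 := by rw [← g1, pow_add]; field_simp; norm_num
    simp only [e1, e2, e3, Nat.cast_ofNat, ← hx, g1, g2] at key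
    linear_combination key
  · rintro ⟨q, hq⟩ h2
    simp only at h2 ⊢
    have : Fact q.Prime := ⟨hq⟩
    obtain ⟨r1, t, ht, r2, r3⟩ := cr_prime h2
    have r1' : (rho 1 q : ℝ) = 2 := by exact_mod_cast r1
    have r2' : (rho 2 q : ℝ) = q - t := by exact_mod_cast r2
    have r3' : (rho 3 q : ℝ) = q ^ 2 + t * q := by exact_mod_cast r3
    have ht' : (t : ℝ) ^ 2 = 1 := by exact_mod_cast ht
    rw [loc_odd hj hq h2, loc_odd hj hq h2, loc_odd hj hq h2, r1', r2', r3']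
    have hq1 : (1 : ℝ) < q := by exact_mod_cast hq.one_lt
    have h1 : (1 : ℝ) < (q : ℝ) ^ (2 * j) := one_lt_pow₀ hq1 (by omega)
    obtain ⟨X, hX⟩ : ∃ X, X = 1 / (q : ℝ) ^ (2 * j) := ⟨_, rfl⟩
    have hX0 : 0 < X := by rw [hX]; positivity
    have hX1 : X < 1 := by rw [hX, div_lt_one (by positivity)]; exact h1
    have g0 : (q : ℝ) / (q : ℝ) ^ (2 * j) = q * X := by rw [hX]; ring
    have g1 : 1 / (q : ℝ) ^ (4 * j) = X ^ 2 := by rw [hX, one_div_pow, ← pow_mul]; ring_nf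
    have g2 : 1 / (q : ℝ) ^ (4 * j + 2) = X ^ 2 / q ^ 2 := by rw [← g1, pow_add]; field_simp
    rw [g0, g1, g2, ← hX]
    have n1 : 1 - X ≠ 0 := by linarith
    have n2 : 1 - X ^ 2 ≠ 0 := by nlinarith
    have n3 : (q : ℝ) ^ 2 - X ^ 2 ≠ 0 := by nlinarith
    have hq0 : (q : ℝ) ≠ 0 := by linarith
    have l1 : 2 / (q : ℝ) ^ 1 * (q * X) / (1 - X) + 1 = (1 + X) / (1 - X) := by field_simp; ring
    have l2 : (q - t) / (q : ℝ) ^ 2 * (q * X) / (1 - X) + 1 = (1 - t * X / q) / (1 - X) := by field_simp; ring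
    have l3 : (q ^ 2 + t * q) / (q : ℝ) ^ 3 * (q * X) / (1 - X) + 1 = (1 + t * X / q) / (1 - X) := by field_simp; ring
    rw [l1, l2, l3]
    have l4 : (1 - X ^ 2 / (q : ℝ) ^ 2) = (1 - t * X / q) * (1 + t * X / q) := by
      field_simp; linear_combination X ^ 2 * ht'
    have n4 : (1 - X ^ 2 / (q : ℝ) ^ 2) ≠ 0 := by
      rw [one_sub_div (by positivity)]; exact div_ne_zero n3 (by positivity)
    rw [l4] at n4 ⊢
    have n5 := left_ne_zero_of_mul n4
    have n6 := right_ne_zero_of_mul n4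
    rw [show 1 - X ^ 2 = (1 - X) * (1 + X) by ring] at n2 ⊢
    have n7 := right_ne_zero_of_mul n2
    generalize 1 - t * X / (q : ℝ) = u at *
    generalize 1 + t * X / (q : ℝ) = v at *
    generalize 1 - X = a at *
    generalize 1 + X = b at *
    field_simp

lemma ss_zero (j : ℕ) : ss j 0 = 1 := by
  rw [ss, tsum_eq_single 1]
  · exact fr_one
  · intro d hd
    rw [rho_zero hd]; simp

end MF

namespace MF
open Matrix Filter Topology
open scoped Real

variable {n : ℕ}

lemma reps_filter {R : Finset (Mt n)} (hR : IsReps (fun _ => True) R) (P : Mt n → Prop) [DecidablePred P]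
    (hP : ∀ G H, IsU G → IsU H → Iso G H → P G → P H) : IsReps P (R.filter P) := by
  refine ⟨fun G hG => ?_, fun G hG hp => ?_, fun G hG H hH hi => ?_⟩
  · rw [Finset.mem_filter] at hG
    exact ⟨(hR.mem G hG.1).1, hG.2⟩
  · obtain ⟨H, hH, hi⟩ := hR.cover G hG trivial
    exact ⟨H, Finset.mem_filter.2 ⟨hH, hP G H hG (hR.mem H hH).1 hi hp⟩, hi⟩
  · exact hR.irr G (Finset.mem_filter.1 hG).1 H (Finset.mem_filter.1 hH).1 hi

lemma evenF_iso {G H : Mt n} (h : Iso G H) (he : EvenF G) : EvenF H := by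
  obtain ⟨A, hA⟩ := h
  intro x
  have hA' : Aᵀ * G * A = H := hA
  have : nf H x = nf G (A *ᵥ x) := by
    rw [← hA']
    simp only [nf, bf]
    rw [Matrix.dotProduct_mulVec, Matrix.dotProduct_mulVec, ← Matrix.vecMul_vecMul, ← Matrix.vecMul_vecMul,
      Matrix.vecMul_transpose, ← Matrix.dotProduct_mulVec, ← Matrix.dotProduct_mulVec]
  rw [this]; exact he _

open Classical in
lemma mass_split {R : Finset (Mt n)} (hR : IsReps (fun _ => True) R) :
    ∃ Ro Re : Finset (Mt n), IsReps OddF Ro ∧ IsReps EvenF Re ∧ mass R = mass Ro + mass Re := by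
  refine ⟨R.filter OddF, R.filter EvenF, reps_filter hR _ ?_, reps_filter hR _ ?_, ?_⟩
  · intro G H hG hH hi ho
    by_contra hc
    rw [not_oddF] at hc
    have := evenF_iso (Iso.symm hG hH hi) hc
    exact (not_oddF.2 this) ho
  · intro G H _ _ hi he
    exact evenF_iso hi he
  · have : R.filter EvenF = R.filter fun G => ¬ OddF G := by
      refine Finset.filter_congr fun G _ => ?_
      rw [not_oddF]
    rw [this, mass, mass, mass, Finset.sum_filter_add_sum_filter_not]

lemma even_dvd {G : Mt n} (h : IsU G) (he : EvenF G) : 8 ∣ n := by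
  have := vdB n G h 0 (fun x => by simpa [bf] using he x)
  simp only [nf, bf, Matrix.mulVec_zero, dotProduct_zero, zero_sub, dvd_neg] at this
  exact_mod_cast this

lemma reps_all_odd (h8 : ¬ 8 ∣ n) {R : Finset (Mt n)} (hR : IsReps (fun _ => True) R) : IsReps OddF R := by
  refine ⟨fun G hG => ⟨(hR.mem G hG).1, ?_⟩, fun G hG _ => hR.cover G hG trivial, hR.irr⟩
  by_contra hc
  exact h8 (even_dvd (hR.mem G hG).1 (not_oddF.1 hc))

/-- the relation between all and odd masses in rank `4j` -/
lemma even_odd_mass {j : ℕ} (hj : 2 ≤ j) (h2 : Even j) {Ro Re : Finset (Mt (4 * j))} (ho : IsReps OddF Ro)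
    (he : IsReps EvenF Re) {x : ℝ} (hx : x = 1 / (2 : ℝ) ^ (2 * j)) :
    mass Re * ((1 - x) * (1 + 2 * x)) = 4 * x ^ 2 * mass Ro := by
  obtain ⟨m, hm⟩ := h2
  have key := two_nbr_mass (s := 2 ^ (8 * m - 1) + 2 ^ (4 * m - 1)) ⟨m, by omega⟩ (vdB _)
    (fun G hG hE => sing_count hG hE (by omega : 0 < m) (by omega)) ho he
  have hx0 : x ≠ 0 := by rw [hx]; positivity
  have e1 : (2 : ℝ) ^ (8 * m - 1) = 1 / (2 * x ^ 2) := by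
    have : (2 : ℝ) ^ (8 * m - 1) * 2 = 2 ^ (8 * m) := by rw [← pow_succ]; congr 1; omega
    rw [hx, _root_.one_div_pow, ← pow_mul, show 2 * j * 2 = 8 * m by omega, ← this]
    field_simp
  have e2 : (2 : ℝ) ^ (4 * m - 1) = 1 / (2 * x) := by
    have : (2 : ℝ) ^ (4 * m - 1) * 2 = 2 ^ (4 * m) := by rw [← pow_succ]; congr 1; omega
    rw [hx, show 2 * j = 4 * m by omega, ← this]
    field_simp
  push_cast at key
  rw [e1, e2] at key
  field_simp at key
  linear_combination -key

lemma all_odd_mass {j : ℕ} (hj : 2 ≤ j) {R : Finset (Mt (4 * j))} (hR : IsReps (fun _ => True) R)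
    {x : ℝ} (hx : x = 1 / (2 : ℝ) ^ (2 * j)) :
    ∃ Ro : Finset (Mt (4 * j)), IsReps OddF Ro ∧
      mass R * ((1 - (-1) ^ j * x) * (1 + 2 * (-1) ^ j * x)) = mass Ro * (1 + (-1) ^ j * (x + 2 * x ^ 2)) := by
  rcases Nat.even_or_odd j with h2 | h2
  · obtain ⟨Ro, Re, ho, he, hm⟩ := mass_split hR
    refine ⟨Ro, ho, ?_⟩
    have := even_odd_mass hj h2 ho he hx
    rw [hm, h2.neg_one_pow]
    linear_combination this
  · refine ⟨R, reps_all_odd ?_ hR, ?_⟩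
    · obtain ⟨t, rfl⟩ := h2
      omega
    · rw [h2.neg_one_pow]
      ring

lemma chain4 {j : ℕ} (hj : 2 ≤ j) {R : Finset (Mt (4 * (j + 1)))} (hR : IsReps OddF R) :
    ∃ R' : Finset (Mt (4 * j)), IsReps (fun _ => True) R' ∧ cn (j + 1) 0 * mass R * cn j 3 * cn j 2 * cn j 1 = mass R' := by
  change IsReps (n := 4 * j + 3 + 1) OddF R at hR
  obtain ⟨R3, h3⟩ := reps_descend (m := 4 * j + 3) hR
  have c0 := odd_chain (m := 4 * j + 3) (j := j + 1) (r := 0) (by omega) (by omega) hR h3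
  have o3 : IsReps (n := 4 * j + 2 + 1) OddF R3 := reps_all_odd (by omega) h3
  obtain ⟨R2, h2⟩ := reps_descend (m := 4 * j + 2) o3
  have c3 := odd_chain (m := 4 * j + 2) (j := j) (r := 3) (by omega) (by omega) o3 h2
  have o2 : IsReps (n := 4 * j + 1 + 1) OddF R2 := reps_all_odd (by omega) h2
  obtain ⟨R1, h1⟩ := reps_descend (m := 4 * j + 1) o2
  have c2 := odd_chain (m := 4 * j + 1) (j := j) (r := 2) (by omega) (by omega) o2 h1
  have o1 : IsReps (n := 4 * j + 1) OddF R1 := reps_all_odd (by omega) h1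
  obtain ⟨R0, h0⟩ := reps_descend (m := 4 * j) o1
  have c1 := odd_chain (m := 4 * j) (j := j) (r := 1) (by omega) (by omega) o1 h0
  refine ⟨R0, h0, ?_⟩
  rw [← c1, ← c2, ← c3]
  have : mass (n := 4 * (j + 1)) R = mass (n := 4 * j + 3 + 1) R := rfl
  rw [this, c0]
  ring

lemma zt_eq {j : ℕ} (hj : j ≠ 0) : Zt (2 * j) = 2 ^ (2 * j - 1) * π ^ (2 * j) * |(bernoulli (2 * j) : ℝ)| / (2 * j).factorial :=
  (zeta_bern hj).1.tsum_eq

/-- the analytic constants combine -/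
lemma const_main {j : ℕ} (hj : 2 ≤ j) {x : ℝ} (hx : x = 1 / (2 : ℝ) ^ (2 * j)) :
    (∫ y, ff 1 (2 * j - 1) y) * (∫ y, ff 2 (2 * j - 1) y) * (∫ y, ff 3 (2 * j - 1) y) * (kap j * (1 - x) * Zt (2 * j)) ^ 4 *
      (|(bernoulli (2 * (2 * j)) : ℝ)| * |(bernoulli (2 * (2 * j + 1)) : ℝ)|) = Zt (4 * j) * Zt (4 * j + 2) * (8 * j * (2 * j + 1)) := by
  obtain ⟨K, hK⟩ : ∃ K, 2 * j = K + 1 := ⟨2 * j - 1, by omega⟩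
  have z1 := zt_eq (j := j) (by omega)
  have z2 := zt_eq (j := 2 * j) (by omega)
  have z3 := zt_eq (j := 2 * j + 1) (by omega)
  have hB := (zeta_bern (j := j) (by omega)).2.2
  have hx0 : x ≠ 0 := by rw [hx]; positivity
  have h1 : (1 : ℝ) < 2 ^ (2 * j) := one_lt_pow₀ (by norm_num) (by omega)
  have hkz : kap j * (1 - x) * Zt (2 * j) = π ^ (K + 1) / (K.factorial : ℝ) := by
    rw [z1, kap, hx]
    have h1' : (2 : ℝ) ^ (2 * j) - 1 ≠ 0 := by linarith
    have hj' : (4 * j : ℝ) = 2 * (K + 1) := by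
      have : (2 * j : ℝ) = K + 1 := by exact_mod_cast hK
      linarith
    rw [hj']
    rw [hK] at h1' hB ⊢
    rw [Nat.factorial_succ, show K + 1 - 1 = K by omega]
    push_cast
    have hf : (K.factorial : ℝ) ≠ 0 := by positivity
    have hk1 : (K : ℝ) + 1 ≠ 0 := by positivity
    have hb := hB.ne'
    rw [one_sub_div (by positivity)]
    field_simp
    ring
  rw [hkz, show 4 * j = 2 * (2 * j) by ring, show 2 * (2 * j) + 2 = 2 * (2 * j + 1) by ring, z2, z3,
    ff1 (by omega), ff2 (by omega), ff3 (by omega), VV_eq, show 2 * j - 1 = K by omega]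
  have hj' : (8 * j : ℝ) = 4 * (K + 1) := by
    have : (2 * j : ℝ) = K + 1 := by exact_mod_cast hK
    linarith
  have hj2 : (2 * j : ℝ) = K + 1 := by exact_mod_cast hK
  rw [hj', hj2, hK]
  generalize |(bernoulli (2 * (K + 1)) : ℝ)| = b1
  generalize |(bernoulli (2 * (K + 1 + 1)) : ℝ)| = b2
  rw [show 2 * (K + 1) = 2 * K + 1 + 1 by ring, show 2 * (K + 1 + 1) = 2 * K + 1 + 1 + 1 + 1 by ring,
    Nat.factorial_succ (2 * K + 1 + 1 + 1), Nat.factorial_succ (2 * K + 1 + 1), Nat.factorial_succ (2 * K + 1)]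
  rw [show 2 * K + 1 + 1 - 1 = 2 * K + 1 by omega, show 2 * K + 1 + 1 + 1 + 1 - 1 = 2 * K + 3 by omega]
  have h4 : (4 : ℝ) ^ K = (2 ^ K) ^ 2 := by rw [← pow_mul, mul_comm, pow_mul]; norm_num
  rw [h4]
  push_cast
  have f1 : (K.factorial : ℝ) ≠ 0 := by positivity
  have f2 : ((2 * K + 1).factorial : ℝ) ≠ 0 := by positivity
  generalize (K.factorial : ℝ) = u at *
  generalize ((2 * K + 1).factorial : ℝ) = v at *
  have k1 : (K : ℝ) + 1 ≠ 0 := by positivity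
  have k2 : (2 : ℝ) * K + 3 ≠ 0 := by positivity
  have k3 : (2 : ℝ) * K + 1 + 1 ≠ 0 := by positivity
  have k4 : (2 : ℝ) * K + 1 + 1 + 1 ≠ 0 := by positivity
  have k5 : (2 : ℝ) * K + 1 + 1 + 1 + 1 ≠ 0 := by positivity
  simp only [pow_succ, pow_mul, pow_zero, one_mul, pow_add, mul_pow, div_pow]
  field_simp
  ring

noncomputable def PB (j : ℕ) : ℝ := 2 ^ (2 * j - 2) * ∏ i ∈ Finset.Icc 1 (2 * j - 1), |(bernoulli (2 * i) : ℝ)| / (4 * i)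

lemma PB_succ {j : ℕ} (hj : 2 ≤ j) : PB (j + 1) * (8 * j * (2 * j + 1)) =
    PB j * (|(bernoulli (2 * (2 * j)) : ℝ)| * |(bernoulli (2 * (2 * j + 1)) : ℝ)|) := by
  obtain ⟨K, hK⟩ : ∃ K, 2 * j = K + 2 := ⟨2 * j - 2, by omega⟩
  rw [PB, PB, show 2 * (j + 1) - 1 = K + 1 + 1 + 1 by omega, show 2 * j - 1 = K + 1 by omega, Finset.prod_Icc_succ_top (by omega),
    Finset.prod_Icc_succ_top (by omega), show 2 * (j + 1) - 2 = K + 2 by omega, show 2 * j - 2 = K by omega]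
  have hj2 : (2 * j : ℝ) = K + 2 := by exact_mod_cast hK
  have hj3 : (8 * j : ℝ) = 4 * (K + 2) := by linarith
  rw [hj2, hj3, hK, pow_succ, pow_succ]
  push_cast
  have k1 : (K : ℝ) + 1 + 1 ≠ 0 := by positivity
  have k2 : (K : ℝ) + 1 + 1 + 1 ≠ 0 := by positivity
  field_simp
  ring

lemma cn_zero {j : ℕ} : cn j 0 = kap j := by
  rw [cn, ff0, ss_zero]; ring

lemma x_bound {j : ℕ} (hj : 2 ≤ j) : 1 / (2 : ℝ) ^ (2 * j) ≤ 1 / 16 := by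
  have : (2 : ℝ) ^ 4 ≤ 2 ^ (2 * j) := pow_le_pow_right₀ (by norm_num) (by omega)
  rw [show (16 : ℝ) = 2 ^ 4 by norm_num]
  gcongr

lemma bern_vals : bernoulli 4 = -1 / 30 ∧ bernoulli 6 = 1 / 42 := by
  have h4 : bernoulli 4 = -1 / 30 := by rw [bernoulli_eq_bernoulli'_of_ne_one (by norm_num), bernoulli'_four]
  refine ⟨h4, ?_⟩
  have h5 : bernoulli 5 = 0 := bernoulli_eq_zero_of_odd (by decide) (by norm_num)
  have h3 : bernoulli 3 = 0 := bernoulli_eq_zero_of_odd (by decide) (by norm_num)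
  have h := sum_bernoulli 7
  simp only [Finset.sum_range_succ, Finset.sum_range_zero, h4, h5, h3, bernoulli_zero, bernoulli_one, bernoulli_two] at h
  norm_num [Nat.choose] at h
  linarith

theorem odd_mass {j : ℕ} (hj : 2 ≤ j) : ∀ {R : Finset (Mt (4 * j))}, IsReps OddF R →
    kap j * mass R = (1 + 2 * (-1) ^ j * (1 / (2 : ℝ) ^ (2 * j))) * PB j := by
  induction j, hj using Nat.le_induction with
  | base =>
    intro R hR
    have c0 := odd_chain (m := 7) (j := 2) (r := 0) (by omega) (by omega) hR (reps_one le_rfl)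
    rw [cn_zero, mass_small 7 le_rfl] at c0
    have : mass (n := 4 * 2) R = mass (n := 7 + 1) R := rfl
    rw [this, c0, PB]
    simp only [show 2 * 2 - 1 = 0 + 1 + 1 + 1 by norm_num, Finset.prod_Icc_succ_top (show 1 ≤ 0 + 1 by norm_num),
      Finset.prod_Icc_succ_top (show 1 ≤ 0 + 1 + 1 by norm_num), Finset.prod_Icc_succ_top (show 1 ≤ 0 + 1 + 1 + 1 by norm_num)]
    norm_num [bern_vals.1, bern_vals.2, bernoulli_two, Nat.factorial]
  | succ j hj ih =>
    intro R hR
    obtain ⟨R', hR', hc⟩ := chain4 hj hR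
    obtain ⟨x, hx⟩ : ∃ x, x = 1 / (2 : ℝ) ^ (2 * j) := ⟨_, rfl⟩
    obtain ⟨Ro, ho, hm⟩ := all_odd_mass hj hR' hx
    have hi := ih ho
    have he := euler_main hj hx
    have hk := const_main hj hx
    have hp := PB_succ hj
    have hxb := x_bound hj
    rw [← hx] at hi hxb
    have hx0 : 0 < x := by rw [hx]; positivity
    have hx' : 1 / (2 : ℝ) ^ (2 * (j + 1)) = x / 4 := by
      rw [hx, mul_add, pow_add]; field_simp; norm_num
    have hZ1 : Zt (4 * j) ≠ 0 := by
      rw [show 4 * j = 2 * (2 * j) by ring, zt_eq (by omega)]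
      have := (zeta_bern (j := 2 * j) (by omega)).2.2
      positivity
    have hZ2 : Zt (4 * j + 2) ≠ 0 := by
      rw [show 4 * j + 2 = 2 * (2 * j + 1) by ring, zt_eq (by omega)]
      have := (zeta_bern (j := 2 * j + 1) (by omega)).2.2
      positivity
    rw [cn_zero] at hc
    simp only [cn] at hc
    rw [hx', pow_succ]
    have hD : (8 * j * (2 * j + 1) : ℝ) ≠ 0 := by
      have : (0 : ℝ) < j := by exact_mod_cast (by omega : 0 < j)
      positivity
    have hep : ((-1 : ℝ) ^ j) = 1 ∨ ((-1 : ℝ) ^ j) = -1 := neg_one_pow_eq_or ℝ j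
    generalize (-1 : ℝ) ^ j = e at *
    generalize (8 * j * (2 * j + 1) : ℝ) = D at *
    generalize |(bernoulli (2 * (2 * j)) : ℝ)| * |(bernoulli (2 * (2 * j + 1)) : ℝ)| = b at *
    generalize Zt (4 * j) = Z1 at *
    generalize Zt (4 * j + 2) = Z2 at *
    generalize Zt (2 * j) = Z at *
    generalize ss j 1 = s1 at *
    generalize ss j 2 = s2 at *
    generalize ss j 3 = s3 at *
    generalize (∫ y, ff 1 (2 * j - 1) y) = I1 at *
    generalize (∫ y, ff 2 (2 * j - 1) y) = I2 at *
    generalize (∫ y, ff 3 (2 * j - 1) y) = I3 at *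
    generalize kap (j + 1) * mass R = A at *
    generalize mass R' = M at *
    generalize mass Ro = O at *
    generalize kap j = κ at *
    generalize PB (j + 1) = P' at *
    generalize PB j = P at *
    have he2 : e ^ 2 = 1 := by rcases hep with h | h <;> rw [h] <;> norm_num
    have hea : |e * x| ≤ 1 / 16 := by
      rcases hep with h | h <;> rw [h] <;> simp [abs_of_pos hx0] <;> linarith
    obtain ⟨ha1, ha2⟩ := abs_le.1 hea
    have n1 : 1 + 2 * e * x ≠ 0 := by nlinarith
    have n2 : 1 + e * (x + 2 * x ^ 2) ≠ 0 := by
      rcases hep with h | h <;> rw [h] <;> nlinarith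
    have n3 : 1 + e * (x / 2) ≠ 0 := by nlinarith
    have n4 : 1 - x ≠ 0 := by linarith
    have n5 : 1 - x ^ 2 ≠ 0 := by nlinarith
    have n6 : 1 - x ^ 2 / 4 ≠ 0 := by nlinarith
    have he' : s1 * s2 * s3 * Z1 * Z2 * ((1 - x ^ 2) * (1 - x ^ 2 / 4)) =
        (Z * (1 - x)) ^ 4 * ((1 + e * (x + 2 * x ^ 2)) * (1 + e * x) * (1 + e * (x / 2))) := by
      have q4 : ((1 - x)⁻¹) ^ 4 * (1 - x) ^ 4 = 1 := by rw [← mul_pow, inv_mul_cancel₀ n4, one_pow]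
      have q5 : (1 - x ^ 2)⁻¹ * (1 - x ^ 2) = 1 := inv_mul_cancel₀ n5
      have q6 : (1 - x ^ 2 / 4)⁻¹ * (1 - x ^ 2 / 4) = 1 := inv_mul_cancel₀ n6
      calc _ = (s1 * s2 * s3 * Z1 * Z2 * ((1 - x)⁻¹) ^ 4) * ((1 - x) ^ 4 * ((1 - x ^ 2) * (1 - x ^ 2 / 4))) := by
            linear_combination -(s1 * s2 * s3 * Z1 * Z2 * ((1 - x ^ 2) * (1 - x ^ 2 / 4))) * q4
        _ = _ := by
            rw [he]
            calc _ = (Z * (1 - x)) ^ 4 * ((1 + e * (x + 2 * x ^ 2)) * (1 + e * x) * (1 + e * (x / 2))) *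
                  (((1 - x ^ 2)⁻¹ * (1 - x ^ 2)) * ((1 - x ^ 2 / 4)⁻¹ * (1 - x ^ 2 / 4))) := by ring
              _ = _ := by rw [q5, q6]; ring
    have n7 : 1 - e * x ≠ 0 := by linarith
    have n8 : 1 + e * x ≠ 0 := by linarith
    have a1 : A * κ ^ 4 * (I1 * I2 * I3) * (s1 * s2 * s3) * (1 - e * x) = (1 + e * (x + 2 * x ^ 2)) * P := by
      apply mul_right_cancel₀ n1
      linear_combination (κ * (1 - e * x) * (1 + 2 * e * x)) * hc + κ * hm + (1 + e * (x + 2 * x ^ 2)) * hi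
    have r1 : (1 - e * x) * (1 + e * x) = 1 - x ^ 2 := by linear_combination -x ^ 2 * he2
    have r2 : (1 - e * (x / 2)) * (1 + e * (x / 2)) = 1 - x ^ 2 / 4 := by linear_combination -x ^ 2 / 4 * he2
    have a2 : A * (I1 * I2 * I3) * (κ * (1 - x) * Z) ^ 4 = P * Z1 * Z2 * (1 - e * (x / 2)) := by
      apply mul_right_cancel₀ (mul_ne_zero (mul_ne_zero (mul_ne_zero n2 n3) n8) n7)
      calc _ = A * κ ^ 4 * (I1 * I2 * I3) * (1 - e * x) * ((Z * (1 - x)) ^ 4 * ((1 + e * (x + 2 * x ^ 2)) * (1 + e * x) * (1 + e * (x / 2)))) := by ring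
        _ = (A * κ ^ 4 * (I1 * I2 * I3) * (s1 * s2 * s3) * (1 - e * x)) * (Z1 * Z2 * ((1 - x ^ 2) * (1 - x ^ 2 / 4))) := by
            rw [← he']; ring
        _ = _ := by rw [a1, ← r1, ← r2]; ring
    have a3 : A * D = P * b * (1 - e * (x / 2)) := by
      apply mul_right_cancel₀ (mul_ne_zero hZ1 hZ2)
      linear_combination -A * hk + b * a2
    apply mul_right_cancel₀ hD
    rw [a3]
    linear_combination -(1 - e * (x / 2)) * hp

/-- the mass of even unimodular lattices -/
theorem even_mass {j : ℕ} (hj : 2 ≤ j) (h2 : Even j) {Re : Finset (Mt (4 * j))} (hRe : IsReps EvenF Re) :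
    mass Re = |(bernoulli (2 * j) : ℝ)| / (4 * j) * ∏ i ∈ Finset.Icc 1 (2 * j - 1), |(bernoulli (2 * i) : ℝ)| / (4 * i) := by
  obtain ⟨Ro, ho⟩ := odd_reps (by obtain ⟨m, rfl⟩ := h2; exact ⟨m, by ring⟩) (vdB _) hRe
  obtain ⟨x, hx⟩ : ∃ x, x = 1 / (2 : ℝ) ^ (2 * j) := ⟨_, rfl⟩
  have h1 := even_odd_mass hj h2 ho hRe hx
  have h2 := odd_mass hj ho
  have hxb := x_bound hj
  have hx0 : 0 < x := by rw [hx]; positivity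
  have hB := (zeta_bern (j := j) (by omega)).2.2
  have hj0 : (0 : ℝ) < j := by exact_mod_cast (by omega : 0 < j)
  have hp : (2 : ℝ) ^ (2 * j) = 1 / x := by rw [hx]; field_simp
  have hp2 : (2 : ℝ) ^ (2 * j - 2) = 1 / (4 * x) := by
    have : (2 : ℝ) ^ (2 * j) = 2 ^ (2 * j - 2) * 2 ^ 2 := by rw [← pow_add]; congr 1; omega
    rw [hp] at this
    field_simp at this ⊢
    linarith
  rw [← hx] at hxb h2
  rw [PB, kap, hp, hp2, Even.neg_one_pow ‹Even j›] at h2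
  generalize mass Re = E at *
  generalize mass Ro = O at *
  generalize |(bernoulli (2 * j) : ℝ)| = B at *
  generalize ∏ i ∈ Finset.Icc 1 (2 * j - 1), |(bernoulli (2 * i) : ℝ)| / (4 * i) = P at *
  have n1 : 1 - x ≠ 0 := by linarith
  have n2 : 1 + 2 * x ≠ 0 := by linarith
  have n3 : 1 / x - 1 ≠ 0 := by rw [div_sub_one hx0.ne']; exact div_ne_zero n1 hx0.ne'
  have n4 := hB.ne'
  have h2' : 4 * j * x * O * (4 * x) = (1 + 2 * x) * P * B * (1 - x) := by
    rw [div_sub_one hx0.ne'] at h2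
    field_simp at h2
    linear_combination h2
  have : E * (4 * j) = B * P := by
    apply mul_right_cancel₀ (mul_ne_zero n1 n2)
    linear_combination 4 * j * h1 + h2'
  rw [div_mul_eq_mul_div, eq_div_iff (by positivity), this]

end MF

namespace MF
open Matrix

variable {n : ℕ}

/-- upper triangular part -/
def up (a : Mt n) : Mt n := Matrix.of fun i j => if i ≤ j then a i j else 0

lemma qform_up (a : Mt n) (x : Vc n) : Qform a x = bf (up a) x x := by
  simp only [Qform, bf, up, dotProduct, mulVec, Finset.mul_sum, Matrix.of_apply]
  refine Finset.sum_congr rfl fun i _ => Finset.sum_congr rfl fun j _ => ?_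
  split_ifs <;> ring

lemma gram_up (a : Mt n) : gram a = up a + (up a)ᵀ := by
  ext i j
  simp only [_root_.gram, Matrix.of_apply, Tbil, qform_up, bf_add_left, bf_add_right, bf_single, Matrix.add_apply, Matrix.transpose_apply]
  ring

lemma gram_sym (a : Mt n) : (gram a)ᵀ = gram a := by
  rw [gram_up, Matrix.transpose_add, Matrix.transpose_transpose, add_comm]

lemma nf_gram (a : Mt n) (x : Vc n) : nf (gram a) x = 2 * Qform a x := by
  rw [qform_up, gram_up, nf, bf, bf, Matrix.add_mulVec, dotProduct_add, Matrix.mulVec_transpose,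
    dotProduct_comm x (x ᵥ* up a), ← Matrix.dotProduct_mulVec]
  ring

lemma nf_ext {G H : Mt n} (hG : Gᵀ = G) (hH : Hᵀ = H) (h : ∀ x, nf G x = nf H x) : G = H := by
  refine bf_ext fun x y => ?_
  have h1 := nf_add hG x y
  have h2 := nf_add hH x y
  rw [h, h, h, h2] at h1
  linarith

lemma isU_gram {a : Mt n} (hn : Even n) (hp : _root_.PosDef a) (hd : HasDisc a 1) : IsU (gram a) := by
  refine ⟨gram_sym a, ?_, fun x hx => ?_⟩
  · rw [HasDisc, eps, if_pos hn] at hd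
    simpa using hd
  · rw [nf_gram]
    have := hp x hx
    omega

lemma even_gram (a : Mt n) : EvenF (gram a) := fun x => by
  rw [nf_gram]; exact even_two_mul _

lemma posDef_of_gram {a : Mt n} (h : IsU (gram a)) : _root_.PosDef a := fun x hx => by
  have := h.pos x hx
  rw [nf_gram] at this
  omega

lemma disc_of_gram {a : Mt n} (hn : Even n) (h : IsU (gram a)) : HasDisc a 1 := by
  rw [HasDisc, eps, if_pos hn, h.det]; norm_num

lemma exists_gram {G : Mt n} (hs : Gᵀ = G) (he : EvenF G) : ∃ b : Mt n, gram b = G := by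
  refine ⟨Matrix.of fun i j => if i = j then G i i / 2 else G i j, ?_⟩
  rw [gram_up]
  ext i j
  simp only [up, Matrix.add_apply, Matrix.of_apply, Matrix.transpose_apply]
  have hij : G j i = G i j := by
    conv_rhs => rw [← hs]
    rfl
  rcases lt_trichotomy i j with h | h | h
  · simp [h.le, h.not_ge, h.ne]
  · subst h
    have := he (Pi.single i 1)
    rw [nf, bf_single] at this
    obtain ⟨c, hc⟩ := this
    simp only [le_refl, if_true]
    omega
  · simp [h.le, h.not_ge, h.ne, hij]

lemma gl_isos {a b : Mt n} {A : Mt n} :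
    A ∈ isos (gram a) (gram b) ↔ ∀ x, Qform b x = Qform a (A *ᵥ x) := by
  constructor
  · intro h x
    have h' : Aᵀ * gram a * A = gram b := h
    have := nf_gram b x
    rw [← h', ← nf_mulVec, nf_gram] at this
    omega
  · intro h
    change Aᵀ * gram a * A = gram b
    refine nf_ext ?_ (gram_sym b) fun x => ?_
    · rw [Matrix.transpose_mul, Matrix.transpose_mul, Matrix.transpose_transpose, gram_sym, Matrix.mul_assoc]
    · rw [← nf_mulVec, nf_gram, nf_gram, h]

lemma equiv_iso {a b : Mt n} (h : FormEquiv (Qform a) (Qform b)) : Iso (gram a) (gram b) := by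
  obtain ⟨g, hg⟩ := h
  exact ⟨_, gl_isos.2 hg⟩

lemma iso_equiv {a b : Mt n} (ha : IsU (gram a)) (hb : IsU (gram b)) (h : Iso (gram a) (gram b)) :
    FormEquiv (Qform a) (Qform b) := by
  obtain ⟨A, hA⟩ := h
  have hu := iso_isUnit ha hb hA
  refine ⟨(Matrix.nonsingInvUnit A hu)⁻¹, ?_⟩
  rw [inv_inv]
  exact gl_isos.1 hA

lemma card_aut {a : Mt n} (ha : IsU (gram a)) : Nat.card (AutGrp a) = autc (gram a) := by
  rw [autc, ← Nat.card_coe_set_eq]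
  refine Nat.card_congr (Equiv.ofBijective
    (fun g : AutGrp a => (⟨((g.1⁻¹ : GL (Fin n) ℤ) : Mt n), gl_isos.2 fun x => (g.2 x).symm⟩ : isos (gram a) (gram a))) ⟨?_, ?_⟩)
  · intro g h hgh
    have := congrArg Subtype.val hgh
    simp only at this
    exact Subtype.ext (inv_injective (Units.ext this))
  · rintro ⟨A, hA⟩
    have hu := iso_isUnit ha ha hA
    refine ⟨⟨(Matrix.nonsingInvUnit A hu)⁻¹, ?_⟩, ?_⟩
    · rw [inv_inv]
      exact fun x => (gl_isos.1 hA x).symm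
    · apply Subtype.ext
      simp only [inv_inv]
      rfl

end MF

/-- the Smith–Siegel–Minkowski mass formula for unimodular forms in
`n` variables, `8 ∣ n`: for any complete irredundant system `S` of representatives of the
equivalence classes of positive definite forms of discriminant `1`,
`∑_{Q ∈ S} 1/#Aut(Q) = (|B_{n/2}|/n) ∏_{k=1}^{n/2-1} |B_{2k}|/(4k)`. -/
theorem mass_formula_unimodular (n : ℕ) (hn : 0 < n) (h8 : 8 ∣ n)
    (S : Finset (Matrix (Fin n) (Fin n) ℤ))
    (hS : ∀ a ∈ S, PosDef a ∧ HasDisc a 1)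
    (hcomplete : ∀ b : Matrix (Fin n) (Fin n) ℤ, PosDef b → HasDisc b 1 →
      ∃ a ∈ S, FormEquiv (Qform b) (Qform a))
    (hirredundant : ∀ a ∈ S, ∀ b ∈ S, FormEquiv (Qform a) (Qform b) → a = b) :
    ∑ a ∈ S, (1 : ℚ) / (Nat.card (AutGrp a)) =
      |bernoulli (n / 2)| / (n : ℚ) *
        ∏ k ∈ Finset.Icc 1 (n / 2 - 1), |bernoulli (2 * k)| / (4 * (k : ℚ)) := by
  classical
  have hev : Even n := by obtain ⟨m, rfl⟩ := h8; exact ⟨4 * m, by ring⟩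
  have hU : ∀ a ∈ S, MF.IsU (gram a) := fun a ha => MF.isU_gram hev (hS a ha).1 (hS a ha).2
  have hinj : Set.InjOn gram (S : Set (Matrix (Fin n) (Fin n) ℤ)) := by
    intro a ha b hb h
    exact hirredundant a ha b hb (MF.iso_equiv (hU a ha) (hU b hb) (h ▸ MF.Iso.refl _))
  have hR : MF.IsReps MF.EvenF (S.image gram) := by
    refine ⟨fun G hG => ?_, fun G hG he => ?_, fun G hG H hH hi => ?_⟩
    · obtain ⟨a, ha, rfl⟩ := Finset.mem_image.1 hG
      exact ⟨hU a ha, MF.even_gram a⟩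
    · obtain ⟨b, rfl⟩ := MF.exists_gram hG.sym he
      obtain ⟨a, ha, h⟩ := hcomplete b (MF.posDef_of_gram hG) (MF.disc_of_gram hev hG)
      exact ⟨_, Finset.mem_image_of_mem _ ha, MF.equiv_iso h⟩
    · obtain ⟨a, ha, rfl⟩ := Finset.mem_image.1 hG
      obtain ⟨b, hb, rfl⟩ := Finset.mem_image.1 hH
      rw [hirredundant a ha b hb (MF.iso_equiv (hU a ha) (hU b hb) hi)]
  have hm : MF.mass (S.image gram) = ∑ a ∈ S, (1 : ℝ) / (Nat.card (AutGrp a)) := by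
    rw [MF.mass, Finset.sum_image hinj]
    exact Finset.sum_congr rfl fun a ha => by rw [MF.card_aut (hU a ha)]
  obtain ⟨j, hj, h2, rfl⟩ : ∃ j, 2 ≤ j ∧ Even j ∧ n = 4 * j := by
    obtain ⟨m, rfl⟩ := h8
    exact ⟨2 * m, by omega, even_two_mul m, by ring⟩
  have key := MF.even_mass hj h2 hR
  rw [hm] at key
  rw [show 4 * j / 2 = 2 * j by omega]
  have : (((∑ a ∈ S, (1 : ℚ) / (Nat.card (AutGrp a)) : ℚ)) : ℝ) = ((|bernoulli (2 * j)| / ((4 * j : ℕ) : ℚ) *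
        ∏ k ∈ Finset.Icc 1 (2 * j - 1), |bernoulli (2 * k)| / (4 * (k : ℚ)) : ℚ) : ℝ) := by
    push_cast
    exact key
  exact_mod_cast this
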